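/- There exists a constant c_0 > 0 such that for every constant c ≥ c_0 the following holds for all sufficiently large odd integers N: with D = \sqrt{N} L^{-c} and r_3(m) = \sum_{d | m, d \ge N/D} χ(d), one has \sum_{p_1+p_2+p_3=N} r_3(p_1-1) r_3(p_2-1) (\log p_1)(\log p_2)(\log p_3) \ll N^2 L^{-1}, the sum being over ordered triples of primes and the implied constant depending only on c. -/

import Mathlib

open Finset

noncomputable section

/-- The non-principal Dirichlet character modulo 4. -/
def chi4 (n : ℕ) : ℝ := if n % 4 = 1 then 1 else if n % 4 = 3 then -1 else 0

/-- θ₀ = 1/2 - (1/4) e log 2. -/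
def theta0 : ℝ := 1 / 2 - (1 / 4) * Real.exp 1 * Real.log 2

/-- Weighted sum over ordered triples of primes with p₁ + p₂ + p₃ = N. -/
def tripleSum (N : ℕ) (w1 w2 : ℕ → ℝ) : ℝ :=
  ∑ p1 ∈ Finset.range (N + 1), ∑ p2 ∈ Finset.range (N + 1), ∑ p3 ∈ Finset.range (N + 1),
    if p1.Prime ∧ p2.Prime ∧ p3.Prime ∧ p1 + p2 + p3 = N then
      w1 p1 * w2 p2 * Real.log p1 * Real.log p2 * Real.log p3
    else 0

/-- r₁(m) = ∑_{d ∣ m, d ≤ D} χ(d). -/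
def r1 (D : ℝ) (m : ℕ) : ℝ := ∑ d ∈ m.divisors, if (d : ℝ) ≤ D then chi4 d else 0

/-- r₂(m) = ∑_{d ∣ m, D < d < N/D} χ(d). -/
def r2 (D NR : ℝ) (m : ℕ) : ℝ :=
  ∑ d ∈ m.divisors, if D < (d : ℝ) ∧ (d : ℝ) < NR / D then chi4 d else 0

/-- r₃(m) = ∑_{d ∣ m, d ≥ N/D} χ(d). -/
def r3 (D NR : ℝ) (m : ℕ) : ℝ :=
  ∑ d ∈ m.divisors, if NR / D ≤ (d : ℝ) then chi4 d else 0

/-- Partial sums `a 1 + ... + a n`. -/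
def psum (a : ℕ → ℂ) (n : ℕ) : ℂ := ∑ k ∈ Finset.range n, a (k + 1)

lemma psum_succ (a : ℕ → ℂ) (n : ℕ) : psum a (n + 1) = psum a n + a (n + 1) := by
  simp [psum, Finset.sum_range_succ]

/-- The general term of the Dirichlet series of `a` after Abel summation. -/
def abelTerm (a : ℕ → ℂ) (s : ℂ) (n : ℕ) : ℂ :=
  psum a (n + 1) * (((n + 1 : ℕ) : ℂ) ^ (-s) - ((n + 2 : ℕ) : ℂ) ^ (-s))

lemma abel_finite (a : ℕ → ℂ) (s : ℂ) (X : ℕ) :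
    ∑ n ∈ Finset.range X, a (n + 1) * ((n + 1 : ℕ) : ℂ) ^ (-s) =
      ∑ n ∈ Finset.range X, abelTerm a s n + psum a X * ((X + 1 : ℕ) : ℂ) ^ (-s) := by
  induction X with
  | zero => simp [psum]
  | succ X ih =>
    rw [Finset.sum_range_succ, ih, Finset.sum_range_succ, abelTerm, psum_succ, show X + 1 + 1 = X + 2 from rfl]
    ring

lemma norm_cpow_sub_le {s : ℂ} (hs : 0 < s.re) (n : ℕ) (hn : 1 ≤ n) :
    ‖((n : ℕ) : ℂ) ^ (-s) - ((n + 1 : ℕ) : ℂ) ^ (-s)‖ ≤ ‖s‖ * (n : ℝ) ^ (-s.re - 1) := by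
  have hn' : (1 : ℝ) ≤ n := by exact_mod_cast hn
  have hs0 : -s ≠ 0 := by
    intro h
    have : s = 0 := by simpa using h
    simp [this] at hs
  have := Convex.norm_image_sub_le_of_norm_hasDerivWithin_le
    (f := fun y : ℝ => (y : ℂ) ^ (-s)) (f' := fun x : ℝ => -s * (x : ℂ) ^ (-s - 1))
    (s := Set.Icc (n : ℝ) (n + 1)) (x := (n : ℝ) + 1) (y := (n : ℝ))
    (C := ‖s‖ * (n : ℝ) ^ (-s.re - 1)) ?_ ?_ (convex_Icc _ _) (by simp) (by simp)
  · simpa using this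
  · intro x hx
    have hx0 : x ≠ 0 := by have := hx.1; intro h; linarith
    exact (hasDerivAt_ofReal_cpow_const hx0 hs0).hasDerivWithinAt
  · intro x hx
    have hx0 : 0 < x := by have := hx.1; linarith
    rw [norm_mul, norm_neg, Complex.norm_cpow_eq_rpow_re_of_pos hx0]
    gcongr
    simp only [Complex.sub_re, Complex.neg_re, Complex.one_re]
    exact Real.rpow_le_rpow_of_nonpos (by linarith) hx.1 (by linarith)

lemma norm_abelTerm_le {a : ℕ → ℂ} {A : ℝ} (hA : ∀ n, ‖psum a n‖ ≤ A) {s : ℂ} (hs : 0 < s.re)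
    (n : ℕ) : ‖abelTerm a s n‖ ≤ A * ‖s‖ * ((n + 1 : ℕ) : ℝ) ^ (-s.re - 1) := by
  rw [abelTerm, norm_mul, mul_assoc]
  have hA0 : 0 ≤ A := (norm_nonneg _).trans (hA 0)
  gcongr
  · exact hA _
  · exact norm_cpow_sub_le hs (n + 1) (by omega)

lemma sum_rpow_tail_le {η : ℝ} (hη : 0 < η) (X : ℕ) (hX : 1 ≤ X) (m : ℕ) :
    ∑ n ∈ Finset.range m, ((X + n + 1 : ℕ) : ℝ) ^ (-η - 1) ≤ (X : ℝ) ^ (-η) / η := by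
  have hX0 : (0 : ℝ) < X := by exact_mod_cast hX
  have h := AntitoneOn.sum_le_integral (x₀ := (X : ℝ)) (a := m)
    (f := fun x : ℝ => x ^ (-η - 1)) (by
      intro x hx y hy hxy
      exact Real.rpow_le_rpow_of_nonpos (by linarith [hx.1]) hxy (by linarith))
  rw [integral_rpow (by
    right
    refine ⟨by linarith, ?_⟩
    rw [Set.uIcc_of_le (by linarith [(Nat.cast_nonneg m : (0:ℝ) ≤ m)])]
    intro h0; linarith [h0.1])] at h
  have e : ∀ n : ℕ, ((X + n + 1 : ℕ) : ℝ) = (X : ℝ) + ((n + 1 : ℕ) : ℝ) := by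
    intro n; push_cast; ring
  simp only [e]
  refine h.trans ?_
  have : -η - 1 + 1 = -η := by ring
  rw [this, div_neg, ← neg_div, neg_sub]
  gcongr
  have : 0 ≤ ((X : ℝ) + m) ^ (-η) := by positivity
  linarith

lemma sum_rpow_head_le {η : ℝ} (hη : 0 < η) (hη1 : η ≤ 1) (X : ℕ) :
    ∑ n ∈ Finset.range X, ((n + 1 : ℕ) : ℝ) ^ (η - 1) ≤ (X : ℝ) ^ η / η := by
  have key : ∀ n : ℕ, ((n + 1 : ℕ) : ℝ) ^ (η - 1) ≤ (((n + 1 : ℕ) : ℝ) ^ η - (n : ℝ) ^ η) / η := by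
    intro n
    have hn1 : (0 : ℝ) < ((n + 1 : ℕ) : ℝ) := by positivity
    set y : ℝ := ((n + 1 : ℕ) : ℝ) with hy
    have hny : (n : ℝ) = y * (1 + (-1 / y)) := by
      field_simp
      rw [hy]; push_cast; ring
    have hy1 : 1 ≤ y := by rw [hy]; push_cast; linarith [(Nat.cast_nonneg n : (0:ℝ) ≤ n)]
    have hinv : -1 ≤ -1 / y := by
      rw [neg_div, neg_le_neg_iff, div_le_one hn1]; exact hy1
    have hb := rpow_one_add_le_one_add_mul_self (s := -1 / y) hinv hη.le hη1
    have h2 : (n : ℝ) ^ η ≤ y ^ η * (1 + η * (-1 / y)) := by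
      rw [hny, Real.mul_rpow hn1.le (by linarith)]
      gcongr
    rw [le_div_iff₀ hη, Real.rpow_sub_one hn1.ne']
    have : y ^ η * (1 + η * (-1 / y)) = y ^ η - y ^ η / y * η := by field_simp; ring
    linarith
  calc _ ≤ ∑ n ∈ Finset.range X, (((n + 1 : ℕ) : ℝ) ^ η - (n : ℝ) ^ η) / η :=
        Finset.sum_le_sum fun n _ => key n
    _ = _ := by
        rw [← Finset.sum_div, Finset.sum_range_sub (fun n : ℕ => (n : ℝ) ^ η)]
        simp [Real.zero_rpow hη.ne']

lemma summable_rpow_shift {σ : ℝ} (hσ : 0 < σ) :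
    Summable fun n : ℕ => ((n + 1 : ℕ) : ℝ) ^ (-σ - 1) :=
  (summable_nat_add_iff 1).2 (Real.summable_nat_rpow.2 (by linarith))

lemma summable_abelTerm {a : ℕ → ℂ} {A : ℝ} (hA : ∀ n, ‖psum a n‖ ≤ A) {s : ℂ} (hs : 0 < s.re) :
    Summable (abelTerm a s) :=
  Summable.of_norm_bounded ((summable_rpow_shift hs).mul_left (A * ‖s‖))
    fun n => norm_abelTerm_le hA hs n

lemma differentiableOn_abel {a : ℕ → ℂ} {A : ℝ} (hA : ∀ n, ‖psum a n‖ ≤ A) :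
    DifferentiableOn ℂ (fun s => ∑' n, abelTerm a s n) {s | 0 < s.re} := by
  intro s hs
  have hs' : 0 < s.re := hs
  have hA0 : 0 ≤ A := (norm_nonneg _).trans (hA 0)
  set U : Set ℂ := {w | s.re / 2 < w.re} ∩ Metric.ball 0 (‖s‖ + 1) with hU
  have hUo : IsOpen U := (isOpen_lt continuous_const Complex.continuous_re).inter Metric.isOpen_ball
  have hsU : s ∈ U := ⟨by change s.re / 2 < s.re; linarith, by simp⟩
  have := Complex.differentiableOn_tsum_of_summable_norm (F := fun n s => abelTerm a s n) (U := U)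
    (u := fun n => A * (‖s‖ + 1) * ((n + 1 : ℕ) : ℝ) ^ (-(s.re / 2) - 1))
    ((summable_rpow_shift (by linarith)).mul_left _) ?_ hUo ?_
  · exact ((this s hsU).differentiableAt (hUo.mem_nhds hsU)).differentiableWithinAt
  · intro n
    apply Differentiable.differentiableOn
    unfold abelTerm
    have h1 : ((n + 1 : ℕ) : ℂ) ≠ 0 := by exact_mod_cast Nat.succ_ne_zero n
    have h2 : ((n + 2 : ℕ) : ℂ) ≠ 0 := by exact_mod_cast Nat.succ_ne_zero (n + 1)
    intro z
    apply DifferentiableAt.const_mul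
    apply DifferentiableAt.sub
    · exact DifferentiableAt.const_cpow differentiableAt_id.neg (Or.inl h1)
    · exact DifferentiableAt.const_cpow differentiableAt_id.neg (Or.inl h2)
  · intro n w hw
    have hw1 : s.re / 2 < w.re := hw.1
    have hw2 : ‖w‖ < ‖s‖ + 1 := by simpa using hw.2
    refine (norm_abelTerm_le hA (by linarith) n).trans ?_
    gcongr
    · exact_mod_cast Nat.succ_pos n

lemma tendsto_abel_bdry {a : ℕ → ℂ} {A : ℝ} (hA : ∀ n, ‖psum a n‖ ≤ A) {s : ℂ} (hs : 0 < s.re) :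
    Filter.Tendsto (fun X : ℕ => psum a X * ((X + 1 : ℕ) : ℂ) ^ (-s)) Filter.atTop (nhds 0) := by
  have h1 : Filter.Tendsto (fun X : ℕ => A * ((X + 1 : ℕ) : ℝ) ^ (-s.re)) Filter.atTop (nhds 0) := by
    have := (tendsto_rpow_neg_atTop hs).comp
      ((tendsto_natCast_atTop_atTop (R := ℝ)).comp (Filter.tendsto_add_atTop_nat 1))
    simpa using this.const_mul A
  refine squeeze_zero_norm (fun X => ?_) h1
  rw [norm_mul, Complex.norm_natCast_cpow_of_pos (Nat.succ_pos X)]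
  have hA0 : 0 ≤ A := (norm_nonneg _).trans (hA 0)
  rw [Complex.neg_re]
  gcongr
  exact hA X

lemma LSeries_eq_abel {a : ℕ → ℂ} {A : ℝ} (hA : ∀ n, ‖psum a n‖ ≤ A) {s : ℂ} (hs : 0 < s.re)
    (hsum : LSeriesSummable a s) : LSeries a s = ∑' n, abelTerm a s n := by
  have h1 : HasSum (LSeries.term a s) (LSeries a s) := hsum.hasSum
  have h2 : Filter.Tendsto (fun X : ℕ => ∑ n ∈ Finset.range X, LSeries.term a s (n + 1))
      Filter.atTop (nhds (LSeries a s)) := by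
    have h0 : LSeries.term a s 0 = 0 := LSeries.term_zero a s
    have := (hasSum_nat_add_iff (f := LSeries.term a s) (g := LSeries a s) 1).2 (by simpa [h0] using h1)
    exact this.tendsto_sum_nat
  have h3 := (summable_abelTerm hA hs).hasSum.tendsto_sum_nat
  have h4 := h3.add (tendsto_abel_bdry hA hs)
  rw [add_zero] at h4
  refine tendsto_nhds_unique (h2.congr fun X => ?_) h4
  rw [← abel_finite]
  refine Finset.sum_congr rfl fun n _ => ?_
  rw [LSeries.term_of_ne_zero (Nat.succ_ne_zero n), Complex.cpow_neg, div_eq_mul_inv]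

/-- Bound for the continued Dirichlet series of a sequence with bounded partial sums. -/
lemma norm_abel_le {η : ℝ} (hη : 0 < η) (hη1 : η ≤ 1 / 2) {a : ℕ → ℂ} (ha : ∀ n, ‖a n‖ ≤ 1) {A : ℝ}
    (hA1 : 1 ≤ A) (hA : ∀ n, ‖psum a n‖ ≤ A) {s : ℂ} (hs : 1 - η ≤ s.re) :
    ‖∑' n, abelTerm a s n‖ ≤ 4 * (1 / η + 3) * (A * ‖s‖) ^ η := by
  have hs0 : 0 < s.re := by linarith
  have hns : 1 / 2 ≤ ‖s‖ := by
    have := Complex.abs_re_le_norm s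
    rw [abs_of_pos hs0] at this
    linarith
  set Y : ℝ := A * ‖s‖ with hY
  have hY0 : 1 / 2 ≤ Y := by rw [hY]; nlinarith
  set X : ℕ := ⌈Y⌉₊ with hX
  have hX1 : 1 ≤ X := Nat.one_le_ceil_iff.2 (by linarith)
  have hXr : (1 : ℝ) ≤ X := by exact_mod_cast hX1
  have hYX : Y ≤ X := Nat.le_ceil _
  have hXY : (X : ℝ) ≤ 4 * Y := by
    have := Nat.ceil_lt_add_one (a := Y) (by linarith)
    rw [← hX] at this
    linarith
  have hXη : (X : ℝ) ^ η ≤ 4 * Y ^ η := by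
    calc (X : ℝ) ^ η ≤ (4 * Y) ^ η := by gcongr
      _ = 4 ^ η * Y ^ η := Real.mul_rpow (by norm_num) (by linarith)
      _ ≤ 4 * Y ^ η := by
        gcongr
        calc (4 : ℝ) ^ η ≤ 4 ^ (1 : ℝ) := by
              apply Real.rpow_le_rpow_of_exponent_le <;> linarith
          _ = 4 := by simp
  have hsplit := (summable_abelTerm hA hs0).sum_add_tsum_nat_add X
  have hfin := abel_finite a s X
  have e : ∑' n, abelTerm a s n = ∑ n ∈ Finset.range X, a (n + 1) * ((n + 1 : ℕ) : ℂ) ^ (-s)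
      - psum a X * ((X + 1 : ℕ) : ℂ) ^ (-s) + ∑' n, abelTerm a s (n + X) := by
    rw [← hsplit, hfin]; ring
  have b1 : ‖∑ n ∈ Finset.range X, a (n + 1) * ((n + 1 : ℕ) : ℂ) ^ (-s)‖ ≤ (X : ℝ) ^ η / η := by
    refine (norm_sum_le _ _).trans ((Finset.sum_le_sum fun n _ => ?_).trans
      (sum_rpow_head_le hη (by linarith) X))
    rw [norm_mul, Complex.norm_natCast_cpow_of_pos (Nat.succ_pos n)]
    calc ‖a (n + 1)‖ * ((n + 1 : ℕ) : ℝ) ^ (-s).re ≤ 1 * ((n + 1 : ℕ) : ℝ) ^ (-s).re := by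
          gcongr; exact ha _
      _ ≤ _ := by
          rw [one_mul]
          apply Real.rpow_le_rpow_of_exponent_le
          · push_cast; linarith [(Nat.cast_nonneg n : (0:ℝ) ≤ n)]
          · simp; linarith
  have b2 : ‖psum a X * ((X + 1 : ℕ) : ℂ) ^ (-s)‖ ≤ (X : ℝ) ^ η := by
    rw [norm_mul, Complex.norm_natCast_cpow_of_pos (Nat.succ_pos X)]
    have h1 : ‖psum a X‖ ≤ X := by
      refine (norm_sum_le _ _).trans ((Finset.sum_le_sum fun n _ => ha (n + 1)).trans ?_)
      simp
    calc ‖psum a X‖ * ((X + 1 : ℕ) : ℝ) ^ (-s).re ≤ X * (X : ℝ) ^ (η - 1) := by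
          gcongr
          calc ((X + 1 : ℕ) : ℝ) ^ (-s).re ≤ (X : ℝ) ^ (-s).re := by
                apply Real.rpow_le_rpow_of_nonpos (by linarith)
                · push_cast; linarith
                · simp; linarith
            _ ≤ _ := by
                apply Real.rpow_le_rpow_of_exponent_le hXr
                simp; linarith
      _ = _ := by rw [Real.rpow_sub_one (by linarith)]; field_simp
  have b3 : ‖∑' n, abelTerm a s (n + X)‖ ≤ 2 * (X : ℝ) ^ η := by
    have hb : ∀ n, ‖abelTerm a s (n + X)‖ ≤ Y * ((X + n + 1 : ℕ) : ℝ) ^ (-(1 - η) - 1) := by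
      intro n
      refine (norm_abelTerm_le hA hs0 _).trans ?_
      rw [← hY, show n + X + 1 = X + n + 1 by ring]
      gcongr
      · push_cast; linarith [(Nat.cast_nonneg n : (0:ℝ) ≤ n)]
    have hsm : Summable fun n => ‖abelTerm a s (n + X)‖ :=
      ((summable_nat_add_iff X).2 (summable_abelTerm hA hs0).norm)
    refine (norm_tsum_le_tsum_norm hsm).trans (hsm.tsum_le_of_sum_range_le fun m => ?_)
    calc _ ≤ ∑ n ∈ Finset.range m, Y * ((X + n + 1 : ℕ) : ℝ) ^ (-(1 - η) - 1) :=
          Finset.sum_le_sum fun n _ => hb n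
      _ ≤ Y * ((X : ℝ) ^ (-(1 - η)) / (1 - η)) := by
          rw [← Finset.mul_sum]
          gcongr
          exact sum_rpow_tail_le (by linarith) X hX1 m
      _ ≤ X * ((X : ℝ) ^ (-(1 - η)) / (1 / 2)) := by
          have h1 : 0 ≤ (X : ℝ) ^ (-(1 - η)) := by positivity
          have h2 : 0 < 1 - η := by linarith
          gcongr
          linarith
      _ = _ := by
          rw [show -(1 - η) = η - 1 by ring, Real.rpow_sub_one (by linarith)]; field_simp
  rw [e]
  calc _ ≤ (X : ℝ) ^ η / η + (X : ℝ) ^ η + 2 * (X : ℝ) ^ η :=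
        (norm_add_le _ _).trans (add_le_add ((norm_sub_le _ _).trans (add_le_add b1 b2)) b3)
    _ = (1 / η + 3) * (X : ℝ) ^ η := by ring
    _ ≤ (1 / η + 3) * (4 * Y ^ η) := by gcongr
    _ = _ := by ring

lemma sum_range_zmod {r : ℕ} [NeZero r] (f : ZMod r → ℂ) :
    ∑ k ∈ Finset.range r, f (k : ZMod r) = ∑ x : ZMod r, f x := by
  refine Finset.sum_bij (fun k _ => (k : ZMod r)) (by simp) ?_ ?_ (by simp)
  · intro a ha b hb hab
    have := (ZMod.natCast_eq_natCast_iff' a b r).1 hab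
    rwa [Nat.mod_eq_of_lt (Finset.mem_range.1 ha), Nat.mod_eq_of_lt (Finset.mem_range.1 hb)] at this
  · intro x _
    exact ⟨x.val, Finset.mem_range.2 (ZMod.val_lt x), by simp⟩

/-- Partial sums of a function on `ZMod r` with mean zero and values in the unit disc. -/
lemma norm_psum_periodic_le {r : ℕ} [NeZero r] (f : ZMod r → ℂ) (hf : ∑ x, f x = 0)
    (hf1 : ∀ x, ‖f x‖ ≤ 1) (n : ℕ) : ‖psum (fun k => f (k : ZMod r)) n‖ ≤ r := by
  have hper : ∀ n, psum (fun k => f (k : ZMod r)) (n + r) = psum (fun k => f (k : ZMod r)) n := by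
    intro n
    rw [psum, Finset.sum_range_add, psum, add_eq_left]
    have := sum_range_zmod (r := r) (fun x => f (n + x + 1))
    rw [← Fintype.sum_equiv (Equiv.addRight ((n : ZMod r) + 1)) (fun x => f (n + x + 1)) f
      (fun x => by simp only [Equiv.coe_addRight]; congr 1; ring)] at hf
    rw [hf] at this
    simpa using this
  have hmod : ∀ n, psum (fun k => f (k : ZMod r)) n = psum (fun k => f (k : ZMod r)) (n % r) := by
    intro n
    have : ∀ k m, psum (fun k => f (k : ZMod r)) (m + r * k) = psum (fun k => f (k : ZMod r)) m := by
      intro k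
      induction k with
      | zero => simp
      | succ k ih => intro m; rw [Nat.mul_succ, ← add_assoc, hper, ih]
    conv_lhs => rw [← Nat.mod_add_div n r]
    exact this _ _
  rw [hmod]
  refine (norm_sum_le _ _).trans ((Finset.sum_le_sum fun k _ => hf1 _).trans ?_)
  simp only [Finset.sum_const, Finset.card_range, nsmul_eq_mul, mul_one]
  exact_mod_cast (Nat.mod_lt n (NeZero.pos r)).le

lemma norm_psum_char_le {r : ℕ} [NeZero r] {χ : DirichletCharacter ℂ r} (hχ : χ ≠ 1) (n : ℕ) :
    ‖psum (fun k => χ k) n‖ ≤ r :=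
  norm_psum_periodic_le (fun x => χ x) (MulChar.sum_eq_zero_of_ne_one hχ)
    (fun x => χ.norm_le_one x) n

lemma LFunction_eq_abel {r : ℕ} [NeZero r] {χ : DirichletCharacter ℂ r} (hχ : χ ≠ 1) {s : ℂ}
    (hs : 0 < s.re) : χ.LFunction s = ∑' n, abelTerm (fun k => χ k) s n := by
  have hU : IsOpen {s : ℂ | 0 < s.re} := isOpen_lt continuous_const Complex.continuous_re
  have hA := norm_psum_char_le hχ
  have h1 : AnalyticOnNhd ℂ χ.LFunction {s : ℂ | 0 < s.re} :=
    (DirichletCharacter.differentiable_LFunction hχ).differentiableOn.analyticOnNhd hU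
  have h2 := (differentiableOn_abel hA).analyticOnNhd hU
  have hconn : IsPreconnected {s : ℂ | 0 < s.re} := (convex_halfSpace_re_gt 0).isPreconnected
  refine h1.eqOn_of_preconnected_of_eventuallyEq h2 hconn (z₀ := 2) (by simp) ?_ hs
  have : {s : ℂ | 1 < s.re} ∈ nhds (2 : ℂ) :=
    (isOpen_lt continuous_const Complex.continuous_re).mem_nhds (by simp)
  filter_upwards [this] with z hz
  have hz' : 1 < z.re := hz
  rw [DirichletCharacter.LFunction_eq_LSeries χ hz']
  exact LSeries_eq_abel hA (by linarith) (χ.LSeriesSummable_of_one_lt_re hz')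

lemma norm_LFunction_le {η : ℝ} (hη : 0 < η) (hη1 : η ≤ 1 / 2) {r : ℕ} [NeZero r]
    {χ : DirichletCharacter ℂ r} (hχ : χ ≠ 1) {s : ℂ} (hs : 1 - η ≤ s.re) :
    ‖χ.LFunction s‖ ≤ 4 * (1 / η + 3) * (r * ‖s‖) ^ η := by
  rw [LFunction_eq_abel hχ (by linarith)]
  exact norm_abel_le hη hη1 (fun n => χ.norm_le_one _) (by exact_mod_cast NeZero.one_le)
    (norm_psum_char_le hχ) hs

lemma norm_cpow_sub_integral_le {s : ℂ} (hs : 1 < s.re) (n : ℕ) (hn : 1 ≤ n) :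
    ‖(n : ℂ) ^ (-s) - ((n : ℂ) ^ (1 - s) - ((n + 1 : ℕ) : ℂ) ^ (1 - s)) / (s - 1)‖ ≤
      ‖s‖ * (n : ℝ) ^ (-s.re - 1) := by
  have hn' : (1 : ℝ) ≤ n := by exact_mod_cast hn
  have hs1 : s - 1 ≠ 0 := by
    intro h
    have : s = 1 := by linear_combination h
    simp [this] at hs
  have hs10 : 1 - s ≠ 0 := by intro h; apply hs1; linear_combination -h
  have hs0 : -s ≠ 0 := by
    intro h
    have : s = 0 := by simpa using h
    simp [this] at hs
    linarith
  have hd : ∀ x ∈ Set.Icc (n : ℝ) (n + 1), ‖(x : ℂ) ^ (-s) - (n : ℂ) ^ (-s)‖ ≤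
      ‖s‖ * (n : ℝ) ^ (-s.re - 1) := by
    intro x hx
    have := Convex.norm_image_sub_le_of_norm_hasDerivWithin_le
      (f := fun y : ℝ => (y : ℂ) ^ (-s)) (f' := fun x : ℝ => -s * (x : ℂ) ^ (-s - 1))
      (s := Set.Icc (n : ℝ) (n + 1)) (x := (n : ℝ)) (y := x)
      (C := ‖s‖ * (n : ℝ) ^ (-s.re - 1)) ?_ ?_ (convex_Icc _ _) (by simp) hx
    · refine this.trans ?_
      have hx1 : ‖x - n‖ ≤ 1 := by
        rw [Real.norm_eq_abs, abs_le]; constructor <;> linarith [hx.1, hx.2]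
      exact mul_le_of_le_one_right (by positivity) hx1
    · intro x hx
      have hx0 : x ≠ 0 := by have := hx.1; intro h; linarith
      exact (hasDerivAt_ofReal_cpow_const hx0 hs0).hasDerivWithinAt
    · intro x hx
      have hx0 : 0 < x := by have := hx.1; linarith
      rw [norm_mul, norm_neg, Complex.norm_cpow_eq_rpow_re_of_pos hx0]
      gcongr
      simp only [Complex.sub_re, Complex.neg_re, Complex.one_re]
      exact Real.rpow_le_rpow_of_nonpos (by linarith) hx.1 (by linarith)
  have := Convex.norm_image_sub_le_of_norm_hasDerivWithin_le
    (f := fun y : ℝ => (y : ℂ) ^ (1 - s) / (1 - s) - y * (n : ℂ) ^ (-s))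
    (f' := fun x : ℝ => (x : ℂ) ^ (-s) - (n : ℂ) ^ (-s))
    (s := Set.Icc (n : ℝ) (n + 1)) (x := (n : ℝ)) (y := (n : ℝ) + 1)
    (C := ‖s‖ * (n : ℝ) ^ (-s.re - 1)) ?_ hd (convex_Icc _ _) (by simp) (by simp)
  · rw [← norm_neg]
    refine le_trans (le_of_eq ?_) (this.trans (le_of_eq (by simp)))
    congr 1
    push_cast
    field_simp
    ring
  · intro x hx
    have hx0 : x ≠ 0 := by have := hx.1; intro h; linarith
    have h1 := (hasDerivAt_ofReal_cpow_const hx0 hs10).div_const (1 - s)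
    have h2 := (((hasDerivAt_id x).ofReal_comp).mul_const ((n : ℂ) ^ (-s)))
    have h3 := (h1.sub h2).hasDerivWithinAt (s := Set.Icc (n : ℝ) (n + 1))
    convert h3 using 1
    · rfl
    · rw [show 1 - s - 1 = -s by ring]
      field_simp
      simp

lemma norm_zeta_le {η : ℝ} (hη : 0 < η) (hη1 : η ≤ 1 / 2) {s : ℂ} (hs : 1 < s.re) :
    ‖riemannZeta s‖ ≤ 4 * (1 / η + 3) * ‖s‖ ^ η + 1 / ‖s - 1‖ := by
  have hns : 1 ≤ ‖s‖ := by
    have := Complex.abs_re_le_norm s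
    rw [abs_of_pos (by linarith)] at this
    linarith
  have hs1 : s - 1 ≠ 0 := by
    intro h
    have : s = 1 := by linear_combination h
    simp [this] at hs
  set X : ℕ := ⌈‖s‖⌉₊ with hX
  have hX1 : 1 ≤ X := Nat.one_le_ceil_iff.2 (by linarith)
  have hXr : (1 : ℝ) ≤ X := by exact_mod_cast hX1
  have hYX : ‖s‖ ≤ X := Nat.le_ceil _
  have hXY : (X : ℝ) ≤ 4 * ‖s‖ := by
    have := Nat.ceil_lt_add_one (a := ‖s‖) (by linarith)
    rw [← hX] at this
    linarith
  have hXη : (X : ℝ) ^ η ≤ 4 * ‖s‖ ^ η := by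
    calc (X : ℝ) ^ η ≤ (4 * ‖s‖) ^ η := by gcongr
      _ = 4 ^ η * ‖s‖ ^ η := Real.mul_rpow (by norm_num) (by linarith)
      _ ≤ 4 * ‖s‖ ^ η := by
        gcongr
        calc (4 : ℝ) ^ η ≤ 4 ^ (1 : ℝ) := by
              apply Real.rpow_le_rpow_of_exponent_le <;> linarith
          _ = 4 := by simp
  set f : ℕ → ℂ := fun n => ((n + 1 : ℕ) : ℂ) ^ (-s) with hf
  set g : ℕ → ℂ := fun n => (((n + 1 : ℕ) : ℂ) ^ (1 - s) - ((n + 2 : ℕ) : ℂ) ^ (1 - s)) / (s - 1)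
    with hg
  have hzeta : HasSum f (riemannZeta s) := by
    have h0 := (Complex.summable_one_div_nat_cpow.2 hs).hasSum
    rw [← zeta_eq_tsum_one_div_nat_cpow hs] at h0
    have h1 := (hasSum_nat_add_iff (f := fun n : ℕ => 1 / (n : ℂ) ^ s) (g := riemannZeta s) 1).2 (by
      have : s ≠ 0 := by intro h; simp [h] at hns; linarith
      simpa [this] using h0)
    refine h1.congr_fun ?_ |> fun h => h
    intro n
    simp [hf, Complex.cpow_neg]
  have hfg : ∀ n, ‖f (n + X) - g (n + X)‖ ≤ ‖s‖ * ((X + n + 1 : ℕ) : ℝ) ^ (-(1 : ℝ) - 1) := by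
    intro n
    refine (norm_cpow_sub_integral_le hs (n + X + 1) (by omega)).trans ?_
    rw [show n + X + 1 = X + n + 1 by ring]
    gcongr
    · push_cast; linarith [(Nat.cast_nonneg n : (0:ℝ) ≤ n)]
  have hgsum : Filter.Tendsto (fun m => ∑ n ∈ Finset.range m, g (n + X)) Filter.atTop
      (nhds (((X + 1 : ℕ) : ℂ) ^ (1 - s) / (s - 1))) := by
    have h1 : ∀ m, ∑ n ∈ Finset.range m, g (n + X) =
        (((X + 1 : ℕ) : ℂ) ^ (1 - s) - ((X + m + 1 : ℕ) : ℂ) ^ (1 - s)) / (s - 1) := by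
      intro m
      induction m with
      | zero => simp
      | succ m ih =>
        rw [Finset.sum_range_succ, ih, hg]
        simp only
        rw [show m + X + 1 = X + m + 1 by ring, show m + X + 2 = X + (m + 1) + 1 by ring]
        ring
    simp only [h1]
    have h2 : Filter.Tendsto (fun m : ℕ => ((X + m + 1 : ℕ) : ℂ) ^ (1 - s)) Filter.atTop (nhds 0) := by
      rw [tendsto_zero_iff_norm_tendsto_zero]
      have := (tendsto_rpow_neg_atTop (show 0 < s.re - 1 by linarith)).comp
        ((tendsto_natCast_atTop_atTop (R := ℝ)).comp (Filter.tendsto_add_atTop_nat (X + 1)))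
      refine this.congr fun m => ?_
      rw [Complex.norm_natCast_cpow_of_pos (by omega)]
      simp only [Function.comp, Complex.sub_re, Complex.one_re, neg_sub]
      congr 2
      ring
    simpa using (h2.const_sub _).div_const (s - 1)
  have hdiff : Filter.Tendsto (fun m => ∑ n ∈ Finset.range m, (f (n + X) - g (n + X))) Filter.atTop
      (nhds (riemannZeta s - ∑ n ∈ Finset.range X, f n - ((X + 1 : ℕ) : ℂ) ^ (1 - s) / (s - 1))) := by
    have h3 : HasSum (fun n => f (n + X)) (riemannZeta s - ∑ n ∈ Finset.range X, f n) :=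
      (hasSum_nat_add_iff X).2 (by simpa using hzeta)
    simp only [Finset.sum_sub_distrib]
    exact h3.tendsto_sum_nat.sub hgsum
  have hb : ‖riemannZeta s - ∑ n ∈ Finset.range X, f n - ((X + 1 : ℕ) : ℂ) ^ (1 - s) / (s - 1)‖ ≤ 1 := by
    refine le_of_tendsto hdiff.norm (Filter.Eventually.of_forall fun m => ?_)
    refine (norm_sum_le _ _).trans ((Finset.sum_le_sum fun n _ => hfg n).trans ?_)
    rw [← Finset.mul_sum]
    calc _ ≤ ‖s‖ * ((X : ℝ) ^ (-(1 : ℝ)) / 1) := by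
          gcongr
          exact sum_rpow_tail_le one_pos X hX1 m
      _ ≤ _ := by
          rw [Real.rpow_neg_one, div_one, ← div_eq_mul_inv, div_le_one (by linarith)]
          exact hYX
  have b1 : ‖∑ n ∈ Finset.range X, f n‖ ≤ (X : ℝ) ^ η / η := by
    refine (norm_sum_le _ _).trans ((Finset.sum_le_sum fun n _ => ?_).trans
      (sum_rpow_head_le hη (by linarith) X))
    rw [hf]
    simp only
    rw [Complex.norm_natCast_cpow_of_pos (Nat.succ_pos n)]
    apply Real.rpow_le_rpow_of_exponent_le
    · push_cast; linarith [(Nat.cast_nonneg n : (0:ℝ) ≤ n)]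
    · simp; linarith
  have b2 : ‖((X + 1 : ℕ) : ℂ) ^ (1 - s) / (s - 1)‖ ≤ 1 / ‖s - 1‖ := by
    rw [norm_div, Complex.norm_natCast_cpow_of_pos (Nat.succ_pos X)]
    gcongr
    apply Real.rpow_le_one_of_one_le_of_nonpos
    · push_cast; linarith
    · simp; linarith
  have b3 : 1 ≤ ‖s‖ ^ η := Real.one_le_rpow hns hη.le
  calc ‖riemannZeta s‖ = ‖(riemannZeta s - ∑ n ∈ Finset.range X, f n
        - ((X + 1 : ℕ) : ℂ) ^ (1 - s) / (s - 1)) + ∑ n ∈ Finset.range X, f n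
        + ((X + 1 : ℕ) : ℂ) ^ (1 - s) / (s - 1)‖ := by congr 1; ring
    _ ≤ 1 + (X : ℝ) ^ η / η + 1 / ‖s - 1‖ :=
        (norm_add_le _ _).trans (add_le_add ((norm_add_le _ _).trans (add_le_add hb b1)) b2)
    _ ≤ ‖s‖ ^ η + 4 * ‖s‖ ^ η / η + 1 / ‖s - 1‖ := by gcongr
    _ ≤ _ := by
        have : ‖s‖ ^ η + 4 * ‖s‖ ^ η / η = (4 / η + 1) * ‖s‖ ^ η := by ring
        rw [this]
        gcongr
        have : 4 * (1 / η + 3) = 4 / η + 12 := by ring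
        linarith

open scoped ComplexOrder in
/-- Estermann's inequality for a Dirichlet series with nonnegative coefficients and a simple
pole at `1`. -/
lemma estermann_aux {K : ℂ → ℂ} (hK : Differentiable ℂ K) {f : ℕ → ℂ} (hf : 0 ≤ f) (hf1 : f 1 = 1)
    (hab : LSeries.abscissaOfAbsConv f ≤ 1)
    (hFK : ∀ s : ℂ, 1 < s.re → (s - 1) * LSeries f s = K s) {B : ℝ}
    (hB : ∀ s ∈ Metric.sphere (2 : ℂ) (3 / 2), ‖K s‖ ≤ B) (hB1 : ‖K 1‖ ≤ B)
    {σ : ℝ} (hσ : 7 / 8 ≤ σ) (hσ1 : σ < 1) (hneg : 0 ≤ (K σ).re) (M : ℕ)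
    (hM : 16 * B * (3 / 4) ^ M ≤ 1 / 2) :
    (1 - σ) / 2 ≤ (K 1).re * (2 - σ) ^ M := by
  have hB0 : 0 ≤ B := (norm_nonneg _).trans hB1
  set G : ℂ → ℂ := dslope K 1 with hG
  have hGd : Differentiable ℂ G := by
    have := (Complex.differentiableOn_dslope (s := Set.univ) (c := 1) (f := K) Filter.univ_mem).2
      hK.differentiableOn
    exact differentiableOn_univ.1 this
  have hGne : ∀ s : ℂ, s ≠ 1 → G s = (K s - K 1) / (s - 1) := by
    intro s hs
    rw [hG, dslope_of_ne _ hs, slope_def_field]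
  have hGB : ∀ s ∈ Metric.sphere (2 : ℂ) (3 / 2), ‖G s‖ ≤ 4 * B := by
    intro s hs
    have h2 : ‖s - 2‖ = 3 / 2 := by simpa [mem_sphere_iff_norm] using hs
    have h1 : 1 / 2 ≤ ‖s - 1‖ := by
      have : ‖s - 2‖ ≤ ‖s - 1‖ + ‖(1 : ℂ)‖ := by
        rw [show s - 2 = (s - 1) - 1 by ring]; exact norm_sub_le _ _
      rw [norm_one] at this
      linarith
    have hne : s ≠ 1 := by
      intro h
      rw [h] at h1
      norm_num at h1
    rw [hGne s hne, norm_div, div_le_iff₀ (by linarith)]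
    calc ‖K s - K 1‖ ≤ ‖K s‖ + ‖K 1‖ := norm_sub_le _ _
      _ ≤ 4 * B * (1 / 2) := by linarith [hB s hs]
      _ ≤ _ := by gcongr
  set g : ℕ → ℂ := fun n => (n.factorial : ℂ)⁻¹ * iteratedDeriv n G 2 with hg
  have hgB : ∀ n, ‖g n‖ ≤ 4 * B * (2 / 3) ^ n := by
    intro n
    have := Complex.norm_iteratedDeriv_le_of_forall_mem_sphere_norm_le n (c := (2 : ℂ))
      (R := 3 / 2) (by norm_num) hGd.diffContOnCl hGB
    rw [hg]
    simp only
    rw [norm_mul, norm_inv, Complex.norm_natCast]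
    have hfac : (0 : ℝ) < n.factorial := by exact_mod_cast n.factorial_pos
    rw [inv_mul_le_iff₀ hfac]
    refine this.trans (le_of_eq ?_)
    rw [show (2 / 3 : ℝ) = (3 / 2)⁻¹ by norm_num, inv_pow]
    ring
  have hsum : HasSum (fun n => g n * ((σ : ℂ) - 2) ^ n) (G σ) := by
    have := Complex.hasSum_taylorSeries_of_entire hGd 2 (σ : ℂ)
    refine this.congr_fun ?_ |> fun h => h
    intro n
    simp only [hg, smul_eq_mul]
    ring
  have habs : ∀ x : ℝ, 1 < x → LSeries.abscissaOfAbsConv f < x := fun x hx =>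
    hab.trans_lt (by exact_mod_cast hx)
  have hF : LSeries f =ᶠ[nhds 2] fun s => G s + K 1 * (s - 1)⁻¹ := by
    have : {s : ℂ | 1 < s.re} ∈ nhds (2 : ℂ) :=
      (isOpen_lt continuous_const Complex.continuous_re).mem_nhds (by simp)
    filter_upwards [this] with s hs
    have hs' : 1 < s.re := hs
    have hne : s ≠ 1 := by intro h; simp [h] at hs'
    have hne' : s - 1 ≠ 0 := sub_ne_zero.2 hne
    rw [hGne s hne, ← hFK s hs']
    field_simp
    ring
  have hinv : ∀ n, iteratedDeriv n (fun s : ℂ => K 1 * (s - 1)⁻¹) 2 =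
      K 1 * ((-1) ^ n * n.factorial) := by
    intro n
    have h1 : ContDiffAt ℂ n (fun s : ℂ => (s - 1)⁻¹) 2 := by
      apply ContDiffAt.inv
      · fun_prop
      · norm_num
    rw [iteratedDeriv_const_mul _ h1]
    have h2 := congrFun (iteratedDeriv_comp_sub_const n (fun s : ℂ => s⁻¹) 1) 2
    rw [h2, iteratedDeriv_eq_iterate]
    have h3 := iter_deriv_inv n (2 - 1 : ℂ)
    rw [show (fun s : ℂ => s⁻¹) = Inv.inv from rfl, h3]
    norm_num
  have hder : ∀ n, iteratedDeriv n (LSeries f) 2 =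
      iteratedDeriv n G 2 + K 1 * ((-1) ^ n * n.factorial) := by
    intro n
    rw [hF.iteratedDeriv_eq n, ← hinv n]
    refine iteratedDeriv_add (f := G) (g := fun s : ℂ => K 1 * (s - 1)⁻¹) ?_ ?_
    · exact (hGd.contDiff).contDiffAt
    · refine ContDiffAt.mul contDiffAt_const (ContDiffAt.inv ?_ ?_)
      · fun_prop
      · norm_num
  have hpos : ∀ n, -(K 1).re ≤ ((-1) ^ n * g n).re := by
    intro n
    have h := LSeries.iteratedDeriv_alternating hf (x := 2) (habs 2 (by norm_num)) n
    rw [show ((2 : ℝ) : ℂ) = 2 by norm_num, hder n] at h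
    have h' := (Complex.le_def.1 h).1
    have hfac : (0 : ℝ) < n.factorial := by exact_mod_cast n.factorial_pos
    have e : (-1 : ℂ) ^ n * (iteratedDeriv n G 2 + K 1 * ((-1) ^ n * n.factorial)) =
        ((n.factorial : ℝ) : ℂ) * ((-1) ^ n * g n + K 1) := by
      have h1 : (-1 : ℂ) ^ n * (-1) ^ n = 1 := by rw [← mul_pow]; simp
      have h2 : (n.factorial : ℂ) ≠ 0 := by exact_mod_cast n.factorial_pos.ne'
      simp only [hg, Complex.ofReal_natCast]
      field_simp
      linear_combination (K 1 * n.factorial) * h1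
    rw [e, Complex.re_ofReal_mul] at h'
    simp only [Complex.zero_re, Complex.add_re] at h'
    have := (mul_nonneg_iff_of_pos_left hfac).1 h'
    linarith
  have hpos0 : 1 - (K 1).re ≤ (g 0).re := by
    have h2 : LSeries f 2 = g 0 + K 1 := by
      have := hder 0
      simp only [iteratedDeriv_zero] at this
      rw [this]
      simp [hg]
    have hs : LSeriesSummable f 2 :=
      LSeriesSummable_of_abscissaOfAbsConv_lt_re (by simpa using habs 2 (by norm_num))
    have h3 : LSeries.term f 2 1 ≤ LSeries f 2 := by
      refine hs.le_tsum 1 fun n _ => ?_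
      have := LSeries.term_nonneg (hf n) 2
      simpa using this
    have h4 : LSeries.term f 2 1 = 1 := by simp [LSeries.term_def, hf1]
    rw [h4, h2] at h3
    have := (Complex.le_def.1 h3).1
    simp only [Complex.one_re, Complex.add_re] at this
    linarith
  set ρ := (K 1).re with hρ
  have hx : ((1 : ℝ) ≤ 2 - σ) ∧ 2 - σ ≤ 9 / 8 := ⟨by linarith, by linarith⟩
  have hσpow : ∀ n : ℕ, 0 ≤ (2 - σ) ^ n := fun n => pow_nonneg (by linarith) n
  have hre : ∀ n, (g n * ((σ : ℂ) - 2) ^ n).re = ((-1) ^ n * g n).re * (2 - σ) ^ n := by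
    intro n
    have : g n * ((σ : ℂ) - 2) ^ n = (((2 - σ) ^ n : ℝ) : ℂ) * ((-1) ^ n * g n) := by
      rw [show (σ : ℂ) - 2 = (-1) * ((2 - σ : ℝ) : ℂ) by push_cast; ring, mul_pow]
      push_cast
      ring
    rw [this, Complex.re_ofReal_mul, mul_comm]
  have hsumre : HasSum (fun n => ((-1) ^ n * g n).re * (2 - σ) ^ n) (G σ).re := by
    have := Complex.hasSum_re hsum
    simpa only [hre] using this
  have hlow : ∀ n, -(4 * B * (3 / 4) ^ n) ≤ ((-1) ^ n * g n).re * (2 - σ) ^ n := by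
    intro n
    have h1 : |((-1) ^ n * g n).re| ≤ 4 * B * (2 / 3) ^ n := by
      refine (Complex.abs_re_le_norm _).trans ?_
      rw [norm_mul, norm_pow, norm_neg, norm_one, one_pow, one_mul]
      exact hgB n
    have h2 : (2 - σ) ^ n ≤ (9 / 8) ^ n := by gcongr; linarith; exact hx.2
    have h3 : |((-1) ^ n * g n).re * (2 - σ) ^ n| ≤ 4 * B * (3 / 4) ^ n := by
      rw [abs_mul, abs_of_nonneg (hσpow n)]
      calc _ ≤ 4 * B * (2 / 3) ^ n * (9 / 8) ^ n := by have := hσpow n; gcongr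
        _ = _ := by rw [mul_assoc, ← mul_pow]; norm_num
    exact (abs_le.1 h3).1
  have hgeo : HasSum (fun n => 4 * B * (3 / 4 : ℝ) ^ (n + M)) (16 * B * (3 / 4) ^ M) := by
    have := (hasSum_geometric_of_lt_one (r := (3 / 4 : ℝ)) (by norm_num) (by norm_num)).mul_left
      (4 * B * (3 / 4) ^ M)
    have e : 16 * B * (3 / 4 : ℝ) ^ M = 4 * B * (3 / 4) ^ M * (1 - 3 / 4)⁻¹ := by norm_num; ring
    rw [e]
    refine this.congr_fun ?_ |> fun h => h
    intro n
    rw [pow_add]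
    ring
  have htail : -(16 * B * (3 / 4) ^ M) ≤
      (G σ).re - ∑ n ∈ Finset.range M, ((-1) ^ n * g n).re * (2 - σ) ^ n := by
    have h1 := (hasSum_nat_add_iff M).2 (by simpa using hsumre :
      HasSum (fun n => ((-1) ^ n * g n).re * (2 - σ) ^ n)
        ((G σ).re - ∑ n ∈ Finset.range M, ((-1) ^ n * g n).re * (2 - σ) ^ n +
          ∑ n ∈ Finset.range M, ((-1) ^ n * g n).re * (2 - σ) ^ n))
    exact hasSum_le (fun n => hlow (n + M)) hgeo.neg h1
  have hM1 : 1 ≤ M ∨ M = 0 := by omega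
  have hhead : 1 - ρ * ∑ n ∈ Finset.range M, (2 - σ) ^ n ≤
      ∑ n ∈ Finset.range M, ((-1) ^ n * g n).re * (2 - σ) ^ n + (if M = 0 then 1 else 0) := by
    rcases hM1 with hM1 | hM1
    · obtain ⟨m, rfl⟩ : ∃ m, M = m + 1 := ⟨M - 1, by omega⟩
      rw [Finset.sum_range_succ', Finset.sum_range_succ', if_neg (by omega)]
      have : ∑ n ∈ Finset.range m, (-ρ) * (2 - σ) ^ (n + 1) ≤
          ∑ n ∈ Finset.range m, ((-1) ^ (n + 1) * g (n + 1)).re * (2 - σ) ^ (n + 1) := by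
        refine Finset.sum_le_sum fun n _ => ?_
        exact mul_le_mul_of_nonneg_right (hpos (n + 1)) (hσpow _)
      rw [← Finset.mul_sum] at this
      simp only [pow_zero, mul_one, one_mul, add_zero]
      nlinarith
    · simp [hM1]
  have hB' : (0 : ℝ) ≤ (3 / 4) ^ M := by positivity
  have hσne : (σ : ℂ) ≠ 1 := by
    intro h
    have : σ = 1 := by exact_mod_cast h
    linarith
  have hGσ : (G σ).re ≤ ρ / (1 - σ) := by
    rw [hGne _ hσne]
    have : (K σ - K 1) / ((σ : ℂ) - 1) = (((1 - σ)⁻¹ : ℝ) : ℂ) * (K 1 - K σ) := by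
      have h1 : (σ : ℂ) - 1 ≠ 0 := sub_ne_zero.2 hσne
      have h2 : (1 : ℂ) - σ ≠ 0 := sub_ne_zero.2 hσne.symm
      push_cast
      field_simp
      ring
    rw [this, Complex.re_ofReal_mul, Complex.sub_re, div_eq_inv_mul]
    have : 0 < (1 - σ)⁻¹ := inv_pos.2 (by linarith)
    gcongr
    linarith
  have hgeom : (∑ n ∈ Finset.range M, (2 - σ) ^ n) * (1 - σ) = (2 - σ) ^ M - 1 := by
    have := geom_sum_mul (2 - σ) M
    rw [← this]; ring
  have h1σ : 0 < 1 - σ := by linarith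
  rw [le_div_iff₀ h1σ] at hGσ
  have hMne : (if M = 0 then (1 : ℝ) else 0) ≤ 0 ∨ M = 0 := by
    by_cases h : M = 0 <;> simp [h]
  rcases hMne with h0 | h0
  · have : 1 / 2 - ρ * ∑ n ∈ Finset.range M, (2 - σ) ^ n ≤ (G σ).re := by linarith
    have := mul_le_mul_of_nonneg_right this h1σ.le
    have e : (1 / 2 - ρ * ∑ n ∈ Finset.range M, (2 - σ) ^ n) * (1 - σ) =
      (1 - σ) / 2 - ρ * ((2 - σ) ^ M - 1) := by rw [← hgeom]; ring
    rw [e] at this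
    linarith
  · subst h0
    exfalso
    have h5 : ‖g 0‖ ≤ 4 * B := by simpa using hgB 0
    have h6 := (abs_le.1 ((Complex.abs_re_le_norm _).trans h5)).2
    have h7 := (abs_le.1 ((Complex.abs_re_le_norm _).trans hB1)).2
    rw [pow_zero, mul_one] at hM
    linarith

/-- The product of two characters, as a character modulo the product of the moduli. -/
def charMul {q₁ q₂ : ℕ} (χ₁ : DirichletCharacter ℂ q₁) (χ₂ : DirichletCharacter ℂ q₂) :
    DirichletCharacter ℂ (q₁ * q₂) :=
  DirichletCharacter.changeLevel (dvd_mul_right q₁ q₂) χ₁ *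
    DirichletCharacter.changeLevel (dvd_mul_left q₂ q₁) χ₂

lemma natCast_char_eq_zero {q : ℕ} (χ : DirichletCharacter ℂ q) {n : ℕ} (h : ¬ n.Coprime q) :
    χ (n : ZMod q) = 0 := by
  apply χ.map_nonunit
  rwa [ZMod.isUnit_iff_coprime]

lemma charMul_natCast {q₁ q₂ : ℕ} (χ₁ : DirichletCharacter ℂ q₁) (χ₂ : DirichletCharacter ℂ q₂)
    (n : ℕ) : charMul χ₁ χ₂ n = χ₁ n * χ₂ n := by
  by_cases h : n.Coprime (q₁ * q₂)
  · have hc : IsCoprime (n : ℤ) ((q₁ * q₂ : ℕ) : ℤ) := Nat.isCoprime_iff_coprime.2 h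
    have h1 := DirichletCharacter.changeLevel_eq_cast_of_dvd' χ₁ (dvd_mul_right q₁ q₂) hc
    have h2 := DirichletCharacter.changeLevel_eq_cast_of_dvd' χ₂ (dvd_mul_left q₂ q₁) hc
    simp only [Int.cast_natCast] at h1 h2
    rw [charMul, MulChar.mul_apply, h1, h2]
  · rw [natCast_char_eq_zero _ h]
    rw [Nat.coprime_mul_iff_right, not_and_or] at h
    rcases h with h | h <;> simp [natCast_char_eq_zero _ h]

lemma charMul_sq {q₁ q₂ : ℕ} {χ₁ : DirichletCharacter ℂ q₁} {χ₂ : DirichletCharacter ℂ q₂}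
    (h₁ : χ₁ ^ 2 = 1) (h₂ : χ₂ ^ 2 = 1) : charMul χ₁ χ₂ ^ 2 = 1 := by
  rw [charMul, mul_pow, ← map_pow, ← map_pow, h₁, h₂, map_one, map_one, one_mul]

lemma real_char_values {q : ℕ} {χ : DirichletCharacter ℂ q} (h : χ ^ 2 = 1) (a : ZMod q) :
    χ a = 0 ∨ χ a = 1 ∨ χ a = -1 := by
  by_cases ha : IsUnit a
  · have : (χ ^ 2) a = 1 := by rw [h, MulChar.one_apply ha]
    rw [MulChar.pow_apply' _ (by norm_num)] at this
    exact Or.inr (mul_self_eq_one_iff.1 (by rw [← pow_two]; exact this))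
  · exact Or.inl (χ.map_nonunit ha)

namespace ArithmeticFunction

/-- Multiplication of an arithmetic function by the logarithm. -/
def logMulC (f : ArithmeticFunction ℂ) : ArithmeticFunction ℂ :=
  ⟨fun n => Real.log n * f n, by simp⟩

lemma logMulC_apply (f : ArithmeticFunction ℂ) (n : ℕ) : logMulC f n = Real.log n * f n := rfl

lemma logMulC_mul (f g : ArithmeticFunction ℂ) :
    logMulC (f * g) = logMulC f * g + f * logMulC g := by
  ext n
  rw [ArithmeticFunction.add_apply, logMulC_apply, ArithmeticFunction.mul_apply,
    ArithmeticFunction.mul_apply, ArithmeticFunction.mul_apply, Finset.mul_sum,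
    ← Finset.sum_add_distrib]
  refine Finset.sum_congr rfl fun x hx => ?_
  obtain ⟨h1, h2⟩ := Nat.mem_divisorsAntidiagonal.1 hx
  have hx1 : (x.1 : ℝ) ≠ 0 := by
    intro h; apply h2; rw [← h1]; simp [Nat.cast_eq_zero.1 h]
  have hx2 : (x.2 : ℝ) ≠ 0 := by
    intro h; apply h2; rw [← h1]; simp [Nat.cast_eq_zero.1 h]
  rw [logMulC_apply, logMulC_apply, ← h1, Nat.cast_mul, Real.log_mul hx1 hx2]
  push_cast
  ring

open scoped ComplexOrder in
lemma nonneg_of_logMulC {f v : ArithmeticFunction ℂ} (h : logMulC f = f * v) (hf1 : f 1 = 1)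
    (hv : ∀ n, 0 ≤ v n) (hv1 : v 1 = 0) (n : ℕ) : 0 ≤ f n := by
  induction n using Nat.strong_induction_on with
  | _ n ih =>
    rcases Nat.lt_or_ge n 2 with hn | hn
    · interval_cases n
      · simp
      · simp [hf1]
    · have h1 : (Real.log n : ℂ) * f n = ∑ x ∈ n.divisorsAntidiagonal, f x.1 * v x.2 := by
        rw [← logMulC_apply, h, ArithmeticFunction.mul_apply]
      have h2 : 0 ≤ (Real.log n : ℂ) * f n := by
        rw [h1]
        refine Finset.sum_nonneg fun x hx => ?_
        obtain ⟨h3, h4⟩ := Nat.mem_divisorsAntidiagonal.1 hx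
        by_cases hx2 : x.2 = 1
        · simp [hx2, hv1]
        · refine mul_nonneg (ih _ ?_) (hv _)
          have h5 : x.1 ≠ 0 := by rintro h; simp [h] at h3; omega
          have h6 : x.2 ≠ 0 := by rintro h; simp [h] at h3; omega
          rw [← h3]
          have : 2 ≤ x.2 := by omega
          have : 0 < x.1 := by omega
          nlinarith
      have hlog : 0 < Real.log n := Real.log_pos (by exact_mod_cast hn)
      have h3 : f n = ((Real.log n)⁻¹ : ℝ) * ((Real.log n : ℂ) * f n) := by
        have : (Real.log n : ℂ) ≠ 0 := by exact_mod_cast hlog.ne'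
        rw [Complex.ofReal_inv, inv_mul_cancel_left₀ this]
      rw [h3]
      refine mul_nonneg ?_ h2
      exact Complex.zero_le_real.2 (inv_nonneg.2 hlog.le)

end ArithmeticFunction

/-- A Dirichlet character as an arithmetic function. -/
def charArith {q : ℕ} (χ : DirichletCharacter ℂ q) : ArithmeticFunction ℂ :=
  ⟨fun n => if n = 0 then 0 else χ n, by simp⟩

/-- The arithmetic function `χ Λ`. -/
def charLambda {q : ℕ} (χ : DirichletCharacter ℂ q) : ArithmeticFunction ℂ :=
  ⟨fun n => χ n * ArithmeticFunction.vonMangoldt n, by simp⟩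

lemma charArith_apply {q : ℕ} (χ : DirichletCharacter ℂ q) {n : ℕ} (hn : n ≠ 0) :
    charArith χ n = χ n := by
  change (if n = 0 then (0 : ℂ) else χ n) = _
  rw [if_neg hn]

lemma charLambda_apply {q : ℕ} (χ : DirichletCharacter ℂ q) (n : ℕ) :
    charLambda χ n = χ n * ArithmeticFunction.vonMangoldt n := rfl

lemma logMulC_charArith {q : ℕ} (χ : DirichletCharacter ℂ q) :
    ArithmeticFunction.logMulC (charArith χ) = charArith χ * charLambda χ := by
  ext n
  rcases eq_or_ne n 0 with rfl | hn
  · simp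
  rw [ArithmeticFunction.logMulC_apply, charArith_apply _ hn, ArithmeticFunction.mul_apply]
  have h1 : ∀ x ∈ n.divisorsAntidiagonal, charArith χ x.1 * charLambda χ x.2 =
      χ n * ArithmeticFunction.vonMangoldt x.2 := by
    intro x hx
    obtain ⟨h3, h4⟩ := Nat.mem_divisorsAntidiagonal.1 hx
    have h5 : x.1 ≠ 0 := by rintro h; simp [h] at h3; omega
    rw [charArith_apply _ h5, charLambda_apply, ← h3, Nat.cast_mul, map_mul]
    ring
  rw [Finset.sum_congr rfl h1, ← Finset.mul_sum]
  have h2 : ∑ x ∈ n.divisorsAntidiagonal, ArithmeticFunction.vonMangoldt x.2 = Real.log n := by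
    rw [Nat.sum_divisorsAntidiagonal' (f := fun _ y => ArithmeticFunction.vonMangoldt y)]
    exact ArithmeticFunction.vonMangoldt_sum
  have h3 : ∑ x ∈ n.divisorsAntidiagonal, (ArithmeticFunction.vonMangoldt x.2 : ℂ) =
      (Real.log n : ℂ) := by
    rw [← h2]; push_cast; rfl
  rw [h3, mul_comm]

lemma LSeriesSummable_charArith {q : ℕ} (χ : DirichletCharacter ℂ q) {s : ℂ} (hs : 1 < s.re) :
    LSeriesSummable (charArith χ) s :=
  (LSeriesSummable_congr s fun hn => (charArith_apply χ hn)).2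
    (χ.LSeriesSummable_of_one_lt_re hs)

lemma LSeries_charArith {q : ℕ} [NeZero q] (χ : DirichletCharacter ℂ q) {s : ℂ} (hs : 1 < s.re) :
    LSeries (charArith χ) s = χ.LFunction s := by
  rw [DirichletCharacter.LFunction_eq_LSeries χ hs]
  exact LSeries_congr (fun hn => charArith_apply χ hn) s

/-- The coefficients of `ζ(s) L(s,χ₁) L(s,χ₂) L(s,χ₁χ₂)`. -/
def fourCoeff {q₁ q₂ : ℕ} (χ₁ : DirichletCharacter ℂ q₁) (χ₂ : DirichletCharacter ℂ q₂) :
    ArithmeticFunction ℂ :=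
  charArith (1 : DirichletCharacter ℂ 1) * charArith χ₁ * charArith χ₂ * charArith (charMul χ₁ χ₂)

lemma charArith_one {q : ℕ} (χ : DirichletCharacter ℂ q) : charArith χ 1 = 1 := by
  rw [charArith_apply _ one_ne_zero, Nat.cast_one, map_one]

open scoped ComplexOrder in
lemma fourCoeff_nonneg {q₁ q₂ : ℕ} {χ₁ : DirichletCharacter ℂ q₁} {χ₂ : DirichletCharacter ℂ q₂}
    (h₁ : χ₁ ^ 2 = 1) (h₂ : χ₂ ^ 2 = 1) (n : ℕ) : 0 ≤ fourCoeff χ₁ χ₂ n := by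
  refine ArithmeticFunction.nonneg_of_logMulC (v := charLambda (1 : DirichletCharacter ℂ 1) +
    charLambda χ₁ + charLambda χ₂ + charLambda (charMul χ₁ χ₂)) ?_ ?_ ?_ ?_ n
  · rw [fourCoeff]
    simp only [ArithmeticFunction.logMulC_mul, logMulC_charArith]
    ring
  · simp [fourCoeff, charArith_one]
  · intro n
    have e : (charLambda (1 : DirichletCharacter ℂ 1) + charLambda χ₁ + charLambda χ₂ +
        charLambda (charMul χ₁ χ₂)) n =
        (1 + χ₁ n) * (1 + χ₂ n) * ArithmeticFunction.vonMangoldt n := by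
      simp only [ArithmeticFunction.add_apply, charLambda_apply, charMul_natCast]
      rw [MulChar.one_apply (isUnit_of_subsingleton _)]
      ring
    rw [e]
    have hL : (0 : ℂ) ≤ (ArithmeticFunction.vonMangoldt n : ℂ) :=
      Complex.zero_le_real.2 ArithmeticFunction.vonMangoldt_nonneg
    refine mul_nonneg (mul_nonneg ?_ ?_) hL
    · rcases real_char_values h₁ n with h | h | h <;> rw [h] <;> norm_num
    · rcases real_char_values h₂ n with h | h | h <;> rw [h] <;> norm_num
  · simp [ArithmeticFunction.add_apply, charLambda_apply]

lemma fourCoeff_one {q₁ q₂ : ℕ} (χ₁ : DirichletCharacter ℂ q₁) (χ₂ : DirichletCharacter ℂ q₂) :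
    fourCoeff χ₁ χ₂ 1 = 1 := by
  simp [fourCoeff, charArith_one]

lemma LSeriesHasSum_fourCoeff {q₁ q₂ : ℕ} [NeZero q₁] [NeZero q₂] (χ₁ : DirichletCharacter ℂ q₁)
    (χ₂ : DirichletCharacter ℂ q₂) {s : ℂ} (hs : 1 < s.re) :
    LSeriesHasSum (fourCoeff χ₁ χ₂) s (riemannZeta s * χ₁.LFunction s * χ₂.LFunction s *
      (charMul χ₁ χ₂).LFunction s) := by
  have h : ∀ {q : ℕ} [NeZero q] (χ : DirichletCharacter ℂ q),
      LSeriesHasSum (charArith χ) s (χ.LFunction s) := by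
    intro q _ χ
    rw [← LSeries_charArith χ hs]
    exact (LSeriesSummable_charArith χ hs).LSeriesHasSum
  have h0 := h (1 : DirichletCharacter ℂ 1)
  rw [DirichletCharacter.LFunction_modOne_eq] at h0
  exact ArithmeticFunction.LSeriesHasSum_mul (ArithmeticFunction.LSeriesHasSum_mul
    (ArithmeticFunction.LSeriesHasSum_mul h0 (h χ₁)) (h χ₂)) (h _)

/-- The entire function `(s - 1) ζ(s)`. -/
def zetaOne : ℂ → ℂ := DirichletCharacter.LFunctionTrivChar₁ 1

lemma differentiable_zetaOne : Differentiable ℂ zetaOne :=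
  DirichletCharacter.differentiable_LFunctionTrivChar₁ 1

lemma zetaOne_one : zetaOne 1 = 1 := by
  simp [zetaOne, DirichletCharacter.LFunctionTrivChar₁]

lemma zetaOne_of_ne {s : ℂ} (hs : s ≠ 1) : zetaOne s = (s - 1) * riemannZeta s := by
  rw [zetaOne, DirichletCharacter.LFunctionTrivChar₁, Function.update_of_ne hs,
    DirichletCharacter.LFunctionTrivChar, DirichletCharacter.LFunction_modOne_eq]

/-- The entire function `(s - 1) ζ(s) L(s,χ₁) L(s,χ₂) L(s,χ₁χ₂)`. -/
def fourFun {q₁ q₂ : ℕ} [NeZero q₁] [NeZero q₂] (χ₁ : DirichletCharacter ℂ q₁)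
    (χ₂ : DirichletCharacter ℂ q₂) (s : ℂ) : ℂ :=
  zetaOne s * χ₁.LFunction s * χ₂.LFunction s * (charMul χ₁ χ₂).LFunction s

lemma exists_siegel_const : ∃ C : ℝ, 1 ≤ C ∧ ∀ {q₁ q₂ : ℕ} [NeZero q₁] [NeZero q₂]
    (χ₁ : DirichletCharacter ℂ q₁) (χ₂ : DirichletCharacter ℂ q₂), χ₁ ^ 2 = 1 → χ₂ ^ 2 = 1 →
    χ₁ ≠ 1 → χ₂ ≠ 1 → charMul χ₁ χ₂ ≠ 1 → ∀ σ : ℝ, 7 / 8 ≤ σ → σ < 1 →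
    0 ≤ (fourFun χ₁ χ₂ σ).re →
    (1 - σ) ≤ C * (C * (q₁ * q₂ : ℝ)) ^ (4 * (1 - σ)) * ‖fourFun χ₁ χ₂ 1‖ := by
  obtain ⟨Z, hZ⟩ := (isCompact_closedBall (2 : ℂ) (3 / 2)).exists_bound_of_continuousOn
    (f := zetaOne) differentiable_zetaOne.continuous.continuousOn
  set B₀ : ℝ := max Z 1 * (20 * (4 : ℝ) ^ (1 / 2 : ℝ)) ^ 3 with hB₀
  have hB₀1 : 1 ≤ B₀ := by
    have : (1 : ℝ) ≤ (4 : ℝ) ^ (1 / 2 : ℝ) := Real.one_le_rpow (by norm_num) (by norm_num)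
    have h2 : (1 : ℝ) ≤ (20 * (4 : ℝ) ^ (1 / 2 : ℝ)) ^ 3 := one_le_pow₀ (by linarith)
    exact one_le_mul_of_one_le_of_one_le (le_max_right _ _) h2
  refine ⟨32 * B₀, by linarith, ?_⟩
  intro q₁ q₂ _ _ χ₁ χ₂ h₁ h₂ hn₁ hn₂ hn₁₂ σ hσ hσ1 hneg
  have hq₁ : (1 : ℝ) ≤ q₁ := by exact_mod_cast NeZero.one_le
  have hq₂ : (1 : ℝ) ≤ q₂ := by exact_mod_cast NeZero.one_le
  set B : ℝ := B₀ * (q₁ * q₂) with hB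
  have hB1 : 1 ≤ B := one_le_mul_of_one_le_of_one_le hB₀1 (one_le_mul_of_one_le_of_one_le hq₁ hq₂)
  have hLb : ∀ {q : ℕ} [NeZero q] (χ : DirichletCharacter ℂ q), χ ≠ 1 →
      ∀ s ∈ Metric.closedBall (2 : ℂ) (3 / 2), ‖χ.LFunction s‖ ≤
        20 * (4 : ℝ) ^ (1 / 2 : ℝ) * (q : ℝ) ^ (1 / 2 : ℝ) := by
    intro q _ χ hχ s hs
    have hs2 : ‖s - 2‖ ≤ 3 / 2 := by simpa [dist_eq_norm] using hs
    have h1 : 1 - (1 / 2 : ℝ) ≤ s.re := by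
      have := (Complex.abs_re_le_norm (s - 2)).trans hs2
      simp only [Complex.sub_re, Complex.re_ofNat] at this
      have := (abs_le.1 this).1
      linarith
    have h2 : ‖s‖ ≤ 4 := by
      calc ‖s‖ = ‖(s - 2) + 2‖ := by ring_nf
        _ ≤ ‖s - 2‖ + ‖(2 : ℂ)‖ := norm_add_le _ _
        _ ≤ 3 / 2 + 2 := by gcongr; simp
        _ ≤ 4 := by norm_num
    refine (norm_LFunction_le (by norm_num) le_rfl hχ h1).trans ?_
    calc (4 * (1 / (1 / 2) + 3) * (q * ‖s‖) ^ (1 / 2 : ℝ) : ℝ) ≤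
        20 * (q * 4) ^ (1 / 2 : ℝ) := by norm_num; gcongr
      _ = _ := by rw [Real.mul_rpow (by positivity) (by norm_num)]; ring
  have hKB : ∀ s ∈ Metric.closedBall (2 : ℂ) (3 / 2), ‖fourFun χ₁ χ₂ s‖ ≤ B := by
    intro s hs
    rw [fourFun, norm_mul, norm_mul, norm_mul]
    have b1 := hLb χ₁ hn₁ s hs
    have b2 := hLb χ₂ hn₂ s hs
    have b3 := hLb _ hn₁₂ s hs
    have b0 : ‖zetaOne s‖ ≤ max Z 1 := (hZ s hs).trans (le_max_left _ _)
    calc _ ≤ max Z 1 * (20 * (4 : ℝ) ^ (1 / 2 : ℝ) * (q₁ : ℝ) ^ (1 / 2 : ℝ)) *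
          (20 * (4 : ℝ) ^ (1 / 2 : ℝ) * (q₂ : ℝ) ^ (1 / 2 : ℝ)) *
          (20 * (4 : ℝ) ^ (1 / 2 : ℝ) * ((q₁ * q₂ : ℕ) : ℝ) ^ (1 / 2 : ℝ)) := by gcongr
      _ = B₀ * (((q₁ * q₂ : ℝ) ^ (1 / 2 : ℝ)) * ((q₁ * q₂ : ℝ) ^ (1 / 2 : ℝ))) := by
          push_cast
          rw [hB₀, Real.mul_rpow (by positivity) (by positivity)]
          ring
      _ = B := by
          rw [← Real.rpow_add (by positivity)]
          norm_num
          exact hB.symm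
  set ℓ := Real.log (32 * B) with hℓ
  have hℓ0 : 0 ≤ ℓ := Real.log_nonneg (by linarith)
  set M := ⌈4 * ℓ⌉₊ with hM
  have hMB : 16 * B * (3 / 4) ^ M ≤ 1 / 2 := by
    have h1 : (3 / 4 : ℝ) ^ M ≤ Real.exp (-ℓ) := by
      have h34 : (3 / 4 : ℝ) ≤ Real.exp (-1 / 4) := by
        have := Real.add_one_le_exp (-1 / 4 : ℝ)
        linarith
      calc (3 / 4 : ℝ) ^ M ≤ Real.exp (-1 / 4) ^ M := by gcongr
        _ = Real.exp (M * (-1 / 4)) := (Real.exp_nat_mul _ _).symm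
        _ ≤ _ := by
          apply Real.exp_le_exp.2
          have : 4 * ℓ ≤ M := Nat.le_ceil _
          linarith
    rw [Real.exp_neg, Real.exp_log (by linarith)] at h1
    calc 16 * B * (3 / 4) ^ M ≤ 16 * B * (32 * B)⁻¹ := by gcongr
      _ = 1 / 2 := by field_simp; norm_num
  have key := estermann_aux (K := fourFun χ₁ χ₂) (f := fourCoeff χ₁ χ₂)
    (((differentiable_zetaOne.mul (DirichletCharacter.differentiable_LFunction hn₁)).mul
      (DirichletCharacter.differentiable_LFunction hn₂)).mul
      (DirichletCharacter.differentiable_LFunction hn₁₂))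
    (fun n => fourCoeff_nonneg h₁ h₂ n) (fourCoeff_one χ₁ χ₂)
    (by
      refine LSeries.abscissaOfAbsConv_le_of_forall_lt_LSeriesSummable (x := 1) fun y hy => ?_
      exact (LSeriesHasSum_fourCoeff χ₁ χ₂ (s := y) (by simpa using hy)).LSeriesSummable)
    (by
      intro s hs
      rw [(LSeriesHasSum_fourCoeff χ₁ χ₂ hs).LSeries_eq, fourFun, zetaOne_of_ne]
      · ring
      · intro h; simp [h] at hs)
    (B := B) (fun s hs => hKB s (Metric.sphere_subset_closedBall hs))
    (hKB 1 (by simp [dist_eq_norm]; norm_num)) hσ hσ1 hneg M hMB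
  have hpow : (2 - σ) ^ M ≤ 3 * (32 * B) ^ (4 * (1 - σ)) := by
    have hM1 : (M : ℝ) ≤ 4 * ℓ + 1 := (Nat.ceil_lt_add_one (by linarith)).le
    calc (2 - σ) ^ M ≤ Real.exp (1 - σ) ^ M := by
          have := Real.add_one_le_exp (1 - σ)
          have h2 : 2 - σ ≤ Real.exp (1 - σ) := by linarith
          exact pow_le_pow_left₀ (by linarith) h2 M
      _ = Real.exp (M * (1 - σ)) := (Real.exp_nat_mul _ _).symm
      _ ≤ Real.exp (1 + ℓ * (4 * (1 - σ))) := by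
          apply Real.exp_le_exp.2
          nlinarith
      _ = Real.exp 1 * (32 * B) ^ (4 * (1 - σ)) := by
          rw [Real.exp_add, Real.rpow_def_of_pos (by linarith)]
      _ ≤ _ := by
          have := Real.exp_one_lt_d9
          gcongr
          linarith
  have hre : (fourFun χ₁ χ₂ 1).re ≤ ‖fourFun χ₁ χ₂ 1‖ := Complex.re_le_norm _
  have h0 : 0 ≤ (2 - σ) ^ M := pow_nonneg (by linarith) _
  have hp0 : 0 ≤ (32 * B) ^ (4 * (1 - σ)) := by positivity
  have e : 32 * B₀ * (q₁ * q₂ : ℝ) = 32 * B := by rw [hB]; ring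
  rw [e]
  calc 1 - σ ≤ 2 * ((fourFun χ₁ χ₂ 1).re * (2 - σ) ^ M) := by linarith
    _ ≤ 2 * (‖fourFun χ₁ χ₂ 1‖ * (3 * (32 * B) ^ (4 * (1 - σ)))) := by gcongr
    _ = 6 * (32 * B) ^ (4 * (1 - σ)) * ‖fourFun χ₁ χ₂ 1‖ := by ring
    _ ≤ _ := by gcongr; linarith

lemma conj_natCast_cpow (n : ℕ) (s : ℂ) :
    (starRingEnd ℂ) ((n : ℂ) ^ s) = (n : ℂ) ^ (starRingEnd ℂ s) := by
  have := Complex.conj_cpow (n : ℂ) (starRingEnd ℂ s) (by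
    rw [Complex.natCast_arg]; exact Real.pi_pos.ne)
  rw [Complex.conj_natCast, Complex.conj_conj] at this
  exact this.symm

lemma conj_real_char {q : ℕ} {χ : DirichletCharacter ℂ q} (h : χ ^ 2 = 1) (a : ZMod q) :
    (starRingEnd ℂ) (χ a) = χ a := by
  rcases real_char_values h a with h | h | h <;> rw [h] <;> simp

lemma LFunction_real_im {q : ℕ} [NeZero q] {χ : DirichletCharacter ℂ q} (h : χ ^ 2 = 1)
    (hχ : χ ≠ 1) {σ : ℝ} (hσ : 0 < σ) : (χ.LFunction σ).im = 0 := by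
  rw [← Complex.conj_eq_iff_im, LFunction_eq_abel hχ (by simpa using hσ), Complex.conj_tsum]
  congr 1
  funext n
  simp only [abelTerm, psum, map_mul, map_sum, map_sub, conj_natCast_cpow, conj_real_char h,
    map_neg, Complex.conj_ofReal]

lemma LFunction_two_re_pos {q : ℕ} [NeZero q] (χ : DirichletCharacter ℂ q) :
    0 < (χ.LFunction ((2 : ℝ) : ℂ)).re := by
  have h2 : (1 : ℝ) < (((2 : ℝ) : ℂ)).re := by simp
  have h1 : HasSum (fun n => LSeries.term (fun k => χ k) ((2 : ℝ) : ℂ) n) (χ.LFunction ((2 : ℝ) : ℂ)) := by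
    rw [χ.LFunction_eq_LSeries h2]
    exact (DirichletCharacter.LSeriesSummable_of_one_lt_re χ h2).hasSum
  have h3 := (Complex.hasSum_re h1).add hasSum_zeta_two
  have h4 := le_hasSum h3 1 (by
    intro j _
    have : ‖LSeries.term (fun k => χ k) ((2 : ℝ) : ℂ) j‖ ≤ 1 / (j : ℝ) ^ 2 := by
      rw [LSeries.norm_term_eq]
      split_ifs with hj
      · simp [hj]
      · have e : (((2 : ℝ) : ℂ)).re = ((2 : ℕ) : ℝ) := by simp
        rw [e, Real.rpow_natCast]
        gcongr
        exact χ.norm_le_one _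
    have h5 := Complex.abs_re_le_norm (LSeries.term (fun k => χ k) ((2 : ℝ) : ℂ) j)
    have h6 := neg_abs_le (LSeries.term (fun k => χ k) ((2 : ℝ) : ℂ) j).re
    linarith)
  have h5 : LSeries.term (fun k => χ k) ((2 : ℝ) : ℂ) 1 = 1 := by
    simp [LSeries.term]
  rw [h5] at h4
  have := Real.pi_lt_d2
  have := Real.pi_pos
  have h6 : Real.pi ^ 2 < 12 := by nlinarith
  simp only [Complex.one_re, Nat.cast_one, one_pow, div_one] at h4
  linarith

lemma LFunction_real_pos {q : ℕ} [NeZero q] {χ : DirichletCharacter ℂ q} (h : χ ^ 2 = 1)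
    (hχ : χ ≠ 1) {σ : ℝ} (hσ : 0 < σ) (hσ2 : σ ≤ 2)
    (hz : ∀ x : ℝ, σ ≤ x → x < 1 → χ.LFunction x ≠ 0) : 0 < (χ.LFunction σ).re := by
  by_contra hneg
  push Not at hneg
  have hc : Continuous fun x : ℝ => (χ.LFunction (x : ℂ)).re :=
    Complex.continuous_re.comp ((DirichletCharacter.differentiable_LFunction hχ).continuous.comp
      Complex.continuous_ofReal)
  obtain ⟨x, hx, hx0⟩ := intermediate_value_Icc hσ2 hc.continuousOn
    ⟨hneg, (LFunction_two_re_pos χ).le⟩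
  have h0 : χ.LFunction (x : ℂ) = 0 :=
    Complex.ext hx0 (LFunction_real_im h hχ (hσ.trans_le hx.1))
  by_cases h1 : x < 1
  · exact hz x hx.1 h1 h0
  · exact DirichletCharacter.LFunction_ne_zero_of_one_le_re χ (Or.inl hχ)
      (by simpa using h1) h0

/-- The lower bound for `L(1, χ)` deduced from a single auxiliary pair `(χ₁, σ)`. -/
lemma siegel_of_pair {ε : ℝ} (hε : 0 < ε) {q : ℕ} [NeZero q] (χ₁ : DirichletCharacter ℂ q)
    (h₁ : χ₁ ^ 2 = 1) (h₁' : χ₁ ≠ 1) {σ : ℝ} (hσ : 7 / 8 ≤ σ) (hσε : 1 - σ ≤ ε / 8) (hσ1 : σ < 1)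
    (hpos : ∀ {r : ℕ} [NeZero r] (χ : DirichletCharacter ℂ r), χ ^ 2 = 1 → χ ≠ 1 →
      charMul χ₁ χ ≠ 1 → 0 ≤ (fourFun χ₁ χ σ).re) :
    ∃ c : ℝ, 0 < c ∧ ∀ {r : ℕ} [NeZero r] (χ : DirichletCharacter ℂ r), χ ^ 2 = 1 → χ ≠ 1 →
      charMul χ₁ χ ≠ 1 → c * (r : ℝ) ^ (-ε) ≤ ‖χ.LFunction 1‖ := by
  obtain ⟨C, hC, hS⟩ := exists_siegel_const
  set η : ℝ := min (1 / 2) (ε / 2) with hη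
  have hη0 : 0 < η := by positivity
  have hη1 : η ≤ 1 / 2 := min_le_left _ _
  have hη2 : η ≤ ε / 2 := min_le_right _ _
  have hL1 : 0 < ‖χ₁.LFunction 1‖ :=
    norm_pos_iff.2 (DirichletCharacter.LFunction_apply_one_ne_zero h₁')
  have hq : (0 : ℝ) < q := by exact_mod_cast NeZero.pos q
  set K : ℝ := C * (C * q) ^ (4 * (1 - σ)) * ‖χ₁.LFunction 1‖ * (4 * (1 / η + 3)) * (q : ℝ) ^ η with hK
  have hK0 : 0 < K := by positivity
  refine ⟨(1 - σ) / K, div_pos (by linarith) hK0, ?_⟩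
  intro r _ χ hχ hχ1 hmul
  have h := hS χ₁ χ h₁ hχ h₁' hχ1 hmul σ hσ hσ1 (hpos χ hχ hχ1 hmul)
  have hr : (1 : ℝ) ≤ r := by exact_mod_cast NeZero.one_le
  have hr0 : (0 : ℝ) < r := by linarith
  have hM : ‖(charMul χ₁ χ).LFunction 1‖ ≤ 4 * (1 / η + 3) * (q * r) ^ η := by
    have := norm_LFunction_le hη0 hη1 hmul (s := 1) (by simp; linarith)
    simpa using this
  have e1 : ‖fourFun χ₁ χ 1‖ = ‖χ₁.LFunction 1‖ * ‖χ.LFunction 1‖ * ‖(charMul χ₁ χ).LFunction 1‖ := by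
    simp [fourFun, zetaOne_one]
  rw [e1] at h
  have e2 : (C * (q * r : ℝ)) ^ (4 * (1 - σ)) = (C * q) ^ (4 * (1 - σ)) * (r : ℝ) ^ (4 * (1 - σ)) := by
    rw [← Real.mul_rpow (by positivity) hr0.le, mul_assoc]
  rw [e2] at h
  rw [Real.mul_rpow hq.le hr0.le] at hM
  have h5 : (1 - σ) ≤ K * (r : ℝ) ^ ε * ‖χ.LFunction 1‖ := by
    calc (1 - σ) ≤ _ := h
      _ ≤ C * ((C * q) ^ (4 * (1 - σ)) * (r : ℝ) ^ (4 * (1 - σ))) *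
          (‖χ₁.LFunction 1‖ * ‖χ.LFunction 1‖ * (4 * (1 / η + 3) * (q ^ η * r ^ η))) := by gcongr
      _ = K * ((r : ℝ) ^ (4 * (1 - σ)) * (r : ℝ) ^ η) * ‖χ.LFunction 1‖ := by rw [hK]; ring
      _ ≤ K * (r : ℝ) ^ ε * ‖χ.LFunction 1‖ := by
        rw [← Real.rpow_add hr0]
        gcongr
        linarith
  rw [Real.rpow_neg hr0.le, div_mul_eq_mul_div, div_le_iff₀ hK0, ← div_eq_mul_inv,
    div_le_iff₀ (by positivity)]
  linarith

lemma conductor_eq_of_charMul_eq_one {q r : ℕ} [NeZero q] [NeZero r] {χ₁ : DirichletCharacter ℂ q}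
    {χ : DirichletCharacter ℂ r} (h₁ : χ₁ ^ 2 = 1) (hχ : χ.IsPrimitive)
    (h : charMul χ₁ χ = 1) : r = χ₁.conductor := by
  have h2 : DirichletCharacter.changeLevel (dvd_mul_left r q) χ =
      DirichletCharacter.changeLevel (dvd_mul_right q r) χ₁ := by
    have h3 : DirichletCharacter.changeLevel (dvd_mul_right q r) χ₁ *
        DirichletCharacter.changeLevel (dvd_mul_right q r) χ₁ = 1 := by
      rw [← map_mul, ← pow_two, h₁, map_one]
    rw [charMul, ← h3] at h
    exact mul_left_cancel h
  have h3 := congrArg DirichletCharacter.conductor h2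
  rw [DirichletCharacter.conductor_changeLevel, DirichletCharacter.conductor_changeLevel] at h3
  rw [← h3]
  exact hχ.symm

lemma exists_LFunction_one_lower (m : ℕ) [NeZero m] : ∃ c : ℝ, 0 < c ∧
    ∀ χ : DirichletCharacter ℂ m, χ ≠ 1 → c ≤ ‖χ.LFunction 1‖ := by
  classical
  obtain ⟨χ₀, h₀⟩ := Finite.exists_min (fun χ : DirichletCharacter ℂ m =>
    if χ = 1 then (1 : ℝ) else ‖χ.LFunction 1‖)
  refine ⟨_, ?_, fun χ hχ => by simpa [hχ] using h₀ χ⟩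
  split_ifs with h
  · exact one_pos
  · exact norm_pos_iff.2 (DirichletCharacter.LFunction_apply_one_ne_zero h)

/-- **Siegel's theorem** for primitive quadratic characters. -/
theorem siegel {ε : ℝ} (hε : 0 < ε) : ∃ c : ℝ, 0 < c ∧ ∀ {r : ℕ} [NeZero r]
    (χ : DirichletCharacter ℂ r), χ.IsPrimitive → χ ^ 2 = 1 → χ ≠ 1 →
      c * (r : ℝ) ^ (-ε) ≤ ‖χ.LFunction 1‖ := by
  have hex : (∃ (q : ℕ) (_ : NeZero q) (χ₁ : DirichletCharacter ℂ q), χ₁ ^ 2 = 1 ∧ χ₁ ≠ 1) →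
      ∃ (q : ℕ) (_ : NeZero q) (χ₁ : DirichletCharacter ℂ q) (σ : ℝ), χ₁ ^ 2 = 1 ∧ χ₁ ≠ 1 ∧
      7 / 8 ≤ σ ∧ 1 - σ ≤ ε / 8 ∧ σ < 1 ∧
      (∀ {r : ℕ} [NeZero r] (χ : DirichletCharacter ℂ r), χ ^ 2 = 1 → χ ≠ 1 →
        charMul χ₁ χ ≠ 1 → 0 ≤ (fourFun χ₁ χ σ).re) := by
    rintro ⟨q₀, i₀, χ₀, hχ₀, hχ₀'⟩
    by_cases hz : ∃ (q : ℕ) (_ : NeZero q) (χ₁ : DirichletCharacter ℂ q) (σ : ℝ), χ₁ ^ 2 = 1 ∧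
        χ₁ ≠ 1 ∧ 7 / 8 ≤ σ ∧ 1 - σ ≤ ε / 8 ∧ σ < 1 ∧ χ₁.LFunction σ = 0
    · obtain ⟨q, i, χ₁, σ, h1, h2, h3, h4, h5, h6⟩ := hz
      refine ⟨q, i, χ₁, σ, h1, h2, h3, h4, h5, ?_⟩
      intro r _ χ _ _ _
      simp [fourFun, h6]
    · push Not at hz
      have hc : ContinuousAt (fun x : ℝ => (zetaOne (x : ℂ)).re) 1 :=
        (Complex.continuous_re.comp (differentiable_zetaOne.continuous.comp
          Complex.continuous_ofReal)).continuousAt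
      have hev : ∀ᶠ x : ℝ in nhds (1 : ℝ), 0 < (zetaOne (x : ℂ)).re := by
        apply hc.eventually (lt_mem_nhds _)
        simp [zetaOne_one]
      obtain ⟨δ, hδ, hball⟩ := Metric.eventually_nhds_iff.1 hev
      set t : ℝ := min (δ / 2) (min (1 / 8) (ε / 8)) with ht
      have ht0 : 0 < t := by positivity
      have ht1 : t ≤ δ / 2 := min_le_left _ _
      have ht2 : t ≤ 1 / 8 := (min_le_right _ _).trans (min_le_left _ _)
      have ht3 : t ≤ ε / 8 := (min_le_right _ _).trans (min_le_right _ _)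
      refine ⟨q₀, i₀, χ₀, 1 - t, hχ₀, hχ₀', by linarith, by linarith, by linarith, ?_⟩
      intro r _ χ h1 h2 h3
      have hzp : 0 < (zetaOne ((1 - t : ℝ) : ℂ)).re := by
        apply hball
        rw [Real.dist_eq, show (1 - t - 1 : ℝ) = -t by ring, abs_neg, abs_of_pos ht0]
        linarith
      have key : ∀ {m : ℕ} [NeZero m] (ψ : DirichletCharacter ℂ m), ψ ^ 2 = 1 → ψ ≠ 1 →
          ∃ y : ℝ, 0 < y ∧ ψ.LFunction ((1 - t : ℝ) : ℂ) = y := by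
        intro m _ ψ hψ hψ1
        refine ⟨(ψ.LFunction ((1 - t : ℝ) : ℂ)).re, ?_, ?_⟩
        · refine LFunction_real_pos hψ hψ1 (by linarith) (by linarith) ?_
          intro x hx hx1
          exact hz m inferInstance ψ x hψ hψ1 (by linarith) (by linarith) hx1
        · exact Complex.ext (by simp) (by
            rw [LFunction_real_im hψ hψ1 (by linarith : 0 < 1 - t)]; simp)
      obtain ⟨y1, hy1, e1⟩ := key χ₀ hχ₀ hχ₀'
      obtain ⟨y2, hy2, e2⟩ := key χ h1 h2
      obtain ⟨y3, hy3, e3⟩ := key (charMul χ₀ χ) (charMul_sq hχ₀ h1) h3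
      rw [fourFun, e1, e2, e3, Complex.re_mul_ofReal, Complex.re_mul_ofReal, Complex.re_mul_ofReal]
      positivity
  by_cases hvac : ∃ (q : ℕ) (_ : NeZero q) (χ₁ : DirichletCharacter ℂ q), χ₁ ^ 2 = 1 ∧ χ₁ ≠ 1
  · obtain ⟨q, _, χ₁, σ, h1, h2, h3, h4, h5, h6⟩ := hex hvac
    obtain ⟨c, hc, hmain⟩ := siegel_of_pair hε χ₁ h1 h2 h3 h4 h5 h6
    have hm : NeZero χ₁.conductor := ⟨DirichletCharacter.conductor_ne_zero χ₁⟩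
    obtain ⟨c', hc', hfin⟩ := exists_LFunction_one_lower χ₁.conductor
    refine ⟨min c c', lt_min hc hc', ?_⟩
    intro r _ χ hp hχ hχ1
    have hr : (1 : ℝ) ≤ r := by exact_mod_cast NeZero.one_le
    by_cases hmul : charMul χ₁ χ = 1
    · have e := conductor_eq_of_charMul_eq_one h1 hp hmul
      subst e
      refine le_trans ?_ (hfin χ hχ1)
      have : (χ₁.conductor : ℝ) ^ (-ε) ≤ 1 := Real.rpow_le_one_of_one_le_of_nonpos hr (by linarith)
      have h0 : (0 : ℝ) ≤ (χ₁.conductor : ℝ) ^ (-ε) := by positivity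
      nlinarith [min_le_right c c']
    · refine le_trans ?_ (hmain χ hχ hχ1 hmul)
      gcongr
      exact min_le_left _ _
  · refine ⟨1, one_pos, ?_⟩
    intro r i χ _ hχ hχ1
    exact absurd ⟨r, i, χ, hχ, hχ1⟩ hvac

lemma norm_LFunction_principal_le {η : ℝ} (hη : 0 < η) (hη1 : η ≤ 1 / 2) {r : ℕ} [NeZero r] {s : ℂ}
    (hs : 1 < s.re) : ‖(1 : DirichletCharacter ℂ r).LFunction s‖ ≤
      4 * (1 / η + 3) * (r * ‖s‖) ^ η + (4 * (1 / η + 3) * ‖s‖ ^ η + 1 / ‖s - 1‖) := by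
  classical
  have hr : (0 : ℝ) < r := by exact_mod_cast NeZero.pos r
  set ρ : ℝ := (r.totient : ℝ) / r with hρ
  have hρ0 : 0 ≤ ρ := by positivity
  have hρ1 : ρ ≤ 1 := by
    rw [hρ, div_le_one hr]
    exact_mod_cast Nat.totient_le r
  set f : ZMod r → ℂ := fun x => (1 : DirichletCharacter ℂ r) x - (ρ : ℂ) with hf
  have hf0 : ∑ x, f x = 0 := by
    rw [hf, Finset.sum_sub_distrib, MulChar.sum_one_eq_card_units, ZMod.card_units_eq_totient,
      Finset.sum_const, Finset.card_univ, ZMod.card, nsmul_eq_mul, hρ]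
    have : (r : ℂ) ≠ 0 := by exact_mod_cast NeZero.ne r
    push_cast
    field_simp
    ring
  have hf1 : ∀ x, ‖f x‖ ≤ 1 := by
    intro x
    rw [hf]
    by_cases hx : IsUnit x
    · simp only [MulChar.one_apply hx]
      rw [show (1 : ℂ) - (ρ : ℂ) = ((1 - ρ : ℝ) : ℂ) by push_cast; ring, Complex.norm_real,
        Real.norm_eq_abs, abs_le]
      constructor <;> linarith
    · simp only [MulChar.map_nonunit _ hx]
      rw [zero_sub, norm_neg, Complex.norm_real, Real.norm_eq_abs, abs_of_nonneg hρ0]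
      exact hρ1
  have hpsum := norm_psum_periodic_le f hf0 hf1
  have hS1 := DirichletCharacter.LSeriesSummable_of_one_lt_re (1 : DirichletCharacter ℂ r) hs
  have hS2 : LSeriesSummable ((ρ : ℂ) • (1 : ℕ → ℂ)) s := (LSeriesSummable_one_iff.2 hs).smul _
  have e : (fun k : ℕ => f k) = (fun k : ℕ => (1 : DirichletCharacter ℂ r) k) - (ρ : ℂ) • (1 : ℕ → ℂ) := by
    funext k; simp [hf]
  have h1 : LSeries (fun k : ℕ => f k) s = (1 : DirichletCharacter ℂ r).LFunction s - ρ * riemannZeta s := by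
    rw [e, LSeries_sub hS1 hS2, LSeries_smul, LSeries_one_eq_riemannZeta hs,
      DirichletCharacter.LFunction_eq_LSeries _ hs]
  have h2 : ‖LSeries (fun k : ℕ => f k) s‖ ≤ 4 * (1 / η + 3) * (r * ‖s‖) ^ η := by
    rw [LSeries_eq_abel hpsum (by linarith) (by rw [e]; exact hS1.sub hS2)]
    exact norm_abel_le hη hη1 (fun n => hf1 _) (by exact_mod_cast NeZero.one_le) hpsum (by linarith)
  have h3 := norm_zeta_le hη hη1 hs
  have h4 : (1 : DirichletCharacter ℂ r).LFunction s =
      LSeries (fun k : ℕ => f k) s + ρ * riemannZeta s := by rw [h1]; ring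
  rw [h4]
  refine (norm_add_le _ _).trans (add_le_add h2 ?_)
  rw [norm_mul, Complex.norm_real, Real.norm_eq_abs, abs_of_nonneg hρ0]
  nlinarith [norm_nonneg (riemannZeta s)]

/-- The analytic conductor used to measure the size of `L`-functions near the line `Re s = 1`. -/
def ycond (r : ℕ) (s : ℂ) : ℝ := r * (|s.im| + 3)

lemma one_le_ycond (r : ℕ) [NeZero r] (s : ℂ) : 1 ≤ ycond r s := by
  have : (1 : ℝ) ≤ r := by exact_mod_cast NeZero.one_le
  rw [ycond]
  nlinarith [abs_nonneg s.im]

lemma norm_le_ycond {r : ℕ} {s : ℂ} (h0 : 0 ≤ s.re) (h : s.re ≤ 3) : r * ‖s‖ ≤ ycond r s := by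
  rw [ycond]
  have := Complex.norm_le_abs_re_add_abs_im s
  rw [abs_of_nonneg h0] at this
  gcongr
  linarith

lemma norm_LFunction_le_ycond {η : ℝ} (hη : 0 < η) (hη1 : η ≤ 1 / 2) {r : ℕ} [NeZero r]
    {χ : DirichletCharacter ℂ r} (hχ : χ ≠ 1) {s : ℂ} (hs : 1 - η ≤ s.re) (hs3 : s.re ≤ 3) :
    ‖χ.LFunction s‖ ≤ 4 * (1 / η + 3) * ycond r s ^ η := by
  refine (norm_LFunction_le hη hη1 hχ hs).trans ?_
  gcongr
  exact norm_le_ycond (by linarith) hs3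

lemma norm_LFunction_le_ycond_any {η : ℝ} (hη : 0 < η) (hη1 : η ≤ 1 / 2) {r : ℕ} [NeZero r]
    (χ : DirichletCharacter ℂ r) {s : ℂ} (hs : 1 < s.re) (hs3 : s.re ≤ 3) {δ : ℝ} (hδ : 0 < δ)
    (hδ1 : δ ≤ 1) (h : χ ≠ 1 ∨ δ ≤ ‖s - 1‖) :
    ‖χ.LFunction s‖ ≤ (8 * (1 / η + 3) + 1) * (ycond r s ^ η / δ) := by
  have hy := one_le_ycond r s
  have hyη : 1 ≤ ycond r s ^ η := Real.one_le_rpow hy hη.le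
  have hyδ : ycond r s ^ η ≤ ycond r s ^ η / δ := by
    rw [le_div_iff₀ hδ]; nlinarith
  have hK : 0 < 1 / η := by positivity
  have hr : (1 : ℝ) ≤ r := by exact_mod_cast NeZero.one_le
  by_cases hχ : χ = 1
  · subst hχ
    have h1 : δ ≤ ‖s - 1‖ := by rcases h with h | h; exact absurd rfl h; exact h
    refine (norm_LFunction_principal_le hη hη1 hs).trans ?_
    have h2 : (r * ‖s‖) ^ η ≤ ycond r s ^ η := by
      gcongr; exact norm_le_ycond (by linarith) hs3
    have h3 : ‖s‖ ^ η ≤ ycond r s ^ η := by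
      gcongr
      exact (le_mul_of_one_le_left (norm_nonneg _) hr).trans (norm_le_ycond (by linarith) hs3)
    have h4 : 1 / ‖s - 1‖ ≤ ycond r s ^ η / δ := by gcongr
    have h5 : 4 * (1 / η + 3) * (r * ‖s‖) ^ η ≤ 4 * (1 / η + 3) * (ycond r s ^ η / δ) := by
      gcongr; exact h2.trans hyδ
    have h6 : 4 * (1 / η + 3) * ‖s‖ ^ η ≤ 4 * (1 / η + 3) * (ycond r s ^ η / δ) := by
      gcongr; exact h3.trans hyδ
    linarith
  · refine (norm_LFunction_le_ycond hη hη1 hχ (by linarith) hs3).trans ?_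
    have h5 : 4 * (1 / η + 3) * ycond r s ^ η ≤ 4 * (1 / η + 3) * (ycond r s ^ η / δ) := by
      gcongr
    have : 0 ≤ ycond r s ^ η / δ := by positivity
    nlinarith

/-- Lower bound from the `3-4-1` inequality, away from a possible exceptional zero. -/
lemma LFunction_lower_of_three_four_one {η : ℝ} (hη : 0 < η) (hη1 : η ≤ 1 / 2) :
    ∃ c : ℝ, 0 < c ∧ c ≤ 1 ∧ ∀ {r : ℕ} [NeZero r] (χ : DirichletCharacter ℂ r) (s : ℂ) (w δ : ℝ),
      0 < w → w ^ 4 ≤ s.re - 1 → s.re ≤ 2 → 0 < δ → δ ≤ 1 → (χ ^ 2 ≠ 1 ∨ δ ≤ ‖s - 1‖) →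
      c * w ^ 3 * δ * ycond r s ^ (-η) ≤ ‖χ.LFunction s‖ := by
  set K : ℝ := 8 * (1 / η + 3) + 1 with hK
  have hK1 : 1 ≤ K := by have : 0 < 1 / η := by positivity
                         linarith
  refine ⟨(2 * K)⁻¹, by positivity, inv_le_one_of_one_le₀ (by linarith), ?_⟩
  intro r _ χ s w δ hw hws hs2 hδ hδ1 hor
  set x : ℝ := s.re - 1 with hx
  have hx0 : 0 < x := lt_of_lt_of_le (by positivity) hws
  have hx1 : x ≤ 1 := by linarith
  set y := ycond r s with hy
  have hy1 : 1 ≤ y := one_le_ycond r s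
  have hy0 : 0 < y := by linarith
  set V : ℝ := y ^ η with hV
  have hV1 : 1 ≤ V := Real.one_le_rpow hy1 hη.le
  have h341 := DirichletCharacter.norm_LFunction_product_ge_one χ hx0 s.im
  have e1 : (1 + (x : ℂ) + Complex.I * (s.im : ℂ)) = s := by
    apply Complex.ext <;> simp [hx]
  have e0 : (1 + (x : ℂ)).im = 0 := by simp
  have b0 : ‖DirichletCharacter.LFunctionTrivChar r (1 + (x : ℂ))‖ ≤ K * (V / x) := by
    have := norm_LFunction_le_ycond_any hη hη1 (1 : DirichletCharacter ℂ r) (s := 1 + (x : ℂ))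
      (by simpa using hx0) (by simp; linarith) hx0 hx1
      (Or.inr (by simp [abs_of_pos hx0]))
    refine this.trans ?_
    gcongr
    · rw [hV, hy]; refine Real.rpow_le_rpow (by linarith [one_le_ycond r (1 + (x : ℂ))]) ?_ hη.le; rw [ycond, ycond, e0]; rw [abs_zero]; gcongr; exact abs_nonneg _
  have b2 : ‖(χ ^ 2).LFunction (1 + (x : ℂ) + 2 * Complex.I * (s.im : ℂ))‖ ≤ K * (2 * V / δ) := by
    have := norm_LFunction_le_ycond_any hη hη1 (χ ^ 2)
      (s := 1 + (x : ℂ) + 2 * Complex.I * (s.im : ℂ)) (by simpa using hx0) (by simp; linarith) hδ hδ1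
      (by
        rcases hor with h | h
        · exact Or.inl h
        · refine Or.inr (h.trans ?_)
          rw [Complex.norm_eq_sqrt_sq_add_sq, Complex.norm_eq_sqrt_sq_add_sq]
          apply Real.sqrt_le_sqrt
          simp [← hx]
          nlinarith [sq_nonneg s.im])
    refine this.trans ?_
    gcongr
    have : ycond r (1 + (x : ℂ) + 2 * Complex.I * (s.im : ℂ)) ≤ 2 * y := by
      rw [hy, ycond, ycond]
      have : (1 + (x : ℂ) + 2 * Complex.I * (s.im : ℂ)).im = 2 * s.im := by simp
      rw [this, abs_mul, abs_of_pos (by norm_num : (0 : ℝ) < 2)]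
      have hr : (0 : ℝ) ≤ r := by positivity
      nlinarith
    calc _ ≤ (2 * y) ^ η := Real.rpow_le_rpow (by linarith [one_le_ycond r (1 + (x : ℂ) + 2 * Complex.I * (s.im : ℂ))]) this hη.le
      _ = 2 ^ η * V := Real.mul_rpow (by norm_num) hy0.le
      _ ≤ 2 ^ (1 : ℝ) * V := by gcongr; norm_num; linarith
      _ = 2 * V := by norm_num
  rw [e1, norm_mul, norm_mul, norm_pow, norm_pow] at h341
  set ℓ := ‖χ.LFunction s‖ with hℓ
  have h1 : 1 ≤ (K * (V / x)) ^ 3 * ℓ ^ 4 * (K * (2 * V / δ)) := by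
    refine h341.le.trans ?_
    gcongr
  have h2 : x ^ 3 * δ ≤ 2 * K ^ 4 * V ^ 4 * ℓ ^ 4 := by
    have e : (K * (V / x)) ^ 3 * ℓ ^ 4 * (K * (2 * V / δ)) =
        (2 * K ^ 4 * V ^ 4 * ℓ ^ 4) / (x ^ 3 * δ) := by field_simp
    rw [e, le_div_iff₀ (by positivity)] at h1
    linarith
  have h3 : (w ^ 3 * δ) ^ 4 ≤ (2 * K * V * ℓ) ^ 4 := by
    have a1 : (w ^ 4) ^ 3 ≤ x ^ 3 := by gcongr
    have a2 : δ ^ 4 ≤ δ := by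
      calc δ ^ 4 ≤ δ ^ 1 := pow_le_pow_of_le_one hδ.le hδ1 (by norm_num)
        _ = δ := pow_one _
    calc (w ^ 3 * δ) ^ 4 = (w ^ 4) ^ 3 * δ ^ 4 := by ring
      _ ≤ x ^ 3 * δ := by gcongr
      _ ≤ 2 * K ^ 4 * V ^ 4 * ℓ ^ 4 := h2
      _ ≤ 16 * (K ^ 4 * V ^ 4 * ℓ ^ 4) := by
        have : 0 ≤ K ^ 4 * V ^ 4 * ℓ ^ 4 := by positivity
        linarith
      _ = (2 * K * V * ℓ) ^ 4 := by ring
  have h4 := (pow_le_pow_iff_left₀ (by positivity) (by positivity) (by norm_num)).1 h3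
  rw [Real.rpow_neg hy0.le, ← hV]
  rw [← div_eq_mul_inv, div_le_iff₀ (by linarith), mul_assoc, inv_mul_le_iff₀ (by linarith)]
  linarith

lemma ycond_le_of_im {r : ℕ} {s z : ℂ} (h : |z.im| ≤ |s.im|) : ycond r z ≤ ycond r s := by
  rw [ycond, ycond]; gcongr

lemma ycond_le_two_mul {r : ℕ} {s z : ℂ} (h : ‖z - s‖ ≤ 1) : ycond r z ≤ 2 * ycond r s := by
  have h1 : |z.im| ≤ |s.im| + 1 := by
    have h2 : |(z - s).im| ≤ 1 := (Complex.abs_im_le_norm _).trans h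
    rw [Complex.sub_im] at h2
    have h3 := abs_sub_abs_le_abs_sub z.im s.im
    linarith
  have hr : (0 : ℝ) ≤ r := by positivity
  rw [ycond, ycond]
  nlinarith [abs_nonneg s.im]

lemma norm_deriv_LFunction_le {η : ℝ} (hη : 0 < η) (hη1 : η ≤ 1 / 2) :
    ∃ C : ℝ, 1 ≤ C ∧ ∀ {r : ℕ} [NeZero r] {χ : DirichletCharacter ℂ r}, χ ≠ 1 → ∀ {s : ℂ},
      1 - η / 2 ≤ s.re → s.re ≤ 2 → ‖deriv χ.LFunction s‖ ≤ C * ycond r s ^ η := by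
  have hη' : 0 < 1 / η := by positivity
  refine ⟨4 * (1 / η + 3) * 2 / (η / 2), ?_, ?_⟩
  · rw [le_div_iff₀ (by positivity)]; linarith
  intro r _ χ hχ s hs hs2
  have h := Complex.norm_deriv_le_of_forall_mem_sphere_norm_le (c := s) (R := η / 2)
    (C := 4 * (1 / η + 3) * (2 * ycond r s ^ η)) (f := χ.LFunction) (by positivity)
    (DirichletCharacter.differentiable_LFunction hχ).diffContOnCl (by
      intro z hz
      have hz' : ‖z - s‖ = η / 2 := by simpa [dist_eq_norm] using hz
      have hre : |(z - s).re| ≤ η / 2 := (Complex.abs_re_le_norm _).trans hz'.le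
      rw [Complex.sub_re, abs_le] at hre
      refine (norm_LFunction_le_ycond hη hη1 hχ (by linarith) (by linarith)).trans ?_
      gcongr
      calc ycond r z ^ η ≤ (2 * ycond r s) ^ η := by
            refine Real.rpow_le_rpow (by linarith [one_le_ycond r z])
              (ycond_le_two_mul (by linarith)) hη.le
        _ = 2 ^ η * ycond r s ^ η :=
            Real.mul_rpow (by norm_num) (by linarith [one_le_ycond r s])
        _ ≤ 2 ^ (1 : ℝ) * ycond r s ^ η := by
            have := one_le_ycond r s
            gcongr; norm_num; linarith
        _ = 2 * ycond r s ^ η := by norm_num)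
  refine h.trans (le_of_eq ?_)
  field_simp

lemma norm_sub_LFunction_le {η C : ℝ} {r : ℕ} [NeZero r]
    {χ : DirichletCharacter ℂ r} (hχ : χ ≠ 1) {s w : ℂ} {y : ℝ} (hη : 0 < η)
    (hC : ∀ {s : ℂ}, 1 - η / 2 ≤ s.re → s.re ≤ 2 → ‖deriv χ.LFunction s‖ ≤ C * ycond r s ^ η)
    (hC0 : 0 ≤ C) (hy : ∀ z ∈ segment ℝ s w, ycond r z ≤ y)
    (hs : 1 - η / 2 ≤ s.re) (hs2 : s.re ≤ 2) (hw : 1 - η / 2 ≤ w.re) (hw2 : w.re ≤ 2) :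
    ‖χ.LFunction w - χ.LFunction s‖ ≤ C * y ^ η * ‖w - s‖ := by
  have hconv : Convex ℝ {z : ℂ | 1 - η / 2 ≤ z.re ∧ z.re ≤ 2} :=
    (convex_halfSpace_re_ge _).inter (convex_halfSpace_re_le _)
  refine (convex_segment s w).norm_image_sub_le_of_norm_deriv_le (𝕜 := ℂ) (f := χ.LFunction)
    (fun x _ => (DirichletCharacter.differentiable_LFunction hχ) x) ?_
    (left_mem_segment ℝ s w) (right_mem_segment ℝ s w)
  intro z hz
  have h1 := hconv.segment_subset ⟨hs, hs2⟩ ⟨hw, hw2⟩ hz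
  refine (hC h1.1 h1.2).trans ?_
  have := one_le_ycond r z
  gcongr
  exact hy z hz

lemma abs_im_le_of_mem_segment {s w z : ℂ} {T : ℝ} (hz : z ∈ segment ℝ s w) (hs : |s.im| ≤ T)
    (hw : |w.im| ≤ T) : |z.im| ≤ T := by
  have hconv : Convex ℝ {z : ℂ | -T ≤ z.im ∧ z.im ≤ T} :=
    (convex_halfSpace_im_ge _).inter (convex_halfSpace_im_le _)
  exact abs_le.2 (hconv.segment_subset (abs_le.1 hs) (abs_le.1 hw) hz)

/-- Lower bound for `L(s, χ)` slightly to the left of the line `Re s = 1`. -/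
lemma LFunction_lower {η : ℝ} (hη : 0 < η) (hη1 : η ≤ 1 / 2) :
    ∃ c : ℝ, 0 < c ∧ c ≤ η / 2 ∧ ∀ {r : ℕ} [NeZero r] (χ : DirichletCharacter ℂ r), χ.IsPrimitive →
      χ ≠ 1 → ∀ s : ℂ, 1 - c * (ycond r s ^ (-η)) ^ 16 ≤ s.re → s.re ≤ 3 / 2 →
      c * (ycond r s ^ (-η)) ^ 15 ≤ ‖χ.LFunction s‖ := by
  obtain ⟨cS, hcS, hS⟩ := siegel hη
  obtain ⟨C, hC1, hC⟩ := norm_deriv_LFunction_le hη hη1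
  obtain ⟨c₁, hc₁, hc₁1, h341⟩ := LFunction_lower_of_three_four_one hη hη1
  have hC0 : 0 < C := by linarith
  set d : ℝ := min (η / 2) (cS / (2 * C)) with hd
  have hd0 : 0 < d := by positivity
  have hd1 : d ≤ η / 2 := min_le_left _ _
  have hd2 : d * C ≤ cS / 2 := by
    have : d ≤ cS / (2 * C) := min_le_right _ _
    rw [le_div_iff₀ (by positivity)] at this
    linarith
  set m : ℝ := min (d / 4) (c₁ * d / (8 * C)) with hm
  have hm0 : 0 < m := by positivity
  have hm1 : m ≤ d / 4 := min_le_left _ _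
  have hm2 : m * C ≤ c₁ * d / 8 := by
    have : m ≤ c₁ * d / (8 * C) := min_le_right _ _
    rw [le_div_iff₀ (by positivity)] at this
    linarith
  have hm4 : m ^ 4 ≤ m := by
    calc m ^ 4 ≤ m ^ 1 := pow_le_pow_of_le_one hm0.le (by linarith) (by norm_num)
      _ = m := pow_one _
  set c : ℝ := min (m ^ 4) (min (c₁ * d * m ^ 3 / 4) (cS / 2)) with hc
  have hcm : c ≤ m ^ 4 := min_le_left _ _
  have hcA : c ≤ c₁ * d * m ^ 3 / 4 := (min_le_right _ _).trans (min_le_left _ _)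
  have hcB : c ≤ cS / 2 := (min_le_right _ _).trans (min_le_right _ _)
  have hc0 : 0 < c := by positivity
  refine ⟨c, hc0, by linarith, ?_⟩
  intro r _ χ hprim hχ s hs hs2
  set y := ycond r s with hy
  have hy1 : 1 ≤ y := one_le_ycond r s
  have hy0 : 0 < y := by linarith
  set Y : ℝ := y ^ (-η) with hY
  have hY0 : 0 < Y := by positivity
  have hY1 : Y ≤ 1 := Real.rpow_le_one_of_one_le_of_nonpos hy1 (by linarith)
  have hYinv : y ^ η = Y⁻¹ := by rw [hY, Real.rpow_neg hy0.le, inv_inv]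
  have hYp : ∀ n : ℕ, Y ^ n ≤ 1 := fun n => pow_le_one₀ hY0.le hY1
  set κ : ℝ := (m * Y ^ 4) ^ 4 with hκ
  have hκ0 : 0 < κ := by positivity
  have hκe : κ = m ^ 4 * Y ^ 16 := by rw [hκ]; ring
  set δ : ℝ := d * Y ^ 2 with hδ
  have hδ0 : 0 < δ := by positivity
  have hδ1 : δ ≤ η / 2 := by
    have := hYp 2
    nlinarith
  have hκδ : κ ≤ δ / 4 := by
    rw [hκe, hδ]
    have h1 : Y ^ 16 ≤ Y ^ 2 := pow_le_pow_of_le_one hY0.le hY1 (by norm_num)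
    have h2 : m ^ 4 ≤ d / 4 := by linarith
    calc m ^ 4 * Y ^ 16 ≤ (d / 4) * Y ^ 2 := by gcongr
      _ = d * Y ^ 2 / 4 := by ring
  have hs' : 1 - κ ≤ s.re := by
    have : c * Y ^ 16 ≤ κ := by rw [hκe]; gcongr
    linarith
  have hY15 : Y ^ 15 ≤ Y := by
    calc Y ^ 15 ≤ Y ^ 1 := pow_le_pow_of_le_one hY0.le hY1 (by norm_num)
      _ = Y := pow_one _
  by_cases hcase : χ ^ 2 ≠ 1 ∨ δ ≤ ‖s - 1‖
  · by_cases hfar : κ ≤ s.re - 1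
    · have h := h341 χ s (m * Y ^ 4) δ (by positivity) (by rw [← hκ]; exact hfar) (by linarith)
        hδ0 (by linarith) hcase
      rw [← hy, ← hY] at h
      refine le_trans ?_ h
      have : c₁ * (m * Y ^ 4) ^ 3 * δ * Y = c₁ * d * m ^ 3 * Y ^ 15 := by rw [hδ]; ring
      rw [this]
      have h0 : 0 < c₁ * d * m ^ 3 := by positivity
      gcongr
      linarith
    · push Not at hfar
      set s₀ : ℂ := ⟨1 + κ, s.im⟩ with hs₀
      have him : s₀.im = s.im := rfl
      have hre : s₀.re = 1 + κ := rfl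
      have hy0' : ycond r s₀ = y := by rw [hy, ycond, ycond, him]
      have hdist : ‖s - s₀‖ ≤ 2 * κ := by
        have e : s - s₀ = ((s.re - (1 + κ) : ℝ) : ℂ) := by
          apply Complex.ext <;> simp [hre, him]
        rw [e, Complex.norm_real, Real.norm_eq_abs, abs_le]
        constructor <;> linarith
      have h := h341 χ s₀ (m * Y ^ 4) (δ / 2) (by positivity) (by rw [← hκ, hre]; linarith)
        (by rw [hre]; linarith) (by positivity) (by linarith) (by
          rcases hcase with h | h
          · exact Or.inl h
          · right
            have : ‖s - 1‖ ≤ ‖s - s₀‖ + ‖s₀ - 1‖ := by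
              have := norm_add_le (s - s₀) (s₀ - 1)
              simpa using this
            linarith)
      rw [hy0', ← hY] at h
      have h2 := norm_sub_LFunction_le (s := s) (w := s₀) (y := y) hχ hη (fun a b => hC hχ a b)
        hC0.le (fun z hz => ycond_le_of_im (abs_im_le_of_mem_segment hz le_rfl (by rw [him])))
        (by linarith) (by linarith) (by rw [hre]; linarith) (by rw [hre]; linarith)
      rw [hYinv, norm_sub_rev s₀ s] at h2
      have h3 : C * Y⁻¹ * ‖s - s₀‖ ≤ c₁ * d * m ^ 3 / 4 * Y ^ 15 := by
        calc C * Y⁻¹ * ‖s - s₀‖ ≤ C * Y⁻¹ * (2 * κ) := by gcongr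
          _ = 2 * (m * C) * m ^ 3 * Y ^ 15 := by rw [hκe]; field_simp
          _ ≤ 2 * (c₁ * d / 8) * m ^ 3 * Y ^ 15 := by gcongr
          _ = _ := by ring
      have h4 : ‖χ.LFunction s₀‖ ≤ ‖χ.LFunction s‖ + ‖χ.LFunction s₀ - χ.LFunction s‖ := by
        have := norm_add_le (χ.LFunction s) (χ.LFunction s₀ - χ.LFunction s)
        simpa using this
      have h5 : c₁ * (m * Y ^ 4) ^ 3 * (δ / 2) * Y = c₁ * d * m ^ 3 / 2 * Y ^ 15 := by
        rw [hδ]; ring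
      have h6 : c * Y ^ 15 ≤ c₁ * d * m ^ 3 / 4 * Y ^ 15 := by gcongr
      rw [h5] at h
      linarith
  · push Not at hcase
    obtain ⟨hsq, hnear⟩ := hcase
    have h1 := hS χ hprim hsq hχ
    have hre : |(s - 1).re| ≤ ‖s - 1‖ := Complex.abs_re_le_norm _
    rw [Complex.sub_re, Complex.one_re, abs_le] at hre
    have h2 := norm_sub_LFunction_le (s := s) (w := 1) (y := y) hχ hη (fun a b => hC hχ a b)
      hC0.le (fun z hz => ycond_le_of_im (abs_im_le_of_mem_segment hz le_rfl (by simp)))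
      (by linarith) (by linarith) (by simp; linarith) (by simp)
    rw [hYinv, norm_sub_rev (1 : ℂ) s] at h2
    have h3 : C * Y⁻¹ * ‖s - 1‖ ≤ cS / 2 * Y := by
      calc C * Y⁻¹ * ‖s - 1‖ ≤ C * Y⁻¹ * δ := by gcongr
        _ = (d * C) * Y := by rw [hδ]; field_simp
        _ ≤ cS / 2 * Y := by gcongr
    have h4 : ‖χ.LFunction 1‖ ≤ ‖χ.LFunction s‖ + ‖χ.LFunction 1 - χ.LFunction s‖ := by
      have := norm_add_le (χ.LFunction s) (χ.LFunction 1 - χ.LFunction s)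
      simpa using this
    have h5 : Y ≤ (r : ℝ) ^ (-η) := by
      have hr : (0 : ℝ) < r := by exact_mod_cast NeZero.pos r
      refine Real.rpow_le_rpow_of_nonpos hr ?_ (by linarith)
      rw [hy, ycond]
      nlinarith [abs_nonneg s.im]
    have h6 : cS * Y ≤ cS * (r : ℝ) ^ (-η) := by gcongr
    have h7 : c * Y ^ 15 ≤ cS / 2 * Y := by gcongr
    linarith

/-- Bounds for the derivatives of the logarithmic derivative of `L(s, χ)` to the right of
`Re s = 1`. -/
lemma norm_iteratedDeriv_logDeriv_le (k : ℕ) : ∃ C : ℝ, 0 < C ∧ ∀ {r : ℕ} [NeZero r]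
    (χ : DirichletCharacter ℂ r), χ.IsPrimitive → χ ≠ 1 → ∀ s : ℂ, 1 ≤ s.re → s.re ≤ 5 / 4 →
      ‖iteratedDeriv k (fun z => deriv χ.LFunction z / χ.LFunction z) s‖ ≤
        C * ycond r s ^ (1 / 2 : ℝ) := by
  set η : ℝ := 1 / (2 * (16 + 16 * k : ℝ)) with hηdef
  have hk : (0 : ℝ) ≤ k := by positivity
  have hη : 0 < η := by positivity
  have hη1 : η ≤ 1 / 2 := by
    rw [hηdef]
    apply one_div_le_one_div_of_le <;> linarith
  obtain ⟨c, hc0, hc1, hlow⟩ := LFunction_lower hη hη1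
  obtain ⟨D, hD1, hD⟩ := norm_deriv_LFunction_le hη hη1
  refine ⟨k.factorial * (D * 2 ^ 16 / c) / (c / 2 ^ 16) ^ k, by positivity, ?_⟩
  intro r _ χ hprim hχ s hs hs2
  set y := ycond r s with hy
  have hy1 : 1 ≤ y := one_le_ycond r s
  have hy0 : 0 < y := by linarith
  set Y : ℝ := y ^ (-η) with hY
  have hY0 : 0 < Y := by positivity
  have hY1 : Y ≤ 1 := Real.rpow_le_one_of_one_le_of_nonpos hy1 (by linarith)
  have hY16 : Y ^ 16 ≤ 1 := pow_le_one₀ hY0.le hY1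
  set ρ : ℝ := c / 2 ^ 16 * Y ^ 16 with hρ
  have hρ0 : 0 < ρ := by positivity
  have hρc : ρ ≤ c := by
    have : c / 2 ^ 16 ≤ c := div_le_self hc0.le (by norm_num)
    have h0 : 0 < c / 2 ^ 16 := by positivity
    rw [hρ]
    nlinarith
  have hball : ∀ z ∈ Metric.closedBall s ρ, (c * (Y / 2) ^ 15 ≤ ‖χ.LFunction z‖) ∧
      ‖deriv χ.LFunction z‖ ≤ D * (2 * Y⁻¹) := by
    intro z hz
    have hz' : ‖z - s‖ ≤ ρ := by simpa [dist_eq_norm] using hz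
    have hre : |(z - s).re| ≤ ρ := (Complex.abs_re_le_norm _).trans hz'
    rw [Complex.sub_re, abs_le] at hre
    have hyz : ycond r z ≤ 2 * y := ycond_le_two_mul (by linarith)
    have hyz1 := one_le_ycond r z
    have h2η : (2 : ℝ) ^ η ≤ 2 := by
      calc (2 : ℝ) ^ η ≤ 2 ^ (1 : ℝ) := by gcongr; norm_num; linarith
        _ = 2 := by norm_num
    have hYz' : ycond r z ^ η ≤ 2 * Y⁻¹ := by
      calc ycond r z ^ η ≤ (2 * y) ^ η := by gcongr
        _ = 2 ^ η * y ^ η := Real.mul_rpow (by norm_num) hy0.le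
        _ = 2 ^ η * Y⁻¹ := by rw [hY, Real.rpow_neg hy0.le, inv_inv]
        _ ≤ 2 * Y⁻¹ := by gcongr
    have hYz : Y / 2 ≤ ycond r z ^ (-η) := by
      rw [Real.rpow_neg (by linarith)]
      rw [le_inv_comm₀ (by positivity) (by positivity)]
      refine hYz'.trans (le_of_eq ?_)
      rw [inv_div]; rfl
    constructor
    · refine le_trans ?_ (hlow χ hprim hχ z ?_ (by linarith))
      · gcongr
      · have : ρ ≤ c * (ycond r z ^ (-η)) ^ 16 := by
          calc ρ = c * (Y / 2) ^ 16 := by rw [hρ]; ring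
            _ ≤ _ := by gcongr
        linarith
    · refine (hD hχ (by linarith) (by linarith)).trans ?_
      gcongr
  have hne : ∀ z ∈ Metric.closedBall s ρ, χ.LFunction z ≠ 0 := by
    intro z hz h0
    have := (hball z hz).1
    rw [h0, norm_zero] at this
    have h1 : 0 < c * (Y / 2) ^ 15 := by positivity
    linarith
  have hdiff := DirichletCharacter.differentiable_LFunction hχ
  have hdc : DiffContOnCl ℂ (fun z => deriv χ.LFunction z / χ.LFunction z) (Metric.ball s ρ) :=
    DifferentiableOn.diffContOnCl_ball (U := Metric.closedBall s ρ)
      (hdiff.deriv.differentiableOn.div hdiff.differentiableOn hne) subset_rfl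
  have h := Complex.norm_iteratedDeriv_le_of_forall_mem_sphere_norm_le k hρ0 hdc
    (C := D * 2 ^ 16 / c * (Y⁻¹) ^ 16) (by
      intro z hz
      obtain ⟨h1, h2⟩ := hball z (Metric.sphere_subset_closedBall hz)
      rw [norm_div]
      calc _ ≤ D * (2 * Y⁻¹) / (c * (Y / 2) ^ 15) := by gcongr
        _ = _ := by field_simp)
  refine h.trans (le_of_eq ?_)
  have e : y ^ (1 / 2 : ℝ) = (Y⁻¹) ^ (16 + 16 * k) := by
    rw [hY, ← Real.rpow_neg hy0.le, neg_neg, ← Real.rpow_natCast, ← Real.rpow_mul hy0.le]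
    congr 1
    rw [hηdef]
    push_cast
    field_simp
  rw [e, hρ, mul_pow, pow_add, ← pow_mul]
  field_simp
  rw [one_div, inv_pow, mul_inv_cancel₀ (by positivity)]

/-- The truncated linear weight `u ↦ (1 - u)₊` on `(0, ∞)`, extended by zero. -/
def tentWeight (u : ℝ) : ℂ :=
  (Set.Ioc (0 : ℝ) 1).indicator (fun _ => (1 : ℂ)) u -
    (Set.Ioc (0 : ℝ) 1).indicator (fun t : ℝ => (t : ℂ) ^ (1 : ℂ)) u

lemma tentWeight_of_mem {u : ℝ} (h0 : 0 < u) (h1 : u ≤ 1) : tentWeight u = 1 - u := by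
  have : u ∈ Set.Ioc (0 : ℝ) 1 := ⟨h0, h1⟩
  simp [tentWeight, this]

lemma tentWeight_of_one_le {u : ℝ} (h1 : 1 ≤ u) : tentWeight u = 0 := by
  rcases h1.eq_or_lt with h | h
  · subst h
    rw [tentWeight_of_mem one_pos le_rfl]; simp
  · have : u ∉ Set.Ioc (0 : ℝ) 1 := fun h' => absurd h'.2 (not_le.2 h)
    simp [tentWeight, this]

lemma tentWeight_eq {u : ℝ} (h0 : 0 < u) : tentWeight u = ((max 0 (1 - u) : ℝ) : ℂ) := by
  rcases le_total u 1 with h | h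
  · rw [tentWeight_of_mem h0 h, max_eq_right (by linarith)]; push_cast; ring
  · rw [tentWeight_of_one_le h, max_eq_left (by linarith)]; simp

lemma continuousAt_tentWeight {u : ℝ} (h0 : 0 < u) : ContinuousAt tentWeight u := by
  have hc : Continuous fun u : ℝ => ((max 0 (1 - u) : ℝ) : ℂ) := by fun_prop
  refine hc.continuousAt.congr ?_
  filter_upwards [lt_mem_nhds h0] with v hv
  exact (tentWeight_eq hv).symm

lemma hasMellin_tentWeight {s : ℂ} (hs : 0 < s.re) :
    HasMellin tentWeight s (1 / s - 1 / (s + 1)) := by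
  have h1 := hasMellin_one_Ioc hs
  have h2 := hasMellin_cpow_Ioc 1 (s := s) (by simp; linarith)
  have h3 := hasMellin_sub h1.1 h2.1
  rw [h1.2, h2.2] at h3
  exact h3

lemma norm_tentKernel_le {σ : ℝ} (hσ : 1 ≤ σ) (t : ℝ) :
    ‖1 / ((σ : ℂ) + t * Complex.I) - 1 / ((σ : ℂ) + t * Complex.I + 1)‖ ≤ 2 * (1 + |t|) ^ (-2 : ℝ) := by
  set s : ℂ := (σ : ℂ) + t * Complex.I with hs
  have hre : s.re = σ := by simp [hs]
  have him : s.im = t := by simp [hs]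
  have hs0 : s ≠ 0 := by intro h; rw [h] at hre; simp at hre; linarith
  have hs1 : s + 1 ≠ 0 := by
    intro h
    have := congrArg Complex.re h
    simp [hre] at this; linarith
  have e : 1 / s - 1 / (s + 1) = 1 / (s * (s + 1)) := by field_simp; ring
  have h1 : 1 + t ^ 2 ≤ ‖s‖ ^ 2 := by
    rw [Complex.sq_norm, Complex.normSq_apply, hre, him]; nlinarith
  have h2 : 1 + t ^ 2 ≤ ‖s + 1‖ ^ 2 := by
    rw [Complex.sq_norm, Complex.normSq_apply]
    simp [hre, him]; nlinarith
  have h3 : 1 + t ^ 2 ≤ ‖s‖ * ‖s + 1‖ := by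
    have := mul_le_mul h1 h2 (by positivity) (by positivity)
    refine (pow_le_pow_iff_left₀ (by positivity) (by positivity) (two_ne_zero)).1 ?_
    rw [mul_pow, sq (1 + t ^ 2)]; exact this
  rw [e, norm_div, norm_one, norm_mul]
  rw [Real.rpow_neg (by positivity), show (2 : ℝ) = ((2 : ℕ) : ℝ) by norm_num, Real.rpow_natCast,
    ← div_eq_mul_inv]
  rw [div_le_div_iff₀ (by positivity) (by positivity)]
  push_cast
  have : |t| ^ 2 = t ^ 2 := sq_abs t
  nlinarith [sq_nonneg (1 - |t|)]

lemma integrable_tentKernel {σ : ℝ} (hσ : 1 ≤ σ) : MeasureTheory.Integrable (fun t : ℝ =>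
    1 / ((σ : ℂ) + t * Complex.I) - 1 / ((σ : ℂ) + t * Complex.I + 1)) := by
  have hI := (integrable_one_add_norm (E := ℝ) (μ := MeasureTheory.volume) (r := 2)
    (by simp)).const_mul 2
  refine hI.mono' ?_ (Filter.Eventually.of_forall fun t => norm_tentKernel_le hσ t)
  apply Continuous.aestronglyMeasurable
  have h1 : ∀ t : ℝ, (σ : ℂ) + t * Complex.I ≠ 0 := by
    intro t h
    have := congrArg Complex.re h
    simp at this; linarith
  have h2 : ∀ t : ℝ, (σ : ℂ) + t * Complex.I + 1 ≠ 0 := by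
    intro t h
    have := congrArg Complex.re h
    simp at this; linarith
  exact (continuous_const.div (by fun_prop) h1).sub (continuous_const.div (by fun_prop) h2)

lemma tentWeight_eq_integral {σ : ℝ} (hσ : 1 ≤ σ) {u : ℝ} (hu : 0 < u) :
    ∫ t : ℝ, (u : ℂ) ^ (-((σ : ℂ) + t * Complex.I)) *
      (1 / ((σ : ℂ) + t * Complex.I) - 1 / ((σ : ℂ) + t * Complex.I + 1)) =
      2 * Real.pi * tentWeight u := by
  have hm : ∀ t : ℝ, mellin tentWeight ((σ : ℂ) + t * Complex.I) =
      1 / ((σ : ℂ) + t * Complex.I) - 1 / ((σ : ℂ) + t * Complex.I + 1) := by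
    intro t
    exact (hasMellin_tentWeight (by simp; linarith)).2
  have h := mellinInv_mellin_eq σ tentWeight hu
    (hasMellin_tentWeight (s := (σ : ℂ)) (by simp; linarith)).1
    (by
      unfold Complex.VerticalIntegrable
      simp_rw [hm]
      exact integrable_tentKernel hσ) (continuousAt_tentWeight hu)
  unfold mellinInv at h
  simp_rw [hm, smul_eq_mul] at h
  have hpi : (Real.pi : ℂ) ≠ 0 := by exact_mod_cast Real.pi_ne_zero
  have e : (2 * Real.pi : ℂ) * ((1 / (2 * Real.pi) : ℝ) : ℂ) = 1 := by push_cast; field_simp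
  rw [← h, Complex.real_smul, ← mul_assoc, e, one_mul]

/-- A smoothed partial sum is controlled by its Dirichlet series on a vertical line. -/
lemma norm_tent_sum_le : ∃ C : ℝ, 0 < C ∧ ∀ (a : ℕ → ℂ) (σ B : ℝ) (X : ℕ), 1 ≤ σ → 1 ≤ X →
    LSeriesSummable a σ → a 0 = 0 →
    (∀ t : ℝ, ‖LSeries a ((σ : ℂ) + t * Complex.I)‖ ≤ B * (1 + |t|) ^ (1 / 2 : ℝ)) →
    ‖∑ n ∈ Finset.range (X + 1), a n * (1 - n / X)‖ ≤ C * B * (X : ℝ) ^ σ := by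
  have hI := (integrable_one_add_norm (E := ℝ) (μ := MeasureTheory.volume) (r := 3 / 2)
    (by norm_num)).const_mul 2
  set J : ℝ := ∫ t : ℝ, 2 * (1 + ‖t‖) ^ (-(3 / 2 : ℝ)) with hJ
  have hJ0 : 0 ≤ J := MeasureTheory.integral_nonneg fun t => by positivity
  refine ⟨J / (2 * Real.pi) + 1, by positivity, ?_⟩
  intro a σ B X hσ hX hsum ha0 hB
  have hX0 : (0 : ℝ) < X := by exact_mod_cast hX
  have hXc : (X : ℂ) ≠ 0 := by exact_mod_cast hX0.ne'
  set K : ℝ → ℂ := fun t => 1 / ((σ : ℂ) + t * Complex.I) - 1 / ((σ : ℂ) + t * Complex.I + 1) with hK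
  have hKint : MeasureTheory.Integrable K := integrable_tentKernel hσ
  set G : ℕ → ℝ → ℂ := fun n t =>
    LSeries.term a ((σ : ℂ) + t * Complex.I) n * (X : ℂ) ^ ((σ : ℂ) + t * Complex.I) * K t with hG
  have hGnorm : ∀ n t, ‖G n t‖ = ‖LSeries.term a σ n‖ * (X : ℝ) ^ σ * ‖K t‖ := by
    intro n t
    rw [hG]
    simp only [norm_mul]
    congr 2
    · rw [LSeries.norm_term_eq, LSeries.norm_term_eq]; simp
    · rw [← Complex.ofReal_natCast, Complex.norm_cpow_eq_rpow_re_of_pos hX0]; simp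
  have hGmeas : ∀ n, MeasureTheory.AEStronglyMeasurable (G n) := by
    intro n
    refine MeasureTheory.AEStronglyMeasurable.mul ?_ hKint.1
    apply Continuous.aestronglyMeasurable
    refine Continuous.mul ?_ ?_
    · rcases eq_or_ne n 0 with h | h
      · simp only [h, LSeries.term_zero]; exact continuous_const
      · simp only [LSeries.term_of_ne_zero h]
        have hn : (n : ℂ) ≠ 0 := by exact_mod_cast h
        refine continuous_const.div ?_ ?_
        · exact Continuous.const_cpow (by fun_prop) (Or.inl hn)
        · intro t; simp [Complex.cpow_eq_zero_iff, hn]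
    · exact Continuous.const_cpow (by fun_prop) (Or.inl hXc)
  have hGint : ∀ n, MeasureTheory.Integrable (G n) := by
    intro n
    refine MeasureTheory.Integrable.mono' (hKint.norm.const_mul (‖LSeries.term a σ n‖ * (X : ℝ) ^ σ))
      (hGmeas n) (Filter.Eventually.of_forall fun t => ?_)
    rw [hGnorm]
  have hGsum : Summable fun n => ∫ t, ‖G n t‖ := by
    have : (fun n => ∫ t, ‖G n t‖) = fun n => ‖LSeries.term a σ n‖ * ((X : ℝ) ^ σ * ∫ t, ‖K t‖) := by
      funext n
      simp_rw [hGnorm]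
      rw [MeasureTheory.integral_const_mul, mul_assoc]
    rw [this]
    exact hsum.norm.mul_right _
  have hGval : ∀ n : ℕ, ∫ t, G n t = a n * (2 * Real.pi * tentWeight (n / X)) := by
    intro n
    rcases eq_or_ne n 0 with h | h
    · subst h; simp [hG, ha0]
    · have hn0 : (0 : ℝ) < n := by exact_mod_cast Nat.pos_of_ne_zero h
      rw [← tentWeight_eq_integral hσ (div_pos hn0 hX0), ← MeasureTheory.integral_const_mul]
      congr 1
      funext t
      rw [hG, hK]
      simp only [LSeries.term_of_ne_zero h]
      have e : (((n : ℝ) / X : ℝ) : ℂ) ^ (-((σ : ℂ) + t * Complex.I)) =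
          (X : ℂ) ^ ((σ : ℂ) + t * Complex.I) / (n : ℂ) ^ ((σ : ℂ) + t * Complex.I) := by
        rw [Complex.ofReal_div, div_eq_mul_inv, ← Complex.ofReal_inv,
          Complex.mul_cpow_ofReal_nonneg hn0.le (by positivity), Complex.ofReal_inv,
          Complex.cpow_neg, Complex.ofReal_natCast, Complex.ofReal_natCast,
          Complex.inv_cpow _ _ (by rw [Complex.natCast_arg]; exact Real.pi_pos.ne),
          Complex.cpow_neg, inv_inv]
        field_simp
      rw [e]
      ring
  have hHS := MeasureTheory.hasSum_integral_of_summable_integral_norm hGint hGsum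
  have htsum : ∀ t, ∑' n, G n t =
      LSeries a ((σ : ℂ) + t * Complex.I) * (X : ℂ) ^ ((σ : ℂ) + t * Complex.I) * K t := by
    intro t
    rw [hG]
    simp only [tsum_mul_right]
    rfl
  have hfin : ∑' n, ∫ t, G n t =
      2 * Real.pi * ∑ n ∈ Finset.range (X + 1), a n * (1 - n / X) := by
    rw [tsum_eq_sum (s := Finset.range (X + 1)), Finset.mul_sum]
    · apply Finset.sum_congr rfl
      intro n hn
      rw [hGval]
      rcases eq_or_ne n 0 with h | h
      · subst h; simp [ha0]
      · have hn0 : (0 : ℝ) < n := by exact_mod_cast Nat.pos_of_ne_zero h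
        rw [tentWeight_of_mem (div_pos hn0 hX0)]
        · push_cast; ring
        · rw [div_le_one hX0]
          exact_mod_cast Nat.lt_succ_iff.1 (Finset.mem_range.1 hn)
    · intro n hn
      rw [hGval, tentWeight_of_one_le, mul_zero, mul_zero]
      rw [le_div_iff₀ hX0, one_mul]
      have : X < n := by simpa [Finset.mem_range] using hn
      exact_mod_cast this.le
  have hB0 : 0 ≤ B := by
    have := (norm_nonneg _).trans (hB 0)
    simpa using this
  have hbound : ‖∫ t, ∑' n, G n t‖ ≤ B * (X : ℝ) ^ σ * J := by
    rw [hJ, ← MeasureTheory.integral_const_mul]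
    refine MeasureTheory.norm_integral_le_of_norm_le (hI.const_mul _)
      (Filter.Eventually.of_forall fun t => ?_)
    rw [htsum, norm_mul, norm_mul, ← Complex.ofReal_natCast,
      Complex.norm_cpow_eq_rpow_re_of_pos hX0]
    have e1 : ((σ : ℂ) + t * Complex.I).re = σ := by simp
    rw [e1]
    have h1 := hB t
    have h2 := norm_tentKernel_le hσ t
    have h3 : (1 + ‖t‖) ^ (-(3 / 2 : ℝ)) = (1 + |t|) ^ (1 / 2 : ℝ) * (1 + |t|) ^ (-2 : ℝ) := by
      rw [← Real.rpow_add (by positivity), Real.norm_eq_abs]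
      norm_num
    calc _ ≤ (B * (1 + |t|) ^ (1 / 2 : ℝ)) * (X : ℝ) ^ σ * (2 * (1 + |t|) ^ (-2 : ℝ)) := by
          gcongr
      _ = _ := by rw [h3]; ring
  rw [← hHS.tsum_eq, hfin] at hbound
  rw [norm_mul, norm_mul, Complex.norm_real, Real.norm_eq_abs, abs_of_pos Real.pi_pos] at hbound
  have h2 : ‖(2 : ℂ)‖ = 2 := by simp
  rw [h2] at hbound
  have hpi := Real.pi_pos
  have h4 : ‖∑ n ∈ Finset.range (X + 1), a n * (1 - n / X)‖ ≤ B * (X : ℝ) ^ σ * J / (2 * Real.pi) := by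
    rw [le_div_iff₀ (by positivity)]; linarith
  refine h4.trans ?_
  have h5 : 0 ≤ B * (X : ℝ) ^ σ := by positivity
  calc B * (X : ℝ) ^ σ * J / (2 * Real.pi) = (J / (2 * Real.pi)) * (B * (X : ℝ) ^ σ) := by ring
    _ ≤ (J / (2 * Real.pi) + 1) * (B * (X : ℝ) ^ σ) := by gcongr; linarith
    _ = _ := by ring

lemma log_pow_le_rpow (m : ℕ) {ε : ℝ} (hε : 0 < ε) :
    ∃ C : ℝ, 0 < C ∧ ∀ x : ℝ, 1 ≤ x → Real.log x ^ m ≤ C * x ^ ε := by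
  have hm : (0 : ℝ) < m + 1 := by positivity
  refine ⟨((m + 1) / ε) ^ m, by positivity, ?_⟩
  intro x hx
  have hx0 : 0 < x := by linarith
  have h := Real.log_le_rpow_div hx0.le (div_pos hε hm)
  calc Real.log x ^ m ≤ (x ^ (ε / (m + 1)) / (ε / (m + 1))) ^ m := by
        gcongr
        exact Real.log_nonneg hx
    _ = ((m + 1) / ε) ^ m * (x ^ (ε / (m + 1))) ^ m := by
        rw [← mul_pow]; congr 1; field_simp
    _ ≤ ((m + 1) / ε) ^ m * x ^ ε := by
        gcongr
        rw [← Real.rpow_natCast, ← Real.rpow_mul hx0.le]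
        apply Real.rpow_le_rpow_of_exponent_le hx
        rw [div_mul_eq_mul_div, div_le_iff₀ hm]
        nlinarith

/-- Abel's inequality: a nonincreasing nonnegative weight. -/
lemma norm_sum_range_antitone_le {b : ℕ → ℂ} {w : ℕ → ℝ} {n : ℕ} {P : ℝ} (hP : 0 ≤ P)
    (hw : ∀ i, i + 1 < n → w (i + 1) ≤ w i) (hw0 : ∀ i, i < n → 0 ≤ w i) (hw0' : 0 ≤ w 0)
    (hb : ∀ m, m ≤ n → ‖∑ i ∈ Finset.range m, b i‖ ≤ P) :
    ‖∑ i ∈ Finset.range n, (w i : ℂ) * b i‖ ≤ w 0 * P := by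
  rcases Nat.eq_zero_or_pos n with h0 | hn
  · subst h0; simp; positivity
  have hparts := Finset.sum_range_by_parts (fun i => (w i : ℂ)) b n
  simp only [smul_eq_mul] at hparts
  rw [hparts]
  have h1 : ‖∑ i ∈ Finset.range (n - 1), ((w (i + 1) : ℂ) - (w i : ℂ)) * ∑ j ∈ Finset.range (i + 1), b j‖
      ≤ ∑ i ∈ Finset.range (n - 1), (w i - w (i + 1)) * P := by
    refine norm_sum_le_of_le _ fun i hi => ?_
    have hi' : i < n - 1 := Finset.mem_range.1 hi
    rw [norm_mul, ← Complex.ofReal_sub, Complex.norm_real, Real.norm_eq_abs, abs_sub_comm,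
      abs_of_nonneg (by linarith [hw i (by omega)])]
    exact mul_le_mul_of_nonneg_left (hb _ (by omega)) (by linarith [hw i (by omega)])
  rw [← Finset.sum_mul, Finset.sum_range_sub'] at h1
  have h2 : ‖(w (n - 1) : ℂ) * ∑ i ∈ Finset.range n, b i‖ ≤ w (n - 1) * P := by
    rw [norm_mul, Complex.norm_real, Real.norm_eq_abs, abs_of_nonneg (hw0 _ (by omega))]
    exact mul_le_mul_of_nonneg_left (hb n le_rfl) (hw0 _ (by omega))
  refine (norm_sub_le _ _).trans ?_
  calc _ ≤ w (n - 1) * P + (w 0 - w (n - 1)) * P := add_le_add h2 h1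
    _ = w 0 * P := by ring

/-- The twisted Chebyshev function. -/
def psiChar {r : ℕ} (χ : DirichletCharacter ℂ r) (N : ℕ) : ℂ :=
  ∑ n ∈ Finset.range (N + 1), χ n * ArithmeticFunction.vonMangoldt n

/-- The coefficients `χ(n) Λ(n) (log n)^k`. -/
def logCoeff {r : ℕ} (χ : DirichletCharacter ℂ r) (k : ℕ) (n : ℕ) : ℂ :=
  (Real.log n : ℂ) ^ k * (χ n * ArithmeticFunction.vonMangoldt n)

lemma logMul_iterate_eq {r : ℕ} (χ : DirichletCharacter ℂ r) (k : ℕ) :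
    LSeries.logMul^[k] ((fun n : ℕ => χ n) * fun n => (ArithmeticFunction.vonMangoldt n : ℂ)) =
      logCoeff χ k := by
  induction k with
  | zero => funext n; simp [logCoeff]
  | succ k ih =>
    rw [Function.iterate_succ', Function.comp, ih]
    funext n
    simp only [LSeries.logMul, logCoeff, Complex.natCast_log]
    ring

lemma norm_logCoeff_le {r : ℕ} (χ : DirichletCharacter ℂ r) (k n : ℕ) :
    ‖logCoeff χ k n‖ ≤ Real.log n ^ (k + 1) := by
  have h0 : 0 ≤ Real.log n := Real.log_natCast_nonneg n
  rw [logCoeff, norm_mul, norm_mul, norm_pow, Complex.norm_real, Complex.norm_real,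
    Real.norm_eq_abs, Real.norm_eq_abs, abs_of_nonneg h0,
    abs_of_nonneg ArithmeticFunction.vonMangoldt_nonneg, pow_succ]
  gcongr
  have h1 := χ.norm_le_one (n : ZMod r)
  have h2 : ArithmeticFunction.vonMangoldt n ≤ Real.log n := ArithmeticFunction.vonMangoldt_le_log
  have h3 : 0 ≤ ArithmeticFunction.vonMangoldt n := ArithmeticFunction.vonMangoldt_nonneg
  exact (mul_le_mul h1 h2 h3 zero_le_one).trans (one_mul _).le

lemma norm_LSeries_logCoeff_le (k : ℕ) : ∃ C : ℝ, 0 < C ∧ ∀ {r : ℕ} [NeZero r]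
    (χ : DirichletCharacter ℂ r), χ.IsPrimitive → χ ≠ 1 → ∀ s : ℂ, 1 < s.re → s.re ≤ 5 / 4 →
      LSeriesSummable (logCoeff χ k) s ∧
      ‖LSeries (logCoeff χ k) s‖ ≤ C * ycond r s ^ (1 / 2 : ℝ) := by
  obtain ⟨C, hC, h⟩ := norm_iteratedDeriv_logDeriv_le k
  refine ⟨C, hC, ?_⟩
  intro r _ χ hp hχ s hs hs2
  set f : ℕ → ℂ := (fun n : ℕ => χ n) * fun n => (ArithmeticFunction.vonMangoldt n : ℂ) with hf
  have habs : LSeries.abscissaOfAbsConv f < s.re := by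
    set x : ℝ := (1 + s.re) / 2 with hx
    have h1 : LSeriesSummable f ((x : ℝ) : ℂ) :=
      DirichletCharacter.LSeriesSummable_twist_vonMangoldt χ (by simp; linarith)
    refine lt_of_le_of_lt h1.abscissaOfAbsConv_le ?_
    simp only [Complex.ofReal_re]
    exact_mod_cast (by linarith : x < s.re)
  constructor
  · rw [← logMul_iterate_eq]
    apply LSeriesSummable_of_abscissaOfAbsConv_lt_re
    rw [LSeries.absicssaOfAbsConv_logPowMul]
    exact habs
  have h1 := LSeries_iteratedDeriv k habs
  rw [logMul_iterate_eq] at h1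
  have h2 : LSeries f =ᶠ[nhds s] fun z => -(deriv χ.LFunction z / χ.LFunction z) := by
    have hU : IsOpen {z : ℂ | 1 < z.re} := isOpen_lt continuous_const Complex.continuous_re
    filter_upwards [hU.mem_nhds hs] with z hz
    have hz' : 1 < z.re := hz
    rw [hf, DirichletCharacter.LSeries_twist_vonMangoldt_eq χ hz',
      DirichletCharacter.LFunction_eq_LSeries χ hz', neg_div]
    congr 2
    apply Filter.EventuallyEq.deriv_eq
    filter_upwards [hU.mem_nhds hz] with u hu
    exact (DirichletCharacter.LFunction_eq_LSeries χ hu).symm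
  rw [h2.iteratedDeriv_eq, iteratedDeriv_fun_neg] at h1
  have h3 := congrArg norm h1
  rw [norm_neg, norm_mul, norm_pow, norm_neg, norm_one, one_pow, one_mul] at h3
  rw [← h3]
  exact h χ hp hχ s hs.le hs2

/-- Smoothed sums of `χ Λ log^k`. -/
lemma norm_tent_logCoeff_le (k : ℕ) : ∃ C : ℝ, 0 < C ∧ ∀ {r : ℕ} [NeZero r]
    (χ : DirichletCharacter ℂ r), χ.IsPrimitive → χ ≠ 1 → ∀ X : ℕ, 60 ≤ X →
      ‖∑ n ∈ Finset.range (X + 1), logCoeff χ k n * ((X : ℂ) - n)‖ ≤ C * r * (X : ℝ) ^ 2 := by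
  obtain ⟨C₁, hC₁, h1⟩ := norm_LSeries_logCoeff_le k
  obtain ⟨C₂, hC₂, h2⟩ := norm_tent_sum_le
  refine ⟨C₂ * (C₁ * 2) * Real.exp 1, by positivity, ?_⟩
  intro r _ χ hp hχ X hX
  have hXr : (60 : ℝ) ≤ X := by exact_mod_cast hX
  have hX0 : (0 : ℝ) < X := by linarith
  have hlog : 4 ≤ Real.log X := by
    rw [Real.le_log_iff_exp_le hX0]
    have : Real.exp 4 = (Real.exp 1) ^ 4 := by rw [← Real.exp_nat_mul]; norm_num
    rw [this]
    have h3 := Real.exp_one_lt_d9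
    calc (Real.exp 1) ^ 4 ≤ (2.7182818286 : ℝ) ^ 4 := by gcongr
      _ ≤ 60 := by norm_num
      _ ≤ X := hXr
  set σ : ℝ := 1 + 1 / Real.log X with hσ
  have hσ0 : 0 < 1 / Real.log X := by positivity
  have hσ1 : 1 / Real.log X ≤ 1 / 4 := by gcongr
  have hr : (1 : ℝ) ≤ r := by exact_mod_cast NeZero.one_le
  have key := h2 (logCoeff χ k) σ (C₁ * 2 * r) X (by linarith) (by omega)
    (h1 χ hp hχ (σ : ℂ) (by simp; linarith) (by simp; linarith)).1 (by simp [logCoeff]) (by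
      intro t
      refine (h1 χ hp hχ ((σ : ℂ) + t * Complex.I) (by simp; linarith) (by simp; linarith)).2.trans ?_
      have e : ycond r ((σ : ℂ) + t * Complex.I) ≤ (2 * r) ^ 2 * (1 + |t|) := by
        rw [ycond]
        have : ((σ : ℂ) + t * Complex.I).im = t := by simp
        rw [this]
        have ht := abs_nonneg t
        have hr2 : (r : ℝ) ≤ r ^ 2 := by nlinarith
        calc (r : ℝ) * (|t| + 3) ≤ r ^ 2 * (|t| + 3) := by gcongr
          _ ≤ r ^ 2 * (4 * (1 + |t|)) := by gcongr; linarith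
          _ = _ := by ring
      have e0 := one_le_ycond r ((σ : ℂ) + t * Complex.I)
      calc _ ≤ C₁ * ((2 * r) ^ 2 * (1 + |t|)) ^ (1 / 2 : ℝ) := by gcongr
        _ = C₁ * ((2 * r) * (1 + |t|) ^ (1 / 2 : ℝ)) := by
            rw [Real.mul_rpow (by positivity) (by positivity), ← Real.sqrt_eq_rpow,
              Real.sqrt_sq (by positivity)]
        _ = _ := by ring)
  have hXσ : (X : ℝ) ^ σ = X * Real.exp 1 := by
    rw [hσ, Real.rpow_add hX0, Real.rpow_one, Real.rpow_def_of_pos hX0]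
    congr 2
    field_simp
  rw [hXσ] at key
  have hXc : (X : ℂ) ≠ 0 := by exact_mod_cast hX0.ne'
  have e : ∑ n ∈ Finset.range (X + 1), logCoeff χ k n * ((X : ℂ) - n) =
      X * ∑ n ∈ Finset.range (X + 1), logCoeff χ k n * (1 - n / X) := by
    rw [Finset.mul_sum]
    apply Finset.sum_congr rfl
    intro n _
    field_simp
  rw [e, norm_mul, Complex.norm_natCast]
  calc (X : ℝ) * _ ≤ X * (C₂ * (C₁ * 2 * r) * (X * Real.exp 1)) := by gcongr
    _ = _ := by ring

/-- Unsmoothed sums of `χ Λ log^k`. -/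
lemma norm_sum_logCoeff_le (j : ℕ) : ∃ C : ℝ, 0 < C ∧ ∀ {r : ℕ} [NeZero r]
    (χ : DirichletCharacter ℂ r), χ.IsPrimitive → χ ≠ 1 → ∀ X : ℕ, 60 ≤ X →
      ‖∑ n ∈ Finset.range (X + 1), logCoeff χ (2 * j + 1) n‖ ≤
        C * r * X * Real.log (2 * X) ^ (j + 1) := by
  obtain ⟨C, hC, h⟩ := norm_tent_logCoeff_le (2 * j + 1)
  obtain ⟨D, hD, hlog⟩ := log_pow_le_rpow (j + 1) (ε := 1) one_pos
  refine ⟨5 * C + 1 + 2 * D, by positivity, ?_⟩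
  intro r _ χ hp hχ X hX
  have hXr : (60 : ℝ) ≤ X := by exact_mod_cast hX
  have hX0 : (0 : ℝ) < X := by linarith
  have hr : (1 : ℝ) ≤ r := by exact_mod_cast NeZero.one_le
  set ℓ : ℝ := Real.log (2 * X) with hℓ
  have hℓ1 : 1 ≤ ℓ := by
    rw [hℓ, Real.le_log_iff_exp_le (by positivity)]
    have := Real.exp_one_lt_d9
    linarith
  have hℓj : 1 ≤ ℓ ^ (j + 1) := one_le_pow₀ hℓ1
  set H : ℕ := ⌈(X : ℝ) / ℓ ^ (j + 1)⌉₊ with hH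
  have hH1 : (X : ℝ) / ℓ ^ (j + 1) ≤ H := Nat.le_ceil _
  have hH2 : (H : ℝ) ≤ X / ℓ ^ (j + 1) + 1 := (Nat.ceil_lt_add_one (by positivity)).le
  have hHX : H ≤ X := Nat.ceil_le.2 (div_le_self hX0.le hℓj)
  have hHXr : (H : ℝ) ≤ X := by exact_mod_cast hHX
  have hH0 : (0 : ℝ) < H := lt_of_lt_of_le (by positivity) hH1
  set b := logCoeff χ (2 * j + 1) with hb
  have hsplit : (H : ℂ) * ∑ n ∈ Finset.range (X + 1), b n =
      ∑ n ∈ Finset.range ((X + H) + 1), b n * (((X + H : ℕ) : ℂ) - n) -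
      ∑ n ∈ Finset.range (X + 1), b n * ((X : ℂ) - n) -
      ∑ n ∈ Finset.range H, b (X + 1 + n) * (((X + H : ℕ) : ℂ) - (X + 1 + n : ℕ)) := by
    rw [show (X + H) + 1 = (X + 1) + H by ring,
      Finset.sum_range_add (fun n : ℕ => b n * (((X + H : ℕ) : ℂ) - n)) (X + 1) H, Finset.mul_sum]
    have : ∀ A B C D : ℂ, A = B - D → A = B + C - D - C := by
      intro A B C D hAB; rw [hAB]; ring
    apply this
    rw [← Finset.sum_sub_distrib]
    apply Finset.sum_congr rfl
    intro n _
    push_cast; ring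
  have h3 : ‖∑ n ∈ Finset.range H, b (X + 1 + n) * (((X + H : ℕ) : ℂ) - (X + 1 + n : ℕ))‖ ≤
      H * (ℓ ^ (2 * j + 1 + 1) * H) := by
    have hcard : (H : ℝ) * (ℓ ^ (2 * j + 1 + 1) * H) =
        ∑ n ∈ Finset.range H, ℓ ^ (2 * j + 1 + 1) * (H : ℝ) := by
      rw [Finset.sum_const, Finset.card_range, nsmul_eq_mul]
    rw [hcard]
    refine norm_sum_le_of_le _ ?_
    intro n hn
    have hn' : n < H := Finset.mem_range.1 hn
    rw [norm_mul]
    gcongr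
    · refine (norm_logCoeff_le χ _ _).trans ?_
      have hpos : (0 : ℝ) < ((X + 1 + n : ℕ) : ℝ) := by positivity
      have : Real.log ((X + 1 + n : ℕ) : ℝ) ≤ ℓ := by
        apply Real.log_le_log hpos
        have : X + 1 + n ≤ 2 * X := by omega
        exact_mod_cast this
      have h0 : 0 ≤ Real.log ((X + 1 + n : ℕ) : ℝ) := Real.log_natCast_nonneg _
      gcongr
    · rw [← Nat.cast_sub (by omega), Complex.norm_natCast]
      have : X + H - (X + 1 + n) ≤ H := by omega
      exact_mod_cast this
  have h1 := h χ hp hχ X hX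
  have h2 := h χ hp hχ (X + H) (by omega)
  have h4 : (((X + H : ℕ) : ℝ)) ^ 2 ≤ 4 * X ^ 2 := by push_cast; nlinarith
  have h5 : H * ‖∑ n ∈ Finset.range (X + 1), b n‖ ≤
      5 * C * r * X ^ 2 + H * (ℓ ^ (2 * j + 1 + 1) * H) := by
    rw [← Complex.norm_natCast, ← norm_mul, hsplit]
    refine (norm_sub_le _ _).trans (add_le_add ((norm_sub_le _ _).trans ?_)
      (by simpa only [Complex.norm_natCast] using h3))
    have : C * r * (((X + H : ℕ) : ℝ)) ^ 2 ≤ C * r * (4 * X ^ 2) := by gcongr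
    calc _ ≤ C * r * (((X + H : ℕ) : ℝ)) ^ 2 + C * r * (X : ℝ) ^ 2 := add_le_add h2 h1
      _ ≤ _ := by linarith
  have h6 : ‖∑ n ∈ Finset.range (X + 1), b n‖ ≤ 5 * C * r * X ^ 2 / H + ℓ ^ (2 * j + 1 + 1) * H := by
    have : ‖∑ n ∈ Finset.range (X + 1), b n‖ ≤
      (5 * C * r * X ^ 2 + H * (ℓ ^ (2 * j + 1 + 1) * H)) / H := by
      rw [le_div_iff₀ hH0]; linarith
    refine this.trans (le_of_eq ?_)
    field_simp
  refine h6.trans ?_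
  have h7 : 5 * C * r * X ^ 2 / H ≤ 5 * C * r * X * ℓ ^ (j + 1) := by
    rw [div_le_iff₀ hH0]
    rw [div_le_iff₀ (by positivity)] at hH1
    calc 5 * C * r * (X : ℝ) ^ 2 = 5 * C * r * X * X := by ring
      _ ≤ 5 * C * r * X * (H * ℓ ^ (j + 1)) := by gcongr
      _ = _ := by ring
  have h8 : ℓ ^ (2 * j + 1 + 1) * H ≤ X * ℓ ^ (j + 1) + 2 * D * X * ℓ ^ (j + 1) := by
    have e : ℓ ^ (2 * j + 1 + 1) = ℓ ^ (j + 1) * ℓ ^ (j + 1) := by rw [← pow_add]; congr 1; ring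
    have h9 : ℓ ^ (j + 1) ≤ D * (2 * X) := by
      have := hlog (2 * X) (by linarith)
      simpa using this
    calc ℓ ^ (2 * j + 1 + 1) * H ≤ ℓ ^ (2 * j + 1 + 1) * (X / ℓ ^ (j + 1) + 1) := by gcongr
      _ = X * ℓ ^ (j + 1) + ℓ ^ (j + 1) * ℓ ^ (j + 1) := by rw [e]; field_simp
      _ ≤ X * ℓ ^ (j + 1) + D * (2 * X) * ℓ ^ (j + 1) := by gcongr
      _ = _ := by ring
  have h8' : ℓ ^ (2 * j + 1 + 1) * H ≤ (1 + 2 * D) * (X * ℓ ^ (j + 1)) := by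
    refine h8.trans (le_of_eq ?_); ring
  have h10 : (1 + 2 * D) * (X * ℓ ^ (j + 1)) ≤ (1 + 2 * D) * (r * (X * ℓ ^ (j + 1))) := by
    have : 0 ≤ X * ℓ ^ (j + 1) := by positivity
    exact mul_le_mul_of_nonneg_left (le_mul_of_one_le_left this hr) (by positivity)
  calc _ ≤ 5 * C * r * X * ℓ ^ (j + 1) + (1 + 2 * D) * (X * ℓ ^ (j + 1)) :=
        add_le_add h7 h8'
    _ ≤ 5 * C * r * X * ℓ ^ (j + 1) + (1 + 2 * D) * (r * (X * ℓ ^ (j + 1))) :=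
        add_le_add_right h10 _
    _ = _ := by ring

lemma norm_psiChar_le {r : ℕ} (χ : DirichletCharacter ℂ r) (N : ℕ) :
    ‖psiChar χ N‖ ≤ N * Real.log N := by
  rw [psiChar, Finset.sum_range_succ']
  simp only [Nat.cast_zero, ArithmeticFunction.map_zero, Complex.ofReal_zero, mul_zero, add_zero]
  have hcard : (N : ℝ) * Real.log N = ∑ n ∈ Finset.range N, Real.log N := by
    rw [Finset.sum_const, Finset.card_range, nsmul_eq_mul]
  rw [hcard]
  refine norm_sum_le_of_le _ fun n hn => ?_
  have hn' : n < N := Finset.mem_range.1 hn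
  have h0 := norm_logCoeff_le χ 0 (n + 1)
  rw [logCoeff, pow_zero, one_mul, zero_add, pow_one] at h0
  refine h0.trans ?_
  apply Real.log_le_log (by positivity)
  exact_mod_cast hn'

/-- The Siegel–Walfisz theorem with an arbitrary power of the logarithm, with linear dependence on
the modulus. -/
lemma siegel_walfisz (A : ℕ) : ∃ C : ℝ, 0 < C ∧ ∀ {r : ℕ} [NeZero r]
    (χ : DirichletCharacter ℂ r), χ.IsPrimitive → χ ≠ 1 → ∀ X : ℕ, 2 ≤ X →
      ‖psiChar χ X‖ ≤ C * r * X / Real.log X ^ A := by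
  obtain ⟨C, hC, h⟩ := norm_sum_logCoeff_le A
  obtain ⟨D, hD, hlog⟩ := log_pow_le_rpow (A + 1) (ε := 1 / 2) (by norm_num)
  set E : ℝ := Real.log 3721 ^ (A + 1) with hE
  have hE0 : 0 < E := pow_pos (Real.log_pos (by norm_num)) _
  refine ⟨E + (D + 2 ^ (2 * A + 1) * (2 * C * 2 ^ (A + 1))), by positivity, ?_⟩
  intro r _ χ hp hχ X hX2
  have hXr2 : (2 : ℝ) ≤ X := by exact_mod_cast hX2
  have hX0 : (0 : ℝ) < X := by linarith
  have hr : (1 : ℝ) ≤ r := by exact_mod_cast NeZero.one_le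
  have hl0 : 0 < Real.log X := Real.log_pos (by linarith)
  rw [le_div_iff₀ (by positivity)]
  rcases lt_or_ge X 3721 with hX | hX
  · have h1 : Real.log X ≤ Real.log 3721 := Real.log_le_log hX0 (by exact_mod_cast hX.le)
    calc _ ≤ X * Real.log X * Real.log X ^ A := by gcongr; exact norm_psiChar_le χ X
      _ = 1 * X * Real.log X ^ (A + 1) := by ring
      _ ≤ r * X * Real.log 3721 ^ (A + 1) := by gcongr
      _ = E * r * X := by rw [hE]; ring
      _ ≤ _ := by
        gcongr
        have : 0 < D + 2 ^ (2 * A + 1) * (2 * C * 2 ^ (A + 1)) := by positivity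
        linarith
  set M : ℕ := Nat.sqrt X with hM
  have hM60 : 60 ≤ M := by rw [hM, Nat.le_sqrt]; omega
  have hMX : M * M ≤ X := Nat.sqrt_le X
  have hMX' : X < (M + 1) * (M + 1) := Nat.lt_succ_sqrt X
  have hMleX : M ≤ X := Nat.sqrt_le_self X
  have hM0 : (0 : ℝ) < M := by exact_mod_cast (by omega : 0 < M)
  set k : ℕ := 2 * A + 1 with hk
  have hsplit : psiChar χ X = psiChar χ M + ∑ i ∈ Finset.range (X - M),
      (((Real.log ((M + 1 + i : ℕ) : ℝ) ^ k)⁻¹ : ℝ) : ℂ) * logCoeff χ k (M + 1 + i) := by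
    rw [psiChar, show X + 1 = (M + 1) + (X - M) by omega, Finset.sum_range_add, psiChar]
    congr 1
    apply Finset.sum_congr rfl
    intro i _
    have hpos : Real.log ((M + 1 + i : ℕ) : ℝ) ≠ 0 :=
      (Real.log_pos (by exact_mod_cast (by omega : 1 < M + 1 + i))).ne'
    have hpos' : (Real.log ((M + 1 + i : ℕ) : ℝ) : ℂ) ≠ 0 := by exact_mod_cast hpos
    rw [logCoeff]
    push_cast at hpos' ⊢
    field_simp
  have hlog2 : Real.log (2 * X) ≤ 2 * Real.log X := by
    rw [Real.log_mul (by norm_num) hX0.ne']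
    have := Real.log_le_log (by norm_num) hXr2
    linarith
  have hlog20 : 0 ≤ Real.log (2 * X) := Real.log_nonneg (by linarith)
  have hpart : ∀ Y : ℕ, 60 ≤ Y → Y ≤ X → ‖∑ n ∈ Finset.range (Y + 1), logCoeff χ k n‖ ≤
      C * r * X * Real.log (2 * X) ^ (A + 1) := by
    intro Y hY hYX
    refine (h χ hp hχ Y hY).trans ?_
    have hY1 : (60 : ℝ) ≤ Y := by exact_mod_cast hY
    have hYX' : (Y : ℝ) ≤ X := by exact_mod_cast hYX
    have : 0 ≤ Real.log (2 * Y) := Real.log_nonneg (by linarith)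
    gcongr
  have h2 := norm_sum_range_antitone_le
    (b := fun i => logCoeff χ k (M + 1 + i))
    (w := fun i => (Real.log ((M + 1 + i : ℕ) : ℝ) ^ k)⁻¹) (n := X - M)
    (P := 2 * (C * r * X * Real.log (2 * X) ^ (A + 1))) (by positivity)
    (by
      intro i _
      have h3 : (0 : ℝ) < Real.log ((M + 1 + i : ℕ) : ℝ) :=
        Real.log_pos (by exact_mod_cast (by omega : 1 < M + 1 + i))
      have h4 : Real.log ((M + 1 + i : ℕ) : ℝ) ≤ Real.log ((M + 1 + (i + 1) : ℕ) : ℝ) :=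
        Real.log_le_log (by positivity) (by exact_mod_cast (by omega))
      gcongr)
    (by
      intro i _
      have h3 : (0 : ℝ) ≤ Real.log ((M + 1 + i : ℕ) : ℝ) := Real.log_natCast_nonneg _
      positivity)
    (by
      have h3 : (0 : ℝ) ≤ Real.log ((M + 1 + 0 : ℕ) : ℝ) := Real.log_natCast_nonneg _
      positivity)
    (by
      intro m hm
      have e : ∑ i ∈ Finset.range m, logCoeff χ k (M + 1 + i) =
          ∑ n ∈ Finset.range ((M + m) + 1), logCoeff χ k n -
          ∑ n ∈ Finset.range (M + 1), logCoeff χ k n := by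
        rw [show (M + m) + 1 = (M + 1) + m by ring, Finset.sum_range_add]; ring
      rw [e]
      refine (norm_sub_le _ _).trans ?_
      have := hpart (M + m) (by omega) (by omega)
      have := hpart M (by omega) (by omega)
      linarith)
  have hw : (Real.log ((M + 1 + 0 : ℕ) : ℝ) ^ k)⁻¹ ≤ 2 ^ k / Real.log X ^ k := by
    have h3 : Real.log X / 2 ≤ Real.log ((M + 1 + 0 : ℕ) : ℝ) := by
      have h4 : Real.log X ≤ Real.log (((M + 1 + 0 : ℕ) : ℝ) ^ 2) := by
        apply Real.log_le_log hX0
        have : X ≤ (M + 1 + 0) ^ 2 := by rw [pow_two]; exact hMX'.le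
        exact_mod_cast this
      rw [Real.log_pow] at h4
      push_cast at h4 ⊢
      linarith
    rw [← div_pow, ← inv_pow]
    have h5 : (Real.log ((M + 1 + 0 : ℕ) : ℝ))⁻¹ ≤ (Real.log X / 2)⁻¹ := by gcongr
    rw [inv_div] at h5
    have : 0 ≤ Real.log ((M + 1 + 0 : ℕ) : ℝ) := Real.log_natCast_nonneg _
    gcongr
  have h6 : ‖psiChar χ M‖ * Real.log X ^ A ≤ D * r * X := by
    have h7 : (M : ℝ) ≤ (X : ℝ) ^ (1 / 2 : ℝ) := by
      rw [← Real.sqrt_eq_rpow]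
      apply Real.le_sqrt_of_sq_le
      rw [pow_two]; exact_mod_cast hMX
    have h8 : Real.log M ≤ Real.log X := Real.log_le_log hM0 (by exact_mod_cast hMleX)
    have h9 : (X : ℝ) ^ (1 / 2 : ℝ) * (X : ℝ) ^ (1 / 2 : ℝ) = X := by
      rw [← Real.rpow_add hX0]; norm_num
    calc _ ≤ M * Real.log M * Real.log X ^ A := by gcongr; exact norm_psiChar_le χ M
      _ ≤ (X : ℝ) ^ (1 / 2 : ℝ) * Real.log X * Real.log X ^ A := by gcongr
      _ = (X : ℝ) ^ (1 / 2 : ℝ) * Real.log X ^ (A + 1) := by ring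
      _ ≤ (X : ℝ) ^ (1 / 2 : ℝ) * (D * (X : ℝ) ^ (1 / 2 : ℝ)) := by
          gcongr; exact hlog X (by linarith)
      _ = D * 1 * ((X : ℝ) ^ (1 / 2 : ℝ) * (X : ℝ) ^ (1 / 2 : ℝ)) := by ring
      _ = D * 1 * X := by rw [h9]
      _ ≤ D * r * X := by gcongr
  have h10 : 2 ^ k / Real.log X ^ k * (2 * (C * r * X * Real.log (2 * X) ^ (A + 1))) * Real.log X ^ A
      ≤ 2 ^ k * (2 * C * 2 ^ (A + 1)) * r * X := by
    have e : Real.log X ^ k = Real.log X ^ (A + 1) * Real.log X ^ A := by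
      rw [← pow_add]; congr 1; omega
    calc _ ≤ 2 ^ k / Real.log X ^ k * (2 * (C * r * X * (2 * Real.log X) ^ (A + 1))) * Real.log X ^ A := by
          gcongr
      _ = _ := by rw [e, mul_pow]; field_simp
  rw [hsplit]
  calc _ ≤ (‖psiChar χ M‖ + 2 ^ k / Real.log X ^ k *
        (2 * (C * r * X * Real.log (2 * X) ^ (A + 1)))) * Real.log X ^ A := by
        gcongr
        refine (norm_add_le _ _).trans ?_
        gcongr
        refine h2.trans ?_
        gcongr
    _ ≤ (D + 2 ^ k * (2 * C * 2 ^ (A + 1))) * r * X := by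
        rw [add_mul]
        refine (add_le_add h6 h10).trans (le_of_eq ?_)
        ring
    _ ≤ _ := by
        exact mul_le_mul_of_nonneg_right (mul_le_mul_of_nonneg_right
          (le_add_of_nonneg_left hE0.le) (by positivity)) hX0.le

/-- The additive character `e(x) = exp(2πix)`. -/
def ex (x : ℝ) : ℂ := Complex.exp (((2 * Real.pi * x : ℝ) : ℂ) * Complex.I)

/-- Distance to the nearest integer. -/
def nd (x : ℝ) : ℝ := |x - round x|

lemma norm_ex (x : ℝ) : ‖ex x‖ = 1 := Complex.norm_exp_ofReal_mul_I _

lemma ex_add (x y : ℝ) : ex (x + y) = ex x * ex y := by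
  rw [ex, ex, ex, ← Complex.exp_add]; congr 1; push_cast; ring

lemma ex_zero : ex 0 = 1 := by simp [ex]

lemma ex_int (n : ℤ) : ex n = 1 := by
  rw [ex, Complex.exp_eq_one_iff]
  exact ⟨n, by push_cast; ring⟩

lemma ex_nat_mul (n : ℕ) (x : ℝ) : ex (n * x) = ex x ^ n := by
  rw [ex, ex, ← Complex.exp_nat_mul]; congr 1; push_cast; ring

lemma ex_add_int (x : ℝ) (n : ℤ) : ex (x + n) = ex x := by rw [ex_add, ex_int, mul_one]

lemma conj_ex (x : ℝ) : (starRingEnd ℂ) (ex x) = ex (-x) := by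
  rw [ex, ex, ← Complex.exp_conj, map_mul, Complex.conj_ofReal, Complex.conj_I]; congr 1
  push_cast; ring

lemma norm_ex_sub_ex_le (x y : ℝ) : ‖ex x - ex y‖ ≤ 2 * Real.pi * |x - y| := by
  have h : ex x - ex y = ex y * (ex (x - y) - 1) := by
    rw [mul_sub, ← ex_add]; simp
  rw [h, norm_mul, norm_ex, one_mul, ex, mul_comm _ Complex.I, Complex.norm_exp_I_mul_ofReal_sub_one]
  rw [norm_mul, Real.norm_eq_abs, Real.norm_eq_abs, abs_of_pos (by norm_num : (0 : ℝ) < 2)]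
  have h2 : |Real.sin (2 * Real.pi * (x - y) / 2)| ≤ |2 * Real.pi * (x - y) / 2| := Real.abs_sin_le_abs
  have h3 : |2 * Real.pi * (x - y) / 2| = Real.pi * |x - y| := by
    rw [show 2 * Real.pi * (x - y) / 2 = Real.pi * (x - y) by ring, abs_mul, abs_of_pos Real.pi_pos]
  linarith

lemma nd_nonneg (x : ℝ) : 0 ≤ nd x := abs_nonneg _

lemma nd_le_half (x : ℝ) : nd x ≤ 1 / 2 := abs_sub_round x

lemma nd_le (x : ℝ) (n : ℤ) : nd x ≤ |x - n| := round_le x n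

lemma nd_neg (x : ℝ) : nd (-x) = nd x := by
  apply le_antisymm
  · refine (nd_le (-x) (-round x)).trans (le_of_eq ?_)
    rw [nd, ← abs_neg]; push_cast; congr 1; ring
  · refine (nd_le x (-round (-x))).trans (le_of_eq ?_)
    rw [nd, ← abs_neg]; push_cast; congr 1; ring

lemma nd_sub_le (x y : ℝ) : nd x ≤ nd y + |x - y| := by
  refine (nd_le x (round y)).trans ?_
  rw [nd]
  have : x - round y = (y - round y) + (x - y) := by ring
  rw [this]
  exact abs_add_le _ _

lemma four_nd_le (x : ℝ) : 4 * nd x ≤ ‖ex x - 1‖ := by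
  set d : ℝ := x - round x with hd
  have h1 : ex x = ex d := by
    rw [← ex_add_int d (round x)]; congr 1; rw [hd]; ring
  have h2 : ‖ex x - 1‖ = 2 * |Real.sin (Real.pi * d)| := by
    rw [h1, ex, mul_comm _ Complex.I, Complex.norm_exp_I_mul_ofReal_sub_one, norm_mul,
      Real.norm_eq_abs, Real.norm_eq_abs, abs_of_pos (by norm_num : (0 : ℝ) < 2)]
    congr 3; ring
  have h3 : |Real.sin (Real.pi * d)| = |Real.sin (Real.pi * |d|)| := by
    rcases abs_cases d with h | h
    · rw [h.1]
    · rw [h.1, mul_neg, Real.sin_neg, abs_neg]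
  have hd2 : |d| ≤ 1 / 2 := nd_le_half x
  have h4 := Real.mul_le_sin (x := Real.pi * |d|) (by positivity)
    (by have := Real.pi_pos; nlinarith)
  have h5 : 2 / Real.pi * (Real.pi * |d|) = 2 * |d| := by field_simp
  rw [h2, h3]
  have : nd x = |d| := rfl
  rw [this]
  have := le_abs_self (Real.sin (Real.pi * |d|))
  linarith

lemma norm_sum_ex_mul_nd_le (a b : ℕ) (x : ℝ) :
    ‖∑ k ∈ Finset.Ico a b, ex (k * x)‖ * (2 * nd x) ≤ 1 := by
  rcases le_or_gt b a with hab | hab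
  · rw [Finset.Ico_eq_empty (by omega)]; simp
  have h1 : ∑ k ∈ Finset.Ico a b, ex (k * x) =
      ex x ^ a * ∑ k ∈ Finset.range (b - a), ex x ^ k := by
    rw [Finset.sum_Ico_eq_sum_range, Finset.mul_sum]
    apply Finset.sum_congr rfl
    intro k _
    rw [ex_nat_mul, pow_add]
  have h2 : ‖∑ k ∈ Finset.Ico a b, ex (k * x)‖ * ‖ex x - 1‖ ≤ 2 := by
    rw [h1, norm_mul, norm_pow, norm_ex, one_pow, one_mul, norm_sub_rev, mul_comm, ← norm_mul,
      mul_neg_geom_sum]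
    refine (norm_sub_le _ _).trans ?_
    rw [norm_pow, norm_ex, one_pow, norm_one]; norm_num
  have h3 := four_nd_le x
  have h4 := norm_nonneg (∑ k ∈ Finset.Ico a b, ex (k * x))
  nlinarith

/-- A smooth version of `min(H, 1/(2y))`. -/
def gmin (H y : ℝ) : ℝ := 2 * H / (1 + 2 * H * y)

lemma le_gmin {H y x : ℝ} (hH : 0 ≤ H) (hy : 0 ≤ y) (h1 : x ≤ H) (h2 : x * (2 * y) ≤ 1) :
    x ≤ gmin H y := by
  rw [gmin, le_div_iff₀ (by positivity)]
  nlinarith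

lemma gmin_nonneg {H y : ℝ} (hH : 0 ≤ H) (hy : 0 ≤ y) : 0 ≤ gmin H y := by
  rw [gmin]; positivity

lemma gmin_anti {H x y : ℝ} (hH : 0 ≤ H) (hx : 0 ≤ x) (hxy : x ≤ y) : gmin H y ≤ gmin H x := by
  rw [gmin, gmin]; gcongr

lemma gmin_le_inv {H y : ℝ} (hH : 0 ≤ H) (hy : 0 < y) : gmin H y ≤ 1 / y := by
  rw [gmin, div_le_div_iff₀ (by positivity) hy]
  nlinarith

lemma gmin_zero (H : ℝ) : gmin H 0 = 2 * H := by rw [gmin]; simp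

lemma norm_sum_ex_le_gmin (a b : ℕ) (x : ℝ) {H : ℝ} (hH : ((b - a : ℕ) : ℝ) ≤ H) :
    ‖∑ k ∈ Finset.Ico a b, ex (k * x)‖ ≤ gmin H (nd x) := by
  have h0 : (0 : ℝ) ≤ ((b - a : ℕ) : ℝ) := Nat.cast_nonneg _
  refine le_gmin (by linarith) (nd_nonneg x) ?_ (norm_sum_ex_mul_nd_le a b x)
  refine (norm_sum_le _ _).trans ?_
  simp only [norm_ex, Finset.sum_const, Nat.card_Ico, nsmul_eq_mul, mul_one]
  exact hH

/-- Sums of an antitone function of the distance to the nearest integer over spaced points. -/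
lemma sum_spaced_le {ι : Type*} (s : Finset ι) (u : ι → ℝ) {δ : ℝ} (hδ : 0 < δ) (K : ℕ)
    (hK : 1 / 2 < δ * (K + 1)) (hsp : ∀ y ∈ s, ∀ z ∈ s, y ≠ z → δ ≤ nd (u y - u z))
    (f : ℝ → ℝ) (hf : ∀ x y, 0 ≤ x → x ≤ y → f y ≤ f x) (hf0 : ∀ x, 0 ≤ x → 0 ≤ f x) :
    ∑ y ∈ s, f (nd (u y)) ≤ 2 * ∑ k ∈ Finset.range (K + 1), f (k * δ) := by
  classical
  set g : ι → Bool × ℕ := fun y => (decide (0 ≤ u y - round (u y)), ⌊nd (u y) / δ⌋₊) with hg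
  have hfl : ∀ y, (⌊nd (u y) / δ⌋₊ : ℝ) * δ ≤ nd (u y) := fun y => by
    rw [← le_div_iff₀ hδ]; exact Nat.floor_le (div_nonneg (nd_nonneg _) hδ.le)
  have hfl2 : ∀ y, nd (u y) < ((⌊nd (u y) / δ⌋₊ : ℝ) + 1) * δ := fun y => by
    rw [← div_lt_iff₀ hδ]; exact Nat.lt_floor_add_one _
  have hinj : Set.InjOn g s := by
    intro y hy z hz hyz
    by_contra hne
    have h1 := hsp y hy z hz hne
    simp only [hg, Prod.mk.injEq, decide_eq_decide] at hyz
    obtain ⟨hs, hk⟩ := hyz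
    have h2 : nd (u y - u z) ≤ |(u y - round (u y)) - (u z - round (u z))| := by
      refine (nd_le _ (round (u y) - round (u z))).trans (le_of_eq ?_)
      push_cast; congr 1; ring
    have h3 := hfl y
    have h4 := hfl2 y
    have h5 := hfl z
    have h6 := hfl2 z
    rw [hk] at h3 h4
    have h7 : |(u y - round (u y)) - (u z - round (u z))| < δ := by
      have ey : nd (u y) = |u y - round (u y)| := rfl
      have ez : nd (u z) = |u z - round (u z)| := rfl
      by_cases hp : 0 ≤ u y - round (u y)
      · rw [abs_of_nonneg hp] at ey
        rw [abs_of_nonneg (hs.1 hp)] at ez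
        rw [abs_lt]; constructor <;> linarith
      · have hp' : ¬ 0 ≤ u z - round (u z) := fun h => hp (hs.2 h)
        rw [abs_of_neg (not_le.1 hp)] at ey
        rw [abs_of_neg (not_le.1 hp')] at ez
        rw [abs_lt]; constructor <;> linarith
    linarith
  calc ∑ y ∈ s, f (nd (u y)) ≤ ∑ y ∈ s, f ((g y).2 * δ) := by
        apply Finset.sum_le_sum
        intro y _
        exact hf _ _ (by positivity) (hfl y)
    _ = ∑ p ∈ s.image g, f (p.2 * δ) := by rw [Finset.sum_image hinj]
    _ ≤ ∑ p ∈ (Finset.univ : Finset Bool) ×ˢ Finset.range (K + 1), f (p.2 * δ) := by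
        apply Finset.sum_le_sum_of_subset_of_nonneg
        · intro p hp
          obtain ⟨y, _, rfl⟩ := Finset.mem_image.1 hp
          simp only [Finset.mem_product, Finset.mem_univ, true_and, Finset.mem_range, hg]
          rw [Nat.floor_lt (div_nonneg (nd_nonneg _) hδ.le), div_lt_iff₀ hδ]
          have := nd_le_half (u y)
          push_cast
          linarith
        · intro p _ _
          exact hf0 _ (by positivity)
    _ = _ := by rw [Finset.sum_product]; simp

lemma sum_inv_le_log (K : ℕ) : ∑ k ∈ Finset.range K, (1 : ℝ) / (k + 1) ≤ 1 + Real.log K := by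
  have h := harmonic_le_one_add_log K
  rw [harmonic] at h
  push_cast at h
  simpa [one_div] using h

lemma sum_inv_sq_le (K : ℕ) : ∑ k ∈ Finset.range K, (1 : ℝ) / ((k : ℝ) + 1) ^ 2 ≤ 2 := by
  have h := sum_Ioo_inv_sq_le (α := ℝ) 0 (K + 1)
  have e : Finset.Ioo 0 (K + 1) = Finset.Ico (0 + 1) (K + 1) := by ext; simp; omega
  rw [e, ← Finset.sum_Ico_add' (fun i : ℕ => ((i : ℝ) ^ 2)⁻¹) 0 K 1] at h
  simpa [one_div] using h

/-- Summation over `dm = n ≤ N`. -/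
lemma sum_Ioc_divisorsAntidiagonal {R : Type*} [AddCommMonoid R] (F : ℕ → ℕ → R) (N : ℕ) :
    ∑ n ∈ Finset.Ioc 0 N, ∑ x ∈ n.divisorsAntidiagonal, F x.1 x.2 =
      ∑ d ∈ Finset.Ioc 0 N, ∑ m ∈ Finset.Ioc 0 (N / d), F d m := by
  rw [Finset.sum_sigma', Finset.sum_sigma']
  refine Finset.sum_bij' (fun x _ => ⟨x.2.1, x.2.2⟩) (fun y _ => ⟨y.1 * y.2, (y.1, y.2)⟩) ?_ ?_ ?_ ?_ ?_
  · rintro ⟨n, d, m⟩ h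
    simp only [Finset.mem_sigma, Finset.mem_Ioc, Nat.mem_divisorsAntidiagonal] at h ⊢
    obtain ⟨⟨h0, hN⟩, rfl, h1⟩ := h
    have hd : 0 < d := Nat.pos_of_ne_zero fun h => by simp [h] at h1
    have hm : 0 < m := Nat.pos_of_ne_zero fun h => by simp [h] at h1
    refine ⟨⟨hd, (Nat.le_mul_of_pos_right d hm).trans hN⟩, hm, ?_⟩
    rw [Nat.le_div_iff_mul_le hd, mul_comm]; exact hN
  · rintro ⟨d, m⟩ h
    simp only [Finset.mem_sigma, Finset.mem_Ioc, Nat.mem_divisorsAntidiagonal] at h ⊢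
    obtain ⟨⟨h0, hN⟩, h1, h2⟩ := h
    rw [Nat.le_div_iff_mul_le h0, mul_comm] at h2
    exact ⟨⟨Nat.mul_pos h0 h1, h2⟩, trivial, (Nat.mul_pos h0 h1).ne'⟩
  · rintro ⟨n, d, m⟩ h
    simp only [Finset.mem_sigma, Nat.mem_divisorsAntidiagonal] at h
    simp [h.2.1]
  · rintro ⟨d, m⟩ _; rfl
  · rintro ⟨n, d, m⟩ _; rfl

lemma sum_Ioc_inv_le (N : ℕ) : ∑ d ∈ Finset.Ioc 0 N, (1 : ℝ) / d ≤ 1 + Real.log N := by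
  have h := sum_inv_le_log N
  have e : Finset.Ioc 0 N = Finset.Ico (0 + 1) (N + 1) := by ext; simp; omega
  rw [e, ← Finset.sum_Ico_add' (fun i : ℕ => (1 : ℝ) / (i : ℝ)) 0 N 1]
  simpa using h

/-- The number of divisors, as a real number. -/
def tau (n : ℕ) : ℝ := (n.divisors.card : ℝ)

lemma tau_nonneg (n : ℕ) : 0 ≤ tau n := Nat.cast_nonneg _

lemma tau_mul_le (m n : ℕ) : tau (m * n) ≤ tau m * tau n := by
  rw [tau, tau, tau, Nat.divisors_mul]
  exact_mod_cast Finset.card_mul_le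

lemma tau_eq_sum (n : ℕ) : tau n = ∑ _x ∈ n.divisorsAntidiagonal, (1 : ℝ) := by
  rw [tau, Finset.sum_const, nsmul_eq_mul, mul_one, ← Nat.map_div_right_divisors, Finset.card_map]

lemma log_nat_mono {a b : ℕ} (h : a ≤ b) : Real.log a ≤ Real.log b := by
  rcases Nat.eq_zero_or_pos a with rfl | ha
  · simpa using Real.log_natCast_nonneg b
  · exact Real.log_le_log (by exact_mod_cast ha) (by exact_mod_cast h)

lemma sum_tau_le (N : ℕ) : ∑ n ∈ Finset.Ioc 0 N, tau n ≤ N * (1 + Real.log N) := by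
  simp only [tau_eq_sum]
  rw [sum_Ioc_divisorsAntidiagonal (fun _ _ => (1 : ℝ)) N]
  calc _ ≤ ∑ d ∈ Finset.Ioc 0 N, (N : ℝ) * (1 / d) := by
        apply Finset.sum_le_sum
        intro d _
        simp only [Finset.sum_const, Nat.card_Ioc, nsmul_eq_mul, mul_one, Nat.sub_zero]
        rw [mul_one_div]; exact Nat.cast_div_le
    _ ≤ _ := by
        rw [← Finset.mul_sum]; gcongr; exact sum_Ioc_inv_le N

lemma sum_tau_div_le (N : ℕ) : ∑ n ∈ Finset.Ioc 0 N, tau n / n ≤ (1 + Real.log N) ^ 2 := by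
  have e : ∀ n ∈ Finset.Ioc 0 N, tau n / n =
      ∑ x ∈ n.divisorsAntidiagonal, (1 : ℝ) / x.1 * (1 / x.2) := by
    intro n hn
    rw [tau_eq_sum, Finset.sum_div]
    apply Finset.sum_congr rfl
    intro x hx
    rw [Nat.mem_divisorsAntidiagonal] at hx
    rw [← hx.1, div_mul_div_comm]; push_cast; ring
  rw [Finset.sum_congr rfl e,
    sum_Ioc_divisorsAntidiagonal (fun a b => (1 : ℝ) / (a : ℝ) * (1 / (b : ℝ))) N, pow_two]
  have hlog : 0 ≤ Real.log N := Real.log_natCast_nonneg N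
  calc _ ≤ ∑ d ∈ Finset.Ioc 0 N, (1 : ℝ) / d * (1 + Real.log N) := by
        apply Finset.sum_le_sum
        intro d _
        rw [← Finset.mul_sum]
        gcongr
        refine (sum_Ioc_inv_le _).trans ?_
        have := log_nat_mono (Nat.div_le_self N d)
        linarith
    _ ≤ _ := by
        rw [← Finset.sum_mul]
        gcongr
        exact sum_Ioc_inv_le N

lemma sum_tau_sq_le (N : ℕ) : ∑ n ∈ Finset.Ioc 0 N, tau n ^ 2 ≤ N * (1 + Real.log N) ^ 3 := by
  have hlog : 0 ≤ Real.log N := Real.log_natCast_nonneg N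
  have e : ∀ n ∈ Finset.Ioc 0 N, tau n ^ 2 =
      ∑ x ∈ n.divisorsAntidiagonal, tau (x.1 * x.2) := by
    intro n hn
    rw [pow_two]
    nth_rewrite 1 [tau_eq_sum]
    rw [Finset.sum_mul]
    apply Finset.sum_congr rfl
    intro x hx
    rw [Nat.mem_divisorsAntidiagonal] at hx
    rw [hx.1, one_mul]
  rw [Finset.sum_congr rfl e, sum_Ioc_divisorsAntidiagonal (fun a b => tau (a * b)) N]
  calc _ ≤ ∑ d ∈ Finset.Ioc 0 N, (tau d / d) * (N * (1 + Real.log N)) := by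
        apply Finset.sum_le_sum
        intro d hd
        have hd0 : (0 : ℝ) < d := by exact_mod_cast (Finset.mem_Ioc.1 hd).1
        calc _ ≤ ∑ m ∈ Finset.Ioc 0 (N / d), tau d * tau m :=
              Finset.sum_le_sum fun m _ => tau_mul_le d m
          _ ≤ tau d * ((N / d : ℕ) * (1 + Real.log (N / d : ℕ))) := by
              rw [← Finset.mul_sum]
              exact mul_le_mul_of_nonneg_left (sum_tau_le _) (tau_nonneg d)
          _ ≤ tau d * ((N / d) * (1 + Real.log N)) := by
              have h1 := log_nat_mono (Nat.div_le_self N d)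
              have h2 : ((N / d : ℕ) : ℝ) ≤ N / d := Nat.cast_div_le
              have h3 := tau_nonneg d
              have h4 : 0 ≤ Real.log (N / d : ℕ) := Real.log_natCast_nonneg _
              gcongr
          _ = _ := by field_simp
    _ ≤ (1 + Real.log N) ^ 2 * (N * (1 + Real.log N)) := by
        rw [← Finset.sum_mul]
        gcongr
        exact sum_tau_div_le N
    _ = _ := by ring

lemma le_totient_mul_tau (n : ℕ) : (n : ℝ) ≤ n.totient * tau n := by
  rcases Nat.eq_zero_or_pos n with rfl | hn
  · simp [tau]
  have h : n ≤ n.totient * n.divisors.card := by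
    calc n = ∑ d ∈ n.divisors, d.totient := (Nat.sum_totient n).symm
      _ ≤ ∑ d ∈ n.divisors, n.totient := by
          apply Finset.sum_le_sum
          intro d hd
          exact Nat.le_of_dvd (Nat.totient_pos.2 hn)
            (Nat.totient_dvd_of_dvd (Nat.dvd_of_mem_divisors hd))
      _ = _ := by rw [Finset.sum_const, smul_eq_mul, mul_comm]
  rw [tau]; exact_mod_cast h

lemma sum_inv_totient_le (N : ℕ) :
    ∑ n ∈ Finset.Ioc 0 N, (1 : ℝ) / n.totient ≤ (1 + Real.log N) ^ 2 := by
  refine (Finset.sum_le_sum fun n hn => ?_).trans (sum_tau_div_le N)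
  have hn0 : 0 < n := (Finset.mem_Ioc.1 hn).1
  have h1 : (0 : ℝ) < n.totient := by exact_mod_cast Nat.totient_pos.2 hn0
  rw [div_le_div_iff₀ h1 (by exact_mod_cast hn0), one_mul, mul_comm]
  exact le_totient_mul_tau n

open ArithmeticFunction in
/-- Truncation of an arithmetic function to `n ≤ U`. -/
def lowPart (U : ℕ) (F : ArithmeticFunction ℝ) : ArithmeticFunction ℝ :=
  ⟨fun n => if n ≤ U then F n else 0, by simp⟩

/-- Truncation of an arithmetic function to `n > U`. -/
def highPart (U : ℕ) (F : ArithmeticFunction ℝ) : ArithmeticFunction ℝ :=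
  ⟨fun n => if n ≤ U then 0 else F n, by simp⟩

lemma lowPart_apply (U : ℕ) (F : ArithmeticFunction ℝ) (n : ℕ) :
    lowPart U F n = if n ≤ U then F n else 0 := rfl

lemma highPart_apply (U : ℕ) (F : ArithmeticFunction ℝ) (n : ℕ) :
    highPart U F n = if n ≤ U then 0 else F n := rfl

lemma lowPart_add_highPart (U : ℕ) (F : ArithmeticFunction ℝ) : lowPart U F + highPart U F = F := by
  ext n
  rw [ArithmeticFunction.add_apply, lowPart_apply, highPart_apply]
  split_ifs <;> simp

/-- The real-valued Möbius function. -/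
def muR : ArithmeticFunction ℝ := ((ArithmeticFunction.moebius : ArithmeticFunction ℤ) : ArithmeticFunction ℝ)

/-- The real-valued constant function one. -/
def zetaR : ArithmeticFunction ℝ := ((ArithmeticFunction.zeta : ArithmeticFunction ℕ) : ArithmeticFunction ℝ)

/-- The second factor in the bilinear part of Vaughan's identity. -/
def vaughanB (U : ℕ) : ArithmeticFunction ℝ := zetaR * highPart U muR

lemma vaughan_identity (U : ℕ) :
    ArithmeticFunction.vonMangoldt = lowPart U ArithmeticFunction.vonMangoldt +
      lowPart U muR * ArithmeticFunction.log -
      (lowPart U muR * lowPart U ArithmeticFunction.vonMangoldt) * zetaR +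
      highPart U ArithmeticFunction.vonMangoldt * vaughanB U := by
  have h1 : muR * ArithmeticFunction.log = ArithmeticFunction.vonMangoldt :=
    ArithmeticFunction.moebius_mul_log_eq_vonMangoldt
  have h2 : ArithmeticFunction.vonMangoldt * zetaR = ArithmeticFunction.log :=
    ArithmeticFunction.vonMangoldt_mul_zeta
  have h3 : zetaR * muR = 1 := ArithmeticFunction.coe_zeta_mul_coe_moebius
  have h4 : highPart U ArithmeticFunction.vonMangoldt =
      ArithmeticFunction.vonMangoldt - lowPart U ArithmeticFunction.vonMangoldt := by
    rw [eq_sub_iff_add_eq, add_comm]; exact lowPart_add_highPart U _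
  have h5 : highPart U muR = muR - lowPart U muR := by
    rw [eq_sub_iff_add_eq, add_comm]; exact lowPart_add_highPart U _
  rw [vaughanB, h4, h5]
  set a := lowPart U ArithmeticFunction.vonMangoldt
  set m := lowPart U muR
  rw [← h2]
  linear_combination (a - ArithmeticFunction.vonMangoldt) * h3

lemma sum_mul_twist (F G : ArithmeticFunction ℝ) (f : ℕ → ℂ) (N : ℕ) :
    ∑ n ∈ Finset.Ioc 0 N, ((F * G) n : ℂ) * f n =
      ∑ d ∈ Finset.Ioc 0 N, ∑ m ∈ Finset.Ioc 0 (N / d), (F d : ℂ) * (G m : ℂ) * f (d * m) := by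
  rw [← sum_Ioc_divisorsAntidiagonal (fun d m => (F d : ℂ) * (G m : ℂ) * f (d * m))]
  apply Finset.sum_congr rfl
  intro n _
  rw [ArithmeticFunction.mul_apply]
  push_cast
  rw [Finset.sum_mul]
  apply Finset.sum_congr rfl
  intro x hx
  rw [Nat.mem_divisorsAntidiagonal] at hx
  rw [hx.1]

lemma abs_muR_le (n : ℕ) : |muR n| ≤ 1 := by
  rw [muR, ArithmeticFunction.intCoe_apply]
  exact_mod_cast ArithmeticFunction.abs_moebius_le_one

lemma abs_vaughanB_le (U k : ℕ) : |vaughanB U k| ≤ tau k := by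
  rw [vaughanB, ArithmeticFunction.mul_apply, tau_eq_sum]
  refine (Finset.abs_sum_le_sum_abs _ _).trans (Finset.sum_le_sum fun x hx => ?_)
  rw [abs_mul]
  have h1 : |zetaR x.1| ≤ 1 := by
    rw [zetaR, ArithmeticFunction.natCoe_apply, ArithmeticFunction.zeta_apply]
    split_ifs <;> simp
  have h2 : |highPart U muR x.2| ≤ 1 := by
    rw [highPart_apply]; split_ifs
    · simp
    · exact abs_muR_le _
  exact mul_le_one₀ h1 (abs_nonneg _) h2

lemma vaughanB_eq_zero {U k : ℕ} (hk : k ≤ U) : vaughanB U k = 0 := by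
  rw [vaughanB, ArithmeticFunction.mul_apply]
  apply Finset.sum_eq_zero
  intro x hx
  rw [Nat.mem_divisorsAntidiagonal] at hx
  have : x.2 ≤ U := (Nat.le_of_dvd (Nat.pos_of_ne_zero hx.2) ⟨x.1, by rw [← hx.1, mul_comm]⟩).trans hk
  rw [highPart_apply, if_pos this, mul_zero]

lemma abs_lowPart_mul_le (U m : ℕ) :
    |(lowPart U muR * lowPart U ArithmeticFunction.vonMangoldt) m| ≤ Real.log m := by
  rw [ArithmeticFunction.mul_apply, ← ArithmeticFunction.vonMangoldt_sum,
    ← Nat.sum_divisorsAntidiagonal' (fun _ i => ArithmeticFunction.vonMangoldt i)]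
  refine (Finset.abs_sum_le_sum_abs _ _).trans (Finset.sum_le_sum fun x hx => ?_)
  have h1 : |lowPart U muR x.1| ≤ 1 := by
    rw [lowPart_apply]; split_ifs
    · exact abs_muR_le _
    · simp
  have h2 : |lowPart U ArithmeticFunction.vonMangoldt x.2| ≤ ArithmeticFunction.vonMangoldt x.2 := by
    have h0 : 0 ≤ ArithmeticFunction.vonMangoldt x.2 := ArithmeticFunction.vonMangoldt_nonneg
    rw [lowPart_apply]; split_ifs
    · rw [abs_of_nonneg h0]
    · simpa using h0
  rw [abs_mul]
  calc _ ≤ 1 * ArithmeticFunction.vonMangoldt x.2 :=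
        mul_le_mul h1 h2 (abs_nonneg _) zero_le_one
    _ = _ := one_mul _

lemma lowPart_mul_eq_zero {U m : ℕ} (hm : U ^ 2 < m) :
    (lowPart U muR * lowPart U ArithmeticFunction.vonMangoldt) m = 0 := by
  rw [ArithmeticFunction.mul_apply]
  apply Finset.sum_eq_zero
  intro x hx
  rw [Nat.mem_divisorsAntidiagonal] at hx
  rw [lowPart_apply, lowPart_apply]
  by_cases h1 : x.1 ≤ U
  · by_cases h2 : x.2 ≤ U
    · exfalso
      have := Nat.mul_le_mul h1 h2
      rw [hx.1, ← pow_two] at this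
      omega
    · rw [if_neg h2, mul_zero]
  · rw [if_neg h1, zero_mul]

/-- Removing the logarithm from a sum whose partial sums are bounded. -/
lemma norm_sum_log_mul_le {g : ℕ → ℂ} {x : ℕ} {T : ℝ} (hT : 0 ≤ T)
    (h : ∀ y ≤ x, ‖∑ l ∈ Finset.Ioc 0 y, g l‖ ≤ T) :
    ‖∑ l ∈ Finset.Ioc 0 x, (Real.log l : ℂ) * g l‖ ≤ 2 * Real.log x * T := by
  have hl : 0 ≤ Real.log x := Real.log_natCast_nonneg x
  have e : ∀ (F : ℕ → ℂ) (y : ℕ), ∑ l ∈ Finset.Ioc 0 y, F l = ∑ i ∈ Finset.range y, F (i + 1) := by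
    intro F y
    have e1 : Finset.Ioc 0 y = Finset.Ico (0 + 1) (y + 1) := by ext; simp; omega
    rw [e1, ← Finset.sum_Ico_add' F 0 y 1, Finset.range_eq_Ico]
  have h1 := norm_sum_range_antitone_le (b := fun i => g (i + 1))
    (w := fun i => Real.log x - Real.log ((i + 1 : ℕ) : ℝ)) (n := x) hT
    (by
      intro i _
      have := log_nat_mono (show i + 1 ≤ i + 1 + 1 by omega)
      linarith)
    (by
      intro i hi
      have := log_nat_mono (show i + 1 ≤ x by omega)
      linarith)
    (by simpa using hl)
    (by
      intro m hm
      rw [← e g m]; exact h m hm)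
  have h2 : ∑ l ∈ Finset.Ioc 0 x, (Real.log l : ℂ) * g l =
      (Real.log x : ℂ) * ∑ l ∈ Finset.Ioc 0 x, g l -
      ∑ i ∈ Finset.range x, ((Real.log x - Real.log ((i + 1 : ℕ) : ℝ) : ℝ) : ℂ) * g (i + 1) := by
    rw [e, e, Finset.mul_sum, ← Finset.sum_sub_distrib]
    apply Finset.sum_congr rfl
    intro i _
    push_cast; ring
  rw [h2]
  refine (norm_sub_le _ _).trans ?_
  have h3 : ‖(Real.log x : ℂ) * ∑ l ∈ Finset.Ioc 0 x, g l‖ ≤ Real.log x * T := by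
    rw [norm_mul, Complex.norm_real, Real.norm_eq_abs, abs_of_nonneg hl]
    exact mul_le_mul_of_nonneg_left (h x le_rfl) hl
  have h4 : (Real.log x - Real.log ((0 + 1 : ℕ) : ℝ)) * T = Real.log x * T := by simp
  rw [h4] at h1
  linarith

/-- The bilinear part of Vaughan's identity. -/
def vaughanBilinear (U N : ℕ) (f : ℕ → ℂ) : ℂ :=
  ∑ m ∈ Finset.Ioc 0 N, ∑ k ∈ Finset.Ioc 0 (N / m),
    (highPart U ArithmeticFunction.vonMangoldt m : ℂ) * (vaughanB U k : ℂ) * f (m * k)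

lemma vaughan_bound {U N : ℕ} (hU : 1 ≤ U) (hUN : U ^ 2 ≤ N) {f : ℕ → ℂ} (hf : ∀ n, ‖f n‖ ≤ 1)
    {T : ℝ} (hT : 0 ≤ T)
    (h : ∀ m, 1 ≤ m → m ≤ U ^ 2 → ∀ x ≤ N / m, ‖∑ l ∈ Finset.Ioc 0 x, f (m * l)‖ ≤ T) :
    ‖∑ n ∈ Finset.Ioc 0 N, (ArithmeticFunction.vonMangoldt n : ℂ) * f n‖ ≤
      U * Real.log N + 3 * U ^ 2 * Real.log N * T + ‖vaughanBilinear U N f‖ := by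
  have hl : 0 ≤ Real.log N := Real.log_natCast_nonneg N
  have hUU : U ≤ U ^ 2 := by nlinarith
  have e : ∑ n ∈ Finset.Ioc 0 N, (ArithmeticFunction.vonMangoldt n : ℂ) * f n =
      ∑ n ∈ Finset.Ioc 0 N, (lowPart U ArithmeticFunction.vonMangoldt n : ℂ) * f n +
      ∑ n ∈ Finset.Ioc 0 N, ((lowPart U muR * ArithmeticFunction.log) n : ℂ) * f n -
      ∑ n ∈ Finset.Ioc 0 N, (((lowPart U muR * lowPart U ArithmeticFunction.vonMangoldt) * zetaR) n : ℂ) * f n +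
      ∑ n ∈ Finset.Ioc 0 N, ((highPart U ArithmeticFunction.vonMangoldt * vaughanB U) n : ℂ) * f n := by
    rw [← Finset.sum_add_distrib, ← Finset.sum_sub_distrib, ← Finset.sum_add_distrib]
    apply Finset.sum_congr rfl
    intro n _
    have h1 : ArithmeticFunction.vonMangoldt +
        (lowPart U muR * lowPart U ArithmeticFunction.vonMangoldt) * zetaR =
        lowPart U ArithmeticFunction.vonMangoldt + lowPart U muR * ArithmeticFunction.log +
        highPart U ArithmeticFunction.vonMangoldt * vaughanB U := by
      linear_combination vaughan_identity U
    have h2 := congrArg (fun F : ArithmeticFunction ℝ => ((F n : ℝ) : ℂ)) h1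
    simp only [ArithmeticFunction.add_apply, Complex.ofReal_add] at h2
    linear_combination f n * h2
  have restrict : ∀ (V : ℕ) (g : ℕ → ℂ) (B : ℝ), V ≤ N → 0 ≤ B → (∀ m, V < m → g m = 0) →
      (∀ m, 1 ≤ m → m ≤ V → ‖g m‖ ≤ B) → ‖∑ m ∈ Finset.Ioc 0 N, g m‖ ≤ V * B := by
    intro V g B hV hB h0 h1
    rw [← Finset.sum_subset (Finset.Ioc_subset_Ioc_right hV) (fun m _ hm' => h0 m (by
      simp only [Finset.mem_Ioc, not_and, not_le] at hm' ; exact hm' (by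
        rename_i hm; exact (Finset.mem_Ioc.1 hm).1)))]
    refine (norm_sum_le_of_le _ fun m hm => h1 m (Finset.mem_Ioc.1 hm).1 (Finset.mem_Ioc.1 hm).2).trans ?_
    simp
  have b1 : ‖∑ n ∈ Finset.Ioc 0 N, (lowPart U ArithmeticFunction.vonMangoldt n : ℂ) * f n‖ ≤
      U * Real.log N := by
    refine restrict U _ _ (hUU.trans hUN) hl (fun m hm => ?_) (fun m hm1 hm2 => ?_)
    · rw [lowPart_apply, if_neg (by omega)]; simp
    · rw [lowPart_apply, if_pos hm2, norm_mul, Complex.norm_real, Real.norm_eq_abs,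
        abs_of_nonneg ArithmeticFunction.vonMangoldt_nonneg]
      have h2 : ArithmeticFunction.vonMangoldt m ≤ Real.log N :=
        ArithmeticFunction.vonMangoldt_le_log.trans (log_nat_mono (by omega))
      exact (mul_le_mul h2 (hf m) (norm_nonneg _) hl).trans (mul_one _).le
  have b2 : ‖∑ n ∈ Finset.Ioc 0 N, ((lowPart U muR * ArithmeticFunction.log) n : ℂ) * f n‖ ≤
      U * (2 * Real.log N * T) := by
    rw [sum_mul_twist]
    refine restrict U _ _ (hUU.trans hUN) (by positivity) (fun m hm => ?_) (fun m hm1 hm2 => ?_)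
    · apply Finset.sum_eq_zero
      intro k _
      rw [lowPart_apply, if_neg (by omega)]; simp
    · have h2 : ∑ k ∈ Finset.Ioc 0 (N / m), (lowPart U muR m : ℂ) * (ArithmeticFunction.log k : ℂ) * f (m * k)
          = (lowPart U muR m : ℂ) * ∑ k ∈ Finset.Ioc 0 (N / m), (Real.log k : ℂ) * f (m * k) := by
        rw [Finset.mul_sum]
        apply Finset.sum_congr rfl
        intro k _
        rw [ArithmeticFunction.log_apply]; ring
      rw [h2, norm_mul, lowPart_apply, if_pos hm2, Complex.norm_real, Real.norm_eq_abs]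
      have h3 := norm_sum_log_mul_le hT (h m hm1 (by omega))
      have h4 := log_nat_mono (Nat.div_le_self N m)
      have h5 : 2 * Real.log (N / m : ℕ) * T ≤ 2 * Real.log N * T := by gcongr
      exact (mul_le_mul (abs_muR_le m) (h3.trans h5) (norm_nonneg _) zero_le_one).trans (one_mul _).le
  have b3 : ‖∑ n ∈ Finset.Ioc 0 N, (((lowPart U muR * lowPart U ArithmeticFunction.vonMangoldt) * zetaR) n : ℂ) * f n‖ ≤
      (U ^ 2 : ℕ) * (Real.log N * T) := by
    rw [sum_mul_twist]
    refine restrict (U ^ 2) _ _ hUN (by positivity) (fun m hm => ?_) (fun m hm1 hm2 => ?_)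
    · apply Finset.sum_eq_zero
      intro k _
      rw [lowPart_mul_eq_zero hm]; simp
    · set c := (lowPart U muR * lowPart U ArithmeticFunction.vonMangoldt) m with hc
      have h2 : ∑ k ∈ Finset.Ioc 0 (N / m), (c : ℂ) * (zetaR k : ℂ) * f (m * k)
          = (c : ℂ) * ∑ k ∈ Finset.Ioc 0 (N / m), f (m * k) := by
        rw [Finset.mul_sum]
        apply Finset.sum_congr rfl
        intro k hk
        rw [zetaR, ArithmeticFunction.natCoe_apply, ArithmeticFunction.zeta_apply,
          if_neg (by have := (Finset.mem_Ioc.1 hk).1; omega)]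
        simp
      rw [h2, norm_mul, Complex.norm_real, Real.norm_eq_abs]
      have h3 : |c| ≤ Real.log N := (abs_lowPart_mul_le U m).trans (log_nat_mono (by omega))
      exact mul_le_mul h3 (h m hm1 hm2 _ le_rfl) (norm_nonneg _) hl
  have b4 : ∑ n ∈ Finset.Ioc 0 N, ((highPart U ArithmeticFunction.vonMangoldt * vaughanB U) n : ℂ) * f n =
      vaughanBilinear U N f := sum_mul_twist _ _ f N
  rw [e, b4]
  refine (norm_add_le _ _).trans ?_
  gcongr
  refine (norm_sub_le _ _).trans ?_
  refine (add_le_add (norm_add_le _ _) b3).trans ?_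
  have hUUr : (U : ℝ) ≤ U ^ 2 := by exact_mod_cast hUU
  have h6 : U * (2 * Real.log N * T) ≤ U ^ 2 * (2 * Real.log N * T) := by gcongr
  push_cast
  linarith

/-- A dyadic block of the bilinear part of Vaughan's identity. -/
def vaughanBlock (U N : ℕ) (f : ℕ → ℂ) (i : ℕ) : ℂ :=
  ∑ m ∈ Finset.Ico (2 ^ i) (2 ^ (i + 1)), ∑ k ∈ Finset.Ioc 0 (N / m),
    (highPart U ArithmeticFunction.vonMangoldt m : ℂ) * (vaughanB U k : ℂ) * f (m * k)

/-- The relevant dyadic blocks. -/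
def blockIndex (U N : ℕ) : Finset ℕ :=
  (Finset.range (Nat.log 2 N + 1)).filter fun i => U < 2 ^ (i + 1) ∧ U * 2 ^ i < N

lemma sum_Ico_two_pow {M : Type*} [AddCommMonoid M] (g : ℕ → M) (I : ℕ) :
    ∑ m ∈ Finset.Ico 1 (2 ^ I), g m =
      ∑ i ∈ Finset.range I, ∑ m ∈ Finset.Ico (2 ^ i) (2 ^ (i + 1)), g m := by
  induction I with
  | zero => simp
  | succ I ih =>
    rw [Finset.sum_range_succ, ← ih, Finset.sum_Ico_consecutive]
    · exact Nat.one_le_two_pow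
    · exact Nat.pow_le_pow_right (by norm_num) (by omega)

lemma norm_vaughanBilinear_le (U N : ℕ) (f : ℕ → ℂ) :
    ‖vaughanBilinear U N f‖ ≤ ∑ i ∈ blockIndex U N, ‖vaughanBlock U N f i‖ := by
  have hN : N < 2 ^ (Nat.log 2 N + 1) := Nat.lt_pow_succ_log_self (by norm_num) N
  have e : vaughanBilinear U N f = ∑ i ∈ Finset.range (Nat.log 2 N + 1), vaughanBlock U N f i := by
    simp only [vaughanBlock]
    rw [← sum_Ico_two_pow, vaughanBilinear]
    apply Finset.sum_subset
    · intro m hm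
      rw [Finset.mem_Ioc] at hm
      rw [Finset.mem_Ico]; omega
    · intro m hm hm'
      rw [Finset.mem_Ioc] at hm'
      rw [Finset.mem_Ico] at hm
      rw [Nat.div_eq_of_lt (by omega)]; simp
  rw [e]
  refine (norm_sum_le _ _).trans (le_of_eq ?_)
  symm
  apply Finset.sum_subset (Finset.filter_subset _ _)
  intro i hi hi'
  have hi2 := not_and.1 (mt Finset.mem_filter.2 hi') hi
  rw [not_and_or, not_lt, not_lt] at hi2
  rw [norm_eq_zero, vaughanBlock]
  apply Finset.sum_eq_zero
  intro m hm
  rw [Finset.mem_Ico] at hm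
  apply Finset.sum_eq_zero
  intro k hk
  rw [Finset.mem_Ioc] at hk
  rcases hi2 with h | h
  · rw [highPart_apply, if_pos (by omega)]; simp
  · have h1 : 0 < m := lt_of_lt_of_le (by positivity) hm.1
    have hkm : k * m ≤ N := (Nat.le_div_iff_mul_le h1).1 hk.2
    have : k ≤ U := by
      by_contra hlt
      push Not at hlt
      have h2 : U * 2 ^ i < k * m := by
        calc U * 2 ^ i < k * 2 ^ i := Nat.mul_lt_mul_of_pos_right hlt (by positivity)
          _ ≤ k * m := Nat.mul_le_mul_left _ hm.1
      omega
    rw [vaughanB_eq_zero this]; simp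

/-- The coefficients of a dyadic block, with the hyperbola condition. -/
lemma vaughanBlock_eq (U N : ℕ) (f : ℕ → ℂ) (i : ℕ) : vaughanBlock U N f i =
    ∑ m ∈ Finset.Ico (2 ^ i) (2 ^ (i + 1)), ∑ k ∈ Finset.Ioc 0 (N / 2 ^ i),
      if m * k ≤ N then
        (highPart U ArithmeticFunction.vonMangoldt m : ℂ) * (vaughanB U k : ℂ) * f (m * k) else 0 := by
  rw [vaughanBlock]
  apply Finset.sum_congr rfl
  intro m hm
  rw [Finset.mem_Ico] at hm
  have h1 : 0 < m := lt_of_lt_of_le (by positivity) hm.1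
  rw [← Finset.sum_filter]
  apply Finset.sum_congr
  · ext k
    rw [Finset.mem_filter, Finset.mem_Ioc, Finset.mem_Ioc, Nat.le_div_iff_mul_le h1,
      Nat.le_div_iff_mul_le (by positivity), mul_comm m k]
    constructor
    · rintro ⟨h2, h3⟩
      exact ⟨⟨h2, (Nat.mul_le_mul_left _ hm.1).trans h3⟩, h3⟩
    · rintro ⟨⟨h2, _⟩, h3⟩
      exact ⟨h2, h3⟩
  · intros; rfl

lemma sum_highPart_sq_le (U i : ℕ) {L : ℝ} (hL : Real.log (2 ^ (i + 1) : ℕ) ≤ L) :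
    ∑ m ∈ Finset.Ico (2 ^ i) (2 ^ (i + 1)), highPart U ArithmeticFunction.vonMangoldt m ^ 2 ≤
      2 ^ i * L ^ 2 := by
  have hb : ∀ m ∈ Finset.Ico (2 ^ i) (2 ^ (i + 1)),
      highPart U ArithmeticFunction.vonMangoldt m ^ 2 ≤ L ^ 2 := by
    intro m hm
    rw [Finset.mem_Ico] at hm
    have h0 : 0 ≤ L := (Real.log_natCast_nonneg _).trans hL
    have h1 : ArithmeticFunction.vonMangoldt m ≤ L :=
      ArithmeticFunction.vonMangoldt_le_log.trans ((log_nat_mono hm.2.le).trans hL)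
    have h2 : 0 ≤ ArithmeticFunction.vonMangoldt m := ArithmeticFunction.vonMangoldt_nonneg
    rw [highPart_apply]
    split_ifs
    · simp; positivity
    · gcongr
  refine (Finset.sum_le_sum hb).trans (le_of_eq ?_)
  rw [Finset.sum_const, Nat.card_Ico, nsmul_eq_mul]
  have : 2 ^ (i + 1) - 2 ^ i = 2 ^ i := by rw [pow_succ]; omega
  rw [this]; push_cast; ring

lemma sum_vaughanB_sq_le (U K : ℕ) {L : ℝ} (hL : Real.log K ≤ L) :
    ∑ k ∈ Finset.Ioc 0 K, vaughanB U k ^ 2 ≤ K * (1 + L) ^ 3 := by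
  have h0 : 0 ≤ Real.log K := Real.log_natCast_nonneg K
  calc _ ≤ ∑ k ∈ Finset.Ioc 0 K, tau k ^ 2 := by
        apply Finset.sum_le_sum
        intro k _
        rw [← sq_abs]
        have := abs_vaughanB_le U k
        gcongr
    _ ≤ K * (1 + Real.log K) ^ 3 := sum_tau_sq_le K
    _ ≤ _ := by gcongr

lemma inv_le_nd_rat {q : ℕ} {a d : ℤ} (hq : 0 < q) (hcop : IsCoprime a (q : ℤ))
    (hd : ¬ (q : ℤ) ∣ d) : (1 : ℝ) / q ≤ nd (d * (a / q)) := by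
  have hqr : (0 : ℝ) < q := by exact_mod_cast hq
  rw [nd]
  set n := round ((d : ℝ) * (a / q)) with hn
  have h1 : d * a - n * q ≠ 0 := by
    intro h
    apply hd
    have : (q : ℤ) ∣ d * a := ⟨n, by linarith⟩
    exact hcop.symm.dvd_of_dvd_mul_right this
  have h2 : (1 : ℝ) ≤ |((d * a - n * q : ℤ) : ℝ)| := by
    rw [← Int.cast_abs]; exact_mod_cast Int.one_le_abs h1
  have h3 : (d : ℝ) * (a / q) - n = ((d * a - n * q : ℤ) : ℝ) / q := by
    push_cast; field_simp
  rw [h3, abs_div, abs_of_pos hqr]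
  gcongr

lemma half_inv_le_nd {q : ℕ} {a d : ℤ} {α : ℝ} (hq : 0 < q) (hcop : IsCoprime a (q : ℤ))
    (hα : |α - a / q| ≤ 1 / (q : ℝ) ^ 2) (hd : d ≠ 0) (hdq : 2 * |d| ≤ q) (hq2 : 2 ≤ q) :
    1 / (2 * (q : ℝ)) ≤ nd (d * α) := by
  have hqr : (0 : ℝ) < q := by exact_mod_cast hq
  have h1 : ¬ (q : ℤ) ∣ d := by
    intro h
    have h2 := Int.le_of_dvd (abs_pos.2 hd) ((dvd_abs _ _).2 h)
    have : (0 : ℤ) < q := by exact_mod_cast hq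
    omega
  have h2 := inv_le_nd_rat hq hcop h1
  have h3 := nd_sub_le (d * (a / q : ℝ)) (d * α)
  have h4 : |(d : ℝ) * (a / q) - d * α| ≤ 1 / (2 * q) := by
    rw [← mul_sub, abs_mul, abs_sub_comm]
    have h5 : |(d : ℝ)| ≤ q / 2 := by
      rw [le_div_iff₀ (by norm_num)]
      have : |d| * 2 ≤ q := by linarith
      rw [← Int.cast_abs]; exact_mod_cast this
    calc _ ≤ (q : ℝ) / 2 * (1 / (q : ℝ) ^ 2) := by gcongr
      _ = _ := by field_simp
  have h6 : (1 : ℝ) / q = 1 / (2 * q) + 1 / (2 * q) := by field_simp; norm_num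
  linarith

lemma sum_gmin_spaced_le {ι : Type*} (s : Finset ι) (u : ι → ℝ) {q : ℕ} (hq : 0 < q) {M : ℝ}
    (hM : 0 ≤ M) (hsp : ∀ y ∈ s, ∀ z ∈ s, y ≠ z → 1 / (2 * (q : ℝ)) ≤ nd (u y - u z)) :
    ∑ y ∈ s, gmin M (nd (u y)) ≤ 4 * M + 4 * q * (1 + Real.log q) := by
  have hqr : (0 : ℝ) < q := by exact_mod_cast hq
  have h := sum_spaced_le s u (δ := 1 / (2 * (q : ℝ))) (by positivity) q
    (by rw [div_mul_eq_mul_div, lt_div_iff₀ (by positivity)]; linarith) hsp (gmin M)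
    (fun x y hx hxy => gmin_anti hM hx hxy) (fun x hx => gmin_nonneg hM hx)
  refine h.trans ?_
  rw [Finset.sum_range_succ']
  have h1 : ∑ k ∈ Finset.range q, gmin M (((k + 1 : ℕ) : ℝ) * (1 / (2 * (q : ℝ)))) ≤
      ∑ k ∈ Finset.range q, 2 * (q : ℝ) * (1 / ((k : ℝ) + 1)) := by
    apply Finset.sum_le_sum
    intro k _
    refine (gmin_le_inv hM (by positivity)).trans (le_of_eq ?_)
    push_cast; field_simp
  rw [← Finset.mul_sum] at h1
  have h2 := sum_inv_le_log q
  have h3 : 2 * (q : ℝ) * ∑ k ∈ Finset.range q, (1 : ℝ) / ((k : ℝ) + 1) ≤ 2 * q * (1 + Real.log q) := by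
    gcongr
  simp only [Nat.cast_zero, zero_mul, gmin_zero]
  linarith

lemma sum_gmin_le {q : ℕ} {a : ℤ} {α : ℝ} (hq : 2 ≤ q) (hcop : IsCoprime a (q : ℤ))
    (hα : |α - a / q| ≤ 1 / (q : ℝ) ^ 2) (K : ℕ) (x : ℝ) {M : ℝ} (hM : 0 ≤ M) :
    ∑ k ∈ Finset.Ioc 0 K, gmin M (nd (x - k * α)) ≤
      (3 * K / q + 1) * (4 * M + 4 * q * (1 + Real.log q)) := by
  have hq0 : 0 < q := by omega
  have hqr : (0 : ℝ) < q := by exact_mod_cast hq0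
  have hlq : 0 ≤ Real.log q := Real.log_natCast_nonneg q
  set h := q / 2 with hh
  have hh0 : 0 < h := by omega
  have hh3 : q ≤ 3 * h := by omega
  have hmap : ∀ k ∈ Finset.Ioc 0 K, (k - 1) / h ∈ Finset.range (K / h + 1) := by
    intro k hk
    rw [Finset.mem_Ioc] at hk
    rw [Finset.mem_range]
    have : (k - 1) / h ≤ K / h := Nat.div_le_div_right (by omega)
    omega
  rw [← Finset.sum_fiberwise_of_maps_to hmap]
  have hfib : ∀ j ∈ Finset.range (K / h + 1),
      ∑ k ∈ (Finset.Ioc 0 K).filter (fun k => (k - 1) / h = j), gmin M (nd (x - k * α)) ≤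
      4 * M + 4 * q * (1 + Real.log q) := by
    intro j _
    apply sum_gmin_spaced_le _ (fun k : ℕ => x - k * α) hq0 hM
    intro y hy z hz hyz
    rw [Finset.mem_filter, Finset.mem_Ioc] at hy hz
    have e : x - y * α - (x - z * α) = (((z : ℤ) - (y : ℤ) : ℤ) : ℝ) * α := by push_cast; ring
    rw [e]
    apply half_inv_le_nd hq0 hcop hα (by omega) ?_ hq
    have h1 := Nat.div_add_mod (y - 1) h
    have h2 := Nat.div_add_mod (z - 1) h
    have h3 := Nat.mod_lt (y - 1) hh0
    have h4 := Nat.mod_lt (z - 1) hh0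
    rw [hy.2] at h1
    rw [hz.2] at h2
    have h5 : |(z : ℤ) - y| ≤ h := by
      rw [abs_le]
      constructor <;> omega
    have h6 : 2 * (h : ℤ) ≤ q := by omega
    linarith
  refine (Finset.sum_le_sum hfib).trans ?_
  rw [Finset.sum_const, Finset.card_range, nsmul_eq_mul]
  gcongr
  push_cast
  gcongr
  calc ((K / h : ℕ) : ℝ) ≤ K / h := Nat.cast_div_le
    _ ≤ 3 * K / q := by
      rw [div_le_div_iff₀ (by exact_mod_cast hh0) hqr]
      have : (q : ℝ) ≤ 3 * h := by exact_mod_cast hh3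
      have hK : (0 : ℝ) ≤ K := Nat.cast_nonneg K
      nlinarith

/-- Schur's test for a finite matrix. -/
lemma schur_test {ι κ : Type*} (s : Finset ι) (t : Finset κ) (c : ι → κ → ℂ) (b : κ → ℂ) {R : ℝ}
    (h : ∀ k ∈ t, ∑ k' ∈ t, ‖∑ m ∈ s, c m k * (starRingEnd ℂ) (c m k')‖ ≤ R) :
    ∑ m ∈ s, ‖∑ k ∈ t, c m k * b k‖ ^ 2 ≤ R * ∑ k ∈ t, ‖b k‖ ^ 2 := by
  set G : κ → κ → ℂ := fun k k' => ∑ m ∈ s, c m k * (starRingEnd ℂ) (c m k') with hG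
  have hsymm : ∀ k k', ‖G k k'‖ = ‖G k' k‖ := by
    intro k k'
    rw [← Complex.norm_conj, hG]
    simp only [map_sum, map_mul, Complex.conj_conj]
    congr 1
    exact Finset.sum_congr rfl fun m _ => mul_comm _ _
  have e : ((∑ m ∈ s, ‖∑ k ∈ t, c m k * b k‖ ^ 2 : ℝ) : ℂ) =
      ∑ k ∈ t, ∑ k' ∈ t, b k * (starRingEnd ℂ) (b k') * G k k' := by
    push_cast
    simp only [← Complex.mul_conj', map_sum, map_mul, hG, Finset.sum_mul_sum]
    rw [Finset.sum_comm]
    refine Finset.sum_congr rfl fun k _ => ?_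
    rw [Finset.sum_comm]
    refine Finset.sum_congr rfl fun k' _ => ?_
    rw [Finset.mul_sum]
    exact Finset.sum_congr rfl fun m _ => by ring
  have h0 : 0 ≤ ∑ m ∈ s, ‖∑ k ∈ t, c m k * b k‖ ^ 2 := by positivity
  have h1 : ∑ m ∈ s, ‖∑ k ∈ t, c m k * b k‖ ^ 2 ≤
      ∑ k ∈ t, ∑ k' ∈ t, (‖b k‖ ^ 2 / 2 * ‖G k k'‖ + ‖b k'‖ ^ 2 / 2 * ‖G k k'‖) := by
    rw [← abs_of_nonneg h0, ← Real.norm_eq_abs, ← Complex.norm_real, e]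
    refine (norm_sum_le _ _).trans (Finset.sum_le_sum fun k _ => ?_)
    refine (norm_sum_le _ _).trans (Finset.sum_le_sum fun k' _ => ?_)
    rw [norm_mul, norm_mul, Complex.norm_conj, ← add_mul]
    refine mul_le_mul_of_nonneg_right ?_ (norm_nonneg _)
    nlinarith [sq_nonneg (‖b k‖ - ‖b k'‖)]
  have h2 : ∑ k ∈ t, ∑ k' ∈ t, ‖b k‖ ^ 2 / 2 * ‖G k k'‖ ≤ ∑ k ∈ t, ‖b k‖ ^ 2 / 2 * R := by
    refine Finset.sum_le_sum fun k hk => ?_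
    rw [← Finset.mul_sum]
    exact mul_le_mul_of_nonneg_left (h k hk) (by positivity)
  have h3 : ∑ k ∈ t, ∑ k' ∈ t, ‖b k'‖ ^ 2 / 2 * ‖G k k'‖ =
      ∑ k ∈ t, ∑ k' ∈ t, ‖b k‖ ^ 2 / 2 * ‖G k k'‖ := by
    rw [Finset.sum_comm]
    exact Finset.sum_congr rfl fun k _ => Finset.sum_congr rfl fun k' _ => by rw [hsymm]
  simp only [Finset.sum_add_distrib] at h1
  rw [h3] at h1
  have h4 : ∑ k ∈ t, ‖b k‖ ^ 2 / 2 * R = R * (∑ k ∈ t, ‖b k‖ ^ 2) / 2 := by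
    rw [Finset.mul_sum, Finset.sum_div]
    exact Finset.sum_congr rfl fun k _ => by ring
  linarith

/-- Duality for finite matrices. -/
lemma sum_norm_sq_dual {ι κ : Type*} (s : Finset ι) (t : Finset κ) (c : ι → κ → ℂ) {R : ℝ}
    (hR : 0 ≤ R) (h : ∀ b : κ → ℂ, ∑ m ∈ s, ‖∑ k ∈ t, c m k * b k‖ ^ 2 ≤ R * ∑ k ∈ t, ‖b k‖ ^ 2)
    (a : ι → ℂ) :
    ∑ k ∈ t, ‖∑ m ∈ s, c m k * a m‖ ^ 2 ≤ R * ∑ m ∈ s, ‖a m‖ ^ 2 := by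
  set A : κ → ℂ := fun k => ∑ m ∈ s, c m k * a m with hA
  set X : ℝ := ∑ k ∈ t, ‖A k‖ ^ 2 with hX
  have hX0 : 0 ≤ X := by positivity
  set Y : ℝ := ∑ m ∈ s, ‖a m‖ ^ 2 with hY
  have hY0 : 0 ≤ Y := by positivity
  have e : (X : ℂ) = ∑ m ∈ s, a m * ∑ k ∈ t, c m k * (starRingEnd ℂ) (A k) := by
    rw [hX]; push_cast
    simp only [← Complex.mul_conj', Finset.mul_sum]
    rw [Finset.sum_comm]
    refine Finset.sum_congr rfl fun k _ => ?_
    conv_lhs => rw [hA]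
    rw [Finset.sum_mul]
    exact Finset.sum_congr rfl fun m _ => by ring
  have h1 : X ≤ ∑ m ∈ s, ‖a m‖ * ‖∑ k ∈ t, c m k * (starRingEnd ℂ) (A k)‖ := by
    rw [← abs_of_nonneg hX0, ← Real.norm_eq_abs, ← Complex.norm_real, e]
    refine (norm_sum_le _ _).trans (Finset.sum_le_sum fun m _ => ?_)
    rw [norm_mul]
  have h2 : X ^ 2 ≤ Y * (R * X) := by
    calc X ^ 2 ≤ (∑ m ∈ s, ‖a m‖ * ‖∑ k ∈ t, c m k * (starRingEnd ℂ) (A k)‖) ^ 2 := by gcongr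
      _ ≤ Y * ∑ m ∈ s, ‖∑ k ∈ t, c m k * (starRingEnd ℂ) (A k)‖ ^ 2 :=
          Finset.sum_mul_sq_le_sq_mul_sq _ _ _
      _ ≤ Y * (R * ∑ k ∈ t, ‖(starRingEnd ℂ) (A k)‖ ^ 2) := by gcongr; exact h _
      _ = _ := by simp only [Complex.norm_conj]; rw [hX]
  rcases hX0.eq_or_lt with h0 | h0
  · rw [← h0]; positivity
  · nlinarith

lemma natLog_two_le (N : ℕ) : ((Nat.log 2 N + 1 : ℕ) : ℝ) ≤ 3 * (1 + Real.log N) := by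
  have h0 : 0 ≤ Real.log N := Real.log_natCast_nonneg N
  have h1 := Real.natLog_le_logb N 2
  have h2 : Real.logb 2 N ≤ 2 * Real.log N := by
    rw [Real.logb, div_le_iff₀ (Real.log_pos (by norm_num))]
    have := Real.log_two_gt_d9
    nlinarith
  push_cast at h1 ⊢
  linarith

lemma norm_vaughanBlock_exp_le {U N q : ℕ} {a : ℤ} {α : ℝ} (hU : 2 ≤ U) (hUq : U ≤ q) (hqN : q ≤ N)
    (hcop : IsCoprime a (q : ℤ)) (hα : |α - a / q| ≤ 1 / (q : ℝ) ^ 2) {i : ℕ}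
    (hi : i ∈ blockIndex U N) :
    ‖vaughanBlock U N (fun n => ex (n * α)) i‖ ^ 2 ≤
      40 * N * (1 + Real.log N) ^ 6 * (N / U + q) := by
  obtain ⟨hi1, hi2, hi3⟩ := Finset.mem_filter.1 hi
  have hL0 : 0 ≤ Real.log N := Real.log_natCast_nonneg N
  set L := Real.log N with hL
  set M : ℕ := 2 ^ i with hM
  set K : ℕ := N / M with hK
  have hM0 : 0 < M := by positivity
  have hM2 : 2 ^ (i + 1) = 2 * M := by rw [pow_succ, hM]; ring
  have hUM : U < 2 * M := hM2 ▸ hi2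
  have h2MN : 2 * M ≤ N := by nlinarith
  rw [vaughanBlock_eq]
  have e : ∀ m ∈ Finset.Ico (2 ^ i) (2 ^ (i + 1)),
      (∑ k ∈ Finset.Ioc 0 (N / 2 ^ i), if m * k ≤ N then
        (highPart U ArithmeticFunction.vonMangoldt m : ℂ) * (vaughanB U k : ℂ) *
          ex (((m * k : ℕ) : ℝ) * α) else 0) =
      (highPart U ArithmeticFunction.vonMangoldt m : ℂ) *
      ∑ k ∈ Finset.Ioc 0 K, (if m * k ≤ N then ex ((m : ℝ) * (k * α)) else 0) * (vaughanB U k : ℂ) := by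
    intro m _
    rw [Finset.mul_sum]
    refine Finset.sum_congr rfl fun k _ => ?_
    split_ifs
    · rw [show ((m * k : ℕ) : ℝ) * α = (m : ℝ) * (k * α) by push_cast; ring]; ring
    · simp
  rw [Finset.sum_congr rfl e]
  set R : ℝ := (3 * K / q + 1) * (4 * M + 4 * q * (1 + Real.log q)) with hR
  have hS := schur_test (Finset.Ico (2 ^ i) (2 ^ (i + 1))) (Finset.Ioc 0 K)
    (fun m k => if m * k ≤ N then ex ((m : ℝ) * (k * α)) else 0) (fun k => (vaughanB U k : ℂ)) (R := R) (by
      intro k hk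
      refine le_trans ?_ (sum_gmin_le (by omega) hcop hα K (k * α) (M := M) (by positivity))
      refine Finset.sum_le_sum fun k' hk' => ?_
      have hk0 := (Finset.mem_Ioc.1 hk).1
      have hk0' := (Finset.mem_Ioc.1 hk').1
      have e2 : ∑ m ∈ Finset.Ico (2 ^ i) (2 ^ (i + 1)),
          (if m * k ≤ N then ex ((m : ℝ) * (k * α)) else 0) *
            (starRingEnd ℂ) (if m * k' ≤ N then ex ((m : ℝ) * (k' * α)) else 0) =
          ∑ m ∈ Finset.Ico (2 ^ i) (min (2 ^ (i + 1)) (min (N / k + 1) (N / k' + 1))),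
            ex ((m : ℝ) * (k * α - k' * α)) := by
        rw [← Finset.sum_subset (s₁ := Finset.Ico (2 ^ i) (min (2 ^ (i + 1)) (min (N / k + 1) (N / k' + 1))))]
        · refine Finset.sum_congr rfl fun m hm => ?_
          rw [Finset.mem_Ico, lt_min_iff, lt_min_iff, Nat.lt_succ_iff, Nat.lt_succ_iff,
            Nat.le_div_iff_mul_le hk0, Nat.le_div_iff_mul_le hk0'] at hm
          rw [if_pos hm.2.2.1, if_pos hm.2.2.2, conj_ex, ← ex_add]
          congr 1; ring
        · intro m hm
          rw [Finset.mem_Ico, lt_min_iff] at hm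
          exact Finset.mem_Ico.2 ⟨hm.1, hm.2.1⟩
        · intro m hm hm'
          rw [Finset.mem_Ico] at hm
          rw [Finset.mem_Ico, lt_min_iff, lt_min_iff, Nat.lt_succ_iff, Nat.lt_succ_iff,
            Nat.le_div_iff_mul_le hk0, Nat.le_div_iff_mul_le hk0'] at hm'
          by_cases h1 : m * k ≤ N
          · have h2 : ¬ m * k' ≤ N := fun h2 => hm' ⟨hm.1, hm.2, h1, h2⟩
            rw [if_neg h2, map_zero, mul_zero]
          · rw [if_neg h1, zero_mul]
      rw [e2]
      apply norm_sum_ex_le_gmin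
      have : min (2 ^ (i + 1)) (min (N / k + 1) (N / k' + 1)) - 2 ^ i ≤ M := by
        have := min_le_left (2 ^ (i + 1)) (min (N / k + 1) (N / k' + 1))
        omega
      exact_mod_cast this)
  have hC : ‖∑ m ∈ Finset.Ico (2 ^ i) (2 ^ (i + 1)),
      (highPart U ArithmeticFunction.vonMangoldt m : ℂ) *
      ∑ k ∈ Finset.Ioc 0 K, (if m * k ≤ N then ex ((m : ℝ) * (k * α)) else 0) * (vaughanB U k : ℂ)‖ ^ 2 ≤
      (M * L ^ 2) * (R * (K * (1 + L) ^ 3)) := by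
    have h1 := sum_highPart_sq_le U i (L := L) (log_nat_mono (by rw [hM2]; exact h2MN))
    have h2 := sum_vaughanB_sq_le U K (L := L) (log_nat_mono (Nat.div_le_self _ _))
    have hR0 : 0 ≤ R := by
      have : 0 ≤ Real.log q := Real.log_natCast_nonneg q
      rw [hR]; positivity
    refine (pow_le_pow_left₀ (norm_nonneg _) (norm_sum_le _ _) 2).trans ?_
    simp only [norm_mul]
    refine (Finset.sum_mul_sq_le_sq_mul_sq _ _ _).trans ?_
    have h3 : ∑ m ∈ Finset.Ico (2 ^ i) (2 ^ (i + 1)),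
        ‖(highPart U ArithmeticFunction.vonMangoldt m : ℂ)‖ ^ 2 ≤ M * L ^ 2 := by
      refine le_trans (le_of_eq ?_) (h1.trans (le_of_eq (by rw [hM]; push_cast; ring)))
      refine Finset.sum_congr rfl fun m _ => ?_
      rw [Complex.norm_real, Real.norm_eq_abs, sq_abs]
    have h4 : ∑ k ∈ Finset.Ioc 0 K, ‖(vaughanB U k : ℂ)‖ ^ 2 ≤ K * (1 + L) ^ 3 := by
      refine le_trans (le_of_eq ?_) h2
      refine Finset.sum_congr rfl fun m _ => ?_
      rw [Complex.norm_real, Real.norm_eq_abs, sq_abs]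
    refine mul_le_mul h3 (hS.trans ?_) (by positivity) (by positivity)
    exact mul_le_mul_of_nonneg_left h4 hR0
  refine hC.trans ?_
  have hq0 : (0 : ℝ) < q := by exact_mod_cast (by omega : 0 < q)
  have hU0 : (0 : ℝ) < U := by exact_mod_cast (by omega : 0 < U)
  have hMr : (0 : ℝ) < M := by exact_mod_cast hM0
  have hKM : (M : ℝ) * K ≤ N := by exact_mod_cast Nat.mul_div_le N M
  have hN0 : (0 : ℝ) ≤ N := Nat.cast_nonneg N
  have hK0 : (0 : ℝ) ≤ K := Nat.cast_nonneg K
  have hKU : (K : ℝ) ≤ 2 * (N / U) := by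
    rw [← mul_div_assoc, le_div_iff₀ hU0]
    have : (U : ℝ) ≤ 2 * M := by exact_mod_cast hUM.le
    nlinarith
  have hMU : (M : ℝ) ≤ N / U := by
    rw [le_div_iff₀ hU0]
    have : U * M ≤ N := hi3.le
    rw [mul_comm]; exact_mod_cast this
  have hNq : (N : ℝ) / q ≤ N / U := by gcongr
  have hlq : Real.log q ≤ L := log_nat_mono hqN
  have hlq0 : 0 ≤ Real.log q := Real.log_natCast_nonneg q
  have hR2 : R ≤ (1 + L) * (40 * (N / U + q)) := by
    calc R ≤ (3 * K / q + 1) * (4 * M * (1 + L) + 4 * q * (1 + L)) := by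
          rw [hR]
          refine mul_le_mul_of_nonneg_left (add_le_add ?_ ?_) (by positivity)
          · exact le_mul_of_one_le_right (by positivity) (by linarith)
          · exact mul_le_mul_of_nonneg_left (by linarith) (by positivity)
      _ = (1 + L) * (12 * ((M * K) / q) + 12 * K + 4 * M + 4 * q) := by field_simp; ring
      _ ≤ (1 + L) * (12 * (N / q) + 12 * K + 4 * M + 4 * q) := by gcongr
      _ ≤ _ := by
          apply mul_le_mul_of_nonneg_left _ (by positivity)
          linarith
  calc (M * L ^ 2) * (R * (K * (1 + L) ^ 3)) = (M * K) * (L ^ 2 * (1 + L) ^ 3) * R := by ring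
    _ ≤ N * ((1 + L) ^ 2 * (1 + L) ^ 3) * ((1 + L) * (40 * (N / U + q))) := by
        have : L ≤ 1 + L := by linarith
        gcongr
    _ = _ := by ring

/-- The minor arc estimate for the exponential sum over primes. -/
lemma minor_arc_bound {U N q : ℕ} {a : ℤ} {α : ℝ} (hU : 2 ≤ U) (hUq : 2 * U ^ 2 ≤ q) (hqN : q ≤ N)
    (hcop : IsCoprime a (q : ℤ)) (hα : |α - a / q| ≤ 1 / (q : ℝ) ^ 2) :
    ‖∑ n ∈ Finset.Ioc 0 N, (ArithmeticFunction.vonMangoldt n : ℂ) * ex (n * α)‖ ≤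
      U * Real.log N + 3 * U ^ 2 * Real.log N * q +
      3 * (1 + Real.log N) * Real.sqrt (40 * N * (1 + Real.log N) ^ 6 * (N / U + q)) := by
  have hq2 : 2 ≤ q := by nlinarith
  have hq0 : 0 < q := by omega
  have hqr : (0 : ℝ) < q := by exact_mod_cast hq0
  have hL0 : 0 ≤ Real.log N := Real.log_natCast_nonneg N
  refine (vaughan_bound (U := U) (N := N) (by omega) (by omega) (f := fun n => ex (n * α))
    (fun n => (norm_ex _).le) (T := q) (by positivity) ?_).trans ?_
  · intro m hm1 hm2 x _
    have h1 : 1 / (2 * (q : ℝ)) ≤ nd (m * α) := by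
      have := half_inv_le_nd (d := (m : ℤ)) hq0 hcop hα (by omega)
        (by rw [abs_of_nonneg (by omega)]; exact_mod_cast (by omega : 2 * m ≤ q)) hq2
      simpa using this
    have h2 := norm_sum_ex_mul_nd_le 1 (x + 1) (m * α)
    have e : ∑ l ∈ Finset.Ioc 0 x, ex (((m * l : ℕ) : ℝ) * α) =
        ∑ l ∈ Finset.Ico 1 (x + 1), ex (l * (m * α)) := by
      have : Finset.Ioc 0 x = Finset.Ico 1 (x + 1) := by ext; simp; omega
      rw [this]
      refine Finset.sum_congr rfl fun l _ => ?_
      congr 1; push_cast; ring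
    change ‖∑ l ∈ Finset.Ioc 0 x, ex (((m * l : ℕ) : ℝ) * α)‖ ≤ q
    rw [e]
    set S := ‖∑ l ∈ Finset.Ico 1 (x + 1), ex (l * (m * α))‖
    have hS : 0 ≤ S := norm_nonneg _
    have h3 : S * (2 * (1 / (2 * (q : ℝ)))) ≤ 1 := by
      refine le_trans ?_ h2
      gcongr
    have h4 : S * (2 * (1 / (2 * (q : ℝ)))) = S / q := by field_simp
    rw [h4, div_le_one hqr] at h3
    exact h3
  · gcongr
    refine (norm_vaughanBilinear_le _ _ _).trans ?_
    have hb : ∀ i ∈ blockIndex U N, ‖vaughanBlock U N (fun n => ex (n * α)) i‖ ≤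
        Real.sqrt (40 * N * (1 + Real.log N) ^ 6 * (N / U + q)) := fun i hi =>
      Real.le_sqrt_of_sq_le (norm_vaughanBlock_exp_le hU (by nlinarith) hqN hcop hα hi)
    refine (Finset.sum_le_sum hb).trans ?_
    rw [Finset.sum_const, nsmul_eq_mul]
    gcongr
    refine le_trans ?_ (natLog_two_le N)
    have := (Finset.card_filter_le (Finset.range (Nat.log 2 N + 1))
      (fun i => U < 2 ^ (i + 1) ∧ U * 2 ^ i < N))
    rw [Finset.card_range] at this
    exact_mod_cast this

lemma sum_gmin_sq_le {H : ℝ} (hH : 0 < H) {δ : ℝ} (hδ : 1 / (2 * H) ≤ δ) (K : ℕ) :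
    ∑ k ∈ Finset.range K, gmin H (k * δ) ^ 2 ≤ 8 * H ^ 2 := by
  have h1 : ∀ k ∈ Finset.range K, gmin H (k * δ) ^ 2 ≤ 4 * H ^ 2 * (1 / ((k : ℝ) + 1) ^ 2) := by
    intro k _
    have hk : (0 : ℝ) ≤ k := Nat.cast_nonneg k
    have hδ0 : 0 ≤ δ := le_trans (by positivity) hδ
    have h2 : gmin H (k * δ) ≤ 2 * H / (k + 1) := by
      rw [gmin]
      have : (1 : ℝ) ≤ 2 * H * δ := by
        rw [div_le_iff₀ (by positivity)] at hδ; linarith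
      have h3 : (k : ℝ) + 1 ≤ 1 + 2 * H * (k * δ) := by nlinarith
      gcongr
    calc gmin H (k * δ) ^ 2 ≤ (2 * H / (k + 1)) ^ 2 :=
          pow_le_pow_left₀ (gmin_nonneg hH.le (by positivity)) h2 2
      _ = _ := by field_simp; ring
  refine (Finset.sum_le_sum h1).trans ?_
  rw [← Finset.mul_sum]
  nlinarith [sum_inv_sq_le K, sq_nonneg H]

lemma large_sieve_dual {κ : Type*} (t : Finset κ) (u : κ → ℝ) {δ : ℝ} (hδ : 0 < δ)
    (hsp : ∀ y ∈ t, ∀ z ∈ t, y ≠ z → δ ≤ nd (u y - u z)) (H : ℕ) (hH : 1 / δ ≤ H) (b : κ → ℂ) :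
    ∑ n ∈ Finset.Ioc 0 H, ‖∑ k ∈ t, ex (n * u k) * b k‖ ^ 2 ≤ 64 * H * ∑ k ∈ t, ‖b k‖ ^ 2 := by
  have hH0 : (0 : ℝ) < H := lt_of_lt_of_le (by positivity) hH
  set f : ℝ → ℝ := fun x => ‖∑ k ∈ t, ex (x * u k) * b k‖ ^ 2 with hf
  have hf0 : ∀ x, 0 ≤ f x := fun x => by positivity
  have h1 : ∑ p ∈ Finset.range (2 * H) ×ˢ Finset.range (2 * H), f ((p.1 : ℝ) - p.2) ≤
      (64 * H ^ 2) * ∑ k ∈ t, ‖b k‖ ^ 2 := by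
    apply schur_test (Finset.range (2 * H) ×ˢ Finset.range (2 * H)) t
      (fun (p : ℕ × ℕ) (k : κ) => ex (((p.1 : ℝ) - p.2) * u k)) b (R := 64 * (H : ℝ) ^ 2)
    intro k hk
    have h2 : ∀ k' ∈ t, ‖∑ p ∈ Finset.range (2 * H) ×ˢ Finset.range (2 * H),
        ex (((p.1 : ℝ) - p.2) * u k) * (starRingEnd ℂ) (ex (((p.1 : ℝ) - p.2) * u k'))‖ ≤
        gmin (2 * H) (nd (u k - u k')) ^ 2 := by
      intro k' _
      have e : ∀ p : ℕ × ℕ, ex (((p.1 : ℝ) - p.2) * u k) *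
          (starRingEnd ℂ) (ex (((p.1 : ℝ) - p.2) * u k')) =
          ex (p.1 * (u k - u k')) * (starRingEnd ℂ) (ex (p.2 * (u k - u k'))) := by
        intro p
        rw [conj_ex, conj_ex, ← ex_add, ← ex_add]
        congr 1; ring
      simp only [e]
      rw [Finset.sum_product]
      dsimp only
      rw [← Finset.sum_mul_sum,
        ← map_sum, norm_mul, Complex.norm_conj, ← sq, Finset.range_eq_Ico]
      refine pow_le_pow_left₀ (norm_nonneg _) ?_ 2
      exact norm_sum_ex_le_gmin _ _ _ (by push_cast; simp)
    refine (Finset.sum_le_sum h2).trans ?_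
    have h3 := sum_spaced_le t (fun k' => u k - u k') hδ ⌈1 / δ⌉₊ (by
      have := Nat.le_ceil (1 / δ)
      rw [div_le_iff₀ hδ] at this
      linarith) (by
      intro y hy z hz hyz
      have := hsp z hz y hy (Ne.symm hyz)
      rwa [show u k - u y - (u k - u z) = u z - u y by ring]) (fun x => gmin (2 * H) x ^ 2)
      (fun x y hx hxy => pow_le_pow_left₀ (gmin_nonneg (by positivity) (hx.trans hxy))
        (gmin_anti (by positivity) hx hxy) 2) (fun x hx => by positivity)
    refine h3.trans ?_
    have h4 := sum_gmin_sq_le (H := 2 * H) (by positivity) (δ := δ) (by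
      rw [div_le_iff₀ (by positivity)]
      rw [div_le_iff₀ hδ] at hH
      nlinarith) (⌈1 / δ⌉₊ + 1)
    nlinarith
  have h5 : H * ∑ n ∈ Finset.Ioc 0 H, f n ≤
      ∑ p ∈ Finset.range (2 * H) ×ˢ Finset.range (2 * H), f ((p.1 : ℝ) - p.2) := by
    have e : H * ∑ n ∈ Finset.Ioc 0 H, f n =
        ∑ p ∈ (Finset.Ioc 0 H ×ˢ Finset.range H).image (fun p : ℕ × ℕ => ((p.1 + p.2, p.2) : ℕ × ℕ)),
          f ((p.1 : ℝ) - p.2) := by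
      rw [Finset.sum_image, Finset.sum_product]
      · rw [Finset.mul_sum]
        refine Finset.sum_congr rfl fun n _ => ?_
        simp
      · intro x _ y _ hxy
        simp only [Prod.mk.injEq] at hxy
        ext <;> omega
    rw [e]
    refine Finset.sum_le_sum_of_subset_of_nonneg ?_ fun p _ _ => hf0 _
    intro p hp
    obtain ⟨x, hx, rfl⟩ := Finset.mem_image.1 hp
    simp only [Finset.mem_product, Finset.mem_Ioc, Finset.mem_range] at hx ⊢
    omega
  have h6 : (H : ℝ) * ∑ n ∈ Finset.Ioc 0 H, f n ≤ H * (64 * H * ∑ k ∈ t, ‖b k‖ ^ 2) := by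
    refine (h5.trans h1).trans (le_of_eq (by ring))
  exact le_of_mul_le_mul_left h6 hH0

/-- The additive large sieve inequality. -/
lemma large_sieve_additive {κ : Type*} (t : Finset κ) (u : κ → ℝ) {δ : ℝ} (hδ : 0 < δ)
    (hsp : ∀ y ∈ t, ∀ z ∈ t, y ≠ z → δ ≤ nd (u y - u z)) (N H : ℕ) (hN : N ≤ H) (hH : 1 / δ ≤ H)
    (a : ℕ → ℂ) :
    ∑ k ∈ t, ‖∑ n ∈ Finset.Ioc 0 N, ex (n * u k) * a n‖ ^ 2 ≤
      64 * H * ∑ n ∈ Finset.Ioc 0 N, ‖a n‖ ^ 2 := by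
  refine sum_norm_sq_dual (Finset.Ioc 0 N) t (fun n k => ex (n * u k)) (by positivity) ?_ a
  intro b
  refine le_trans ?_ (large_sieve_dual t u hδ hsp H hH b)
  refine Finset.sum_le_sum_of_subset_of_nonneg (Finset.Ioc_subset_Ioc_right hN) fun n _ _ => ?_
  positivity

/-- The primitive Dirichlet characters modulo `r`. -/
def primChars (r : ℕ) : Finset (DirichletCharacter ℂ r) := by
  classical
  exact if h : r = 0 then ∅ else
    haveI : NeZero r := ⟨h⟩
    Finset.univ.filter fun χ => χ.IsPrimitive

lemma mem_primChars {r : ℕ} [NeZero r] {χ : DirichletCharacter ℂ r} :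
    χ ∈ primChars r ↔ χ.IsPrimitive := by
  classical
  rw [primChars, dif_neg (NeZero.ne r)]
  simp

/-- Fractions with bounded denominators. -/
def fareyPairs (Q : ℕ) : Finset (Σ _ : ℕ, ℕ) :=
  (Finset.Ioc 0 Q).sigma fun r => (Finset.range r).filter fun a => Nat.Coprime a r

lemma fareyPairs_spaced (Q : ℕ) (y z : Σ _ : ℕ, ℕ) (hy : y ∈ fareyPairs Q) (hz : z ∈ fareyPairs Q)
    (hyz : y ≠ z) : 1 / (Q : ℝ) ^ 2 ≤ nd ((y.2 : ℝ) / y.1 - z.2 / z.1) := by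
  obtain ⟨r, a⟩ := y
  obtain ⟨s, b⟩ := z
  simp only [fareyPairs, Finset.mem_sigma, Finset.mem_Ioc, Finset.mem_filter, Finset.mem_range]
    at hy hz
  obtain ⟨⟨hr0, hrQ⟩, har, hac⟩ := hy
  obtain ⟨⟨hs0, hsQ⟩, hbs, hbc⟩ := hz
  have hr : (0 : ℝ) < r := by exact_mod_cast hr0
  have hs : (0 : ℝ) < s := by exact_mod_cast hs0
  rw [nd]
  set n := round ((a : ℝ) / r - b / s)
  have e : (a : ℝ) / r - b / s - n = ((a * s - b * r - n * (r * s) : ℤ) : ℝ) / (r * s) := by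
    push_cast; field_simp
  have hne : (a * s - b * r - n * (r * s) : ℤ) ≠ 0 := by
    intro h
    apply hyz
    have h0 : n = 0 := by
      have h1 : (a : ℤ) * s < r * s := by exact_mod_cast Nat.mul_lt_mul_of_pos_right har hs0
      have h2 : (b : ℤ) * r < r * s := by
        rw [mul_comm (r : ℤ)]; exact_mod_cast Nat.mul_lt_mul_of_pos_right hbs hr0
      have h3 : (0 : ℤ) ≤ a * s := by positivity
      have h4 : (0 : ℤ) ≤ b * r := by positivity
      have h5 : (0 : ℤ) < r * s := by positivity
      have h6 : n < 1 := by nlinarith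
      have h7 : -1 < n := by nlinarith
      omega
    rw [h0, zero_mul, sub_zero] at h
    have h1 : a * s = b * r := by
      have : (a : ℤ) * s = b * r := by linarith
      exact_mod_cast this
    have h2 : r ∣ s := hac.symm.dvd_of_dvd_mul_left ⟨b, by rw [h1, mul_comm]⟩
    have h3 : s ∣ r := hbc.symm.dvd_of_dvd_mul_left ⟨a, by rw [← h1, mul_comm]⟩
    have h4 := Nat.dvd_antisymm h2 h3
    subst h4
    rw [Nat.eq_of_mul_eq_mul_right hr0 h1]
  have h1 : (1 : ℝ) ≤ |((a * s - b * r - n * (r * s) : ℤ) : ℝ)| := by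
    rw [← Int.cast_abs]; exact_mod_cast Int.one_le_abs hne
  rw [e, abs_div, abs_of_pos (by positivity : (0 : ℝ) < r * s)]
  have h2 : (r : ℝ) * s ≤ Q ^ 2 := by
    rw [sq]
    have h3 : (r : ℝ) ≤ Q := by exact_mod_cast hrQ
    have h4 : (s : ℝ) ≤ Q := by exact_mod_cast hsQ
    gcongr
  gcongr

lemma conj_char_eq {r : ℕ} [NeZero r] (χ : DirichletCharacter ℂ r) {b : ZMod r} (hb : IsUnit b) :
    (starRingEnd ℂ) (χ b) = χ b⁻¹ := by
  have h1 : ‖χ b‖ = 1 := χ.unit_norm_eq_one hb.unit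
  have h2 : χ b * χ b⁻¹ = 1 := by
    rw [← map_mul, ZMod.mul_inv_of_unit b hb, map_one]
  have h3 : χ b * (starRingEnd ℂ) (χ b) = 1 := by
    rw [Complex.mul_conj', h1]; norm_num
  have h4 : χ b ≠ 0 := left_ne_zero_of_mul_eq_one h2
  exact mul_left_cancel₀ h4 (h3.trans h2.symm)

lemma sum_norm_sq_chars {r : ℕ} [NeZero r] (S : ZMod r → ℂ) :
    ∑ χ : DirichletCharacter ℂ r, ‖∑ a : ZMod r, χ a * S a‖ ^ 2 =
      r.totient * ∑ a : ZMod r with IsUnit a, ‖S a‖ ^ 2 := by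
  have h1 : ∀ χ : DirichletCharacter ℂ r, ∑ a : ZMod r, χ a * S a =
      ∑ a : ZMod r with IsUnit a, χ a * S a := by
    intro χ
    rw [Finset.sum_filter]
    refine Finset.sum_congr rfl fun a _ => ?_
    split_ifs with h
    · rfl
    · rw [MulChar.map_nonunit _ h, zero_mul]
  simp only [h1]
  apply Complex.ofReal_injective
  push_cast
  simp only [← Complex.mul_conj', map_sum, map_mul, Finset.sum_mul_sum]
  rw [Finset.sum_comm, Finset.mul_sum]
  refine Finset.sum_congr rfl fun a ha => ?_
  rw [Finset.sum_comm]
  have h2 : ∀ b ∈ (Finset.univ : Finset (ZMod r)).filter (fun b => IsUnit b),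
      ∑ χ : DirichletCharacter ℂ r, χ a * S a * ((starRingEnd ℂ) (χ b) * (starRingEnd ℂ) (S b)) =
      if b = a then S a * (starRingEnd ℂ) (S b) * (r.totient : ℂ) else 0 := by
    intro b hb
    rw [← mul_ite_zero, ← DirichletCharacter.sum_char_inv_mul_char_eq ℂ (Finset.mem_filter.1 hb).2 a,
      Finset.mul_sum]
    refine Finset.sum_congr rfl fun χ _ => ?_
    rw [conj_char_eq χ (Finset.mem_filter.1 hb).2]; ring
  rw [Finset.sum_congr rfl h2, Finset.sum_ite_eq', if_pos ha]
  ring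

lemma card_units_zmod (r : ℕ) [NeZero r] :
    ((Finset.univ : Finset (ZMod r)).filter (fun b => IsUnit b)).card = r.totient := by
  rw [← ZMod.card_units_eq_totient, ← Finset.card_univ]
  symm
  refine Finset.card_bij (fun u _ => (u : ZMod r)) (by simp) (fun a _ b _ h => Units.ext h) ?_
  intro b hb
  exact ⟨(Finset.mem_filter.1 hb).2.unit, Finset.mem_univ _, rfl⟩

lemma sum_norm_sq_char {r : ℕ} [NeZero r] (χ : DirichletCharacter ℂ r) :
    ∑ a : ZMod r, ‖χ a‖ ^ 2 = r.totient := by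
  rw [← card_units_zmod, Finset.card_eq_sum_ones, Nat.cast_sum, Finset.sum_filter]
  refine Finset.sum_congr rfl fun a _ => ?_
  split_ifs with h
  · rw [show ‖χ a‖ = 1 from χ.unit_norm_eq_one h.unit]; norm_num
  · rw [MulChar.map_nonunit _ h]; simp

lemma norm_gaussSum_sq {r : ℕ} [NeZero r] {χ : DirichletCharacter ℂ r} (hχ : χ.IsPrimitive) :
    ‖gaussSum χ (ZMod.stdAddChar (N := r))‖ ^ 2 = r := by
  set e := ZMod.stdAddChar (N := r) with he
  have h1 : ∑ n : ZMod r, ‖gaussSum χ (e.mulShift n)‖ ^ 2 = r.totient * ‖gaussSum χ e‖ ^ 2 := by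
    simp only [gaussSum_mulShift_of_isPrimitive e hχ, norm_mul, mul_pow]
    rw [← Finset.sum_mul, sum_norm_sq_char]
  have h2 : ∑ n : ZMod r, ‖gaussSum χ (e.mulShift n)‖ ^ 2 = r * r.totient := by
    rw [← sum_norm_sq_char χ]
    apply Complex.ofReal_injective
    push_cast
    simp only [← Complex.mul_conj', gaussSum, map_sum, map_mul, Finset.sum_mul_sum]
    rw [Finset.sum_comm, Finset.mul_sum]
    refine Finset.sum_congr rfl fun a _ => ?_
    rw [Finset.sum_comm]
    have h3 : ∀ b : ZMod r, ∑ n : ZMod r, χ a * e.mulShift n a *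
        ((starRingEnd ℂ) (χ b) * (starRingEnd ℂ) (e.mulShift n b)) =
        if b = a then χ a * (starRingEnd ℂ) (χ b) * r else 0 := by
      intro b
      have h4 := AddChar.sum_mulShift (a - b) (ZMod.isPrimitive_stdAddChar r)
      rw [ZMod.card] at h4
      have h5 : (if b = a then χ a * (starRingEnd ℂ) (χ b) * (r : ℂ) else 0) =
          χ a * (starRingEnd ℂ) (χ b) * ((if a - b = 0 then r else 0 : ℕ) : ℂ) := by
        simp only [sub_eq_zero, eq_comm (a := a)]
        split_ifs <;> simp
      rw [h5, ← h4, Finset.mul_sum]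
      refine Finset.sum_congr rfl fun n _ => ?_
      rw [AddChar.mulShift_apply, AddChar.mulShift_apply, ← AddChar.map_neg_eq_conj, mul_sub,
        sub_eq_add_neg, AddChar.map_add_eq_mul]
      ring
    simp only [h3]
    rw [Finset.sum_ite_eq', if_pos (Finset.mem_univ _)]
    ring
  have hφ : (0 : ℝ) < r.totient := by exact_mod_cast Nat.totient_pos.2 (NeZero.pos r)
  have h3 := h1.symm.trans h2
  rw [mul_comm (r : ℝ)] at h3
  exact mul_left_cancel₀ hφ.ne' h3

lemma stdAddChar_eq_ex {r : ℕ} [NeZero r] (k : ℕ) :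
    ZMod.stdAddChar ((k : ℕ) : ZMod r) = ex ((k : ℝ) / r) := by
  have := ZMod.stdAddChar_coe (N := r) (k : ℤ)
  rw [Int.cast_natCast] at this
  rw [this, ex]
  congr 1
  push_cast
  ring

lemma sum_norm_sq_primChars_le (r : ℕ) [NeZero r] (N : ℕ) (a : ℕ → ℂ) :
    (r / r.totient : ℝ) * ∑ χ ∈ primChars r, ‖∑ n ∈ Finset.Ioc 0 N, a n * χ n‖ ^ 2 ≤
      ∑ b ∈ (Finset.range r).filter (fun b => Nat.Coprime b r),
        ‖∑ n ∈ Finset.Ioc 0 N, ex (n * ((b : ℝ) / r)) * (starRingEnd ℂ) (a n)‖ ^ 2 := by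
  set e := ZMod.stdAddChar (N := r) with he
  set S : ZMod r → ℂ := fun b => ∑ n ∈ Finset.Ioc 0 N, e (n * b) * (starRingEnd ℂ) (a n) with hS
  have hφ : (0 : ℝ) < r.totient := by exact_mod_cast Nat.totient_pos.2 (NeZero.pos r)
  have h1 : ∀ χ ∈ primChars r, r * ‖∑ n ∈ Finset.Ioc 0 N, a n * χ n‖ ^ 2 =
      ‖∑ b : ZMod r, χ b * S b‖ ^ 2 := by
    intro χ hχ
    rw [mem_primChars] at hχ
    have h2 : ∑ b : ZMod r, χ b * S b =
        (∑ n ∈ Finset.Ioc 0 N, χ⁻¹ n * (starRingEnd ℂ) (a n)) * gaussSum χ e := by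
      simp only [hS, Finset.mul_sum]
      rw [Finset.sum_comm, Finset.sum_mul]
      refine Finset.sum_congr rfl fun n _ => ?_
      rw [mul_right_comm, ← gaussSum_mulShift_of_isPrimitive e hχ, gaussSum, Finset.sum_mul]
      refine Finset.sum_congr rfl fun b _ => ?_
      rw [AddChar.mulShift_apply]; ring
    have h3 : ∑ n ∈ Finset.Ioc 0 N, χ⁻¹ n * (starRingEnd ℂ) (a n) =
        (starRingEnd ℂ) (∑ n ∈ Finset.Ioc 0 N, a n * χ n) := by
      rw [map_sum]
      refine Finset.sum_congr rfl fun n _ => ?_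
      rw [map_mul, mul_comm, ← MulChar.star_apply']
      rfl
    rw [h2, h3, norm_mul, mul_pow, Complex.norm_conj, norm_gaussSum_sq hχ, mul_comm]
  have h4 : r * ∑ χ ∈ primChars r, ‖∑ n ∈ Finset.Ioc 0 N, a n * χ n‖ ^ 2 ≤
      r.totient * ∑ b : ZMod r with IsUnit b, ‖S b‖ ^ 2 := by
    rw [← sum_norm_sq_chars, Finset.mul_sum, Finset.sum_congr rfl h1]
    exact Finset.sum_le_sum_of_subset_of_nonneg (Finset.subset_univ _) fun _ _ _ => by positivity
  have h5 : ∑ b : ZMod r with IsUnit b, ‖S b‖ ^ 2 =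
      ∑ b ∈ (Finset.range r).filter (fun b => Nat.Coprime b r),
        ‖∑ n ∈ Finset.Ioc 0 N, ex (n * ((b : ℝ) / r)) * (starRingEnd ℂ) (a n)‖ ^ 2 := by
    symm
    refine Finset.sum_bij (fun k _ => (k : ZMod r)) ?_ ?_ ?_ ?_
    · intro k hk
      simp only [Finset.mem_filter, Finset.mem_univ, true_and]
      exact (ZMod.isUnit_iff_coprime k r).2 (Finset.mem_filter.1 hk).2
    · intro k hk l hl hkl
      have := (ZMod.natCast_eq_natCast_iff' k l r).1 hkl
      rwa [Nat.mod_eq_of_lt (Finset.mem_range.1 (Finset.mem_filter.1 hk).1),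
        Nat.mod_eq_of_lt (Finset.mem_range.1 (Finset.mem_filter.1 hl).1)] at this
    · intro b hb
      refine ⟨b.val, ?_, ZMod.natCast_zmod_val b⟩
      rw [Finset.mem_filter, Finset.mem_range, ← ZMod.isUnit_iff_coprime, ZMod.natCast_zmod_val]
      exact ⟨ZMod.val_lt b, (Finset.mem_filter.1 hb).2⟩
    · intro k _
      simp only [hS]
      congr 2
      refine Finset.sum_congr rfl fun n _ => ?_
      rw [← Nat.cast_mul, he, stdAddChar_eq_ex]
      congr 2
      push_cast; ring
  rw [← h5, div_mul_eq_mul_div, div_le_iff₀ hφ]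
  linarith

/-- The multiplicative large sieve inequality. -/
lemma large_sieve (Q N : ℕ) (a : ℕ → ℂ) :
    ∑ r ∈ Finset.Ioc 0 Q, (r / r.totient : ℝ) *
      ∑ χ ∈ primChars r, ‖∑ n ∈ Finset.Ioc 0 N, a n * χ n‖ ^ 2 ≤
      64 * (N + Q ^ 2) * ∑ n ∈ Finset.Ioc 0 N, ‖a n‖ ^ 2 := by
  rcases Nat.eq_zero_or_pos Q with rfl | hQ
  · simp; positivity
  have hQr : (0 : ℝ) < Q := by exact_mod_cast hQ
  have h1 := large_sieve_additive (fareyPairs Q) (fun y => (y.2 : ℝ) / y.1)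
    (δ := 1 / (Q : ℝ) ^ 2) (by positivity) (fun y hy z hz => fareyPairs_spaced Q y z hy hz)
    N (N + Q ^ 2) (by omega) (by push_cast; rw [one_div_one_div]; linarith [(Nat.cast_nonneg N : (0 : ℝ) ≤ N)])
    (fun n => (starRingEnd ℂ) (a n))
  rw [fareyPairs, Finset.sum_sigma] at h1
  simp only [Complex.norm_conj] at h1
  push_cast at h1
  refine le_trans (Finset.sum_le_sum fun r hr => ?_) h1
  have : NeZero r := ⟨(Finset.mem_Ioc.1 hr).1.ne'⟩
  exact sum_norm_sq_primChars_le r N a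

lemma card_primChars_le (r : ℕ) : (primChars r).card ≤ r.totient := by
  classical
  rcases Nat.eq_zero_or_pos r with rfl | hr
  · rw [primChars, dif_pos rfl]; simp
  · have : NeZero r := ⟨hr.ne'⟩
    refine (Finset.card_le_univ _).trans (le_of_eq ?_)
    rw [← Nat.card_eq_fintype_card]
    exact DirichletCharacter.card_eq_totient_of_hasEnoughRootsOfUnity ℂ r

/-- The weight in the finite Fourier expansion of the indicator function of an initial segment. -/
def segWeight (K j T : ℕ) : ℂ := ∑ l ∈ Finset.Ioc 0 T, ex (-(l * (j / K : ℝ)))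

lemma segWeight_expansion {K : ℕ} (k T : ℕ) (hk0 : 0 < k) (hk : k ≤ K) (hT : T ≤ K) :
    ((if k ≤ T then 1 else 0 : ℕ) : ℂ) =
      (1 / K : ℂ) * ∑ j ∈ Finset.range K, segWeight K j T * ex (k * (j / K : ℝ)) := by
  have hK : 0 < K := by omega
  have hKr : (0 : ℝ) < K := by exact_mod_cast hK
  have h1 : ∀ l ∈ Finset.Ioc 0 T, ∑ j ∈ Finset.range K, ex (-(l * (j / K : ℝ))) * ex (k * (j / K : ℝ)) =
      if l = k then (K : ℂ) else 0 := by
    intro l hl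
    have hl' := Finset.mem_Ioc.1 hl
    have e : ∀ j ∈ Finset.range K, ex (-(l * (j / K : ℝ))) * ex (k * (j / K : ℝ)) =
        ex (((k : ℝ) - l) / K) ^ j := by
      intro j _
      rw [← ex_add, ← ex_nat_mul]
      congr 1; field_simp; ring
    rw [Finset.sum_congr rfl e]
    split_ifs with h
    · subst h
      simp [ex_zero]
    · have hne : ex (((k : ℝ) - l) / K) ≠ 1 := by
        intro h1
        have h2 := four_nd_le (((k : ℝ) - l) / K)
        rw [h1, sub_self, norm_zero] at h2
        have hco : IsCoprime (1 : ℤ) (K : ℤ) := isCoprime_one_left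
        have h3 := inv_le_nd_rat (a := 1) (d := (k : ℤ) - l) hK hco (by
          intro hd
          have h4 : ((k : ℤ) - l) ≠ 0 := by omega
          have h5 := Int.le_of_dvd (abs_pos.2 h4) ((dvd_abs _ _).2 hd)
          have h6 : |(k : ℤ) - l| < K := by rw [abs_lt]; omega
          omega)
        push_cast at h3
        rw [mul_one_div] at h3
        have : (0 : ℝ) < 1 / K := by positivity
        linarith
      rw [geom_sum_eq hne, ← ex_nat_mul, mul_div_cancel₀ _ hKr.ne']
      have : ex ((k : ℝ) - l) = 1 := by
        have := ex_int ((k : ℤ) - l)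
        push_cast at this
        exact this
      rw [this]; simp
  have h2 : ∑ j ∈ Finset.range K, segWeight K j T * ex (k * (j / K : ℝ)) =
      if k ≤ T then (K : ℂ) else 0 := by
    simp only [segWeight, Finset.sum_mul]
    rw [Finset.sum_comm, Finset.sum_congr rfl h1, Finset.sum_ite_eq']
    simp only [Finset.mem_Ioc, hk0, true_and]
  rw [h2]
  have : (K : ℂ) ≠ 0 := by exact_mod_cast hK.ne'
  split_ifs
  · field_simp; simp
  · simp

lemma norm_segWeight_le {K j T : ℕ} (hT : T ≤ K) : ‖segWeight K j T‖ ≤ gmin K (nd (j / K : ℝ)) := by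
  have e : segWeight K j T = ∑ l ∈ Finset.Ico 1 (T + 1), ex (l * (-(j / K : ℝ))) := by
    have : Finset.Ioc 0 T = Finset.Ico 1 (T + 1) := by ext; simp; omega
    rw [segWeight, this]
    exact Finset.sum_congr rfl fun l _ => by rw [mul_neg]
  rw [e, ← nd_neg]
  apply norm_sum_ex_le_gmin
  simpa using hT

lemma sum_gmin_div_le (K : ℕ) :
    ∑ j ∈ Finset.range K, gmin K (nd (j / K : ℝ)) ≤ K * (8 * (1 + Real.log K)) := by
  rcases Nat.eq_zero_or_pos K with rfl | hK
  · simp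
  have hKr : (0 : ℝ) < K := by exact_mod_cast hK
  have hl : 0 ≤ Real.log K := Real.log_natCast_nonneg K
  refine (sum_gmin_spaced_le (Finset.range K) (fun j => (j / K : ℝ)) hK (M := K) hKr.le ?_).trans ?_
  · intro y hy z hz hyz
    rw [Finset.mem_range] at hy hz
    have h3 := inv_le_nd_rat (a := 1) (d := (y : ℤ) - z) hK isCoprime_one_left (by
      intro hd
      have h4 : ((y : ℤ) - z) ≠ 0 := by omega
      have h5 := Int.le_of_dvd (abs_pos.2 h4) ((dvd_abs _ _).2 hd)
      have h6 : |(y : ℤ) - z| < K := by rw [abs_lt]; omega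
      omega)
    push_cast at h3
    rw [mul_one_div, sub_div] at h3
    refine le_trans ?_ h3
    gcongr
    linarith
  · nlinarith

lemma large_sieve_cauchy (Q M K : ℕ) (a b : ℕ → ℂ) :
    ∑ r ∈ Finset.Ioc 0 Q, (r / r.totient : ℝ) * ∑ χ ∈ primChars r,
      ‖∑ m ∈ Finset.Ioc 0 M, a m * χ m‖ * ‖∑ k ∈ Finset.Ioc 0 K, b k * χ k‖ ≤
    64 * Real.sqrt (((M + Q ^ 2) * ∑ m ∈ Finset.Ioc 0 M, ‖a m‖ ^ 2) *
      ((K + Q ^ 2) * ∑ k ∈ Finset.Ioc 0 K, ‖b k‖ ^ 2)) := by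
  set t : Finset (Σ r : ℕ, DirichletCharacter ℂ r) := (Finset.Ioc 0 Q).sigma primChars with ht
  set w : (Σ r : ℕ, DirichletCharacter ℂ r) → ℝ := fun x => Real.sqrt (x.1 / x.1.totient) with hw
  have hw2 : ∀ x, w x ^ 2 = x.1 / x.1.totient := fun x => Real.sq_sqrt (by positivity)
  have e : ∀ F : (Σ r : ℕ, DirichletCharacter ℂ r) → ℝ,
      ∑ r ∈ Finset.Ioc 0 Q, (r / r.totient : ℝ) * ∑ χ ∈ primChars r, F ⟨r, χ⟩ =
      ∑ x ∈ t, w x ^ 2 * F x := by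
    intro F
    rw [ht, Finset.sum_sigma]
    refine Finset.sum_congr rfl fun r _ => ?_
    rw [Finset.mul_sum]
    exact Finset.sum_congr rfl fun χ _ => by rw [hw2]
  have hA := large_sieve Q M a
  have hB := large_sieve Q K b
  rw [e (fun x => ‖∑ m ∈ Finset.Ioc 0 M, a m * x.2 m‖ ^ 2)] at hA
  rw [e (fun x => ‖∑ k ∈ Finset.Ioc 0 K, b k * x.2 k‖ ^ 2)] at hB
  rw [e (fun x => ‖∑ m ∈ Finset.Ioc 0 M, a m * x.2 m‖ * ‖∑ k ∈ Finset.Ioc 0 K, b k * x.2 k‖)]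
  have h64 : (64 : ℝ) = Real.sqrt (64 * 64) := by
    rw [Real.sqrt_mul_self]; norm_num
  rw [h64, ← Real.sqrt_mul (by norm_num)]
  apply Real.le_sqrt_of_sq_le
  have h := Finset.sum_mul_sq_le_sq_mul_sq t (fun x => w x * ‖∑ m ∈ Finset.Ioc 0 M, a m * x.2 m‖)
    (fun x => w x * ‖∑ k ∈ Finset.Ioc 0 K, b k * x.2 k‖)
  simp only [mul_pow] at h
  calc _ = (∑ x ∈ t, w x * ‖∑ m ∈ Finset.Ioc 0 M, a m * x.2 m‖ *
        (w x * ‖∑ k ∈ Finset.Ioc 0 K, b k * x.2 k‖)) ^ 2 := by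
        congr 1
        exact Finset.sum_congr rfl fun x _ => by ring
    _ ≤ _ := h
    _ ≤ (64 * (M + Q ^ 2) * ∑ m ∈ Finset.Ioc 0 M, ‖a m‖ ^ 2) *
        (64 * (K + Q ^ 2) * ∑ k ∈ Finset.Ioc 0 K, ‖b k‖ ^ 2) :=
        mul_le_mul hA hB (by positivity) (by positivity)
    _ = _ := by ring

/-- Bilinear large sieve with a hyperbolic cutoff. -/
lemma large_sieve_bilinear (Q M K t : ℕ) (a b : ℕ → ℂ) :
    ∑ r ∈ Finset.Ioc 0 Q, (r / r.totient : ℝ) * ∑ χ ∈ primChars r,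
      ‖∑ m ∈ Finset.Ioc 0 M, ∑ k ∈ Finset.Ioc 0 K,
        if m * k ≤ t then a m * b k * χ ((m * k : ℕ) : ZMod r) else 0‖ ≤
    512 * (1 + Real.log K) * Real.sqrt (((M + Q ^ 2) * ∑ m ∈ Finset.Ioc 0 M, ‖a m‖ ^ 2) *
      ((K + Q ^ 2) * ∑ k ∈ Finset.Ioc 0 K, ‖b k‖ ^ 2)) := by
  set S : ℝ := Real.sqrt (((M + Q ^ 2) * ∑ m ∈ Finset.Ioc 0 M, ‖a m‖ ^ 2) *
      ((K + Q ^ 2) * ∑ k ∈ Finset.Ioc 0 K, ‖b k‖ ^ 2)) with hS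
  rcases Nat.eq_zero_or_pos K with rfl | hK
  · simp [hS]
  have hKr : (0 : ℝ) < K := by exact_mod_cast hK
  set A : ℕ → ℕ → ℂ := fun j m => a m * segWeight K j (min (t / m) K) with hA
  set B : ℕ → ℕ → ℂ := fun j k => b k * ex (k * (j / K : ℝ)) with hB
  have e : ∀ r : ℕ, ∀ χ : DirichletCharacter ℂ r, ∑ m ∈ Finset.Ioc 0 M, ∑ k ∈ Finset.Ioc 0 K,
        (if m * k ≤ t then a m * b k * χ ((m * k : ℕ) : ZMod r) else 0) =
      (1 / K : ℂ) * ∑ j ∈ Finset.range K, (∑ m ∈ Finset.Ioc 0 M, A j m * χ m) *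
        (∑ k ∈ Finset.Ioc 0 K, B j k * χ k) := by
    intro r χ
    simp only [Finset.sum_mul_sum]
    conv_rhs => rw [Finset.sum_comm, Finset.mul_sum]
    refine Finset.sum_congr rfl fun m hm => ?_
    conv_rhs => rw [Finset.sum_comm, Finset.mul_sum]
    refine Finset.sum_congr rfl fun k hk => ?_
    obtain ⟨hk0, hkK⟩ := Finset.mem_Ioc.1 hk
    have h1 := segWeight_expansion (K := K) k (min (t / m) K) hk0 hkK (min_le_right _ _)
    have h2 : (k ≤ min (t / m) K) ↔ m * k ≤ t := by
      rw [le_min_iff, Nat.le_div_iff_mul_le (Finset.mem_Ioc.1 hm).1, mul_comm k m]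
      exact and_iff_left hkK
    simp only [h2] at h1
    have h3 : (if m * k ≤ t then a m * b k * χ ((m * k : ℕ) : ZMod r) else 0) =
        a m * b k * (χ m * χ k) * ((if m * k ≤ t then 1 else 0 : ℕ) : ℂ) := by
      split_ifs
      · push_cast; rw [map_mul]; ring
      · simp
    rw [h3, h1, Finset.mul_sum, Finset.mul_sum, Finset.mul_sum]
    refine Finset.sum_congr rfl fun j _ => ?_
    simp only [hA, hB]; ring
  have h1 : ∀ j ∈ Finset.range K, ∑ r ∈ Finset.Ioc 0 Q, (r / r.totient : ℝ) * ∑ χ ∈ primChars r,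
      ‖∑ m ∈ Finset.Ioc 0 M, A j m * χ m‖ * ‖∑ k ∈ Finset.Ioc 0 K, B j k * χ k‖ ≤
      64 * (gmin K (nd (j / K : ℝ)) * S) := by
    intro j _
    refine (large_sieve_cauchy Q M K (A j) (B j)).trans ?_
    refine mul_le_mul_of_nonneg_left ?_ (by norm_num)
    have hg : 0 ≤ gmin K (nd (j / K : ℝ)) := gmin_nonneg hKr.le (nd_nonneg _)
    rw [← Real.sqrt_sq hg, hS, ← Real.sqrt_mul (by positivity)]
    apply Real.sqrt_le_sqrt
    have h2 : ∑ k ∈ Finset.Ioc 0 K, ‖B j k‖ ^ 2 = ∑ k ∈ Finset.Ioc 0 K, ‖b k‖ ^ 2 :=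
      Finset.sum_congr rfl fun k _ => by simp only [hB]; rw [norm_mul, norm_ex, mul_one]
    have h3 : ∑ m ∈ Finset.Ioc 0 M, ‖A j m‖ ^ 2 ≤
        gmin K (nd (j / K : ℝ)) ^ 2 * ∑ m ∈ Finset.Ioc 0 M, ‖a m‖ ^ 2 := by
      rw [Finset.mul_sum]
      refine Finset.sum_le_sum fun m _ => ?_
      simp only [hA]
      rw [norm_mul, mul_pow, mul_comm]
      exact mul_le_mul_of_nonneg_right
        (pow_le_pow_left₀ (norm_nonneg _) (norm_segWeight_le (min_le_right _ _)) 2) (by positivity)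
    rw [h2]
    calc _ ≤ ((M + Q ^ 2) * (gmin K (nd (j / K : ℝ)) ^ 2 * ∑ m ∈ Finset.Ioc 0 M, ‖a m‖ ^ 2)) *
          ((K + Q ^ 2) * ∑ k ∈ Finset.Ioc 0 K, ‖b k‖ ^ 2) := by gcongr
      _ = _ := by ring
  have h2 : ∀ r : ℕ, ∀ χ : DirichletCharacter ℂ r, ‖∑ m ∈ Finset.Ioc 0 M, ∑ k ∈ Finset.Ioc 0 K,
        (if m * k ≤ t then a m * b k * χ ((m * k : ℕ) : ZMod r) else 0)‖ ≤
      (1 / K : ℝ) * ∑ j ∈ Finset.range K, ‖∑ m ∈ Finset.Ioc 0 M, A j m * χ m‖ *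
        ‖∑ k ∈ Finset.Ioc 0 K, B j k * χ k‖ := by
    intro r χ
    rw [e, norm_mul]
    have : ‖(1 / K : ℂ)‖ = 1 / K := by rw [norm_div, norm_one, Complex.norm_natCast]
    rw [this]
    refine mul_le_mul_of_nonneg_left ((norm_sum_le _ _).trans (le_of_eq ?_)) (by positivity)
    exact Finset.sum_congr rfl fun j _ => norm_mul _ _
  calc _ ≤ ∑ r ∈ Finset.Ioc 0 Q, (r / r.totient : ℝ) * ∑ χ ∈ primChars r,
        (1 / K : ℝ) * ∑ j ∈ Finset.range K, ‖∑ m ∈ Finset.Ioc 0 M, A j m * χ m‖ *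
        ‖∑ k ∈ Finset.Ioc 0 K, B j k * χ k‖ := by
        refine Finset.sum_le_sum fun r _ => mul_le_mul_of_nonneg_left ?_ (by positivity)
        exact Finset.sum_le_sum fun χ _ => h2 r χ
    _ = (1 / K : ℝ) * ∑ j ∈ Finset.range K, ∑ r ∈ Finset.Ioc 0 Q, (r / r.totient : ℝ) *
        ∑ χ ∈ primChars r, ‖∑ m ∈ Finset.Ioc 0 M, A j m * χ m‖ *
          ‖∑ k ∈ Finset.Ioc 0 K, B j k * χ k‖ := by
        rw [Finset.sum_comm, Finset.mul_sum]
        refine Finset.sum_congr rfl fun r _ => ?_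
        rw [← Finset.mul_sum, ← Finset.mul_sum, Finset.sum_comm]
        ring
    _ ≤ (1 / K : ℝ) * ∑ j ∈ Finset.range K, 64 * (gmin K (nd (j / K : ℝ)) * S) := by
        refine mul_le_mul_of_nonneg_left (Finset.sum_le_sum h1) (by positivity)
    _ = (1 / K : ℝ) * (64 * S) * ∑ j ∈ Finset.range K, gmin K (nd (j / K : ℝ)) := by
        rw [← Finset.mul_sum, ← Finset.sum_mul]; ring
    _ ≤ (1 / K : ℝ) * (64 * S) * (K * (8 * (1 + Real.log K))) := by
        have hS0 : 0 ≤ S := Real.sqrt_nonneg _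
        exact mul_le_mul_of_nonneg_left (sum_gmin_div_le K) (by positivity)
    _ = _ := by field_simp; ring

lemma primChars_ne_one {r : ℕ} [NeZero r] (hr : 1 < r) {χ : DirichletCharacter ℂ r}
    (hχ : χ.IsPrimitive) : χ ≠ 1 := by
  intro h
  have h1 := DirichletCharacter.eq_one_iff_conductor_eq_one.1 h
  have h2 : χ.conductor = r := hχ
  omega

lemma psiChar_eq_sum_Ioc {r : ℕ} (χ : DirichletCharacter ℂ r) (t : ℕ) :
    psiChar χ t = ∑ n ∈ Finset.Ioc 0 t, (ArithmeticFunction.vonMangoldt n : ℂ) * χ n := by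
  have : Finset.range (t + 1) = insert 0 (Finset.Ioc 0 t) := by
    ext x; simp only [Finset.mem_range, Finset.mem_insert, Finset.mem_Ioc]; omega
  rw [psiChar, this, Finset.sum_insert (by simp)]
  simp only [ArithmeticFunction.map_zero, Complex.ofReal_zero, mul_zero, zero_add]
  exact Finset.sum_congr rfl fun n _ => mul_comm _ _

lemma sum_vaughanBlock_le {V Q t N : ℕ} (hV : 1 ≤ V) (htN : t ≤ N) {i : ℕ}
    (hi : i ∈ blockIndex (V ^ 2) t) :
    ∑ r ∈ Finset.Ioc 0 Q, (r / r.totient : ℝ) * ∑ χ ∈ primChars r,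
      ‖vaughanBlock (V ^ 2) t (fun n => χ n) i‖ ≤
    512 * (1 + Real.log N) ^ 4 * (2 * N + 2 * Q * N / V + Q ^ 2 * Real.sqrt N) := by
  classical
  obtain ⟨-, hi2, hi3⟩ := Finset.mem_filter.1 hi
  have hL0 : 0 ≤ Real.log N := Real.log_natCast_nonneg N
  set L := Real.log N with hL
  set M : ℕ := 2 ^ i with hM
  set K : ℕ := t / M with hK
  have hM0 : 0 < M := by positivity
  have hM2 : 2 ^ (i + 1) = 2 * M := by rw [pow_succ, hM]; ring
  have hV2 : 1 ≤ V ^ 2 := Nat.one_le_pow _ _ hV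
  have hUM : V ^ 2 < 2 * M := hM2 ▸ hi2
  have hMN : M ≤ t := by nlinarith
  have h2MN : 2 * M ≤ N ∨ V = 1 := by
    by_cases h : V = 1
    · right; exact h
    · left
      have : 2 ≤ V := by omega
      have : 4 ≤ V ^ 2 := by nlinarith
      nlinarith
  set a : ℕ → ℂ := fun m => if m ∈ Finset.Ico (2 ^ i) (2 ^ (i + 1)) then
    (highPart (V ^ 2) ArithmeticFunction.vonMangoldt m : ℂ) else 0 with ha
  set b : ℕ → ℂ := fun k => (vaughanB (V ^ 2) k : ℂ) with hb
  have e : ∀ r : ℕ, ∀ χ : DirichletCharacter ℂ r, vaughanBlock (V ^ 2) t (fun n => χ n) i =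
      ∑ m ∈ Finset.Ioc 0 (2 * M), ∑ k ∈ Finset.Ioc 0 K,
        if m * k ≤ t then a m * b k * χ ((m * k : ℕ) : ZMod r) else 0 := by
    intro r χ
    rw [vaughanBlock_eq]
    have hsub : Finset.Ico (2 ^ i) (2 ^ (i + 1)) ⊆ Finset.Ioc 0 (2 * M) := by
      intro m hm
      rw [Finset.mem_Ico] at hm
      rw [Finset.mem_Ioc]
      omega
    rw [← Finset.sum_subset hsub]
    · refine Finset.sum_congr rfl fun m hm => Finset.sum_congr rfl fun k _ => ?_
      simp only [ha, hb, if_pos hm]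
    · intro m _ hm
      refine Finset.sum_eq_zero fun k _ => ?_
      simp only [ha, if_neg hm, zero_mul, ite_self]
  simp only [e]
  refine (large_sieve_bilinear Q (2 * M) K t a b).trans ?_
  have hN0 : (0 : ℝ) ≤ N := Nat.cast_nonneg N
  have hlK : Real.log K ≤ L := log_nat_mono ((Nat.div_le_self _ _).trans htN)
  have hlK0 : 0 ≤ Real.log K := Real.log_natCast_nonneg K
  have h1 : ∑ m ∈ Finset.Ioc 0 (2 * M), ‖a m‖ ^ 2 ≤ M * (1 + L) ^ 2 := by
    have h2 : ∑ m ∈ Finset.Ioc 0 (2 * M), ‖a m‖ ^ 2 ≤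
        ∑ m ∈ Finset.Ico (2 ^ i) (2 ^ (i + 1)), highPart (V ^ 2) ArithmeticFunction.vonMangoldt m ^ 2 := by
      have h3 : ∀ m ∈ Finset.Ioc 0 (2 * M), ‖a m‖ ^ 2 = if m ∈ Finset.Ico (2 ^ i) (2 ^ (i + 1)) then
          highPart (V ^ 2) ArithmeticFunction.vonMangoldt m ^ 2 else 0 := by
        intro m _
        simp only [ha]
        split_ifs
        · rw [Complex.norm_real, Real.norm_eq_abs, sq_abs]
        · simp
      rw [Finset.sum_congr rfl h3, ← Finset.sum_filter]
      refine Finset.sum_le_sum_of_subset_of_nonneg ?_ fun _ _ _ => sq_nonneg _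
      intro m hm
      exact (Finset.mem_filter.1 hm).2
    refine h2.trans ((sum_highPart_sq_le (V ^ 2) i (L := 1 + L) ?_).trans (le_of_eq (by rw [hM]; push_cast; ring)))
    have h4 : Real.log ((2 ^ (i + 1) : ℕ) : ℝ) = Real.log 2 + Real.log M := by
      rw [hM2]; push_cast
      exact Real.log_mul (by norm_num) (by positivity)
    have h5 : Real.log M ≤ L := log_nat_mono (hMN.trans htN)
    have := Real.log_two_lt_d9
    linarith
  have h2 : ∑ k ∈ Finset.Ioc 0 K, ‖b k‖ ^ 2 ≤ K * (1 + L) ^ 3 := by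
    refine le_trans (le_of_eq ?_) (sum_vaughanB_sq_le (V ^ 2) K hlK)
    exact Finset.sum_congr rfl fun m _ => by
      simp only [hb]; rw [Complex.norm_real, Real.norm_eq_abs, sq_abs]
  have hVr : (0 : ℝ) < V := by exact_mod_cast hV
  have hKM : (M : ℝ) * K ≤ N := by exact_mod_cast (Nat.mul_div_le t M).trans htN
  have hK0 : (0 : ℝ) ≤ K := Nat.cast_nonneg K
  have hMr : (0 : ℝ) < M := by exact_mod_cast hM0
  have hKV : (K : ℝ) ≤ 2 * (N / V ^ 2) := by
    rw [← mul_div_assoc, le_div_iff₀ (by positivity)]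
    have : (V : ℝ) ^ 2 ≤ 2 * M := by exact_mod_cast hUM.le
    nlinarith
  have hMV : (M : ℝ) ≤ N / V ^ 2 := by
    rw [le_div_iff₀ (by positivity)]
    have : V ^ 2 * M ≤ N := hi3.le.trans htN
    rw [mul_comm]; exact_mod_cast this
  set s := Real.sqrt N with hs
  have hs0 : 0 ≤ s := Real.sqrt_nonneg _
  have hs2 : s ^ 2 = N := Real.sq_sqrt hN0
  have hQ0 : (0 : ℝ) ≤ Q := Nat.cast_nonneg Q
  have h3 : Real.sqrt ((((2 * M : ℕ) + Q ^ 2) * ∑ m ∈ Finset.Ioc 0 (2 * M), ‖a m‖ ^ 2) *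
      ((K + Q ^ 2) * ∑ k ∈ Finset.Ioc 0 K, ‖b k‖ ^ 2)) ≤
      (1 + L) ^ 3 * (s * (2 * s + 2 * Q * (s / V) + Q ^ 2)) := by
    apply Real.sqrt_le_iff.2 ⟨by positivity, ?_⟩
    calc _ ≤ (((2 * M : ℕ) + Q ^ 2) * (M * (1 + L) ^ 2)) * ((K + Q ^ 2) * (K * (1 + L) ^ 3)) := by
          gcongr
      _ = (1 + L) ^ 5 * ((M * K) * (2 * (M * K) + Q ^ 2 * (2 * M + K) + Q ^ 4)) := by
          push_cast; ring
      _ ≤ (1 + L) ^ 6 * (N * (2 * N + Q ^ 2 * (2 * (N / V ^ 2) + 2 * (N / V ^ 2)) + Q ^ 4)) := by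
          have : (1 + L) ^ 5 ≤ (1 + L) ^ 6 := pow_le_pow_right₀ (by linarith) (by norm_num)
          gcongr
      _ = (1 + L) ^ 6 * (s ^ 2 * (2 * s ^ 2 + 4 * (Q * (s / V)) ^ 2 + Q ^ 4)) := by
          rw [hs2, mul_pow, div_pow, hs2]; ring
      _ ≤ (1 + L) ^ 6 * (s ^ 2 * (2 * s + 2 * Q * (s / V) + Q ^ 2) ^ 2) := by
          have hx : 0 ≤ Q * (s / V) := by positivity
          refine mul_le_mul_of_nonneg_left (mul_le_mul_of_nonneg_left ?_ (by positivity)) (by positivity)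
          have : 0 ≤ s * (Q * (s / V)) := by positivity
          have : 0 ≤ s * (Q : ℝ) ^ 2 := by positivity
          have : 0 ≤ (Q * (s / V)) * (Q : ℝ) ^ 2 := by positivity
          nlinarith
      _ = _ := by ring
  calc _ ≤ 512 * (1 + L) * ((1 + L) ^ 3 * (s * (2 * s + 2 * Q * (s / V) + Q ^ 2))) := by gcongr
    _ = 512 * (1 + L) ^ 4 * (2 * s ^ 2 + 2 * Q * s ^ 2 / V + Q ^ 2 * s) := by ring
    _ = _ := by rw [hs2]

lemma sum_norm_psiChar_le {V Q t N : ℕ} (hV : 1 ≤ V) (hVt : V ^ 4 ≤ t) (htN : t ≤ N) :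
    ∑ r ∈ Finset.Ioc 1 Q, (r / r.totient : ℝ) * ∑ χ ∈ primChars r, ‖psiChar χ t‖ ≤
    4 * V ^ 4 * Real.log N * Q ^ 3 +
      1536 * (1 + Real.log N) ^ 5 * (2 * N + 2 * Q * N / V + Q ^ 2 * Real.sqrt N) := by
  have hL0 : 0 ≤ Real.log N := Real.log_natCast_nonneg N
  set L := Real.log N with hL
  have hlt : Real.log t ≤ L := log_nat_mono htN
  have hlt0 : 0 ≤ Real.log t := Real.log_natCast_nonneg t
  have hVr : (1 : ℝ) ≤ V := by exact_mod_cast hV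
  set R : ℝ := 512 * (1 + L) ^ 4 * (2 * N + 2 * Q * N / V + Q ^ 2 * Real.sqrt N) with hR
  have h1 : ∀ r ∈ Finset.Ioc 1 Q, ∀ χ ∈ primChars r, ‖psiChar χ t‖ ≤ 4 * V ^ 4 * L * Q +
      ∑ i ∈ blockIndex (V ^ 2) t, ‖vaughanBlock (V ^ 2) t (fun n => χ n) i‖ := by
    intro r hr χ hχ
    obtain ⟨hr1, hrQ⟩ := Finset.mem_Ioc.1 hr
    have : NeZero r := ⟨by omega⟩
    rw [mem_primChars] at hχ
    have hne := primChars_ne_one hr1 hχ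
    rw [psiChar_eq_sum_Ioc]
    refine (vaughan_bound (U := V ^ 2) (Nat.one_le_pow _ _ hV) (by rw [← pow_mul]; exact hVt)
      (f := fun n => χ n) (fun n => χ.norm_le_one n) (T := r) (by positivity) ?_).trans ?_
    · intro m _ _ x _
      have h2 := norm_psum_char_le hne x
      have h3 : ∑ l ∈ Finset.Ioc 0 x, χ ((m * l : ℕ) : ZMod r) =
          χ m * psum (fun k => χ k) x := by
        have : Finset.Ioc 0 x = Finset.Ico 1 (x + 1) := by ext; simp; omega
        rw [psum, this, Finset.sum_Ico_eq_sum_range, Finset.mul_sum]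
        refine Finset.sum_congr (by simp) fun k _ => ?_
        rw [← map_mul, add_comm 1 k]; push_cast; rfl
      rw [h3, norm_mul]
      calc ‖χ m‖ * ‖psum (fun k => χ k) x‖ ≤ 1 * r := by
            gcongr
            exact χ.norm_le_one _
        _ = r := one_mul _
    · refine add_le_add ?_ (norm_vaughanBilinear_le _ _ _)
      have hrQ' : (r : ℝ) ≤ Q := by exact_mod_cast hrQ
      have hQ1 : (1 : ℝ) ≤ Q := by exact_mod_cast (by omega : 1 ≤ Q)
      push_cast
      have h5 : (V : ℝ) ^ 2 * Real.log t ≤ V ^ 4 * L * Q := by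
        have : (V : ℝ) ^ 2 ≤ V ^ 4 := pow_le_pow_right₀ hVr (by norm_num)
        calc (V : ℝ) ^ 2 * Real.log t ≤ V ^ 4 * L := by gcongr
          _ ≤ V ^ 4 * L * Q := le_mul_of_one_le_right (by positivity) hQ1
      have h6 : 3 * ((V : ℝ) ^ 2) ^ 2 * Real.log t * r ≤ 3 * V ^ 4 * L * Q := by
        rw [← pow_mul]; gcongr
      linarith
  have h2 : ∑ r ∈ Finset.Ioc 1 Q, (r / r.totient : ℝ) * ∑ χ ∈ primChars r, ‖psiChar χ t‖ ≤
      ∑ r ∈ Finset.Ioc 1 Q, (r / r.totient : ℝ) * ∑ χ ∈ primChars r, (4 * V ^ 4 * L * Q) +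
      ∑ i ∈ blockIndex (V ^ 2) t, ∑ r ∈ Finset.Ioc 1 Q, (r / r.totient : ℝ) * ∑ χ ∈ primChars r,
        ‖vaughanBlock (V ^ 2) t (fun n => χ n) i‖ := by
    rw [Finset.sum_comm (s := blockIndex (V ^ 2) t), ← Finset.sum_add_distrib]
    refine Finset.sum_le_sum fun r hr => ?_
    rw [← Finset.mul_sum (blockIndex (V ^ 2) t), ← mul_add]
    refine mul_le_mul_of_nonneg_left ?_ (by positivity)
    rw [Finset.sum_comm (s := blockIndex (V ^ 2) t), ← Finset.sum_add_distrib]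
    exact Finset.sum_le_sum fun χ hχ => h1 r hr χ hχ
  refine h2.trans (add_le_add ?_ ?_)
  · have h3 : ∀ r ∈ Finset.Ioc 1 Q, (r / r.totient : ℝ) * ∑ χ ∈ primChars r, (4 * V ^ 4 * L * Q) ≤
        Q * (4 * V ^ 4 * L * Q) := by
      intro r hr
      obtain ⟨hr1, hrQ⟩ := Finset.mem_Ioc.1 hr
      have hφ : (0 : ℝ) < r.totient := by exact_mod_cast Nat.totient_pos.2 (by omega)
      have hc : ((primChars r).card : ℝ) ≤ r.totient := by exact_mod_cast card_primChars_le r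
      have hrQ' : (r : ℝ) ≤ Q := by exact_mod_cast hrQ
      rw [Finset.sum_const, nsmul_eq_mul, ← mul_assoc]
      refine mul_le_mul_of_nonneg_right ?_ (by positivity)
      calc (r / r.totient : ℝ) * (primChars r).card ≤ r / r.totient * r.totient := by gcongr
        _ = r := div_mul_cancel₀ _ hφ.ne'
        _ ≤ Q := hrQ'
    refine (Finset.sum_le_sum h3).trans ?_
    rw [Finset.sum_const, nsmul_eq_mul, Nat.card_Ioc]
    have : ((Q - 1 : ℕ) : ℝ) ≤ Q := by exact_mod_cast Nat.sub_le _ _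
    calc ((Q - 1 : ℕ) : ℝ) * (Q * (4 * V ^ 4 * L * Q)) ≤ Q * (Q * (4 * V ^ 4 * L * Q)) := by gcongr
      _ = _ := by ring
  · have h3 : ∀ i ∈ blockIndex (V ^ 2) t, ∑ r ∈ Finset.Ioc 1 Q, (r / r.totient : ℝ) *
        ∑ χ ∈ primChars r, ‖vaughanBlock (V ^ 2) t (fun n => χ n) i‖ ≤ R := by
      intro i hi
      refine le_trans ?_ (sum_vaughanBlock_le hV htN hi)
      refine Finset.sum_le_sum_of_subset_of_nonneg (Finset.Ioc_subset_Ioc_left (by norm_num)) ?_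
      intro r _ _
      positivity
    refine (Finset.sum_le_sum h3).trans ?_
    rw [Finset.sum_const, nsmul_eq_mul]
    have hR0 : 0 ≤ R := by positivity
    have hc : ((blockIndex (V ^ 2) t).card : ℝ) ≤ 3 * (1 + L) := by
      have h4 := Finset.card_filter_le (Finset.range (Nat.log 2 t + 1))
        (fun i => V ^ 2 < 2 ^ (i + 1) ∧ V ^ 2 * 2 ^ i < t)
      rw [Finset.card_range] at h4
      have h5 : ((blockIndex (V ^ 2) t).card : ℝ) ≤ ((Nat.log 2 t + 1 : ℕ) : ℝ) := by exact_mod_cast h4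
      have h6 := natLog_two_le t
      linarith
    calc _ ≤ 3 * (1 + L) * R := by gcongr
      _ = _ := by rw [hR]; ring

/-- The sum of `|ψ(t, χ)|` over the primitive characters modulo `r`. -/
def primSum (t r : ℕ) : ℝ := ∑ χ ∈ primChars r, ‖psiChar χ t‖

lemma primSum_nonneg (t r : ℕ) : 0 ≤ primSum t r := Finset.sum_nonneg fun _ _ => norm_nonneg _

lemma inv_totient_mul_primSum_le {t r : ℕ} {P : ℝ} (hr : 0 < r)
    (hP : ∀ χ ∈ primChars r, ‖psiChar χ t‖ ≤ P) (hP0 : 0 ≤ P) :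
    (1 / r.totient : ℝ) * primSum t r ≤ P := by
  have hφ : (0 : ℝ) < r.totient := by exact_mod_cast Nat.totient_pos.2 hr
  have hc : ((primChars r).card : ℝ) ≤ r.totient := by exact_mod_cast card_primChars_le r
  have h1 : primSum t r ≤ r.totient * P := by
    refine (Finset.sum_le_sum hP).trans ?_
    rw [Finset.sum_const, nsmul_eq_mul]
    gcongr
  calc (1 / r.totient : ℝ) * primSum t r ≤ 1 / r.totient * (r.totient * P) := by gcongr
    _ = P := by field_simp

lemma sum_inv_totient_primSum_le {t R : ℕ} {P : ℝ} {s : Finset ℕ} (hs : s ⊆ Finset.Ioc 0 R)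
    (hP : ∀ r ∈ s, ∀ χ ∈ primChars r, ‖psiChar χ t‖ ≤ P) (hP0 : 0 ≤ P) :
    ∑ r ∈ s, (1 / r.totient : ℝ) * primSum t r ≤ R * P := by
  have h1 : ∀ r ∈ s, (1 / r.totient : ℝ) * primSum t r ≤ P := fun r hr =>
    inv_totient_mul_primSum_le (Finset.mem_Ioc.1 (hs hr)).1 (hP r hr) hP0
  refine (Finset.sum_le_sum h1).trans ?_
  rw [Finset.sum_const, nsmul_eq_mul]
  have : s.card ≤ R := by simpa using Finset.card_le_card hs
  gcongr

lemma sum_primSum_large_le {V R Q t N : ℕ} (hV : 1 ≤ V) (hR : 1 ≤ R) (htN : t ≤ N) (hQN : Q ≤ N) :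
    ∑ r ∈ Finset.Ioc R Q, (1 / r.totient : ℝ) * primSum t r ≤
    20000 * (1 + Real.log N) ^ 6 * (V ^ 4 * Q ^ 2 + N / R + N / V + Q * Real.sqrt N) := by
  have hL0 : 0 ≤ Real.log N := Real.log_natCast_nonneg N
  set L := Real.log N with hL
  have hVr : (1 : ℝ) ≤ V := by exact_mod_cast hV
  have hRr : (1 : ℝ) ≤ R := by exact_mod_cast hR
  have hsub : Finset.Ioc R Q ⊆ Finset.Ioc 0 Q := Finset.Ioc_subset_Ioc_left (Nat.zero_le _)
  rcases Nat.eq_zero_or_pos Q with hQ0 | hQ0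
  · subst hQ0
    simp only [Finset.Ioc_eq_empty_of_le (Nat.zero_le R), Finset.sum_empty]
    positivity
  have hQr : (1 : ℝ) ≤ Q := by exact_mod_cast hQ0
  rcases lt_or_ge t (V ^ 4) with ht | ht
  · refine (sum_inv_totient_primSum_le (P := V ^ 4 * L) hsub ?_ (by positivity)).trans ?_
    · intro r _ χ _
      refine (norm_psiChar_le χ t).trans ?_
      have : (t : ℝ) ≤ (V : ℝ) ^ 4 := by exact_mod_cast ht.le
      have h2 := log_nat_mono htN
      have h3 := Real.log_natCast_nonneg t
      gcongr
    · have h1 : L ≤ (1 + L) ^ 6 :=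
        (by linarith : L ≤ 1 + L).trans (le_self_pow₀ (by linarith) (by norm_num))
      have h2 : (Q : ℝ) ≤ Q ^ 2 := le_self_pow₀ hQr (by norm_num)
      have h3 : 0 ≤ N / R + N / V + Q * Real.sqrt N := by positivity
      calc (Q : ℝ) * (V ^ 4 * L) ≤ Q ^ 2 * (V ^ 4 * (1 + L) ^ 6) := by gcongr
        _ = 1 * (1 + L) ^ 6 * (V ^ 4 * Q ^ 2 + 0) := by ring
        _ ≤ 20000 * (1 + L) ^ 6 * (V ^ 4 * Q ^ 2 + (N / R + N / V + Q * Real.sqrt N)) := by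
          gcongr
          norm_num
        _ = _ := by ring
  set s := Real.sqrt N with hs
  have hs0 : 0 ≤ s := Real.sqrt_nonneg _
  set P : ℝ := 6144 * (1 + L) ^ 5 * (V ^ 4 * Q ^ 2 + N / R + N / V + Q * s) with hP
  have hmaps : ∀ r ∈ Finset.Ioc R Q, Nat.log 2 r ∈ Finset.range (Nat.log 2 Q + 1) := fun r hr =>
    Finset.mem_range.2 (Nat.lt_succ_of_le (Nat.log_mono_right (Finset.mem_Ioc.1 hr).2))
  rw [← Finset.sum_fiberwise_of_maps_to hmaps]
  have key : ∀ j ∈ Finset.range (Nat.log 2 Q + 1), ∑ r ∈ Finset.Ioc R Q with Nat.log 2 r = j,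
      (1 / r.totient : ℝ) * primSum t r ≤ P := by
    intro j hj
    have hjQ : 2 ^ j ≤ Q := Nat.pow_le_of_le_log hQ0.ne' (Nat.lt_succ_iff.1 (Finset.mem_range.1 hj))
    by_cases hjR : 2 ^ (j + 1) ≤ R
    · rw [Finset.sum_eq_zero]
      · positivity
      · intro r hr
        obtain ⟨h1, h2⟩ := Finset.mem_filter.1 hr
        have h3 := Nat.lt_pow_succ_log_self (b := 2) (by norm_num) r
        rw [h2] at h3
        have := (Finset.mem_Ioc.1 h1).1
        omega
    set T : ℕ := 2 ^ j with hT
    have hT2 : 2 ^ (j + 1) = 2 * T := by rw [pow_succ, hT]; ring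
    rw [hT2] at hjR
    have hT0 : 0 < T := by positivity
    have hTr : (0 : ℝ) < T := by exact_mod_cast hT0
    have h1 : ∑ r ∈ Finset.Ioc R Q with Nat.log 2 r = j, (1 / r.totient : ℝ) * primSum t r ≤
        1 / T * ∑ r ∈ Finset.Ioc 1 (2 * T), (r / r.totient : ℝ) * primSum t r := by
      rw [Finset.mul_sum]
      calc _ ≤ ∑ r ∈ Finset.Ioc R Q with Nat.log 2 r = j,
            (1 / T : ℝ) * ((r / r.totient : ℝ) * primSum t r) := by
            refine Finset.sum_le_sum fun r hr => ?_
            obtain ⟨h1, h2⟩ := Finset.mem_filter.1 hr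
            have h4 : r ≠ 0 := by have := (Finset.mem_Ioc.1 h1).1; omega
            have h3 := Nat.pow_log_le_self 2 h4
            rw [h2] at h3
            have h5 : (T : ℝ) ≤ r := by exact_mod_cast h3
            rw [← mul_assoc]
            refine mul_le_mul_of_nonneg_right ?_ (primSum_nonneg _ _)
            rw [div_mul_div_comm, one_mul, mul_comm, ← div_div]
            rw [div_right_comm]
            gcongr
            rwa [le_div_iff₀ hTr, one_mul]
        _ ≤ _ := by
            refine Finset.sum_le_sum_of_subset_of_nonneg ?_ fun r _ _ =>
              mul_nonneg (by positivity) (mul_nonneg (by positivity) (primSum_nonneg _ _))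
            intro r hr
            obtain ⟨h1, h2⟩ := Finset.mem_filter.1 hr
            have h3 := Nat.lt_pow_succ_log_self (b := 2) (by norm_num) r
            rw [h2, hT2] at h3
            have := (Finset.mem_Ioc.1 h1).1
            rw [Finset.mem_Ioc]
            omega
    refine h1.trans ?_
    have h2 := sum_norm_psiChar_le (Q := 2 * T) hV ht htN
    rw [← hL, ← hs] at h2
    have hTQ : (T : ℝ) ≤ Q := by exact_mod_cast hjQ
    have hRT : (R : ℝ) ≤ 2 * T := by exact_mod_cast (not_le.1 hjR).le
    have hN0 : (0 : ℝ) ≤ N := Nat.cast_nonneg N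
    have hL5 : L ≤ (1 + L) ^ 5 :=
        (by linarith : L ≤ 1 + L).trans (le_self_pow₀ (by linarith) (by norm_num))
    calc _ ≤ 1 / (T : ℝ) * (4 * V ^ 4 * L * (2 * T : ℕ) ^ 3 + 1536 * (1 + L) ^ 5 *
          (2 * N + 2 * (2 * T : ℕ) * N / V + (2 * T : ℕ) ^ 2 * s)) :=
          mul_le_mul_of_nonneg_left h2 (by positivity)
      _ = 32 * V ^ 4 * L * T ^ 2 + 6144 * (1 + L) ^ 5 * (N / (2 * T) + N / V + T * s) := by
          push_cast; field_simp; ring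
      _ ≤ 6144 * V ^ 4 * (1 + L) ^ 5 * Q ^ 2 + 6144 * (1 + L) ^ 5 * (N / R + N / V + Q * s) := by
          gcongr
          norm_num
      _ = P := by rw [hP]; ring
  refine (Finset.sum_le_sum key).trans ?_
  rw [Finset.sum_const, nsmul_eq_mul, Finset.card_range]
  have h6 := natLog_two_le Q
  have h7 := log_nat_mono hQN
  have hP0 : 0 ≤ P := by positivity
  have hX0 : 0 ≤ V ^ 4 * Q ^ 2 + N / R + N / V + Q * s := by positivity
  calc ((Nat.log 2 Q + 1 : ℕ) : ℝ) * P ≤ 3 * (1 + L) * P := by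
        gcongr
        linarith
    _ = 18432 * (1 + L) ^ 6 * (V ^ 4 * Q ^ 2 + N / R + N / V + Q * s) := by rw [hP]; ring
    _ ≤ _ := by gcongr; norm_num

/-- A Bombieri–Vinogradov type bound for primitive characters. -/
lemma bombieri_vinogradov (A : ℕ) : ∃ B : ℕ, ∃ C : ℝ, 0 < C ∧ ∀ N : ℕ, 3 ≤ N → ∀ t ≤ N, ∀ Q : ℕ,
    (Q : ℝ) ≤ Real.sqrt N / Real.log N ^ B →
    ∑ r ∈ Finset.Ioc 1 Q, (1 / r.totient : ℝ) * primSum t r ≤ C * N / Real.log N ^ A := by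
  obtain ⟨a, ha⟩ : ∃ a, a = A + 6 := ⟨_, rfl⟩
  obtain ⟨C1, hC1, hsw⟩ := siegel_walfisz (2 * a + A)
  obtain ⟨C2, hC2, hlog⟩ := log_pow_le_rpow (a + 1 + A) (ε := 1 / 2) (by norm_num)
  refine ⟨4 * a, 20000 * 64 * 19 + 4 * C1 * 2 ^ (2 * a + A) + 2 * C2, by positivity, ?_⟩
  intro N hN t ht Q hQ
  have hNr : (3 : ℝ) ≤ N := by exact_mod_cast hN
  have hL1 : 1 ≤ Real.log N := by
    rw [Real.le_log_iff_exp_le (by linarith)]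
    have := Real.exp_one_lt_d9
    linarith
  set L := Real.log N with hL
  set s := Real.sqrt N with hs
  have hs0 : 0 < s := Real.sqrt_pos.2 (by linarith)
  have hs2 : s ^ 2 = N := Real.sq_sqrt (by linarith)
  have hLa : 1 ≤ L ^ a := one_le_pow₀ hL1
  set V : ℕ := ⌈L ^ a⌉₊ with hV
  have hV1 : L ^ a ≤ V := Nat.le_ceil _
  have hV2 : (V : ℝ) ≤ 2 * L ^ a := by
    have := (Nat.ceil_lt_add_one (by positivity : 0 ≤ L ^ a)).le
    linarith
  have hV0 : 1 ≤ V := by exact_mod_cast hLa.trans hV1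
  have hLA : 0 < L ^ A := by positivity
  have hs1 : 1 ≤ s := by
    rw [hs, Real.one_le_sqrt]; linarith
  have hQN : Q ≤ N := by
    have : (Q : ℝ) ≤ N := by
      refine hQ.trans ((div_le_self hs0.le (one_le_pow₀ hL1)).trans ?_)
      nlinarith
    exact_mod_cast this
  have hsub : Finset.Ioc 1 Q ⊆ Finset.Ioc 1 V ∪ Finset.Ioc V Q := by
    intro r hr
    rw [Finset.mem_union, Finset.mem_Ioc, Finset.mem_Ioc]
    have := Finset.mem_Ioc.1 hr
    omega
  have hnn : ∀ r : ℕ, 0 ≤ (1 / r.totient : ℝ) * primSum t r := fun r =>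
    mul_nonneg (by positivity) (primSum_nonneg _ _)
  have hdisj : Disjoint (Finset.Ioc 1 V) (Finset.Ioc V Q) :=
    Finset.disjoint_left.2 fun x h1 h2 => by
      rw [Finset.mem_Ioc] at h1 h2; omega
  refine (Finset.sum_le_sum_of_subset_of_nonneg hsub fun r _ _ => hnn r).trans ?_
  rw [Finset.sum_union hdisj]
  have hbig := sum_primSum_large_le hV0 hV0 ht hQN
  rw [← hL, ← hs] at hbig
  have hpw : ∀ m n : ℕ, m ≤ n → L ^ m ≤ L ^ n := fun m n h => pow_le_pow_right₀ hL1 h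
  have hbig' : 20000 * (1 + L) ^ 6 * (V ^ 4 * Q ^ 2 + N / V + N / V + Q * s) ≤
      20000 * 64 * 19 * (N / L ^ A) := by
    have h1 : (1 + L) ^ 6 ≤ 64 * L ^ 6 := by
      calc (1 + L) ^ 6 ≤ (2 * L) ^ 6 := by gcongr; linarith
        _ = _ := by ring
    have h2 : (V : ℝ) ^ 4 * Q ^ 2 ≤ 16 * (N / L ^ a) := by
      calc (V : ℝ) ^ 4 * Q ^ 2 ≤ (2 * L ^ a) ^ 4 * (s / L ^ (4 * a)) ^ 2 := by gcongr
        _ = 16 * (s ^ 2 / L ^ (4 * a)) := by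
          field_simp
          ring
        _ ≤ 16 * (N / L ^ a) := by
          rw [hs2]
          have := hpw a (4 * a) (by omega)
          gcongr
    have h3 : (N : ℝ) / V ≤ N / L ^ a := by gcongr
    have h4 : (Q : ℝ) * s ≤ N / L ^ a := by
      calc (Q : ℝ) * s ≤ s / L ^ (4 * a) * s := by gcongr
        _ = N / L ^ (4 * a) := by rw [← hs2]; ring
        _ ≤ N / L ^ a := by
          have := hpw a (4 * a) (by omega)
          gcongr
    calc _ ≤ 20000 * (64 * L ^ 6) * (16 * (N / L ^ a) + N / L ^ a + N / L ^ a + N / L ^ a) := by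
          gcongr
      _ = 20000 * 64 * 19 * (N / L ^ A) := by
          rw [ha, pow_add]; field_simp; ring
  have hsmall : ∑ r ∈ Finset.Ioc 1 V, (1 / r.totient : ℝ) * primSum t r ≤
      (4 * C1 * 2 ^ (2 * a + A) + 2 * C2) * (N / L ^ A) := by
    rcases le_or_gt s t with hst | hst
    · have ht2 : 2 ≤ t := by
        have h1 : (1 : ℝ) < s := by rw [hs, Real.lt_sqrt (by norm_num)]; linarith
        have : (1 : ℝ) < t := h1.trans_le hst
        exact_mod_cast this
      have hlt : L / 2 ≤ Real.log t := by
        rw [hL, ← Real.log_sqrt (by linarith)]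
        exact Real.log_le_log hs0 hst
      have hP : ∀ r ∈ Finset.Ioc 1 V, ∀ χ ∈ primChars r, ‖psiChar χ t‖ ≤
          C1 * V * N / (L / 2) ^ (2 * a + A) := by
        intro r hr χ hχ
        obtain ⟨hr1, hrV⟩ := Finset.mem_Ioc.1 hr
        have : NeZero r := ⟨by omega⟩
        rw [mem_primChars] at hχ
        refine (hsw χ hχ (primChars_ne_one hr1 hχ) t ht2).trans ?_
        have h1 : (r : ℝ) ≤ V := by exact_mod_cast hrV
        have h2 : (t : ℝ) ≤ N := by exact_mod_cast ht
        gcongr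
      refine (sum_inv_totient_primSum_le (Finset.Ioc_subset_Ioc_left (Nat.zero_le 1)) hP
        (by positivity)).trans ?_
      calc (V : ℝ) * (C1 * V * N / (L / 2) ^ (2 * a + A))
          ≤ (2 * L ^ a) * (C1 * (2 * L ^ a) * N / (L / 2) ^ (2 * a + A)) := by gcongr
        _ = 4 * C1 * 2 ^ (2 * a + A) * (N / L ^ A) := by
          have h6 : L ^ (2 * a + A) = L ^ a * L ^ a * L ^ A := by ring
          rw [div_pow, h6]; field_simp; ring
        _ ≤ _ := by
          gcongr
          linarith
    · have hP : ∀ r ∈ Finset.Ioc 1 V, ∀ χ ∈ primChars r, ‖psiChar χ t‖ ≤ s * L := by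
        intro r _ χ _
        refine (norm_psiChar_le χ t).trans ?_
        have := log_nat_mono ht
        have h3 := Real.log_natCast_nonneg t
        gcongr
      refine (sum_inv_totient_primSum_le (Finset.Ioc_subset_Ioc_left (Nat.zero_le 1)) hP
        (by positivity)).trans ?_
      have h5 := hlog N (by linarith)
      rw [← Real.sqrt_eq_rpow, ← hL, ← hs] at h5
      calc (V : ℝ) * (s * L) ≤ 2 * L ^ a * (s * L) := by gcongr
        _ = 2 * (s * L ^ (a + 1 + A)) / L ^ A := by rw [pow_add, pow_add]; field_simp
        _ ≤ 2 * (s * (C2 * s)) / L ^ A := by gcongr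
        _ = 2 * C2 * (N / L ^ A) := by rw [← hs2]; ring
        _ ≤ _ := by
          gcongr
          have : 0 ≤ 4 * C1 * 2 ^ (2 * a + A) := by positivity
          linarith
  calc _ ≤ (4 * C1 * 2 ^ (2 * a + A) + 2 * C2) * (N / L ^ A) + 20000 * 64 * 19 * (N / L ^ A) :=
        add_le_add hsmall (hbig.trans hbig')
    _ = _ := by ring

/-- The weight `log p` on primes. -/
def primeLog (n : ℕ) : ℝ := if n.Prime then Real.log n else 0

lemma primeLog_nonneg (n : ℕ) : 0 ≤ primeLog n := by
  rw [primeLog]; split_ifs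
  · exact Real.log_natCast_nonneg n
  · exact le_rfl

lemma primeLog_le_vonMangoldt (n : ℕ) : primeLog n ≤ ArithmeticFunction.vonMangoldt n := by
  rw [primeLog]; split_ifs with h
  · rw [ArithmeticFunction.vonMangoldt_apply_prime h]
  · exact ArithmeticFunction.vonMangoldt_nonneg

lemma primeLog_le_log {n N : ℕ} (h : n ≤ N) : primeLog n ≤ Real.log N := by
  rw [primeLog]; split_ifs
  · exact log_nat_mono h
  · exact Real.log_natCast_nonneg N

lemma sum_primeLog_le (N : ℕ) : ∑ n ∈ Finset.Ioc 0 N, primeLog n ≤ 6 * N := by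
  refine (Finset.sum_le_sum fun n _ => primeLog_le_vonMangoldt n).trans ?_
  have h := Chebyshev.psi_le_const_mul_self (x := N) (Nat.cast_nonneg N)
  rw [Chebyshev.psi, Nat.floor_natCast] at h
  refine h.trans ?_
  have h4 : Real.log 4 = 2 * Real.log 2 := by
    rw [show (4 : ℝ) = 2 ^ 2 by norm_num, Real.log_pow]; norm_num
  have := Real.log_two_lt_d9
  gcongr
  linarith

lemma sum_vonMangoldt_sub_primeLog_le (t : ℕ) :
    ∑ n ∈ Finset.Ioc 0 t, (ArithmeticFunction.vonMangoldt n - primeLog n) ≤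
      2 * Real.sqrt t * Real.log t := by
  rcases Nat.eq_zero_or_pos t with rfl | ht
  · simp
  have h := Chebyshev.abs_psi_sub_theta_le_sqrt_mul_log (x := t) (by exact_mod_cast ht)
  rw [Chebyshev.psi, Chebyshev.theta, Nat.floor_natCast] at h
  refine le_trans (le_of_eq ?_) ((le_abs_self _).trans h)
  rw [Finset.sum_sub_distrib, Finset.sum_filter]
  rfl

lemma norm_sum_vonMangoldt_sub_le {t N : ℕ} (htN : t ≤ N) {f : ℕ → ℂ} (hf : ∀ n, ‖f n‖ ≤ 1) :
    ‖∑ n ∈ Finset.Ioc 0 t, (ArithmeticFunction.vonMangoldt n : ℂ) * f n -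
      ∑ n ∈ Finset.Ioc 0 t, (primeLog n : ℂ) * f n‖ ≤ 2 * Real.sqrt N * Real.log N := by
  rw [← Finset.sum_sub_distrib]
  have h1 : 2 * Real.sqrt t * Real.log t ≤ 2 * Real.sqrt N * Real.log N := by
    have := log_nat_mono htN
    have h3 := Real.log_natCast_nonneg t
    have : (t : ℝ) ≤ N := by exact_mod_cast htN
    gcongr
  refine (norm_sum_le _ _).trans (le_trans (Finset.sum_le_sum fun n _ => ?_)
    ((sum_vonMangoldt_sub_primeLog_le t).trans h1))
  rw [← sub_mul, norm_mul, ← Complex.ofReal_sub, Complex.norm_real, Real.norm_eq_abs,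
    abs_of_nonneg (sub_nonneg.2 (primeLog_le_vonMangoldt n))]
  exact mul_le_of_le_one_right (sub_nonneg.2 (primeLog_le_vonMangoldt n)) (hf n)

lemma sum_primeLog_not_coprime_le {m : ℕ} (hm : 0 < m) (t : ℕ) :
    ∑ n ∈ Finset.Ioc 0 t with ¬ n.Coprime m, primeLog n ≤ Real.log m := by
  have h1 : ∑ n ∈ Finset.Ioc 0 t with ¬ n.Coprime m, primeLog n ≤
      ∑ p ∈ m.primeFactors, Real.log p := by
    have e : ∑ n ∈ Finset.Ioc 0 t with ¬ n.Coprime m, primeLog n =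
        ∑ n ∈ (Finset.Ioc 0 t).filter (fun n => ¬ n.Coprime m) with n.Prime, Real.log n := by
      rw [Finset.sum_filter (fun n : ℕ => n.Prime)]
      rfl
    rw [e]
    refine Finset.sum_le_sum_of_subset_of_nonneg ?_ fun n _ _ => Real.log_natCast_nonneg n
    intro n hn
    obtain ⟨h1, h2⟩ := Finset.mem_filter.1 hn
    have h3 := (Finset.mem_filter.1 h1).2
    rw [h2.coprime_iff_not_dvd, not_not] at h3
    exact Nat.mem_primeFactors.2 ⟨h2, h3, hm.ne'⟩
  refine h1.trans ?_
  rw [← Real.log_prod fun p hp => by exact_mod_cast (Nat.prime_of_mem_primeFactors hp).ne_zero]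
  rw [← Nat.cast_prod]
  exact log_nat_mono (Nat.le_of_dvd hm (Nat.prod_primeFactors_dvd m))

/-- The sum `∑_{p ≤ t} χ(p) log p`. -/
def thetaChar {r : ℕ} (χ : DirichletCharacter ℂ r) (t : ℕ) : ℂ :=
  ∑ n ∈ Finset.Ioc 0 t, (primeLog n : ℂ) * χ n

lemma norm_thetaChar_le {r : ℕ} (χ : DirichletCharacter ℂ r) {t N : ℕ} (htN : t ≤ N) :
    ‖thetaChar χ t‖ ≤ ‖psiChar χ t‖ + 2 * Real.sqrt N * Real.log N := by
  have h := norm_sum_vonMangoldt_sub_le htN (f := fun n => χ n) fun n => χ.norm_le_one n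
  rw [← psiChar_eq_sum_Ioc] at h
  have h2 := norm_le_norm_add_norm_sub' (thetaChar χ t) (psiChar χ t)
  rw [norm_sub_rev] at h2
  exact h2.trans (by gcongr; exact h)

lemma norm_thetaChar_le_primitive {m : ℕ} (hm : 0 < m) (ψ : DirichletCharacter ℂ m) (t : ℕ) :
    ‖thetaChar ψ t‖ ≤ ‖thetaChar ψ.primitiveCharacter t‖ + Real.log m := by
  have h : ‖thetaChar ψ t - thetaChar ψ.primitiveCharacter t‖ ≤ Real.log m := by
    rw [thetaChar, thetaChar, ← Finset.sum_sub_distrib]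
    refine (norm_sum_le _ _).trans (le_trans ?_ (sum_primeLog_not_coprime_le hm t))
    rw [Finset.sum_filter]
    refine Finset.sum_le_sum fun n _ => ?_
    rw [← mul_sub, norm_mul, Complex.norm_real, Real.norm_eq_abs, abs_of_nonneg (primeLog_nonneg n)]
    by_cases hc : n.Coprime m
    swap
    · rw [if_pos hc]
      refine mul_le_of_le_one_right (primeLog_nonneg n) ?_
      have hu : ¬ IsUnit (n : ZMod m) := by rwa [ZMod.isUnit_iff_coprime]
      rw [MulChar.map_nonunit _ hu, zero_sub, norm_neg]
      exact ψ.primitiveCharacter.norm_le_one _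
    · rw [if_neg (not_not.2 hc)]
      have := ψ.primitiveCharacter_apply_of_isCoprime (a := n) (Nat.isCoprime_iff_coprime.2 hc)
      rw [Int.cast_natCast, Int.cast_natCast] at this
      rw [this, sub_self, norm_zero, mul_zero]
  have := norm_le_norm_add_norm_sub' (thetaChar ψ t) (thetaChar ψ.primitiveCharacter t)
  linarith

lemma sum_conductor_le {m r : ℕ} (hm : 0 < m) (t : ℕ) :
    ∑ ψ : DirichletCharacter ℂ m with ψ.conductor = r, ‖psiChar ψ.primitiveCharacter t‖ ≤
      primSum t r := by
  classical
  have : NeZero m := ⟨hm.ne'⟩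
  by_cases hrm : r ∣ m
  · have hr0 : r ≠ 0 := fun h => by subst h; exact hm.ne' (Nat.eq_zero_of_zero_dvd hrm)
    have : NeZero r := ⟨hr0⟩
    have key : ∀ χ : DirichletCharacter ℂ r, ∀ ψ : DirichletCharacter ℂ m, ψ.conductor = r →
        DirichletCharacter.changeLevel hrm χ = ψ →
        ‖psiChar ψ.primitiveCharacter t‖ = ‖psiChar χ t‖ := by
      intro χ ψ h1 h2
      subst h1
      rw [DirichletCharacter.changeLevel_injective hrm
        (h2.trans ψ.changeLevel_primitiveCharacter.symm)]
    have hex : ∀ ψ : DirichletCharacter ℂ m, ψ.conductor = r →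
        ∃ χ : DirichletCharacter ℂ r, χ.IsPrimitive ∧ DirichletCharacter.changeLevel hrm χ = ψ := by
      intro ψ h1
      subst h1
      exact ⟨_, ψ.primitiveCharacter_isPrimitive, ψ.changeLevel_primitiveCharacter⟩
    have hsub : (univ.filter fun ψ : DirichletCharacter ℂ m => ψ.conductor = r) ⊆
        (primChars r).image (DirichletCharacter.changeLevel hrm) := by
      intro ψ hψ
      obtain ⟨χ, h1, h2⟩ := hex ψ (Finset.mem_filter.1 hψ).2
      exact Finset.mem_image.2 ⟨χ, mem_primChars.2 h1, h2⟩
    choose! f hf1 hf2 using hex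
    have hinj : Set.InjOn f (univ.filter fun ψ : DirichletCharacter ℂ m => ψ.conductor = r) := by
      intro a ha b hb hab
      rw [← hf2 a (Finset.mem_filter.1 ha).2, ← hf2 b (Finset.mem_filter.1 hb).2, hab]
    calc _ = ∑ ψ : DirichletCharacter ℂ m with ψ.conductor = r, ‖psiChar (f ψ) t‖ :=
          Finset.sum_congr rfl fun ψ hψ =>
            key _ _ (Finset.mem_filter.1 hψ).2 (hf2 ψ (Finset.mem_filter.1 hψ).2)
      _ = ∑ χ ∈ (univ.filter fun ψ : DirichletCharacter ℂ m => ψ.conductor = r).image f,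
            ‖psiChar χ t‖ := (Finset.sum_image (f := fun χ => ‖psiChar χ t‖) hinj).symm
      _ ≤ _ := by
          refine Finset.sum_le_sum_of_subset_of_nonneg ?_ fun _ _ _ => norm_nonneg _
          intro χ hχ
          obtain ⟨ψ, hψ, rfl⟩ := Finset.mem_image.1 hχ
          exact mem_primChars.2 (hf1 ψ (Finset.mem_filter.1 hψ).2)
  · rw [Finset.sum_eq_zero]
    · exact primSum_nonneg _ _
    · intro ψ hψ
      exact absurd ((Finset.mem_filter.1 hψ).2 ▸ ψ.conductor_dvd_level) hrm

lemma card_dirichletCharacter {m : ℕ} (hm : 0 < m) :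
    Fintype.card (DirichletCharacter ℂ m) = m.totient := by
  have : NeZero m := ⟨hm.ne'⟩
  rw [← Nat.card_eq_fintype_card]
  exact DirichletCharacter.card_eq_totient_of_hasEnoughRootsOfUnity ℂ m

lemma sum_norm_thetaChar_le {m t N : ℕ} [NeZero m] (hm : 0 < m) (htN : t ≤ N) :
    ∑ ψ ∈ (univ : Finset (DirichletCharacter ℂ m)).erase 1, ‖thetaChar ψ t‖ ≤
      ∑ r ∈ m.divisors.erase 1, primSum t r +
        m.totient * (2 * Real.sqrt N * Real.log N + Real.log m) := by
  set E := 2 * Real.sqrt N * Real.log N + Real.log m with hE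
  have hE0 : 0 ≤ E := by
    have := Real.log_natCast_nonneg N
    have := Real.log_natCast_nonneg m
    positivity
  have h1 : ∀ ψ : DirichletCharacter ℂ m,
      ‖thetaChar ψ t‖ ≤ ‖psiChar ψ.primitiveCharacter t‖ + E := fun ψ => by
    have h2 := norm_thetaChar_le_primitive hm ψ t
    have h3 := norm_thetaChar_le ψ.primitiveCharacter htN
    linarith
  refine (Finset.sum_le_sum fun ψ _ => h1 ψ).trans ?_
  rw [Finset.sum_add_distrib]
  refine add_le_add ?_ ?_
  · have hmaps : ∀ ψ ∈ (univ : Finset (DirichletCharacter ℂ m)).erase 1,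
        ψ.conductor ∈ m.divisors.erase 1 := by
      intro ψ hψ
      rw [Finset.mem_erase, Nat.mem_divisors]
      refine ⟨fun h => (Finset.mem_erase.1 hψ).1 (DirichletCharacter.eq_one_iff_conductor_eq_one.2 h),
        ψ.conductor_dvd_level, hm.ne'⟩
    rw [← Finset.sum_fiberwise_of_maps_to hmaps]
    refine Finset.sum_le_sum fun r _ => le_trans ?_ (sum_conductor_le hm t)
    refine Finset.sum_le_sum_of_subset_of_nonneg ?_ fun _ _ _ => norm_nonneg _
    intro ψ hψ
    simp only [Finset.mem_filter] at hψ ⊢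
    exact ⟨Finset.mem_univ _, hψ.2⟩
  · rw [Finset.sum_const, nsmul_eq_mul]
    refine mul_le_mul_of_nonneg_right ?_ hE0
    rw [← card_dirichletCharacter hm]
    exact_mod_cast Finset.card_erase_le

lemma eq_sum_characters {m : ℕ} (hm : 0 < m) {G : ZMod m → ℂ} (hG : ∀ x, G x ≠ 0 → IsUnit x)
    (y : ZMod m) : G y = (1 / m.totient : ℂ) * ∑ ψ : DirichletCharacter ℂ m,
      (haveI : NeZero m := ⟨hm.ne'⟩; ∑ x : ZMod m, G x * ψ x⁻¹) * ψ y := by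
  have : NeZero m := ⟨hm.ne'⟩
  have hφ : (m.totient : ℂ) ≠ 0 := by exact_mod_cast (Nat.totient_pos.2 hm).ne'
  simp only [Finset.sum_mul]
  rw [Finset.sum_comm]
  have h1 : ∀ x : ZMod m, ∑ ψ : DirichletCharacter ℂ m, G x * ψ x⁻¹ * ψ y =
      if x = y then G x * m.totient else 0 := by
    intro x
    by_cases hx : G x = 0
    · simp [hx]
    · simp only [mul_assoc]
      rw [← Finset.mul_sum, DirichletCharacter.sum_char_inv_mul_char_eq ℂ (hG x hx) y]
      split_ifs <;> simp
  rw [Finset.sum_congr rfl fun x _ => h1 x, Finset.sum_ite_eq' Finset.univ y, if_pos (Finset.mem_univ _)]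
  field_simp

/-- Sums over primes of a function on the units modulo `m` with mean zero. -/
lemma norm_sum_primeLog_mean_zero_le {m t N : ℕ} (hm : 0 < m) (htN : t ≤ N) {g : ℕ → ℂ} {S : ℕ}
    (hper : Function.Periodic g m) (hcop : ∀ n, g n ≠ 0 → n.Coprime m) (hg : ∀ n, ‖g n‖ ≤ 1)
    (hsum : ∑ n ∈ Finset.range m, g n = 0)
    (hS : ((Finset.range m).filter fun n => g n ≠ 0).card ≤ S) :
    ‖∑ n ∈ Finset.Ioc 0 t, (primeLog n : ℂ) * g n‖ ≤
      S * ((1 / m.totient : ℝ) * ∑ r ∈ m.divisors.erase 1, primSum t r +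
        (2 * Real.sqrt N * Real.log N + Real.log m)) := by
  have : NeZero m := ⟨hm.ne'⟩
  set G : ZMod m → ℂ := fun x => g x.val with hGdef
  have hgG : ∀ n : ℕ, g n = G n := fun n => by
    simp only [hGdef, ZMod.val_natCast]
    exact (hper.map_mod_nat n).symm
  have hG : ∀ x, G x ≠ 0 → IsUnit x := fun x hx => by
    have := hcop _ hx
    rwa [← ZMod.isUnit_iff_coprime, ZMod.natCast_zmod_val] at this
  have hφ : (0 : ℝ) < m.totient := by exact_mod_cast Nat.totient_pos.2 hm
  set c : DirichletCharacter ℂ m → ℂ := fun ψ => ∑ x : ZMod m, G x * ψ x⁻¹ with hc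
  have hcS : ∀ ψ, ‖c ψ‖ ≤ S := by
    intro ψ
    have h1 : ∑ x : ZMod m, ‖G x * ψ x⁻¹‖ ≤ ∑ x : ZMod m, if G x ≠ 0 then (1 : ℝ) else 0 := by
      refine Finset.sum_le_sum fun x _ => ?_
      split_ifs with hx
      · rw [norm_mul]
        exact mul_le_one₀ (hg _) (norm_nonneg _) (ψ.norm_le_one _)
      · rw [not_not] at hx
        simp [hx]
    refine (norm_sum_le _ _).trans (h1.trans ?_)
    rw [← Finset.sum_filter, Finset.sum_const, nsmul_eq_mul, mul_one]
    refine Nat.cast_le.2 (le_trans ?_ hS)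
    refine Finset.card_le_card_of_injOn ZMod.val (fun x hx => ?_) (ZMod.val_injective m).injOn
    rw [Finset.mem_coe, Finset.mem_filter] at hx ⊢
    exact ⟨Finset.mem_range.2 (ZMod.val_lt x), hx.2⟩
  have hc1 : c 1 = 0 := by
    have : c 1 = ∑ x : ZMod m, G x := by
      refine Finset.sum_congr rfl fun x _ => ?_
      by_cases hx : G x = 0
      · simp [hx]
      · have h1 : IsUnit x⁻¹ := by
          obtain ⟨u, rfl⟩ := hG x hx
          rw [ZMod.inv_coe_unit]
          exact u⁻¹.isUnit
        rw [MulChar.one_apply h1, mul_one]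
    rw [this, ← sum_range_zmod]
    simpa only [← hgG] using hsum
  have e : ∑ n ∈ Finset.Ioc 0 t, (primeLog n : ℂ) * g n =
      (1 / m.totient : ℂ) * ∑ ψ : DirichletCharacter ℂ m, c ψ * thetaChar ψ t := by
    simp only [thetaChar, Finset.mul_sum]
    rw [Finset.sum_comm]
    refine Finset.sum_congr rfl fun n _ => ?_
    rw [hgG n, eq_sum_characters hm hG n, Finset.mul_sum, Finset.mul_sum]
    exact Finset.sum_congr rfl fun ψ _ => by ring
  have h2 : ‖∑ ψ : DirichletCharacter ℂ m, c ψ * thetaChar ψ t‖ ≤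
      S * ∑ ψ ∈ (univ : Finset (DirichletCharacter ℂ m)).erase 1, ‖thetaChar ψ t‖ := by
    rw [Finset.mul_sum, ← Finset.sum_erase (a := 1) _ (by rw [hc1, zero_mul])]
    refine (norm_sum_le _ _).trans (Finset.sum_le_sum fun ψ _ => ?_)
    rw [norm_mul]
    exact mul_le_mul_of_nonneg_right (hcS ψ) (norm_nonneg _)
  rw [e, norm_mul]
  have h3 : ‖(1 / m.totient : ℂ)‖ = 1 / m.totient := by simp
  rw [h3]
  calc _ ≤ (1 / m.totient : ℝ) * (S * (∑ r ∈ m.divisors.erase 1, primSum t r +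
        m.totient * (2 * Real.sqrt N * Real.log N + Real.log m))) := by
        refine mul_le_mul_of_nonneg_left (h2.trans ?_) (by positivity)
        exact mul_le_mul_of_nonneg_left (sum_norm_thetaChar_le hm htN) (Nat.cast_nonneg _)
    _ = _ := by field_simp

lemma sum_inv_totient_dilate_le {k D t : ℕ} (hk : 0 < k) :
    ∑ δ ∈ Finset.Ioc 0 D, (1 / (k * δ).totient : ℝ) *
      ∑ r ∈ (k * δ).divisors.erase 1, primSum t r ≤
    (1 + Real.log (k * D : ℕ)) ^ 2 *
      ∑ r ∈ Finset.Ioc 1 (k * D), (1 / r.totient : ℝ) * primSum t r := by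
  set Y := k * D with hY
  have hf : ∀ m : ℕ, 0 ≤ (1 / m.totient : ℝ) * ∑ r ∈ m.divisors.erase 1, primSum t r := fun m =>
    mul_nonneg (by positivity) (Finset.sum_nonneg fun r _ => primSum_nonneg t r)
  have h1 : ∑ δ ∈ Finset.Ioc 0 D, (1 / (k * δ).totient : ℝ) *
      ∑ r ∈ (k * δ).divisors.erase 1, primSum t r ≤
      ∑ m ∈ Finset.Ioc 0 Y, (1 / m.totient : ℝ) * ∑ r ∈ m.divisors.erase 1, primSum t r := by
    have hinj : Set.InjOn (fun δ => k * δ) (Finset.Ioc 0 D : Finset ℕ) := fun a _ b _ h =>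
      Nat.eq_of_mul_eq_mul_left hk h
    rw [← Finset.sum_image (f := fun m : ℕ => (1 / m.totient : ℝ) *
      ∑ r ∈ m.divisors.erase 1, primSum t r) hinj]
    refine Finset.sum_le_sum_of_subset_of_nonneg ?_ fun m _ _ => hf m
    intro m hm
    obtain ⟨δ, hδ, rfl⟩ := Finset.mem_image.1 hm
    rw [Finset.mem_Ioc] at hδ ⊢
    exact ⟨Nat.mul_pos hk hδ.1, Nat.mul_le_mul_left k hδ.2⟩
  refine h1.trans ?_
  set F : ℕ → ℕ → ℝ := fun d e => if d = 1 then 0 else primSum t d / (d * e).totient with hF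
  have h2 : ∀ m ∈ Finset.Ioc 0 Y, (1 / m.totient : ℝ) * ∑ r ∈ m.divisors.erase 1, primSum t r =
      ∑ x ∈ m.divisorsAntidiagonal, F x.1 x.2 := by
    intro m _
    have e1 : ∑ x ∈ m.divisorsAntidiagonal, F x.1 x.2 =
        ∑ x ∈ m.divisorsAntidiagonal, (fun d _ => if d = 1 then 0 else primSum t d / m.totient)
          x.1 x.2 := by
      refine Finset.sum_congr rfl fun x hx => ?_
      simp only [hF]
      rw [(Nat.mem_divisorsAntidiagonal.1 hx).1]
    rw [e1, Nat.sum_divisorsAntidiagonal (fun d _ => if d = 1 then 0 else primSum t d / m.totient),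
      Finset.mul_sum]
    by_cases h1m : 1 ∈ m.divisors
    · rw [← Finset.add_sum_erase _ _ h1m, if_pos rfl, zero_add]
      refine Finset.sum_congr rfl fun r hr => ?_
      rw [if_neg (Finset.mem_erase.1 hr).1]
      ring
    · rw [Finset.erase_eq_of_notMem h1m]
      refine Finset.sum_congr rfl fun r hr => ?_
      rw [if_neg (fun h : r = 1 => h1m (h ▸ hr))]
      ring
  rw [Finset.sum_congr rfl h2, sum_Ioc_divisorsAntidiagonal F Y]
  rw [Finset.mul_sum]
  have hsub : Finset.Ioc 1 Y ⊆ Finset.Ioc 0 Y := Finset.Ioc_subset_Ioc_left (Nat.zero_le 1)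
  rw [← Finset.sum_subset hsub]
  · refine Finset.sum_le_sum fun d hd => ?_
    obtain ⟨hd1, hdY⟩ := Finset.mem_Ioc.1 hd
    have hφd : (0 : ℝ) < d.totient := by exact_mod_cast Nat.totient_pos.2 (by omega)
    have h3 : ∀ e ∈ Finset.Ioc 0 (Y / d), F d e ≤ (1 / d.totient : ℝ) * primSum t d * (1 / e.totient) := by
      intro e he
      simp only [hF]
      rw [if_neg (by omega)]
      have hφe : (0 : ℝ) < e.totient := by
        exact_mod_cast Nat.totient_pos.2 (Finset.mem_Ioc.1 he).1
      have h4 : (d.totient : ℝ) * e.totient ≤ (d * e).totient := by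
        exact_mod_cast Nat.totient_super_multiplicative d e
      calc primSum t d / (d * e).totient ≤ primSum t d / (d.totient * e.totient) :=
            div_le_div_of_nonneg_left (primSum_nonneg _ _) (by positivity) h4
        _ = _ := by field_simp
    refine (Finset.sum_le_sum h3).trans ?_
    rw [← Finset.mul_sum, mul_comm]
    refine mul_le_mul_of_nonneg_right ((sum_inv_totient_le _).trans ?_)
      (mul_nonneg (by positivity) (primSum_nonneg _ _))
    have h5 := log_nat_mono (Nat.div_le_self Y d)
    have h6 := Real.log_natCast_nonneg (Y / d)
    gcongr
  · intro d hd hd'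
    have : d = 1 := by
      rw [Finset.mem_Ioc] at hd hd'
      omega
    refine Finset.sum_eq_zero fun e _ => ?_
    simp only [hF, if_pos this]

lemma inv_totient_mul_sum_divisors_le {q t : ℕ} (hq : 0 < q) :
    (1 / q.totient : ℝ) * ∑ r ∈ q.divisors.erase 1, primSum t r ≤
      ∑ r ∈ Finset.Ioc 1 q, (1 / r.totient : ℝ) * primSum t r := by
  rw [Finset.mul_sum]
  have hsub : q.divisors.erase 1 ⊆ Finset.Ioc 1 q := by
    intro r hr
    obtain ⟨h1, h2⟩ := Finset.mem_erase.1 hr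
    have h3 := Nat.pos_of_mem_divisors h2
    have h4 := Nat.divisor_le h2
    rw [Finset.mem_Ioc]
    omega
  refine le_trans (Finset.sum_le_sum fun r hr => ?_) (Finset.sum_le_sum_of_subset_of_nonneg hsub
    fun r _ _ => mul_nonneg (by positivity) (primSum_nonneg t r))
  have h1 := Nat.dvd_of_mem_divisors (Finset.mem_erase.1 hr).2
  have h2 : r.totient ≤ q.totient := Nat.le_of_dvd (Nat.totient_pos.2 hq) (Nat.totient_dvd_of_dvd h1)
  have h3 : (0 : ℝ) < r.totient := by
    exact_mod_cast Nat.totient_pos.2 (Nat.pos_of_dvd_of_pos h1 hq)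
  refine mul_le_mul_of_nonneg_right ?_ (primSum_nonneg t r)
  have : (r.totient : ℝ) ≤ q.totient := by exact_mod_cast h2
  gcongr

/-- If `g` changes sign under a shift then it has mean zero over a period. -/
lemma sum_range_eq_zero_of_antiperiodic {g : ℕ → ℂ} {m s : ℕ} (hper : Function.Periodic g m)
    (hs : ∀ n, g (n + s) = -g n) : ∑ n ∈ Finset.range m, g n = 0 := by
  have h1 : ∀ k, ∑ n ∈ Finset.range m, g (n + k) = ∑ n ∈ Finset.range m, g n := by
    intro k
    induction k with
    | zero => simp
    | succ k ih =>
      rw [← ih]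
      have e1 := Finset.sum_range_succ' (fun n => g (n + k)) m
      have e2 := Finset.sum_range_succ (fun n => g (n + k)) m
      have e3 : g (m + k) = g (0 + k) := by rw [add_comm m k, hper k, zero_add]
      rw [e2] at e1
      rw [e3] at e1
      have e4 := add_right_cancel e1
      rw [e4]
      exact Finset.sum_congr rfl fun n _ => by rw [add_right_comm, add_assoc]
  have h2 := h1 s
  simp only [hs, Finset.sum_neg_distrib] at h2
  exact self_eq_neg.1 h2.symm

lemma ex_add_int_mul_div {q : ℕ} (hq : 0 < q) (a : ℤ) (n k : ℕ) :
    ex (((n + q * k : ℕ) : ℝ) * (a / q)) = ex (n * (a / q)) := by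
  have : ((n + q * k : ℕ) : ℝ) * (a / q) = n * (a / q) + ((k * a : ℤ) : ℝ) := by
    have : (q : ℝ) ≠ 0 := by exact_mod_cast hq.ne'
    push_cast; field_simp
  rw [this, ex_add_int]

lemma norm_sum_primeLog_four_dvd_le {q t N : ℕ} {a : ℤ} {Z : ℝ} (hq : 0 < q) (h4 : 4 ∣ q)
    (hcop : IsCoprime a (q : ℤ)) (htN : t ≤ N)
    (hZ : ∑ r ∈ Finset.Ioc 1 q, (1 / r.totient : ℝ) * primSum t r ≤ Z) :
    ‖∑ n ∈ Finset.Ioc 0 t, (primeLog n : ℂ) * (if n.Coprime q then ex (n * (a / q)) else 0)‖ ≤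
      q * (Z + (2 * Real.sqrt N * Real.log N + Real.log q)) := by
  have hqr : (q : ℝ) ≠ 0 := by exact_mod_cast hq.ne'
  refine (norm_sum_primeLog_mean_zero_le hq htN (S := q)
    (g := fun n => if n.Coprime q then ex (n * (a / q)) else 0) ?_ ?_ ?_ ?_ ?_).trans ?_
  · intro n
    have h1 := ex_add_int_mul_div hq a n 1
    rw [mul_one] at h1
    simp only [h1, Nat.coprime_add_self_left]
  · intro n hn
    by_contra h
    exact hn (if_neg h)
  · intro n
    split_ifs
    · rw [norm_ex]
    · simp
  · refine sum_range_eq_zero_of_antiperiodic (s := q / 2) ?_ ?_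
    · intro n
      have h1 := ex_add_int_mul_div hq a n 1
      rw [mul_one] at h1
      simp only [h1, Nat.coprime_add_self_left]
    · intro n
      obtain ⟨u, hu⟩ := h4
      have hq2 : q / 2 = 2 * u := by omega
      have hc : (n + q / 2).Coprime q ↔ n.Coprime q := by
        rw [hq2]
        have e1 : q = 2 * u * 2 := by omega
        have e2 : ∀ x : ℕ, x.Coprime q ↔ x.Coprime (2 * u) := by
          intro x
          rw [e1]
          constructor
          · exact fun h => Nat.Coprime.coprime_mul_right_right h
          · exact fun h => h.mul_right (Nat.Coprime.coprime_mul_right_right h)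
        rw [e2, e2, Nat.coprime_add_self_left]
      have ha : Odd a := by
        rw [← Int.not_even_iff_odd]
        intro h
        have h2 : (2 : ℤ) ∣ q := by rw [hu]; exact ⟨2 * u, by push_cast; ring⟩
        have h3 := hcop.isUnit_of_dvd' h.two_dvd h2
        rw [Int.isUnit_iff] at h3
        omega
      obtain ⟨b, hb⟩ := ha
      have hex : ex (((n + q / 2 : ℕ) : ℝ) * (a / q)) = -ex (n * (a / q)) := by
        have e1 : ((n + q / 2 : ℕ) : ℝ) * (a / q) = n * (a / q) + 1 / 2 + (b : ℝ) := by
          have : ((q / 2 : ℕ) : ℝ) = q / 2 := by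
            rw [hq2]; rw [hu]; push_cast; ring
          rw [Nat.cast_add, this, hb]; push_cast; field_simp; ring
        have e2 : ex (1 / 2) = -1 := by
          rw [ex]
          push_cast
          rw [show 2 * (Real.pi : ℂ) * (1 / 2) * Complex.I = Real.pi * Complex.I by ring,
            Complex.exp_pi_mul_I]
        rw [e1, ex_add_int, ex_add, e2, mul_neg_one]
      simp only [hc, hex]
      split_ifs <;> simp
  · refine (Finset.card_filter_le _ _).trans (by simp)
  · refine mul_le_mul_of_nonneg_left ?_ (Nat.cast_nonneg _)
    have := (inv_totient_mul_sum_divisors_le (t := t) hq).trans hZ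
    linarith

lemma abs_chi4_le (n : ℕ) : |chi4 n| ≤ 1 := by
  rw [chi4]; split_ifs <;> simp

lemma chi4_add_two_mod {k s : ℕ} (hs : s % 4 = 2) : chi4 (k + s) = -chi4 k := by
  have h : k % 4 < 4 := Nat.mod_lt _ (by norm_num)
  have h2 : (k + s) % 4 = (k % 4 + 2) % 4 := by omega
  rw [chi4, chi4, h2]
  interval_cases k % 4 <;> simp

lemma chi4_add_four_mul (k s : ℕ) : chi4 (k + 4 * s) = chi4 k := by
  rw [chi4, chi4, Nat.add_mul_mod_self_left]

/-- The function `χ₄((n-1)/δ) e(an/q)` on the integers `n ≡ 1 (mod δ)` coprime to `4qδ`. -/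
def divisorTwist (q : ℕ) (a : ℤ) (δ n : ℕ) : ℂ :=
  if n.Coprime (4 * q * δ) ∧ δ ∣ n - 1 then (chi4 ((n - 1) / δ) : ℂ) * ex (n * (a / q)) else 0

lemma norm_divisorTwist_le (q : ℕ) (a : ℤ) (δ n : ℕ) :
    ‖divisorTwist q a δ n‖ ≤ if δ ∣ n - 1 then 1 else 0 := by
  rw [divisorTwist]
  by_cases h : δ ∣ n - 1
  · rw [if_pos h]
    split_ifs
    · rw [norm_mul, norm_ex, mul_one, Complex.norm_real]
      exact abs_chi4_le _
    · simp
  · rw [if_neg h, if_neg (fun h' => h h'.2), norm_zero]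

lemma divisorTwist_zero {q : ℕ} (a : ℤ) (δ : ℕ) : divisorTwist q a δ 0 = 0 := by
  rw [divisorTwist, if_neg]
  rintro ⟨h, -⟩
  rw [Nat.coprime_zero_left, mul_assoc] at h
  omega

lemma divisorTwist_add_period {q δ : ℕ} (hq : 0 < q) (hδ : 0 < δ) (a : ℤ) (n : ℕ) :
    divisorTwist q a δ (n + 4 * q * δ) = divisorTwist q a δ n := by
  rcases Nat.eq_zero_or_pos n with rfl | hn
  · rw [divisorTwist_zero, divisorTwist, if_neg]
    rintro ⟨h, -⟩
    rw [zero_add, Nat.coprime_self, mul_assoc] at h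
    omega
  · have e1 : n + 4 * q * δ - 1 = n - 1 + δ * (4 * q) := by
      rw [show 4 * q * δ = δ * (4 * q) by ring]; omega
    have e2 := ex_add_int_mul_div hq a n (4 * δ)
    rw [show q * (4 * δ) = 4 * q * δ by ring] at e2
    have hcnd : ((n + 4 * q * δ).Coprime (4 * q * δ) ∧ δ ∣ n + 4 * q * δ - 1) ↔
        (n.Coprime (4 * q * δ) ∧ δ ∣ n - 1) := by
      rw [e1, Nat.coprime_add_self_left, Nat.dvd_add_left (Dvd.intro _ rfl)]
    rw [divisorTwist, divisorTwist, e2, if_congr hcnd rfl rfl, e1, Nat.add_mul_div_left _ _ hδ,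
      chi4_add_four_mul]

lemma divisorTwist_add_shift {q δ q' u : ℕ} (hδ : 0 < δ) (hq' : q' = 2 * u + 1)
    (hqq : q = q' ∨ q = 2 * q') (a : ℤ) (n : ℕ) :
    divisorTwist q a δ (n + 2 * q' * δ) = -divisorTwist q a δ n := by
  have hq : 0 < q := by omega
  have hcop : ∀ x : ℕ, x.Coprime (4 * q * δ) ↔ x.Coprime (2 * q' * δ) := by
    intro x
    constructor
    · intro h
      refine Nat.Coprime.coprime_dvd_right ?_ h
      refine Nat.mul_dvd_mul_right ?_ δ
      rcases hqq with h | h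
      · exact ⟨2, by rw [h]; ring⟩
      · exact ⟨4, by rw [h]; ring⟩
    · intro h
      have h1 : x.Coprime (2 * q') := Nat.Coprime.coprime_mul_right_right h
      have h2 : x.Coprime δ := Nat.Coprime.coprime_mul_left_right h
      have h3 : x.Coprime 2 := Nat.Coprime.coprime_mul_right_right h1
      have h4 : x.Coprime q' := Nat.Coprime.coprime_mul_left_right h1
      refine Nat.Coprime.mul_right (Nat.Coprime.mul_right ?_ ?_) h2
      · exact h3.mul_right h3
      · rcases hqq with h | h
        · rwa [h]
        · rw [h]; exact h3.mul_right h4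
  rcases Nat.eq_zero_or_pos n with rfl | hn
  · rw [divisorTwist_zero, divisorTwist, if_neg, neg_zero]
    rintro ⟨h, -⟩
    rw [hcop, zero_add, Nat.coprime_self, mul_assoc] at h
    omega
  · have e1 : n + 2 * q' * δ - 1 = n - 1 + δ * (2 * q') := by
      rw [show 2 * q' * δ = δ * (2 * q') by ring]; omega
    have e2 : ex (((n + 2 * q' * δ : ℕ) : ℝ) * (a / q)) = ex (n * (a / q)) := by
      rcases hqq with h | h
      · have := ex_add_int_mul_div hq a n (2 * δ)
        rwa [show q * (2 * δ) = 2 * q' * δ by rw [h]; ring] at this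
      · have := ex_add_int_mul_div hq a n δ
        rwa [show q * δ = 2 * q' * δ by rw [h]] at this
    have hcnd : ((n + 2 * q' * δ).Coprime (4 * q * δ) ∧ δ ∣ n + 2 * q' * δ - 1) ↔
        (n.Coprime (4 * q * δ) ∧ δ ∣ n - 1) := by
      rw [e1, hcop, hcop, Nat.coprime_add_self_left, Nat.dvd_add_left (Dvd.intro _ rfl)]
    rw [divisorTwist, divisorTwist, e2, if_congr hcnd rfl rfl, e1, Nat.add_mul_div_left _ _ hδ,
      chi4_add_two_mod (by omega)]
    split_ifs
    · push_cast; ring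
    · simp

lemma card_divisorTwist_support_le {q δ : ℕ} (hδ : 0 < δ) (a : ℤ) :
    ((Finset.range (4 * q * δ)).filter fun n => divisorTwist q a δ n ≠ 0).card ≤ 4 * q := by
  refine (Finset.card_le_card_of_injOn (t := Finset.range (4 * q)) (fun n => (n - 1) / δ)
    ?_ ?_).trans_eq (Finset.card_range _)
  · intro n hn
    obtain ⟨h1, h2⟩ := Finset.mem_filter.1 hn
    rw [Finset.mem_range] at h1
    rw [Finset.mem_coe, Finset.mem_range, Nat.div_lt_iff_lt_mul hδ]
    exact (Nat.sub_le n 1).trans_lt h1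
  · have key : ∀ n, divisorTwist q a δ n ≠ 0 → 0 < n ∧ δ ∣ n - 1 := by
      intro n h
      refine ⟨Nat.pos_of_ne_zero fun h0 => h (h0 ▸ divisorTwist_zero a δ), ?_⟩
      by_contra h'
      exact h (if_neg fun h'' => h' h''.2)
    intro x hx y hy hxy
    obtain ⟨hx0, hx1⟩ := key x (Finset.mem_filter.1 hx).2
    obtain ⟨hy0, hy1⟩ := key y (Finset.mem_filter.1 hy).2
    have := (Nat.div_left_inj hx1 hy1).1 hxy
    omega

lemma sum_norm_divisorTwist_le {q D t N : ℕ} (a : ℤ) {Z : ℝ} (hq : 0 < q) (h4 : ¬ 4 ∣ q)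
    (htN : t ≤ N) (hD : 4 * q * D ≤ N)
    (hZ : ∑ r ∈ Finset.Ioc 1 (4 * q * D), (1 / r.totient : ℝ) * primSum t r ≤ Z) :
    ∑ δ ∈ Finset.Ioc 0 D, ‖∑ n ∈ Finset.Ioc 0 t, (primeLog n : ℂ) * divisorTwist q a δ n‖ ≤
      4 * q * ((1 + Real.log N) ^ 2 * Z + D * (3 * Real.sqrt N * (1 + Real.log N))) := by
  have hL0 := Real.log_natCast_nonneg N
  set L := Real.log N with hL
  obtain ⟨q', u, hq', hqq⟩ : ∃ q' u, q' = 2 * u + 1 ∧ (q = q' ∨ q = 2 * q') := by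
    rcases Nat.even_or_odd' q with ⟨k, hk | hk⟩
    · exact ⟨k, k / 2, by omega, Or.inr hk⟩
    · exact ⟨q, k, hk, Or.inl rfl⟩
  set E : ℝ := 3 * Real.sqrt N * (1 + L) with hE
  have key : ∀ δ ∈ Finset.Ioc 0 D,
      ‖∑ n ∈ Finset.Ioc 0 t, (primeLog n : ℂ) * divisorTwist q a δ n‖ ≤
      4 * q * ((1 / (4 * q * δ).totient : ℝ) * ∑ r ∈ (4 * q * δ).divisors.erase 1, primSum t r + E) := by
    intro δ hδ
    obtain ⟨hδ0, hδD⟩ := Finset.mem_Ioc.1 hδ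
    have hm : 0 < 4 * q * δ := by positivity
    have hmN : 4 * q * δ ≤ N := (Nat.mul_le_mul_left _ hδD).trans hD
    refine (norm_sum_primeLog_mean_zero_le hm htN (S := 4 * q) (g := divisorTwist q a δ)
      (divisorTwist_add_period hq hδ0 a) ?_ ?_ ?_ (card_divisorTwist_support_le hδ0 a)).trans ?_
    · intro n hn
      by_contra h
      exact hn (if_neg fun h' => h h'.1)
    · intro n
      refine (norm_divisorTwist_le q a δ n).trans ?_
      split_ifs <;> norm_num
    · exact sum_range_eq_zero_of_antiperiodic (divisorTwist_add_period hq hδ0 a)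
        (divisorTwist_add_shift hδ0 hq' hqq a)
    · push_cast
      refine mul_le_mul_of_nonneg_left ?_ (by positivity)
      have h1 := log_nat_mono hmN
      have hN1 : (1 : ℝ) ≤ N := by exact_mod_cast (by omega : 1 ≤ N)
      have h2 : 1 ≤ Real.sqrt N := Real.one_le_sqrt.2 hN1
      have h3 : Real.log (4 * q * δ : ℕ) ≤ Real.sqrt N * L := by nlinarith
      push_cast at h3
      rw [hE]
      nlinarith
  refine (Finset.sum_le_sum key).trans ?_
  rw [← Finset.mul_sum, Finset.sum_add_distrib, Finset.sum_const, nsmul_eq_mul, Nat.card_Ioc,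
    Nat.sub_zero]
  refine mul_le_mul_of_nonneg_left ?_ (by positivity)
  gcongr
  refine (sum_inv_totient_dilate_le (t := t) (D := D) (k := 4 * q) (by positivity)).trans ?_
  have h1 := log_nat_mono hD
  have h2 := Real.log_natCast_nonneg (4 * q * D)
  have h3 : 0 ≤ ∑ r ∈ Finset.Ioc 1 (4 * q * D), (1 / r.totient : ℝ) * primSum t r :=
    Finset.sum_nonneg fun r _ => mul_nonneg (by positivity) (primSum_nonneg t r)
  gcongr

/-- Partition of `(0, N]` into short intervals on which a weight is nearly constant. -/
lemma norm_sum_mul_weight_le {N J : ℕ} (hJ : 0 < J) (f w : ℕ → ℂ) (e : ℕ → ℝ)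
    (hw : ∀ n, ‖w n‖ ≤ 1)
    (he : ∀ s n : ℕ, s < n → (n : ℝ) ≤ s + (N / J + 1) → ‖w n - w (s + 1)‖ ≤ e n) :
    ‖∑ n ∈ Finset.Ioc 0 N, f n * w n‖ ≤
      ∑ j ∈ Finset.range J, (‖∑ n ∈ Finset.Ioc 0 (j * N / J), f n‖ +
        ‖∑ n ∈ Finset.Ioc 0 ((j + 1) * N / J), f n‖) + ∑ n ∈ Finset.Ioc 0 N, ‖f n‖ * e n := by
  set T : ℕ → ℕ := fun j => j * N / J with hT
  have hTmono : Monotone T := fun a b h => Nat.div_le_div_right (Nat.mul_le_mul_right N h)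
  have split : ∀ {R : Type} [AddCommMonoid R] (g : ℕ → R) (K : ℕ),
      ∑ n ∈ Finset.Ioc 0 (T K), g n = ∑ j ∈ Finset.range K, ∑ n ∈ Finset.Ioc (T j) (T (j + 1)), g n := by
    intro R _ g K
    induction K with
    | zero => simp [hT]
    | succ K ih =>
      rw [Finset.sum_range_succ, ← ih]
      have h1 : Finset.Ioc 0 (T (K + 1)) = Finset.Ioc 0 (T K) ∪ Finset.Ioc (T K) (T (K + 1)) :=
        (Finset.Ioc_union_Ioc_eq_Ioc (Nat.zero_le _) (hTmono (Nat.le_succ K))).symm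
      rw [h1, Finset.sum_union]
      exact Finset.disjoint_left.2 fun x h1 h2 => by
        rw [Finset.mem_Ioc] at h1 h2; omega
  have hTJ : T J = N := Nat.mul_div_cancel_left N hJ
  have hlen : ∀ j, (T (j + 1) : ℝ) ≤ T j + (N / J + 1) := by
    intro j
    have hJr : (0 : ℝ) < J := by exact_mod_cast hJ
    have h1 : (T (j + 1) : ℝ) ≤ ((j + 1) * N : ℕ) / J := Nat.cast_div_le
    have h2 : (((j * N : ℕ) : ℝ)) / J ≤ T j + 1 := by
      rw [div_le_iff₀ hJr]
      have h3 := Nat.lt_div_mul_add hJ (a := j * N)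
      have h4 : j * N ≤ (T j + 1) * J := by
        simp only [hT]; rw [add_mul, one_mul]; exact h3.le
      exact_mod_cast h4
    have h5 : (((j + 1) * N : ℕ) : ℝ) / J = (((j * N : ℕ) : ℝ)) / J + N / J := by
      push_cast; ring
    linarith
  have hN1 := split (fun n => f n * w n) J
  have hN2 := split (fun n => ‖f n‖ * e n) J
  rw [hTJ] at hN1 hN2
  rw [hN1, hN2, ← Finset.sum_add_distrib]
  refine (norm_sum_le _ _).trans (Finset.sum_le_sum fun j _ => ?_)
  have h1 : ∑ n ∈ Finset.Ioc (T j) (T (j + 1)), f n * w n =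
      (∑ n ∈ Finset.Ioc (T j) (T (j + 1)), f n) * w (T j + 1) +
      ∑ n ∈ Finset.Ioc (T j) (T (j + 1)), f n * (w n - w (T j + 1)) := by
    rw [Finset.sum_mul, ← Finset.sum_add_distrib]
    exact Finset.sum_congr rfl fun n _ => by ring
  have h2 : ∑ n ∈ Finset.Ioc (T j) (T (j + 1)), f n =
      ∑ n ∈ Finset.Ioc 0 (T (j + 1)), f n - ∑ n ∈ Finset.Ioc 0 (T j), f n := by
    rw [split f (j + 1), split f j, Finset.sum_range_succ]; ring
  rw [h1]
  refine (norm_add_le _ _).trans (add_le_add ?_ ?_)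
  · rw [norm_mul]
    refine (mul_le_of_le_one_right (norm_nonneg _) (hw _)).trans ?_
    rw [h2]
    exact (norm_sub_le _ _).trans (le_of_eq (add_comm _ _))
  · refine (norm_sum_le _ _).trans (Finset.sum_le_sum fun n hn => ?_)
    rw [norm_mul]
    obtain ⟨h3, h4⟩ := Finset.mem_Ioc.1 hn
    refine mul_le_mul_of_nonneg_left (he (T j) n h3 ?_) (norm_nonneg _)
    have : (n : ℝ) ≤ T (j + 1) := by exact_mod_cast h4
    exact this.trans (hlen j)

lemma norm_weight_error_le {N J : ℕ} (hJ : 0 < J) {f w : ℕ → ℂ} {e : ℕ → ℝ}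
    (hw : ∀ n, ‖w n‖ ≤ 1)
    (he : ∀ s n : ℕ, s < n → (n : ℝ) ≤ s + (N / J + 1) → ‖w n - w (s + 1)‖ ≤ e n) {X : ℝ}
    (hX : ∀ t ≤ N, ‖∑ n ∈ Finset.Ioc 0 t, f n‖ ≤ X) :
    ‖∑ n ∈ Finset.Ioc 0 N, f n * w n‖ ≤ J * (2 * X) + ∑ n ∈ Finset.Ioc 0 N, ‖f n‖ * e n := by
  refine (norm_sum_mul_weight_le hJ f w e hw he).trans (add_le_add ?_ le_rfl)
  have h : ∀ j ∈ Finset.range J, ‖∑ n ∈ Finset.Ioc 0 (j * N / J), f n‖ +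
        ‖∑ n ∈ Finset.Ioc 0 ((j + 1) * N / J), f n‖ ≤ 2 * X := by
    intro j hj
    rw [Finset.mem_range] at hj
    rw [two_mul]
    have hT : ∀ i ≤ J, i * N / J ≤ N := fun i hi =>
      Nat.div_le_of_le_mul (Nat.mul_le_mul_right N hi)
    exact add_le_add (hX _ (hT _ hj.le)) (hX _ (hT _ hj))
  refine (Finset.sum_le_sum h).trans ?_
  rw [Finset.sum_const, Finset.card_range, nsmul_eq_mul]

lemma norm_ex_mul_sub_le (β h : ℝ) {s n : ℕ} (hsn : s < n) (hn : (n : ℝ) ≤ s + h) :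
    ‖ex (n * β) - ex ((s + 1 : ℕ) * β)‖ ≤ 2 * Real.pi * (|β| * h) := by
  refine (norm_ex_sub_ex_le _ _).trans ?_
  refine mul_le_mul_of_nonneg_left ?_ (by positivity)
  rw [← sub_mul, abs_mul, mul_comm]
  refine mul_le_mul_of_nonneg_left ?_ (abs_nonneg _)
  have : ((s + 1 : ℕ) : ℝ) ≤ n := by exact_mod_cast hsn
  rw [abs_of_nonneg (by linarith)]
  push_cast at this ⊢
  linarith

/-- The exponential sum over primes near a rational with denominator divisible by four. -/
lemma norm_primeSum_four_dvd_le {q N J : ℕ} {a : ℤ} {β Z : ℝ} (hq : 0 < q) (h4 : 4 ∣ q)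
    (hcop : IsCoprime a q) (hJ : 0 < J)
    (hZ : ∀ t ≤ N, ∑ r ∈ Finset.Ioc 1 q, (1 / r.totient : ℝ) * primSum t r ≤ Z) :
    ‖∑ n ∈ Finset.Ioc 0 N, (primeLog n : ℂ) * ex (n * (a / q + β))‖ ≤
      J * (2 * (q * (Z + (2 * Real.sqrt N * Real.log N + Real.log q)))) +
        6 * N * (2 * Real.pi * (|β| * (N / J + 1))) + Real.log q := by
  set f : ℕ → ℂ := fun n => (primeLog n : ℂ) * (if n.Coprime q then ex (n * (a / q)) else 0) with hf
  have hsplit : ∑ n ∈ Finset.Ioc 0 N, (primeLog n : ℂ) * ex (n * (a / q + β)) =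
      ∑ n ∈ Finset.Ioc 0 N, f n * ex (n * β) +
      ∑ n ∈ (Finset.Ioc 0 N).filter (fun n => ¬ n.Coprime q),
        (primeLog n : ℂ) * ex (n * (a / q + β)) := by
    rw [Finset.sum_filter, ← Finset.sum_add_distrib]
    refine Finset.sum_congr rfl fun n _ => ?_
    simp only [hf]
    by_cases h : n.Coprime q
    · rw [if_pos h, if_neg (not_not.2 h), add_zero, mul_add, ex_add]; ring
    · rw [if_neg h, if_pos h]; ring
  have hfn : ∀ n, ‖f n‖ ≤ primeLog n := by
    intro n
    simp only [hf]
    rw [norm_mul, Complex.norm_real, Real.norm_of_nonneg (primeLog_nonneg n)]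
    refine mul_le_of_le_one_right (primeLog_nonneg n) ?_
    split_ifs
    · rw [norm_ex]
    · simp
  have hX : ∀ t ≤ N, ‖∑ n ∈ Finset.Ioc 0 t, f n‖ ≤
      q * (Z + (2 * Real.sqrt N * Real.log N + Real.log q)) := fun t ht =>
    norm_sum_primeLog_four_dvd_le hq h4 hcop ht (hZ t ht)
  rw [hsplit]
  refine (norm_add_le _ _).trans (add_le_add ?_ ?_)
  · have he : ∀ s n : ℕ, s < n → (n : ℝ) ≤ s + (N / J + 1) →
        ‖ex (n * β) - ex ((s + 1 : ℕ) * β)‖ ≤ 2 * Real.pi * (|β| * (N / J + 1)) :=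
      fun s n h1 h2 => norm_ex_mul_sub_le β _ h1 h2
    have hmain := norm_weight_error_le hJ (w := fun n => ex (n * β))
      (e := fun _ => 2 * Real.pi * (|β| * (N / J + 1))) (fun n => (norm_ex _).le) he hX
    refine hmain.trans (add_le_add le_rfl ?_)
    rw [← Finset.sum_mul]
    refine mul_le_mul_of_nonneg_right ?_ (by positivity)
    exact (Finset.sum_le_sum fun n _ => hfn n).trans (sum_primeLog_le N)
  · refine (norm_sum_le _ _).trans ((Finset.sum_le_sum fun n _ => ?_).trans
      (sum_primeLog_not_coprime_le hq N))
    rw [norm_mul, norm_ex, mul_one, Complex.norm_real, Real.norm_of_nonneg (primeLog_nonneg n)]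

/-- The truncated divisor sum, written in terms of the complementary divisor. -/
lemma r3_eq_sum_small {N D' n : ℕ} {D NR : ℝ} (hK : 0 < NR / D) (hD : (N : ℝ) < NR / D * (D' + 1))
    (hn : n ≤ N) :
    r3 D NR (n - 1) = ∑ δ ∈ Finset.Ioc 0 D',
      if δ ∣ n - 1 ∧ NR / D ≤ (((n - 1) / δ : ℕ) : ℝ) then chi4 ((n - 1) / δ) else 0 := by
  set K := NR / D with hKdef
  set m := n - 1 with hm
  rw [r3, ← Nat.sum_div_divisors m (fun d => if K ≤ (d : ℝ) then chi4 d else 0)]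
  rw [← Finset.sum_filter, ← Finset.sum_filter]
  refine Finset.sum_congr ?_ fun _ _ => rfl
  ext δ
  simp only [Finset.mem_filter, Nat.mem_divisors, Finset.mem_Ioc]
  constructor
  · rintro ⟨⟨h1, h2⟩, h3⟩
    have hδ := Nat.pos_of_dvd_of_pos h1 (Nat.pos_of_ne_zero h2)
    refine ⟨⟨hδ, ?_⟩, h1, h3⟩
    by_contra hlt
    have h4 : ((D' + 1 : ℕ) : ℝ) ≤ δ := by exact_mod_cast (by omega : D' + 1 ≤ δ)
    have h5 : (((m / δ : ℕ) : ℝ)) * δ ≤ N := by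
      have : m / δ * δ ≤ N := (Nat.div_mul_le_self m δ).trans (by omega)
      exact_mod_cast this
    have h6 : K * (D' + 1) ≤ ((m / δ : ℕ) : ℝ) * δ := by
      push_cast at h4
      exact mul_le_mul h3 h4 (by positivity) (by positivity)
    linarith
  · rintro ⟨h1, h2, h3⟩
    refine ⟨⟨h2, ?_⟩, h3⟩
    rintro h0
    rw [h0, Nat.zero_div, Nat.cast_zero] at h3
    linarith

lemma card_dvd_sub_one_le {N δ : ℕ} (hδ : 0 < δ) {K X : ℝ} (hK : 0 ≤ K) (hX : 0 ≤ X) :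
    ((((Finset.Ioc 0 N).filter fun n => δ ∣ n - 1 ∧ K ≤ (((n - 1) / δ : ℕ) : ℝ) ∧
      (((n - 1) / δ : ℕ) : ℝ) < K + X).card : ℕ) : ℝ) ≤ X + 1 := by
  have h1 : ((Finset.Ioc 0 N).filter fun n => δ ∣ n - 1 ∧ K ≤ (((n - 1) / δ : ℕ) : ℝ) ∧
      (((n - 1) / δ : ℕ) : ℝ) < K + X).card ≤ (Finset.Ico ⌈K⌉₊ ⌈K + X⌉₊).card := by
    refine Finset.card_le_card_of_injOn (fun n => (n - 1) / δ) ?_ ?_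
    · intro n hn
      obtain ⟨-, -, h2, h3⟩ := Finset.mem_filter.1 hn
      exact Finset.mem_coe.2 (Finset.mem_Ico.2 ⟨Nat.ceil_le.2 h2, Nat.lt_ceil.2 h3⟩)
    · intro x hx y hy hxy
      obtain ⟨hx0, hx1, -⟩ := Finset.mem_filter.1 hx
      obtain ⟨hy0, hy1, -⟩ := Finset.mem_filter.1 hy
      rw [Finset.mem_Ioc] at hx0 hy0
      have := (Nat.div_left_inj hx1 hy1).1 hxy
      omega
  rw [Nat.card_Ico] at h1
  have h2 : (⌈K⌉₊ : ℝ) ≤ ⌈K + X⌉₊ := by exact_mod_cast Nat.ceil_le_ceil (by linarith)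
  have h3 : (((⌈K + X⌉₊ - ⌈K⌉₊ : ℕ)) : ℝ) = (⌈K + X⌉₊ : ℝ) - ⌈K⌉₊ :=
    Nat.cast_sub (by exact_mod_cast h2)
  have h4 := Nat.ceil_lt_add_one (a := K + X) (by linarith)
  have h5 := Nat.le_ceil K
  calc _ ≤ (((⌈K + X⌉₊ - ⌈K⌉₊ : ℕ)) : ℝ) := by exact_mod_cast h1
    _ ≤ _ := by rw [h3]; linarith

/-- The weight carrying the cutoff of the complementary divisor and the small phase. -/
def cutoffPhase (K β : ℝ) (δ n : ℕ) : ℂ :=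
  if K ≤ (((n - 1) / δ : ℕ) : ℝ) then ex (n * β) else 0

lemma norm_cutoffPhase_le (K β : ℝ) (δ n : ℕ) : ‖cutoffPhase K β δ n‖ ≤ 1 := by
  rw [cutoffPhase]
  split_ifs
  · rw [norm_ex]
  · simp

lemma norm_cutoffPhase_sub_le {K β h : ℝ} (hh : 0 ≤ h) {δ s n : ℕ} (hδ : 0 < δ) (hsn : s < n)
    (hn : (n : ℝ) ≤ s + h) :
    ‖cutoffPhase K β δ n - cutoffPhase K β δ (s + 1)‖ ≤ 2 * Real.pi * (|β| * h) +
      if K ≤ (((n - 1) / δ : ℕ) : ℝ) ∧ (((n - 1) / δ : ℕ) : ℝ) < K + (h / δ + 1) then 1 else 0 := by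
  have hnn : 0 ≤ 2 * Real.pi * (|β| * h) := by positivity
  have hmono : s / δ ≤ (n - 1) / δ := Nat.div_le_div_right (by omega)
  have hmono' : ((s / δ : ℕ) : ℝ) ≤ (((n - 1) / δ : ℕ) : ℝ) := by exact_mod_cast hmono
  rw [cutoffPhase, cutoffPhase, Nat.add_sub_cancel]
  by_cases h1 : K ≤ ((s / δ : ℕ) : ℝ)
  · rw [if_pos h1, if_pos (h1.trans hmono')]
    refine (norm_ex_mul_sub_le β h hsn hn).trans (le_add_of_nonneg_right ?_)
    split_ifs <;> norm_num
  · rw [if_neg h1, sub_zero]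
    by_cases h2 : K ≤ (((n - 1) / δ : ℕ) : ℝ)
    · have hδr : (0 : ℝ) < δ := by exact_mod_cast hδ
      have h3 : (((n - 1) / δ : ℕ) : ℝ) ≤ (s + h) / δ := by
        refine Nat.cast_div_le.trans (div_le_div_of_nonneg_right ?_ hδr.le)
        refine le_trans ?_ hn
        exact_mod_cast Nat.sub_le n 1
      have h4 : (s : ℝ) / δ ≤ ((s / δ : ℕ) : ℝ) + 1 := by
        rw [div_le_iff₀ hδr]
        have := (Nat.lt_div_mul_add hδ (a := s)).le
        have h5 : s ≤ (s / δ + 1) * δ := by rw [add_mul, one_mul]; exact this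
        exact_mod_cast h5
      rw [add_div] at h3
      push Not at h1
      rw [if_pos h2, if_pos ⟨h2, by linarith⟩, norm_ex]
      linarith
    · rw [if_neg h2, if_neg (fun h => h2 h.1), norm_zero, add_zero]
      exact hnn

/-- The exponential sum over primes weighted by a divisor sum with large divisors, near a rational
with denominator not divisible by four. -/
lemma norm_primeSum_r3_le {q N J D' : ℕ} {a : ℤ} {β Z D NR : ℝ} (hq : 0 < q) (h4 : ¬ 4 ∣ q)
    (hJ : 0 < J) (hK : 0 < NR / D) (hD : (N : ℝ) < NR / D * (D' + 1)) (hDN : 4 * q * D' ≤ N)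
    (hZ : ∀ t ≤ N, ∑ r ∈ Finset.Ioc 1 (4 * q * D'), (1 / r.totient : ℝ) * primSum t r ≤ Z) :
    ‖∑ n ∈ Finset.Ioc 0 N, (primeLog n : ℂ) * (r3 D NR (n - 1) : ℂ) * ex (n * (a / q + β))‖ ≤
      J * (2 * (4 * q * ((1 + Real.log N) ^ 2 * Z + D' * (3 * Real.sqrt N * (1 + Real.log N))))) +
      Real.log N * (2 * Real.pi * (|β| * (N / J + 1)) * (N * (1 + Real.log N) + D')) +
      Real.log N * ((N / J + 1) * (1 + Real.log N) + 2 * D') + D' * Real.log N := by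
  have hL0 := Real.log_natCast_nonneg N
  set L := Real.log N with hL
  set K := NR / D with hKdef
  set h : ℝ := N / J + 1 with hh
  have hh0 : 0 ≤ h := by positivity
  set c : ℝ := 2 * Real.pi * (|β| * h) with hc
  have hc0 : 0 ≤ c := by positivity
  set f : ℕ → ℕ → ℂ := fun δ n => (primeLog n : ℂ) * divisorTwist q a δ n with hf
  set g : ℕ → ℕ → ℂ := fun δ n => (primeLog n : ℂ) * (if ¬ n.Coprime (4 * q * δ) ∧ δ ∣ n - 1 then
    (chi4 ((n - 1) / δ) : ℂ) * ex (n * (a / q)) else 0) * cutoffPhase K β δ n with hg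
  have hsplit : ∑ n ∈ Finset.Ioc 0 N,
      (primeLog n : ℂ) * (r3 D NR (n - 1) : ℂ) * ex (n * (a / q + β)) =
      ∑ δ ∈ Finset.Ioc 0 D', (∑ n ∈ Finset.Ioc 0 N, f δ n * cutoffPhase K β δ n +
        ∑ n ∈ Finset.Ioc 0 N, g δ n) := by
    simp_rw [← Finset.sum_add_distrib]
    rw [Finset.sum_comm]
    refine Finset.sum_congr rfl fun n hn => ?_
    rw [r3_eq_sum_small hK hD (Finset.mem_Ioc.1 hn).2, ← hKdef, Complex.ofReal_sum, Finset.mul_sum,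
      Finset.sum_mul]
    refine Finset.sum_congr rfl fun δ _ => ?_
    simp only [hf, hg]
    rw [divisorTwist, cutoffPhase, mul_add, ex_add]
    generalize (((n - 1) / δ : ℕ) : ℝ) = k
    split_ifs <;> first | tauto | (push_cast; ring)
  have hfn : ∀ δ, ∀ n ≤ N, ‖f δ n‖ ≤ L * if δ ∣ n - 1 then 1 else 0 := by
    intro δ n hn
    simp only [hf]
    rw [norm_mul, Complex.norm_real, Real.norm_of_nonneg (primeLog_nonneg n)]
    exact mul_le_mul (primeLog_le_log hn) (norm_divisorTwist_le q a δ n) (norm_nonneg _) hL0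
  have hgn : ∀ δ ∈ Finset.Ioc 0 D', ‖∑ n ∈ Finset.Ioc 0 N, g δ n‖ ≤ L := by
    intro δ hδ
    obtain ⟨hδ0, hδD⟩ := Finset.mem_Ioc.1 hδ
    refine (norm_sum_le _ _).trans (le_trans ?_
      ((sum_primeLog_not_coprime_le (m := 4 * q * δ) (by positivity) N).trans
        (log_nat_mono ((Nat.mul_le_mul_left _ hδD).trans hDN))))
    rw [Finset.sum_filter]
    refine Finset.sum_le_sum fun n _ => ?_
    simp only [hg]
    rw [norm_mul, norm_mul, Complex.norm_real, Real.norm_of_nonneg (primeLog_nonneg n)]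
    refine (mul_le_of_le_one_right (mul_nonneg (primeLog_nonneg n) (norm_nonneg _))
      (norm_cutoffPhase_le K β δ n)).trans ?_
    by_cases h1 : n.Coprime (4 * q * δ)
    · simp [h1]
    · rw [if_pos h1]
      refine mul_le_of_le_one_right (primeLog_nonneg n) ?_
      split_ifs
      · rw [norm_mul, norm_ex, mul_one, Complex.norm_real]
        exact abs_chi4_le _
      · simp
  have hfm : ∀ δ ∈ Finset.Ioc 0 D', ‖∑ n ∈ Finset.Ioc 0 N, f δ n * cutoffPhase K β δ n‖ ≤
      ∑ j ∈ Finset.range J, (‖∑ n ∈ Finset.Ioc 0 (j * N / J), f δ n‖ +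
        ‖∑ n ∈ Finset.Ioc 0 ((j + 1) * N / J), f δ n‖) +
      (L * (c * (N * (1 / δ : ℝ) + 1)) + L * (h * (1 / δ : ℝ) + 2)) := by
    intro δ hδ
    obtain ⟨hδ0, hδD⟩ := Finset.mem_Ioc.1 hδ
    refine (norm_sum_mul_weight_le hJ (f δ) (cutoffPhase K β δ) (fun n => c +
      if K ≤ (((n - 1) / δ : ℕ) : ℝ) ∧ (((n - 1) / δ : ℕ) : ℝ) < K + (h / δ + 1) then 1 else 0)
      (norm_cutoffPhase_le K β δ)
      (fun s n h1 h2 => norm_cutoffPhase_sub_le hh0 hδ0 h1 h2)).trans (add_le_add le_rfl ?_)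
    have hterm : ∀ n ∈ Finset.Ioc 0 N, ‖f δ n‖ * (c +
        if K ≤ (((n - 1) / δ : ℕ) : ℝ) ∧ (((n - 1) / δ : ℕ) : ℝ) < K + (h / δ + 1) then 1 else 0) ≤
        L * (c * (if δ ∣ n - 1 ∧ 0 ≤ (((n - 1) / δ : ℕ) : ℝ) ∧
          (((n - 1) / δ : ℕ) : ℝ) < 0 + (N / δ : ℝ) then 1 else 0)) +
        L * (if δ ∣ n - 1 ∧ K ≤ (((n - 1) / δ : ℕ) : ℝ) ∧
          (((n - 1) / δ : ℕ) : ℝ) < K + (h / δ + 1) then 1 else 0) := by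
      intro n hn
      obtain ⟨hn0, hnN⟩ := Finset.mem_Ioc.1 hn
      have hδr : (0 : ℝ) < δ := by exact_mod_cast hδ0
      have h2 : (((n - 1) / δ : ℕ) : ℝ) < 0 + (N / δ : ℝ) := by
        rw [zero_add]
        refine Nat.cast_div_le.trans_lt (div_lt_div_of_pos_right ?_ hδr)
        exact_mod_cast (by omega : n - 1 < N)
      have h5 := hfn δ n hnN
      by_cases h1 : δ ∣ n - 1
      · rw [if_pos h1, mul_one] at h5
        rw [if_pos (show δ ∣ n - 1 ∧ 0 ≤ (((n - 1) / δ : ℕ) : ℝ) ∧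
          (((n - 1) / δ : ℕ) : ℝ) < 0 + (N / δ : ℝ) from ⟨h1, Nat.cast_nonneg _, h2⟩)]
        generalize (((n - 1) / δ : ℕ) : ℝ) = k
        simp only [h1, true_and]
        rw [mul_one, ← mul_add]
        refine mul_le_mul_of_nonneg_right h5 (add_nonneg hc0 ?_)
        split_ifs <;> norm_num
      · rw [if_neg h1, mul_zero] at h5
        have h6 : ‖f δ n‖ = 0 := le_antisymm h5 (norm_nonneg _)
        generalize (((n - 1) / δ : ℕ) : ℝ) = k
        simp [h6, h1]
    refine (Finset.sum_le_sum hterm).trans ?_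
    rw [Finset.sum_add_distrib, ← Finset.mul_sum, ← Finset.mul_sum, ← Finset.mul_sum,
      Finset.sum_boole, Finset.sum_boole]
    have c1 := card_dvd_sub_one_le (N := N) hδ0 (K := 0) (X := (N / δ : ℝ)) le_rfl (by positivity)
    have c2 := card_dvd_sub_one_le (N := N) hδ0 (K := K) (X := h / δ + 1) hK.le (by positivity)
    refine add_le_add (mul_le_mul_of_nonneg_left (mul_le_mul_of_nonneg_left ?_ hc0) hL0)
      (mul_le_mul_of_nonneg_left ?_ hL0)
    · rw [mul_one_div]; exact c1
    · rw [mul_one_div]; linarith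
  rw [hsplit]
  refine (norm_sum_le _ _).trans ((Finset.sum_le_sum fun δ hδ => (norm_add_le _ _).trans
    (add_le_add (hfm δ hδ) (hgn δ hδ))).trans ?_)
  rw [Finset.sum_add_distrib, Finset.sum_add_distrib, Finset.sum_comm, Finset.sum_const,
    Nat.card_Ioc, Nat.sub_zero, nsmul_eq_mul]
  refine add_le_add ?_ le_rfl
  rw [add_assoc]
  have hDN' : D' ≤ N := le_trans (Nat.le_mul_of_pos_left _ (by positivity)) hDN
  have hinv : ∑ δ ∈ Finset.Ioc 0 D', (1 / δ : ℝ) ≤ 1 + L := by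
    refine (sum_Ioc_inv_le D').trans ?_
    have := log_nat_mono hDN'
    linarith
  refine add_le_add ?_ ?_
  · have hT : ∀ i ≤ J, i * N / J ≤ N := fun i hi =>
      Nat.div_le_of_le_mul (Nat.mul_le_mul_right N hi)
    have hX : ∀ t ≤ N, ∑ δ ∈ Finset.Ioc 0 D', ‖∑ n ∈ Finset.Ioc 0 t, f δ n‖ ≤
        4 * q * ((1 + L) ^ 2 * Z + D' * (3 * Real.sqrt N * (1 + L))) := fun t ht =>
      sum_norm_divisorTwist_le a hq h4 ht hDN (hZ t ht)
    refine (Finset.sum_le_sum (g := fun _ => 2 * (4 * q * ((1 + L) ^ 2 * Z +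
      D' * (3 * Real.sqrt N * (1 + L))))) fun j hj => ?_).trans_eq ?_
    · rw [Finset.mem_range] at hj
      rw [Finset.sum_add_distrib, two_mul]
      exact add_le_add (hX _ (hT _ hj.le)) (hX _ (hT _ hj))
    · rw [Finset.sum_const, Finset.card_range, nsmul_eq_mul]
  · rw [Finset.sum_add_distrib, ← Finset.mul_sum, ← Finset.mul_sum, ← Finset.mul_sum,
      Finset.sum_add_distrib, Finset.sum_add_distrib, ← Finset.mul_sum, ← Finset.mul_sum,
      Finset.sum_const, Finset.sum_const, Nat.card_Ioc, Nat.sub_zero, nsmul_eq_mul, nsmul_eq_mul,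
      mul_one, mul_comm (D' : ℝ) 2]
    gcongr

lemma ex_eq_one_iff {x : ℝ} : ex x = 1 ↔ ∃ k : ℤ, x = k := by
  constructor
  · intro h
    have h1 := four_nd_le x
    rw [h, sub_self, norm_zero] at h1
    have h2 : nd x = 0 := le_antisymm (by linarith) (nd_nonneg x)
    rw [nd, abs_eq_zero, sub_eq_zero] at h2
    exact ⟨_, h2⟩
  · rintro ⟨k, rfl⟩
    exact ex_int k

lemma sum_ex_mul_div {M : ℕ} (hM : 0 < M) (k : ℤ) :
    ∑ j ∈ Finset.range M, ex (k * ((j : ℝ) / M)) = if (M : ℤ) ∣ k then (M : ℂ) else 0 := by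
  have hMr : (M : ℝ) ≠ 0 := by exact_mod_cast hM.ne'
  have h1 : ∀ j ∈ Finset.range M, ex (k * ((j : ℝ) / M)) = ex ((k : ℝ) / M) ^ j := by
    intro j _
    rw [← ex_nat_mul]; congr 1; ring
  rw [Finset.sum_congr rfl h1]
  split_ifs with h
  · obtain ⟨l, rfl⟩ := h
    have : ex (((M * l : ℤ) : ℝ) / M) = 1 := by
      rw [ex_eq_one_iff]
      exact ⟨l, by push_cast; field_simp⟩
    rw [this]; simp
  · have hne : ex ((k : ℝ) / M) ≠ 1 := by
      rw [Ne, ex_eq_one_iff]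
      rintro ⟨l, hl⟩
      refine h ⟨l, ?_⟩
      rw [div_eq_iff hMr] at hl
      have : ((k : ℤ) : ℝ) = ((M * l : ℤ) : ℝ) := by rw [hl]; push_cast; ring
      exact_mod_cast this
    have h2 : ex ((k : ℝ) / M) ^ M = 1 := by
      rw [← ex_nat_mul, mul_div_cancel₀ _ hMr, ex_int]
    rw [geom_sum_eq hne, h2, sub_self, zero_div]

/-- The exponential sum with coefficients `f` over `(0, N]`. -/
def expSum (N : ℕ) (f : ℕ → ℝ) (α : ℝ) : ℂ := ∑ n ∈ Finset.Ioc 0 N, (f n : ℂ) * ex (n * α)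

lemma sum_norm_expSum_sq {M N : ℕ} (hNM : N < M) (f : ℕ → ℝ) :
    ∑ j ∈ Finset.range M, ‖expSum N f ((j : ℝ) / M)‖ ^ 2 = M * ∑ n ∈ Finset.Ioc 0 N, f n ^ 2 := by
  have hM : 0 < M := by omega
  have key : ∑ j ∈ Finset.range M, ((‖expSum N f ((j : ℝ) / M)‖ ^ 2 : ℝ) : ℂ) =
      ((M * ∑ n ∈ Finset.Ioc 0 N, f n ^ 2 : ℝ) : ℂ) := by
    have h1 : ∀ j ∈ Finset.range M, ((‖expSum N f ((j : ℝ) / M)‖ ^ 2 : ℝ) : ℂ) =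
        ∑ n ∈ Finset.Ioc 0 N, ∑ m ∈ Finset.Ioc 0 N,
          ((f n * f m : ℝ) : ℂ) * ex (((n - m : ℤ) : ℝ) * ((j : ℝ) / M)) := by
      intro j _
      rw [Complex.ofReal_pow, ← Complex.mul_conj', expSum, map_sum, Finset.sum_mul_sum]
      refine Finset.sum_congr rfl fun n _ => Finset.sum_congr rfl fun m _ => ?_
      rw [map_mul, Complex.conj_ofReal, conj_ex]
      have : ex (((n - m : ℤ) : ℝ) * ((j : ℝ) / M)) = ex (n * ((j : ℝ) / M)) * ex (-(m * ((j : ℝ) / M))) := by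
        rw [← ex_add]; congr 1; push_cast; ring
      rw [this]; push_cast; ring
    rw [Finset.sum_congr rfl h1, Finset.sum_comm, Complex.ofReal_mul, Complex.ofReal_sum,
      Finset.mul_sum]
    refine Finset.sum_congr rfl fun n hn => ?_
    rw [Finset.sum_comm]
    rw [Finset.sum_eq_single n]
    · rw [← Finset.mul_sum, sum_ex_mul_div hM, sub_self, if_pos (dvd_zero _)]
      push_cast; ring
    · intro m hm hmn
      rw [← Finset.mul_sum, sum_ex_mul_div hM, if_neg, mul_zero]
      intro h
      rw [Finset.mem_Ioc] at hn hm
      have := Int.eq_zero_of_abs_lt_dvd h (by rw [abs_lt]; constructor <;> omega)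
      omega
    · intro h; exact absurd hn h
  exact_mod_cast key

lemma sum_range_succ_eq_Ioc {R : Type*} [AddCommMonoid R] {F : ℕ → R} (h0 : F 0 = 0) (N : ℕ) :
    ∑ n ∈ Finset.range (N + 1), F n = ∑ n ∈ Finset.Ioc 0 N, F n := by
  symm
  refine Finset.sum_subset (fun n hn => ?_) fun n hn hn' => ?_
  · rw [Finset.mem_Ioc] at hn; rw [Finset.mem_range]; omega
  · rw [Finset.mem_range] at hn
    rw [Finset.mem_Ioc] at hn'
    have : n = 0 := by omega
    rw [this, h0]

lemma tripleSum_eq (N : ℕ) (r : ℕ → ℝ) :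
    tripleSum N r r = ∑ a ∈ Finset.Ioc 0 N, ∑ b ∈ Finset.Ioc 0 N, ∑ c ∈ Finset.Ioc 0 N,
      if a + b + c = N then primeLog a * r a * (primeLog b * r b) * primeLog c else 0 := by
  rw [tripleSum, sum_range_succ_eq_Ioc]
  · refine Finset.sum_congr rfl fun a _ => ?_
    rw [sum_range_succ_eq_Ioc]
    · refine Finset.sum_congr rfl fun b _ => ?_
      rw [sum_range_succ_eq_Ioc]
      · refine Finset.sum_congr rfl fun c _ => ?_
        rw [primeLog, primeLog, primeLog]
        by_cases h : a + b + c = N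
        · by_cases h1 : a.Prime
          · by_cases h2 : b.Prime
            · by_cases h3 : c.Prime
              · rw [if_pos ⟨h1, h2, h3, h⟩, if_pos h, if_pos h1, if_pos h2, if_pos h3]; ring
              · simp [h3]
            · simp [h2]
          · simp [h1]
        · simp [h]
      · simp [Nat.not_prime_zero]
    · simp [Nat.not_prime_zero]
  · simp [Nat.not_prime_zero]

lemma mul_tripleSum_eq (N : ℕ) (r : ℕ → ℝ) :
    ((3 * N + 1 : ℕ) : ℂ) * (tripleSum N r r : ℂ) =
      ∑ j ∈ Finset.range (3 * N + 1),
        expSum N (fun n => primeLog n * r n) ((j : ℝ) / (3 * N + 1 : ℕ)) ^ 2 *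
        expSum N primeLog ((j : ℝ) / (3 * N + 1 : ℕ)) * ex (-(N * ((j : ℝ) / (3 * N + 1 : ℕ)))) := by
  set M := 3 * N + 1 with hM
  have hM0 : 0 < M := by omega
  have h1 : ∀ j ∈ Finset.range M, expSum N (fun n => primeLog n * r n) ((j : ℝ) / M) ^ 2 *
      expSum N primeLog ((j : ℝ) / M) * ex (-(N * ((j : ℝ) / M))) =
      ∑ a ∈ Finset.Ioc 0 N, ∑ b ∈ Finset.Ioc 0 N, ∑ c ∈ Finset.Ioc 0 N,
        ((primeLog a * r a * (primeLog b * r b) * primeLog c : ℝ) : ℂ) *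
          ex (((a + b + c - N : ℤ) : ℝ) * ((j : ℝ) / M)) := by
    intro j _
    rw [sq, expSum, expSum, Finset.sum_mul_sum, Finset.sum_mul, Finset.sum_mul]
    refine Finset.sum_congr rfl fun a _ => ?_
    rw [Finset.sum_mul, Finset.sum_mul]
    refine Finset.sum_congr rfl fun b _ => ?_
    rw [Finset.mul_sum, Finset.sum_mul]
    refine Finset.sum_congr rfl fun c _ => ?_
    have : ex (((a + b + c - N : ℤ) : ℝ) * ((j : ℝ) / M)) = ex (a * ((j : ℝ) / M)) *
        ex (b * ((j : ℝ) / M)) * ex (c * ((j : ℝ) / M)) * ex (-(N * ((j : ℝ) / M))) := by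
      rw [← ex_add, ← ex_add, ← ex_add]; congr 1; push_cast; ring
    rw [this]; push_cast; ring
  rw [Finset.sum_congr rfl h1, tripleSum_eq, Complex.ofReal_sum, Finset.mul_sum,
    Finset.sum_comm (s := Finset.range M)]
  refine Finset.sum_congr rfl fun a ha => ?_
  rw [Finset.sum_comm (s := Finset.range M), Complex.ofReal_sum, Finset.mul_sum]
  refine Finset.sum_congr rfl fun b hb => ?_
  rw [Finset.sum_comm (s := Finset.range M), Complex.ofReal_sum, Finset.mul_sum]
  refine Finset.sum_congr rfl fun c hc => ?_
  rw [← Finset.mul_sum, sum_ex_mul_div hM0]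
  rw [Finset.mem_Ioc] at ha hb hc
  have hiff : (M : ℤ) ∣ (a + b + c - N : ℤ) ↔ a + b + c = N := by
    constructor
    · intro h
      have := Int.eq_zero_of_abs_lt_dvd h (by rw [abs_lt]; constructor <;> omega)
      omega
    · intro h
      rw [show (a + b + c - N : ℤ) = 0 by omega]
      exact dvd_zero _
  rw [if_congr hiff rfl rfl]
  split_ifs
  · push_cast; ring
  · simp

/-- The circle method bound: it suffices that one of the two exponential sums is small everywhere. -/
lemma abs_tripleSum_le {N : ℕ} {η : ℝ} (r : ℕ → ℝ) (hη : ∀ α : ℝ,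
      ‖expSum N (fun n => primeLog n * r n) α‖ ≤ η ∨ ‖expSum N primeLog α‖ ≤ η) :
    |tripleSum N r r| ≤ η * (∑ n ∈ Finset.Ioc 0 N, (primeLog n * r n) ^ 2 +
      ∑ n ∈ Finset.Ioc 0 N, primeLog n ^ 2) := by
  set M := 3 * N + 1 with hM
  have hMr : (0 : ℝ) < M := by exact_mod_cast (by omega : 0 < M)
  have h1 := congrArg norm (mul_tripleSum_eq N r)
  rw [norm_mul, Complex.norm_natCast, Complex.norm_real, Real.norm_eq_abs, ← hM] at h1
  have h2 : (M : ℝ) * |tripleSum N r r| ≤ ∑ j ∈ Finset.range M,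
      η * (‖expSum N (fun n => primeLog n * r n) ((j : ℝ) / M)‖ ^ 2 +
        ‖expSum N primeLog ((j : ℝ) / M)‖ ^ 2) := by
    rw [h1]
    refine (norm_sum_le _ _).trans (Finset.sum_le_sum fun j _ => ?_)
    rw [norm_mul, norm_ex, mul_one, norm_mul, norm_pow]
    have hA := norm_nonneg (expSum N (fun n => primeLog n * r n) ((j : ℝ) / M))
    have hB := norm_nonneg (expSum N primeLog ((j : ℝ) / M))
    rcases hη ((j : ℝ) / M) with h | h
    · nlinarith [mul_nonneg hA hB, sq_nonneg (‖expSum N (fun n => primeLog n * r n) ((j : ℝ) / M)‖ -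
        ‖expSum N primeLog ((j : ℝ) / M)‖), mul_le_mul_of_nonneg_right h (mul_nonneg hA hB),
        mul_nonneg (hA.trans h) (sq_nonneg (‖expSum N (fun n => primeLog n * r n) ((j : ℝ) / M)‖ -
        ‖expSum N primeLog ((j : ℝ) / M)‖)), mul_nonneg (hA.trans h) (add_nonneg (sq_nonneg
        ‖expSum N (fun n => primeLog n * r n) ((j : ℝ) / M)‖) (sq_nonneg
        ‖expSum N primeLog ((j : ℝ) / M)‖))]
    · have := mul_le_mul_of_nonneg_left h
        (sq_nonneg ‖expSum N (fun n => primeLog n * r n) ((j : ℝ) / M)‖)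
      nlinarith [mul_nonneg (hB.trans h) (sq_nonneg ‖expSum N primeLog ((j : ℝ) / M)‖)]
  rw [← Finset.mul_sum, Finset.sum_add_distrib, sum_norm_expSum_sq (by omega),
    sum_norm_expSum_sq (by omega)] at h2
  refine le_of_mul_le_mul_left (h2.trans_eq ?_) hMr
  ring

lemma abs_r3_le_tau (D NR : ℝ) (m : ℕ) : |r3 D NR m| ≤ tau m := by
  rw [r3, tau]
  refine (Finset.abs_sum_le_sum_abs _ _).trans ?_
  rw [Finset.card_eq_sum_ones]
  push_cast
  refine Finset.sum_le_sum fun d _ => ?_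
  split_ifs
  · exact abs_chi4_le d
  · simp

lemma sum_sq_primeLog_le {N : ℕ} (D NR : ℝ) (hL : 1 ≤ Real.log N) :
    ∑ n ∈ Finset.Ioc 0 N, (primeLog n * r3 D NR (n - 1)) ^ 2 +
      ∑ n ∈ Finset.Ioc 0 N, primeLog n ^ 2 ≤ 9 * (N * Real.log N ^ 5) := by
  set L := Real.log N with hLdef
  have hp : ∀ n ∈ Finset.Ioc 0 N, primeLog n ^ 2 ≤ L ^ 2 := fun n hn =>
    pow_le_pow_left₀ (primeLog_nonneg n) (primeLog_le_log (Finset.mem_Ioc.1 hn).2) 2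
  have h1 : ∑ n ∈ Finset.Ioc 0 N, primeLog n ^ 2 ≤ N * L ^ 2 := by
    refine (Finset.sum_le_sum hp).trans_eq ?_
    rw [Finset.sum_const, Nat.card_Ioc, Nat.sub_zero, nsmul_eq_mul]
  have hshift : ∑ n ∈ Finset.Ioc 0 N, tau (n - 1) ^ 2 ≤ ∑ n ∈ Finset.Ioc 0 N, tau n ^ 2 := by
    have e1 : ∑ n ∈ Finset.Ioc 0 N, tau (n - 1) ^ 2 = ∑ n ∈ Finset.range N, tau n ^ 2 := by
      refine Finset.sum_bij' (fun n _ => n - 1) (fun n _ => n + 1) ?_ ?_ ?_ ?_ ?_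
      · intro n hn; rw [Finset.mem_Ioc] at hn; rw [Finset.mem_range]; omega
      · intro n hn; rw [Finset.mem_range] at hn; rw [Finset.mem_Ioc]; omega
      · intro n hn; rw [Finset.mem_Ioc] at hn; omega
      · intro n _; rfl
      · intro n _; rfl
    have e2 := sum_range_succ_eq_Ioc (F := fun n => tau n ^ 2) (by simp [tau]) N
    rw [e1, ← e2, Finset.sum_range_succ]
    exact le_add_of_nonneg_right (sq_nonneg _)
  have h2 : ∑ n ∈ Finset.Ioc 0 N, (primeLog n * r3 D NR (n - 1)) ^ 2 ≤
      L ^ 2 * (N * (1 + L) ^ 3) := by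
    calc _ ≤ ∑ n ∈ Finset.Ioc 0 N, L ^ 2 * tau (n - 1) ^ 2 := by
          refine Finset.sum_le_sum fun n hn => ?_
          rw [mul_pow]
          refine mul_le_mul (hp n hn) ?_ (sq_nonneg _) (by positivity)
          exact sq_le_sq' (by linarith [neg_abs_le (r3 D NR (n - 1)), abs_r3_le_tau D NR (n - 1)])
            ((le_abs_self _).trans (abs_r3_le_tau D NR (n - 1)))
      _ ≤ _ := by
          rw [← Finset.mul_sum]
          exact mul_le_mul_of_nonneg_left (hshift.trans (sum_tau_sq_le N)) (by positivity)
  have h3 : (1 + L) ^ 3 ≤ 8 * L ^ 3 := by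
    calc (1 + L) ^ 3 ≤ (2 * L) ^ 3 := pow_le_pow_left₀ (by linarith) (by linarith) 3
      _ = _ := by ring
  have h4 : L ^ 2 ≤ L ^ 5 := pow_le_pow_right₀ hL (by norm_num)
  have hN : (0 : ℝ) ≤ N := Nat.cast_nonneg N
  calc _ ≤ L ^ 2 * (N * (8 * L ^ 3)) + N * L ^ 5 := by
        refine add_le_add (h2.trans ?_) (h1.trans ?_)
        · gcongr
        · gcongr
    _ = _ := by ring

lemma div_log_pow_anti {x L : ℝ} {k m : ℕ} (hx : 0 ≤ x) (hL : 1 ≤ L) (hkm : k ≤ m) :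
    x / L ^ m ≤ x / L ^ k :=
  div_le_div_of_nonneg_left hx (by positivity) (pow_le_pow_right₀ hL hkm)

lemma pow_mul_sqrt_le {N L : ℝ} {a b m : ℕ} (hN : 0 ≤ N) (hL : 1 ≤ L) (h : L ^ m ≤ Real.sqrt N)
    (hab : a + b ≤ m) : L ^ a * Real.sqrt N ≤ N / L ^ b := by
  rw [le_div_iff₀ (by positivity)]
  calc L ^ a * Real.sqrt N * L ^ b = L ^ (a + b) * Real.sqrt N := by ring
    _ ≤ Real.sqrt N * Real.sqrt N := by
        refine mul_le_mul_of_nonneg_right ?_ (Real.sqrt_nonneg _)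
        exact (pow_le_pow_right₀ hL hab).trans h
    _ = N := Real.mul_self_sqrt hN

lemma pow_le_div_pow {N L : ℝ} {a b m : ℕ} (hN : 0 ≤ N) (hL : 1 ≤ L) (h : L ^ m ≤ Real.sqrt N)
    (hab : a + b ≤ m) : L ^ a ≤ N / L ^ b := by
  refine le_trans ?_ (pow_mul_sqrt_le hN hL h hab)
  exact le_mul_of_one_le_right (by positivity) ((one_le_pow₀ hL).trans h)

/-- The minor arc bound for primes. -/
lemma norm_expSum_primeLog_minor_le {N q : ℕ} {a : ℤ} {α : ℝ} (hL : 2 ≤ Real.log N)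
    (hN : Real.log N ^ 200 ≤ Real.sqrt N) (hq : Real.log N ^ 47 < q)
    (hqN : (q : ℝ) ≤ N / Real.log N ^ 47) (hcop : IsCoprime a (q : ℤ))
    (hα : |α - a / q| ≤ 1 / (q : ℝ) ^ 2) :
    ‖expSum N primeLog α‖ ≤ 1000 * (N / Real.log N ^ 6) := by
  have hN0 : (0 : ℝ) ≤ N := Nat.cast_nonneg N
  set L := Real.log N with hLdef
  have hL1 : 1 ≤ L := by linarith
  set U := ⌊L ^ 20⌋₊ with hU
  have hU1 : (U : ℝ) ≤ L ^ 20 := Nat.floor_le (by positivity)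
  have hL20 : 4 ≤ L ^ 20 := by
    calc (4 : ℝ) ≤ 2 ^ 20 := by norm_num
      _ ≤ L ^ 20 := pow_le_pow_left₀ (by norm_num) hL 20
  have hU2 : L ^ 20 / 2 ≤ U := by
    have := Nat.lt_floor_add_one (L ^ 20)
    rw [← hU] at this
    linarith
  have hU2' : 2 ≤ U := by
    have : (2 : ℝ) ≤ U := by linarith
    exact_mod_cast this
  have hUq : 2 * U ^ 2 ≤ q := by
    have h1 : (2 * U ^ 2 : ℝ) ≤ q := by
      calc (2 * U ^ 2 : ℝ) ≤ L ^ 7 * (L ^ 20) ^ 2 := by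
            have : (2 : ℝ) ≤ L ^ 7 := by
              calc (2 : ℝ) ≤ 2 ^ 7 := by norm_num
                _ ≤ L ^ 7 := pow_le_pow_left₀ (by norm_num) hL 7
            gcongr
        _ = L ^ 47 := by ring
        _ ≤ q := hq.le
    exact_mod_cast h1
  have hqN' : q ≤ N := by
    have h1 : (q : ℝ) ≤ N := hqN.trans (div_le_self hN0 (one_le_pow₀ hL1))
    exact_mod_cast h1
  have h1 := minor_arc_bound hU2' hUq hqN' hcop hα
  have h2 := norm_sum_vonMangoldt_sub_le (le_refl N) (f := fun n => ex (n * α)) fun n => (norm_ex _).le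
  have h3 : ‖expSum N primeLog α‖ ≤
      ‖∑ n ∈ Finset.Ioc 0 N, (ArithmeticFunction.vonMangoldt n : ℂ) * ex (n * α)‖ +
      2 * Real.sqrt N * L := by
    rw [expSum]
    rw [norm_sub_rev] at h2
    exact (norm_le_norm_add_norm_sub' _ _).trans (add_le_add le_rfl h2)
  have b1 : (U : ℝ) * L ≤ N / L ^ 6 := by
    calc (U : ℝ) * L ≤ L ^ 20 * L := by gcongr
      _ = L ^ 21 := by ring
      _ ≤ _ := pow_le_div_pow hN0 hL1 hN (by norm_num)
  have b2 : 3 * (U : ℝ) ^ 2 * L * q ≤ 3 * (N / L ^ 6) := by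
    calc 3 * (U : ℝ) ^ 2 * L * q ≤ 3 * (L ^ 20) ^ 2 * L * (N / L ^ 47) := by gcongr
      _ = 3 * (N / L ^ 6) := by field_simp
  have b3 : 3 * (1 + L) * Real.sqrt (40 * N * (1 + L) ^ 6 * (N / U + q)) ≤ 540 * (N / L ^ 6) := by
    have c1 : (N / U + q : ℝ) ≤ 3 * (N / L ^ 20) := by
      have d1 : (N / U : ℝ) ≤ N / (L ^ 20 / 2) :=
        div_le_div_of_nonneg_left hN0 (by positivity) hU2
      have d2 : (N / (L ^ 20 / 2) : ℝ) = 2 * (N / L ^ 20) := by field_simp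
      have d3 := div_log_pow_anti hN0 hL1 (show 20 ≤ 47 by norm_num)
      linarith
    have c2 : (1 + L) ^ 6 ≤ 64 * L ^ 6 := by
      calc (1 + L) ^ 6 ≤ (2 * L) ^ 6 := pow_le_pow_left₀ (by linarith) (by linarith) 6
        _ = _ := by ring
    have c3 : Real.sqrt (40 * N * (1 + L) ^ 6 * (N / U + q)) ≤ 90 * (N / L ^ 7) := by
      refine Real.sqrt_le_iff.2 ⟨by positivity, ?_⟩
      calc 40 * N * (1 + L) ^ 6 * (N / U + q) ≤ 40 * N * (64 * L ^ 6) * (3 * (N / L ^ 20)) := by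
            gcongr
        _ = 7680 * (N / L ^ 7) ^ 2 := by field_simp; ring
        _ ≤ (90 * (N / L ^ 7)) ^ 2 := by
            rw [mul_pow]; gcongr; norm_num
    calc 3 * (1 + L) * Real.sqrt (40 * N * (1 + L) ^ 6 * (N / U + q))
        ≤ 3 * (2 * L) * (90 * (N / L ^ 7)) := by gcongr; linarith
      _ = 540 * (N / L ^ 6) := by field_simp; ring
  have b4 : 2 * Real.sqrt N * L ≤ 2 * (N / L ^ 6) := by
    have := pow_mul_sqrt_le (a := 1) (b := 6) hN0 hL1 hN (by norm_num)
    rw [pow_one] at this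
    linarith
  have hpos : 0 ≤ N / L ^ 6 := by positivity
  linarith

lemma ceil_pow_bounds {L : ℝ} (hL : 1 ≤ L) (k : ℕ) :
    L ^ k ≤ (⌈L ^ k⌉₊ : ℝ) ∧ (⌈L ^ k⌉₊ : ℝ) ≤ 2 * L ^ k := by
  have h1 := one_le_pow₀ hL (n := k)
  have h2 := (Nat.ceil_lt_add_one (a := L ^ k) (by positivity)).le
  exact ⟨Nat.le_ceil _, by linarith⟩

lemma abs_mul_step_le {N q : ℕ} {β L : ℝ} (hq : 0 < q) (hL : 1 ≤ L)
    (hN : L ^ 200 ≤ Real.sqrt N) (hβ : |β| ≤ L ^ 47 / (N * q)) :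
    |β| * (N / ⌈L ^ 56⌉₊ + 1) ≤ 2 / L ^ 9 ∧ (N / ⌈L ^ 56⌉₊ + 1 : ℝ) ≤ 2 * (N / L ^ 56) := by
  have hN0 : (0 : ℝ) ≤ N := Nat.cast_nonneg N
  have hNp : (0 : ℝ) < N := by
    have h1 : 1 ≤ Real.sqrt N := (one_le_pow₀ hL).trans hN
    by_contra h
    have : (N : ℝ) = 0 := le_antisymm (not_lt.1 h) hN0
    rw [this, Real.sqrt_zero] at h1
    linarith
  have h1 : (N / ⌈L ^ 56⌉₊ + 1 : ℝ) ≤ 2 * (N / L ^ 56) := by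
    have e1 : (N / ⌈L ^ 56⌉₊ : ℝ) ≤ N / L ^ 56 :=
      div_le_div_of_nonneg_left hN0 (by positivity) (ceil_pow_bounds hL 56).1
    have e2 := pow_le_div_pow (a := 0) (b := 56) hN0 hL hN (by norm_num)
    rw [pow_zero] at e2
    linarith
  refine ⟨?_, h1⟩
  have h2 : |β| ≤ L ^ 47 / N := by
    refine hβ.trans (div_le_div_of_nonneg_left (by positivity) hNp ?_)
    exact le_mul_of_one_le_right hN0 (by exact_mod_cast hq)
  calc |β| * (N / ⌈L ^ 56⌉₊ + 1) ≤ L ^ 47 / N * (2 * (N / L ^ 56)) :=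
        mul_le_mul h2 h1 (by positivity) (by positivity)
    _ = 2 / L ^ 9 := by field_simp

/-- The exponential sum over primes on the major arcs with denominator divisible by four. -/
lemma norm_expSum_primeLog_major_le {N q : ℕ} {a : ℤ} {α C : ℝ} (hL : 2 ≤ Real.log N)
    (hN : Real.log N ^ 200 ≤ Real.sqrt N) (hC : 0 < C) (hq0 : 0 < q) (hq : (q : ℝ) ≤ Real.log N ^ 47)
    (h4 : 4 ∣ q) (hcop : IsCoprime a (q : ℤ)) (hα : |α - a / q| ≤ Real.log N ^ 47 / (N * q))
    (hZ : ∀ t ≤ N, ∑ r ∈ Finset.Ioc 1 q, (1 / r.totient : ℝ) * primSum t r ≤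
      C * N / Real.log N ^ 111) :
    ‖expSum N primeLog α‖ ≤ (1000 + 1000 * C) * (N / Real.log N ^ 6) := by
  have hN0 : (0 : ℝ) ≤ N := Nat.cast_nonneg N
  set L := Real.log N with hLdef
  have hL1 : 1 ≤ L := by linarith
  obtain ⟨β, hβ⟩ : ∃ β, β = α - a / q := ⟨_, rfl⟩
  rw [← hβ] at hα
  have hαβ : α = a / q + β := by rw [hβ]; ring
  obtain ⟨hJ1, hJ2⟩ := ceil_pow_bounds hL1 56
  obtain ⟨hs1, hs2⟩ := abs_mul_step_le hq0 hL1 hN hα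
  set J := ⌈L ^ 56⌉₊ with hJ
  have hJ0 : 0 < J := Nat.ceil_pos.2 (by positivity)
  have h1 := norm_primeSum_four_dvd_le hq0 h4 hcop hJ0 (β := β) hZ
  rw [← hαβ] at h1
  have hlogq : Real.log q ≤ Real.sqrt N * L := by
    have e1 : Real.log q ≤ q := Real.log_le_self (Nat.cast_nonneg q)
    have e2 : L ^ 47 ≤ L ^ 200 := pow_le_pow_right₀ hL1 (by norm_num)
    have e3 : Real.sqrt N ≤ Real.sqrt N * L := le_mul_of_one_le_right (Real.sqrt_nonneg _) hL1
    linarith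
  have b1 : (J : ℝ) * (2 * (q * (C * N / L ^ 111 + (2 * Real.sqrt N * L + Real.log q)))) ≤
      4 * C * (N / L ^ 6) + 12 * (N / L ^ 6) := by
    calc (J : ℝ) * (2 * (q * (C * N / L ^ 111 + (2 * Real.sqrt N * L + Real.log q))))
        ≤ (2 * L ^ 56) * (2 * (L ^ 47 * (C * N / L ^ 111 +
          (2 * Real.sqrt N * L + Real.sqrt N * L)))) := by gcongr
      _ = 4 * C * (N / L ^ 8) + 12 * (L ^ 104 * Real.sqrt N) := by field_simp; ring
      _ ≤ _ := by
          have e1 := div_log_pow_anti hN0 hL1 (show 6 ≤ 8 by norm_num)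
          have e2 := pow_mul_sqrt_le (a := 104) (b := 6) hN0 hL1 hN (by norm_num)
          gcongr
  have b2 : 6 * (N : ℝ) * (2 * Real.pi * (|β| * (N / J + 1))) ≤ 96 * (N / L ^ 6) := by
    calc 6 * (N : ℝ) * (2 * Real.pi * (|β| * (N / J + 1))) ≤ 6 * N * (2 * 4 * (2 / L ^ 9)) := by
          gcongr; exact Real.pi_le_four
      _ = 96 * (N / L ^ 9) := by ring
      _ ≤ _ := by
          have := div_log_pow_anti hN0 hL1 (show 6 ≤ 9 by norm_num)
          gcongr
  have b3 : Real.log q ≤ N / L ^ 6 := by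
    have := pow_mul_sqrt_le (a := 1) (b := 6) hN0 hL1 hN (by norm_num)
    rw [pow_one] at this
    linarith
  have hpos : 0 ≤ N / L ^ 6 := by positivity
  have hpos' : 0 ≤ C * (N / L ^ 6) := by positivity
  rw [expSum]
  nlinarith

set_option maxHeartbeats 1000000 in
/-- The exponential sum over primes weighted by `r₃` on the major arcs with denominator not
divisible by four. -/
lemma norm_expSum_r3_major_le {N q D' : ℕ} {a : ℤ} {α C D : ℝ} (hL : 2 ≤ Real.log N)
    (hN : Real.log N ^ 200 ≤ Real.sqrt N) (hC : 0 < C) (hq0 : 0 < q) (hq : (q : ℝ) ≤ Real.log N ^ 47)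
    (h4 : ¬ 4 ∣ q) (hα : |α - a / q| ≤ Real.log N ^ 47 / (N * q)) (hD0 : 0 < D)
    (hD : D ≤ Real.sqrt N / Real.log N ^ 110) (hD' : D' = ⌊D⌋₊)
    (hZ : ∀ t ≤ N, ∑ r ∈ Finset.Ioc 1 (4 * q * D'), (1 / r.totient : ℝ) * primSum t r ≤
      C * N / Real.log N ^ 111) :
    ‖expSum N (fun n => primeLog n * r3 D N (n - 1)) α‖ ≤
      (1000 + 1000 * C) * (N / Real.log N ^ 6) := by
  have hN0 : (0 : ℝ) ≤ N := Nat.cast_nonneg N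
  set L := Real.log N with hLdef
  have hL1 : 1 ≤ L := by linarith
  obtain ⟨β, hβ⟩ : ∃ β, β = α - a / q := ⟨_, rfl⟩
  rw [← hβ] at hα
  have hαβ : α = a / q + β := by rw [hβ]; ring
  obtain ⟨hJ1, hJ2⟩ := ceil_pow_bounds hL1 56
  obtain ⟨hs1, hs2⟩ := abs_mul_step_le hq0 hL1 hN hα
  set J := ⌈L ^ 56⌉₊ with hJ
  have hJ0 : 0 < J := Nat.ceil_pos.2 (by positivity)
  have hS1 : 1 ≤ Real.sqrt N := (one_le_pow₀ hL1).trans hN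
  have hNS : Real.sqrt N * Real.sqrt N = N := Real.mul_self_sqrt hN0
  have hNp : (0 : ℝ) < N := by nlinarith
  have hDD : (D' : ℝ) ≤ Real.sqrt N / L ^ 110 := by
    rw [hD']; exact (Nat.floor_le hD0.le).trans hD
  have hDS : (D' : ℝ) ≤ Real.sqrt N := hDD.trans (div_le_self (by positivity) (one_le_pow₀ hL1))
  have hK : 0 < (N : ℝ) / D := div_pos hNp hD0
  have hKD : (N : ℝ) < N / D * (D' + 1) := by
    have h1 := Nat.lt_floor_add_one D
    rw [← hD'] at h1
    calc (N : ℝ) = N / D * D := by field_simp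
      _ < _ := mul_lt_mul_of_pos_left h1 hK
  have hDN : 4 * q * D' ≤ N := by
    have h1 : (4 * q * D' : ℝ) ≤ N := by
      calc (4 * q * D' : ℝ) ≤ L ^ 2 * L ^ 47 * (Real.sqrt N / L ^ 110) := by
            have : 4 ≤ L ^ 2 := by nlinarith
            gcongr
        _ = Real.sqrt N / L ^ 61 := by field_simp
        _ ≤ Real.sqrt N := div_le_self (by positivity) (one_le_pow₀ hL1)
        _ ≤ N := by nlinarith
    exact_mod_cast h1
  have h1 := norm_primeSum_r3_le (a := a) (β := β) hq0 h4 hJ0 hK hKD hDN hZ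
  rw [← hαβ] at h1
  have h2L : 1 + L ≤ 2 * L := by linarith
  have b1 : (J : ℝ) * (2 * (4 * q * ((1 + L) ^ 2 * (C * N / L ^ 111) +
      D' * (3 * Real.sqrt N * (1 + L))))) ≤ 64 * C * (N / L ^ 6) + 96 * (N / L ^ 6) := by
    calc (J : ℝ) * (2 * (4 * q * ((1 + L) ^ 2 * (C * N / L ^ 111) +
          D' * (3 * Real.sqrt N * (1 + L)))))
        ≤ (2 * L ^ 56) * (2 * (4 * L ^ 47 * ((2 * L) ^ 2 * (C * N / L ^ 111) +
          Real.sqrt N / L ^ 110 * (3 * Real.sqrt N * (2 * L))))) := by gcongr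
      _ = 64 * C * (N / L ^ 6) + 96 * ((Real.sqrt N * Real.sqrt N) / L ^ 6) := by
          field_simp; ring
      _ = _ := by rw [hNS]
  have b2 : L * (2 * Real.pi * (|β| * (N / J + 1)) * (N * (1 + L) + D')) ≤ 48 * (N / L ^ 6) := by
    calc L * (2 * Real.pi * (|β| * (N / J + 1)) * (N * (1 + L) + D'))
        ≤ L * (2 * 4 * (2 / L ^ 9) * (N * (2 * L) + N * L)) := by
          have : (D' : ℝ) ≤ N * L := by nlinarith
          gcongr
          exact Real.pi_le_four
      _ = 48 * (N / L ^ 7) := by field_simp; ring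
      _ ≤ _ := by
          have := div_log_pow_anti hN0 hL1 (show 6 ≤ 7 by norm_num)
          gcongr
  have e1 := pow_mul_sqrt_le (a := 1) (b := 6) hN0 hL1 hN (by norm_num)
  rw [pow_one] at e1
  have b3 : L * ((N / J + 1) * (1 + L) + 2 * D') ≤ 6 * (N / L ^ 6) := by
    calc L * ((N / J + 1) * (1 + L) + 2 * D') ≤ L * (2 * (N / L ^ 56) * (2 * L) + 2 * Real.sqrt N) := by
          gcongr
      _ = 4 * (N / L ^ 54) + 2 * (L * Real.sqrt N) := by field_simp; ring
      _ ≤ 4 * (N / L ^ 6) + 2 * (N / L ^ 6) := by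
          have := div_log_pow_anti hN0 hL1 (show 6 ≤ 54 by norm_num)
          gcongr
      _ = _ := by ring
  have b4 : D' * L ≤ N / L ^ 6 := by
    calc D' * L ≤ Real.sqrt N * L := by gcongr
      _ = L * Real.sqrt N := mul_comm _ _
      _ ≤ _ := e1
  have hpos : 0 ≤ N / L ^ 6 := by positivity
  have hpos' : 0 ≤ C * (N / L ^ 6) := by positivity
  have h3 : expSum N (fun n => primeLog n * r3 D N (n - 1)) α =
      ∑ n ∈ Finset.Ioc 0 N, (primeLog n : ℂ) * (r3 D N (n - 1) : ℂ) * ex (n * α) := by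
    rw [expSum]
    exact Finset.sum_congr rfl fun n _ => by push_cast; rfl
  rw [h3]
  linarith

lemma eventually_log_pow_le_sqrt (m : ℕ) :
    ∃ N0 : ℕ, ∀ N ≥ N0, 2 ≤ Real.log N ∧ Real.log N ^ m ≤ Real.sqrt N := by
  have h1 : Filter.Tendsto (fun N : ℕ => Real.log N) Filter.atTop Filter.atTop :=
    Real.tendsto_log_atTop.comp tendsto_natCast_atTop_atTop
  have h2 : (fun x : ℝ => Real.log x ^ m) =o[Filter.atTop] fun x => x ^ (1 / 2 : ℝ) := by
    have := isLittleO_log_rpow_rpow_atTop (s := 1 / 2) (m : ℝ) (by norm_num)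
    simpa [Real.rpow_natCast] using this
  have h3 := (h2.bound (c := 1) (by norm_num)).and (Filter.eventually_ge_atTop 1)
  obtain ⟨N0, hN0⟩ := Filter.eventually_atTop.1
    ((tendsto_natCast_atTop_atTop.eventually h3).and (h1.eventually_ge_atTop 2))
  refine ⟨N0, fun N hN => ⟨(hN0 N hN).2, ?_⟩⟩
  obtain ⟨⟨h4, -⟩, h6⟩ := hN0 N hN
  rw [one_mul, ← Real.sqrt_eq_rpow, Real.norm_of_nonneg (Real.sqrt_nonneg _),
    Real.norm_of_nonneg (by positivity)] at h4
  exact h4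

/-- For every `α` one of the two exponential sums saves six powers of the logarithm. -/
lemma expSum_dichotomy {B N : ℕ} {C D : ℝ} (hC : 0 < C) (hL : 2 ≤ Real.log N)
    (hN : Real.log N ^ (200 + B) ≤ Real.sqrt N) (hD0 : 0 < D)
    (hD : D ≤ Real.sqrt N / Real.log N ^ (110 + B))
    (hZ : ∀ t ≤ N, ∀ Q : ℕ, (Q : ℝ) ≤ Real.sqrt N / Real.log N ^ B →
      ∑ r ∈ Finset.Ioc 1 Q, (1 / r.totient : ℝ) * primSum t r ≤ C * N / Real.log N ^ 111) (α : ℝ) :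
    ‖expSum N (fun n => primeLog n * r3 D N (n - 1)) α‖ ≤
      (1000 + 1000 * C) * (N / Real.log N ^ 6) ∨
    ‖expSum N primeLog α‖ ≤ (1000 + 1000 * C) * (N / Real.log N ^ 6) := by
  have hN0 : (0 : ℝ) ≤ N := Nat.cast_nonneg N
  set L := Real.log N with hLdef
  have hL1 : 1 ≤ L := by linarith
  have hN' : L ^ 200 ≤ Real.sqrt N := (pow_le_pow_right₀ hL1 (by omega)).trans hN
  have hS1 : 1 ≤ Real.sqrt N := (one_le_pow₀ hL1).trans hN
  have hNS : Real.sqrt N * Real.sqrt N = N := Real.mul_self_sqrt hN0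
  have hNp : (0 : ℝ) < N := by nlinarith
  have hn1 : 1 ≤ (N : ℝ) / L ^ 47 := by
    have := pow_le_div_pow (a := 0) (b := 47) hN0 hL1 hN' (by norm_num)
    rwa [pow_zero] at this
  set n := ⌊(N : ℝ) / L ^ 47⌋₊ with hn
  have hnpos : 0 < n := Nat.floor_pos.2 hn1
  obtain ⟨ρ, hρ1, hρ2⟩ := Real.exists_rat_abs_sub_le_and_den_le α hnpos
  set q := ρ.den with hqdef
  set a := ρ.num with hadef
  have hq0 : 0 < q := ρ.den_pos
  have hqr : (0 : ℝ) < q := by exact_mod_cast hq0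
  have hcop : IsCoprime a (q : ℤ) := by
    rw [Int.isCoprime_iff_gcd_eq_one, Int.gcd, Int.natAbs_natCast]
    exact ρ.reduced
  have hρ : (ρ : ℝ) = a / q := Rat.cast_def ρ
  rw [hρ] at hρ1
  have hn2 : (N : ℝ) / L ^ 47 ≤ n + 1 := (Nat.lt_floor_add_one _).le
  have hqn : (q : ℝ) ≤ n := by exact_mod_cast hρ2
  have hqN : (q : ℝ) ≤ N / L ^ 47 := hqn.trans (Nat.floor_le (by positivity))
  have hα1 : |α - a / q| ≤ 1 / (q : ℝ) ^ 2 := by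
    refine hρ1.trans (one_div_le_one_div_of_le (by positivity) ?_)
    nlinarith
  have hα2 : |α - a / q| ≤ L ^ 47 / (N * q) := by
    refine hρ1.trans ?_
    rw [div_le_div_iff₀ (by positivity) (by positivity), one_mul, ← mul_assoc]
    refine mul_le_mul_of_nonneg_right ?_ hqr.le
    rwa [div_le_iff₀ (by positivity), mul_comm] at hn2
  have hpos : 0 ≤ N / L ^ 6 := by positivity
  have hpos' : 0 ≤ C * (N / L ^ 6) := by positivity
  rcases lt_or_ge (L ^ 47) (q : ℝ) with hq | hq
  · right
    refine (norm_expSum_primeLog_minor_le hL hN' hq hqN hcop hα1).trans ?_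
    nlinarith
  · have hLB : L ^ (B + 47) ≤ Real.sqrt N := (pow_le_pow_right₀ hL1 (by omega)).trans hN
    by_cases h4 : 4 ∣ q
    · right
      refine norm_expSum_primeLog_major_le hL hN' hC hq0 hq h4 hcop hα2 fun t ht => hZ t ht q ?_
      rw [le_div_iff₀ (by positivity)]
      calc (q : ℝ) * L ^ B ≤ L ^ 47 * L ^ B := by gcongr
        _ = L ^ (B + 47) := by ring
        _ ≤ _ := hLB
    · left
      have hD110 : D ≤ Real.sqrt N / L ^ 110 :=
        hD.trans (div_log_pow_anti (Real.sqrt_nonneg _) hL1 (by omega))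
      refine norm_expSum_r3_major_le hL hN' hC hq0 hq h4 hα2 hD0 hD110 rfl fun t ht =>
        hZ t ht _ ?_
      have h4L : 4 ≤ L ^ 2 := by nlinarith
      have hfl : (⌊D⌋₊ : ℝ) ≤ Real.sqrt N / L ^ (110 + B) := (Nat.floor_le hD0.le).trans hD
      push_cast
      calc (4 * q * ⌊D⌋₊ : ℝ) ≤ L ^ 2 * L ^ 47 * (Real.sqrt N / L ^ (110 + B)) := by gcongr
        _ = Real.sqrt N / L ^ B / L ^ 61 := by
            rw [pow_add]; field_simp
        _ ≤ Real.sqrt N / L ^ B := div_le_self (by positivity) (one_le_pow₀ hL1)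

/-- with D = √N (log N)^{-c} for any large enough constant c,
R₃,₃(N) ≪ N² (log N)^{-1} for large odd N. -/
theorem R_three_three_bound :
    ∃ c0 : ℝ, 0 < c0 ∧ ∀ c : ℝ, c0 ≤ c → ∃ C : ℝ, 0 < C ∧ ∃ N0 : ℕ,
      ∀ N : ℕ, N0 ≤ N → Odd N →
        |tripleSum N (fun p => r3 (Real.sqrt N * Real.log N ^ (-c)) (N : ℝ) (p - 1))
            (fun p => r3 (Real.sqrt N * Real.log N ^ (-c)) (N : ℝ) (p - 1))| ≤
          C * (N : ℝ) ^ 2 * (Real.log N)⁻¹ := by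
  obtain ⟨B, C, hC, hBV⟩ := bombieri_vinogradov 111
  obtain ⟨N0, hN0⟩ := eventually_log_pow_le_sqrt (200 + B)
  refine ⟨110 + B, by positivity, fun c hc => ⟨9 * (1000 + 1000 * C), by positivity, max N0 3,
    fun N hN _ => ?_⟩⟩
  obtain ⟨hL, hlog⟩ := hN0 N ((le_max_left _ _).trans hN)
  have hN3 : 3 ≤ N := (le_max_right _ _).trans hN
  have hNp : (0 : ℝ) < N := by exact_mod_cast (by omega : 0 < N)
  have hLpos : 0 < Real.log N := by linarith
  set D := Real.sqrt N * Real.log N ^ (-c) with hDdef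
  have hD0 : 0 < D := mul_pos (Real.sqrt_pos.2 hNp) (Real.rpow_pos_of_pos hLpos _)
  have hD : D ≤ Real.sqrt N / Real.log N ^ (110 + B) := by
    rw [hDdef, div_eq_mul_inv, ← Real.rpow_natCast, ← Real.rpow_neg hLpos.le]
    refine mul_le_mul_of_nonneg_left (Real.rpow_le_rpow_of_exponent_le (by linarith) ?_)
      (Real.sqrt_nonneg _)
    push_cast
    linarith
  have h1 := abs_tripleSum_le (fun p => r3 D N (p - 1))
    (expSum_dichotomy hC hL hlog hD0 hD fun t ht Q hQ => hBV N hN3 t ht Q hQ)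
  refine h1.trans ?_
  calc (1000 + 1000 * C) * (N / Real.log N ^ 6) *
        (∑ n ∈ Finset.Ioc 0 N, (primeLog n * r3 D N (n - 1)) ^ 2 +
          ∑ n ∈ Finset.Ioc 0 N, primeLog n ^ 2)
      ≤ (1000 + 1000 * C) * (N / Real.log N ^ 6) * (9 * (N * Real.log N ^ 5)) :=
        mul_le_mul_of_nonneg_left (sum_sq_primeLog_le D N (by linarith)) (by positivity)
    _ = 9 * (1000 + 1000 * C) * (N : ℝ) ^ 2 * (Real.log N)⁻¹ := by field_simp
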